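/- Let f:(R,m,k) → (S,n,l) be a local homomorphism of noetherian local rings such that the flat dimension of S as an R-module is finite, where R has a dualizing complex and S is n-adically complete, and let M be a non-zero artinian S-module with Gid_R(M) ≤ edim(R) − edim(S). Then: (i) M is a Gorenstein injective S-module; (ii) f is an exceptional complete intersection map; and (iii) Gid_R(M) = edim(R) − edim(S). In particular, if M is Gorenstein injective as an R-module, then edim(R) = edim(S). -/

import Mathlib

/- ## Preliminary definitions -/

universe u

open IsLocalRing

noncomputable section

/-- The embedding dimension of a local ring: `dim_k (m/m²)`. -/
def embDim (R : Type u) [CommRing R] [IsLocalRing R] : ℕ :=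
  Module.finrank (ResidueField R) (CotangentSpace R)

/-- Witness that `Q` is a Gorenstein flat `R`-module: a two-sided exact complex `F` of
flat modules, which stays exact after applying `I ⊗ᵣ -` for every injective module `I`,
with `Q` isomorphic to the image of the differential `F₁ → F₀`. -/
structure GorensteinFlatWitness (R : Type u) [CommRing R] (Q : Type u) [AddCommGroup Q]
    [Module R Q] where
  F : ℤ → Type u
  [instAdd : ∀ i, AddCommGroup (F i)]
  [instMod : ∀ i, Module R (F i)]
  d : (i : ℤ) → F (i + 1) →ₗ[R] F i
  flat : ∀ i, Module.Flat R (F i)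
  exact : ∀ i : ℤ, Function.Exact (d (i + 1)) (d i)
  exact_tensor : ∀ (I : Type u) [AddCommGroup I] [Module R I], Module.Injective R I →
    ∀ i : ℤ, Function.Exact (LinearMap.lTensor I (d (i + 1))) (LinearMap.lTensor I (d i))
  iso : Nonempty (Q ≃ₗ[R] LinearMap.range (d 0))

/-- `Q` is a Gorenstein flat `R`-module. -/
def IsGorensteinFlat (R : Type u) [CommRing R] (Q : Type u) [AddCommGroup Q]
    [Module R Q] : Prop :=
  Nonempty (GorensteinFlatWitness R Q)

/-- Witness that `J` is a Gorenstein injective `R`-module: a two-sided exact complex `I` of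
injective modules, which stays exact after applying `Hom_R(E, -)` for every injective module
`E`, with `J` isomorphic to the image of the differential `I₁ → I₀`. -/
structure GorensteinInjectiveWitness (R : Type u) [CommRing R] (J : Type u) [AddCommGroup J]
    [Module R J] where
  I : ℤ → Type u
  [instAdd : ∀ i, AddCommGroup (I i)]
  [instMod : ∀ i, Module R (I i)]
  d : (i : ℤ) → I (i + 1) →ₗ[R] I i
  injective : ∀ i, Module.Injective R (I i)
  exact : ∀ i : ℤ, Function.Exact (d (i + 1)) (d i)
  exact_hom : ∀ (E : Type u) [AddCommGroup E] [Module R E], Module.Injective R E →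
    ∀ i : ℤ, Function.Exact (LinearMap.llcomp (σ₁₂ := RingHom.id R) R E (I (i + 1 + 1)) (I (i + 1)) (d (i + 1)))
      (LinearMap.llcomp (σ₁₂ := RingHom.id R) R E (I (i + 1)) (I i) (d i))
  iso : Nonempty (J ≃ₗ[R] LinearMap.range (d 0))

/-- `J` is a Gorenstein injective `R`-module. -/
def IsGorensteinInjective (R : Type u) [CommRing R] (J : Type u) [AddCommGroup J]
    [Module R J] : Prop :=
  Nonempty (GorensteinInjectiveWitness R J)

/-- A surjection onto `M` whose source is Gorenstein flat. -/
structure GorensteinFlatCover (R : Type u) [CommRing R] (M : Type u) [AddCommGroup M]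
    [Module R M] where
  Q : Type u
  [instAdd : AddCommGroup Q]
  [instMod : Module R Q]
  π : Q →ₗ[R] M
  gflat : IsGorensteinFlat R Q
  surj : Function.Surjective π

attribute [instance] GorensteinFlatCover.instAdd GorensteinFlatCover.instMod

/-- `M` admits an exact sequence `0 → Qₙ → ⋯ → Q₀ → M → 0` with all `Qᵢ` Gorenstein flat;
equivalently (by splicing), defined by recursion on `n`. -/
def gfdLE (R : Type u) [CommRing R] :
    (n : ℕ) → (M : Type u) → [AddCommGroup M] → [Module R M] → Prop
  | 0, M, _, _ => IsGorensteinFlat R M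
  | n + 1, M, _, _ => ∃ c : GorensteinFlatCover R M, gfdLE R n (LinearMap.ker c.π)

/-- The Gorenstein flat dimension of `M` over `R`, as an element of `ℕ∞`
(the zero module has Gorenstein flat dimension `0` here, and `⊤` means infinite). -/
def gfd (R : Type u) [CommRing R] (M : Type u) [AddCommGroup M] [Module R M] : ℕ∞ :=
  sInf ((↑) '' { n : ℕ | gfdLE R n M })

/-- A flat cover of `M`. -/
structure FlatCover (R : Type u) [CommRing R] (M : Type u) [AddCommGroup M]
    [Module R M] where
  Q : Type u
  [instAdd : AddCommGroup Q]
  [instMod : Module R Q]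
  π : Q →ₗ[R] M
  flat : Module.Flat R Q
  surj : Function.Surjective π

attribute [instance] FlatCover.instAdd FlatCover.instMod

/-- `M` admits a flat resolution of length `≤ n`. -/
def fdLE (R : Type u) [CommRing R] :
    (n : ℕ) → (M : Type u) → [AddCommGroup M] → [Module R M] → Prop
  | 0, M, _, _ => Module.Flat R M
  | n + 1, M, _, _ => ∃ c : FlatCover R M, fdLE R n (LinearMap.ker c.π)

/-- The flat dimension of `M` over `R`, as an element of `ℕ∞`. -/
def flatDim (R : Type u) [CommRing R] (M : Type u) [AddCommGroup M] [Module R M] : ℕ∞ :=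
  sInf ((↑) '' { n : ℕ | fdLE R n M })

/-- An embedding of `M` into a Gorenstein injective module. -/
structure GorensteinInjectiveHull (R : Type u) [CommRing R] (M : Type u) [AddCommGroup M]
    [Module R M] where
  J : Type u
  [instAdd : AddCommGroup J]
  [instMod : Module R J]
  ι : M →ₗ[R] J
  ginj : IsGorensteinInjective R J
  inj : Function.Injective ι

attribute [instance] GorensteinInjectiveHull.instAdd GorensteinInjectiveHull.instMod

/-- `M` admits an exact sequence `0 → M → J₀ → ⋯ → J₋ₙ → 0` with all `Jᵢ`
Gorenstein injective. -/
def gidLE (R : Type u) [CommRing R] :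
    (n : ℕ) → (M : Type u) → [AddCommGroup M] → [Module R M] → Prop
  | 0, M, _, _ => IsGorensteinInjective R M
  | n + 1, M, _, _ => ∃ c : GorensteinInjectiveHull R M,
      gidLE R n (c.J ⧸ LinearMap.range c.ι)

/-- The Gorenstein injective dimension of `M` over `R`, as an element of `ℕ∞`. -/
def gid (R : Type u) [CommRing R] (M : Type u) [AddCommGroup M] [Module R M] : ℕ∞ :=
  sInf ((↑) '' { n : ℕ | gidLE R n M })

/-- An embedding of `M` into an injective module. -/
structure InjectiveHullStep (R : Type u) [CommRing R] (M : Type u) [AddCommGroup M]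
    [Module R M] where
  J : Type u
  [instAdd : AddCommGroup J]
  [instMod : Module R J]
  ι : M →ₗ[R] J
  injective : Module.Injective R J
  inj : Function.Injective ι

attribute [instance] InjectiveHullStep.instAdd InjectiveHullStep.instMod

/-- `M` admits an injective resolution of length `≤ n`. -/
def idLE (R : Type u) [CommRing R] :
    (n : ℕ) → (M : Type u) → [AddCommGroup M] → [Module R M] → Prop
  | 0, M, _, _ => Module.Injective R M
  | n + 1, M, _, _ => ∃ c : InjectiveHullStep R M, idLE R n (c.J ⧸ LinearMap.range c.ι)

/-- The injective dimension of `M` over `R`, as an element of `ℕ∞`. -/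
def injDim (R : Type u) [CommRing R] (M : Type u) [AddCommGroup M] [Module R M] : ℕ∞ :=
  sInf ((↑) '' { n : ℕ | idLE R n M })

/-- The `i`-th Ext module `Ext_R^i(N, M)`. -/
def extModule (R : Type u) [CommRing R] (i : ℕ) (N M : Type u) [AddCommGroup N] [Module R N]
    [AddCommGroup M] [Module R M] : ModuleCat.{u} R :=
  ((Ext R (ModuleCat.{u} R) i).obj (Opposite.op (ModuleCat.of R N))).obj (ModuleCat.of R M)

/-- The depth of `M` with respect to the ideal `I`: the least `i` such that
`Ext_R^i(R/I, M) ≠ 0` (with value `⊤ : ℕ∞` if no such `i` exists). -/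
def idealDepth (R : Type u) [CommRing R] (I : Ideal R) (M : Type u) [AddCommGroup M]
    [Module R M] : ℕ∞ :=
  sInf ((↑) '' { i : ℕ | ¬ Subsingleton (extModule R i (R ⧸ I) M) })

/-- A finitely generated `S`-module `M` is totally reflexive if the biduality map
`M → Hom_S(Hom_S(M,S),S)` is bijective and `Ext_S^i(M,S) = 0 = Ext_S^i(M^*,S)`
for all `i ≥ 1`. -/
def IsTotallyReflexive (S : Type u) [CommRing S] (M : Type u) [AddCommGroup M]
    [Module S M] : Prop :=
  Module.Finite S M ∧ Function.Bijective (Module.Dual.eval S M) ∧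
    ∀ i : ℕ, 1 ≤ i → Subsingleton (extModule S i M S) ∧
      Subsingleton (extModule S i (Module.Dual S M) S)

/-- A noetherian local ring is G-regular if every totally reflexive module is free. -/
def IsGRegular (S : Type u) [CommRing S] : Prop :=
  ∀ (M : Type u) [AddCommGroup M] [Module S M], IsTotallyReflexive S M → Module.Free S M

/-- A commutative ring is a regular local ring if it is a noetherian local ring whose
maximal ideal is generated by a regular sequence. -/
def IsRegularLocal (A : Type u) [CommRing A] : Prop :=
  IsNoetherianRing A ∧ ∃ h : IsLocalRing A, ∃ rs : List A,
    RingTheory.Sequence.IsRegular A rs ∧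
      Ideal.span { x | x ∈ rs } = @IsLocalRing.maximalIdeal A _ h

/-- A Gorenstein local ring: a noetherian local ring of finite self-injective dimension. -/
def IsGorensteinLocal (A : Type u) [CommRing A] : Prop :=
  IsNoetherianRing A ∧ IsLocalRing A ∧ injDim A A < ⊤

/-- `E` is an injective envelope (injective hull) of the residue field of the local
ring `S`: an injective module containing the residue field as an essential submodule. -/
def IsInjEnvResidueField (S : Type u) [CommRing S] [IsLocalRing S] (E : Type u)
    [AddCommGroup E] [Module S E] : Prop :=
  Module.Injective S E ∧ ∃ ι : ResidueField S →ₗ[S] E, Function.Injective ι ∧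
    ∀ N : Submodule S E, N ≠ ⊥ → N ⊓ LinearMap.range ι ≠ ⊥

end
/- ## Cohen factorizations and (exceptional) complete intersection maps -/

noncomputable section

/-- The canonical ring homomorphism from a local ring `S` to its
maximal-adic completion. -/
def completionHom (S : Type u) [CommRing S] [IsLocalRing S] :
    S →+* AdicCompletion (maximalIdeal S) S :=
  algebraMap S (AdicCompletion (maximalIdeal S) S)

/-- `R → R' → Ŝ` is a Cohen factorization of the local homomorphism `f : R → S`:
`R'` is a complete noetherian local ring, `R → R'` is a flat local homomorphism with
regular closed fiber `R'/mR'`, and `R' → Ŝ` is surjective, the composite being the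
composition of `f` with the completion map of `S`. -/
def IsCohenFactorization {R S R' : Type u} [CommRing R] [CommRing S] [IsLocalRing R]
    [IsLocalRing S] [CommRing R'] (f : R →+* S) (g : R →+* R')
    (h : R' →+* AdicCompletion (maximalIdeal S) S) : Prop :=
  IsNoetherianRing R' ∧ IsLocalRing R' ∧ IsAdicComplete ((⊥ : Ideal R').jacobson) R' ∧
    h.comp g = (completionHom S).comp f ∧ IsLocalHom g ∧ g.Flat ∧
    IsRegularLocal (R' ⧸ (maximalIdeal R).map g) ∧ Function.Surjective h

/-- A local homomorphism `f : R → S` of noetherian local rings is a complete intersection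
map if in some Cohen factorization `R → R' → Ŝ` the kernel of `R' → Ŝ` is generated by a
regular sequence. -/
def IsCIMap {R S : Type u} [CommRing R] [CommRing S] [IsLocalRing R] [IsLocalRing S]
    (f : R →+* S) : Prop :=
  ∃ (R' : Type u) (_ : CommRing R') (g : R →+* R')
    (h : R' →+* AdicCompletion (maximalIdeal S) S),
    IsCohenFactorization f g h ∧ ∃ rs : List R',
      RingTheory.Sequence.IsRegular R' rs ∧ RingHom.ker h = Ideal.span { x | x ∈ rs }

/-- A local homomorphism `f : R → S` of noetherian local rings is an exceptional complete
intersection map if it is a complete intersection map and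
`edim R - dim R = edim S - dim S`. -/
def IsExceptionalCIMap {R S : Type u} [CommRing R] [CommRing S] [IsLocalRing R]
    [IsLocalRing S] (f : R →+* S) : Prop :=
  IsCIMap f ∧
    (embDim R : WithBot ℕ∞) + ringKrullDim S =
      (embDim S : WithBot ℕ∞) + ringKrullDim R

end
/- ## Homological dimensions along a ring homomorphism -/

noncomputable section

variable {R S : Type u} [CommRing R] [CommRing S]

/-- The flat dimension `fd_R S` of `S` as an `R`-module along `f : R → S`. -/
def flatDimAlong (f : R →+* S) : ℕ∞ :=
  letI := f.toModule; flatDim R S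

/-- The Gorenstein flat dimension over `R` of an `S`-module `M`, viewed as an
`R`-module along `f : R → S`. -/
def gfdAlong (f : R →+* S) (M : Type u) [AddCommGroup M] [Module S M] : ℕ∞ :=
  letI := Module.compHom M f; gfd R M

/-- The Gorenstein injective dimension over `R` of an `S`-module `M`, viewed as an
`R`-module along `f : R → S`. -/
def gidAlong (f : R →+* S) (M : Type u) [AddCommGroup M] [Module S M] : ℕ∞ :=
  letI := Module.compHom M f; gid R M

/-- `M` is Gorenstein flat as an `R`-module along `f : R → S`. -/
def IsGorensteinFlatAlong (f : R →+* S) (M : Type u) [AddCommGroup M] [Module S M] : Prop :=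
  letI := Module.compHom M f; IsGorensteinFlat R M

/-- `M` is Gorenstein injective as an `R`-module along `f : R → S`. -/
def IsGorensteinInjectiveAlong (f : R →+* S) (M : Type u) [AddCommGroup M]
    [Module S M] : Prop :=
  letI := Module.compHom M f; IsGorensteinInjective R M

end
/- ## Dualizing complexes -/

noncomputable section

/-- The data of a `ℤ`-indexed sequence of modules with degree `+1` maps. -/
structure CochainData (R : Type u) [CommRing R] where
  D : ℤ → Type u
  [instAdd : ∀ i, AddCommGroup (D i)]
  [instMod : ∀ i, Module R (D i)]
  d : (i : ℤ) → D i →ₗ[R] D (i + 1)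

attribute [instance] CochainData.instAdd CochainData.instMod

namespace CochainData

variable {R : Type u} [CommRing R] (C : CochainData R)

/-- Transport along an equality of indices. -/
def cast {a b : ℤ} (h : a = b) : C.D a →ₗ[R] C.D b := by subst h; exact LinearMap.id

/-- Degree `n` component of the endomorphism Hom-complex `Hom(C, C)`. -/
abbrev Hc (n : ℤ) : Type u := ∀ i : ℤ, C.D i →ₗ[R] C.D (i + n)

/-- Transport along an equality of degrees in the Hom-complex. -/
def hcast {a b : ℤ} (h : a = b) (x : C.Hc a) : C.Hc b := h ▸ x

/-- The differential of the endomorphism Hom-complex: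
`δ(φ) = d ∘ φ - (-1)ⁿ φ ∘ d`. -/
def δ (n : ℤ) (φ : C.Hc n) : C.Hc (n + 1) := fun i =>
  (C.cast (show i + n + 1 = i + (n + 1) by ring)).comp ((C.d (i + n)).comp (φ i)) -
    (Int.negOnePow n : ℤ) •
      (C.cast (show i + 1 + n = i + (n + 1) by ring)).comp ((φ (i + 1)).comp (C.d i))

/-- The canonical degree-zero cocycle `r • id` of the endomorphism Hom-complex. -/
def unit (r : R) : C.Hc 0 := fun i =>
  (C.cast (show i = i + 0 by ring)).comp (r • LinearMap.id)

end CochainData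

/-- A dualizing complex for `R`: a bounded complex of injective `R`-modules with finitely
generated cohomology (in particular of finite injective dimension), whose endomorphism
complex in the derived category is isomorphic to `R`, i.e. the cohomology of the Hom-complex
`Hom(D, D)` vanishes in nonzero degrees and in degree zero is isomorphic to `R` via
`r ↦ r • id`. -/
structure DualizingComplex (R : Type u) [CommRing R] extends CochainData R where
  comp_zero : ∀ i : ℤ, (d (i + 1)).comp (d i) = 0
  injective : ∀ i, Module.Injective R (D i)
  bounded : ∃ a b : ℤ, ∀ i : ℤ, i < a ∨ b < i → Subsingleton (D i)
  finite_cohomology : ∀ i : ℤ,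
    Module.Finite R
      (↥(LinearMap.ker (d (i + 1))) ⧸
        Submodule.comap (LinearMap.ker (d (i + 1))).subtype (LinearMap.range (d i)))
  hom_exact : ∀ n : ℤ, n ≠ -1 →
    Function.Exact (toCochainData.δ n) (toCochainData.δ (n + 1))
  h0_surjective : ∀ φ : toCochainData.Hc 0, toCochainData.δ 0 φ = 0 →
    ∃ (r : R) (ψ : toCochainData.Hc (-1)),
      φ = toCochainData.unit r +
        toCochainData.hcast (by norm_num) (toCochainData.δ (-1) ψ)
  h0_injective : ∀ r : R,
    (∃ ψ : toCochainData.Hc (-1),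
      toCochainData.hcast (by norm_num) (toCochainData.δ (-1) ψ) =
        toCochainData.unit r) → r = 0

/-- `R` has a dualizing complex. -/
def HasDualizingComplex (R : Type u) [CommRing R] : Prop :=
  Nonempty (DualizingComplex R)

end

/-! ### Vanishing of Ext groups of modules -/

section ExtVanishing

open CategoryTheory Abelian

/-- A short exact sequence of modules. -/
structure SES {R : Type u} [CommRing R] {M₁ M₂ M₃ : Type u} [AddCommGroup M₁] [Module R M₁]
    [AddCommGroup M₂] [Module R M₂] [AddCommGroup M₃] [Module R M₃]
    (f : M₁ →ₗ[R] M₂) (g : M₂ →ₗ[R] M₃) : Prop where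
  inj : Function.Injective f
  surj : Function.Surjective g
  exact : Function.Exact f g

/-- `Ext_R^i(X, M) = 0`. -/
def EV (R : Type u) [CommRing R] (X M : Type u) [AddCommGroup X] [Module R X]
    [AddCommGroup M] [Module R M] (i : ℕ) : Prop :=
  Subsingleton (Ext (ModuleCat.of R X) (ModuleCat.of R M) i)

variable {R : Type u} [CommRing R]
variable {X Y M M₁ M₂ M₃ : Type u} [AddCommGroup X] [Module R X] [AddCommGroup Y] [Module R Y]
  [AddCommGroup M] [Module R M]
  [AddCommGroup M₁] [Module R M₁] [AddCommGroup M₂] [Module R M₂] [AddCommGroup M₃] [Module R M₃]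
  {f : M₁ →ₗ[R] M₂} {g : M₂ →ₗ[R] M₃}

theorem SES.comp_eq_zero (h : SES f g) : g ∘ₗ f = 0 := h.exact.linearMap_comp_eq_zero

theorem SES.apply_apply (h : SES f g) (x : M₁) : g (f x) = 0 := h.exact.apply_apply_eq_zero x

theorem SES.shortExact (h : SES f g) :
    (ShortComplex.mk (ModuleCat.ofHom f) (ModuleCat.ofHom g) (by
      rw [← ModuleCat.ofHom_comp, h.comp_eq_zero]; rfl)).ShortExact :=
  ModuleCat.shortComplex_shortExact _ (by exact h.exact) (by exact h.inj) (by exact h.surj)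

theorem SES.ev_cov2 (h : SES f g) {i : ℕ} (h1 : EV R X M₁ i) (h3 : EV R X M₃ i) :
    EV R X M₂ i := by
  unfold EV at *
  refine subsingleton_of_forall_eq 0 fun x => ?_
  obtain ⟨y, rfl⟩ := Ext.covariant_sequence_exact₂ (ModuleCat.of R X) h.shortExact x
    (h3.elim _ _)
  rw [h1.elim y 0, Ext.zero_comp]

theorem SES.ev_cov1 (h : SES f g) {i : ℕ} (h3 : EV R X M₃ i) (h2 : EV R X M₂ (i + 1)) :
    EV R X M₁ (i + 1) := by
  unfold EV at *
  refine subsingleton_of_forall_eq 0 fun x => ?_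
  obtain ⟨y, rfl⟩ := Ext.covariant_sequence_exact₁ (ModuleCat.of R X) h.shortExact x
    (h2.elim _ _) rfl
  rw [h3.elim y 0, Ext.zero_comp]

theorem SES.ev_cov3 (h : SES f g) {i : ℕ} (h2 : EV R X M₂ i) (h1 : EV R X M₁ (i + 1)) :
    EV R X M₃ i := by
  unfold EV at *
  refine subsingleton_of_forall_eq 0 fun x => ?_
  obtain ⟨y, rfl⟩ := Ext.covariant_sequence_exact₃ (ModuleCat.of R X) h.shortExact x rfl
    (h1.elim _ _)
  rw [h2.elim y 0, Ext.zero_comp]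

theorem SES.ev_con2 (h : SES f g) {i : ℕ} (h1 : EV R M₁ Y i) (h3 : EV R M₃ Y i) :
    EV R M₂ Y i := by
  unfold EV at *
  refine subsingleton_of_forall_eq 0 fun x => ?_
  obtain ⟨y, rfl⟩ := Ext.contravariant_sequence_exact₂ h.shortExact (ModuleCat.of R Y) x
    (h1.elim _ _)
  rw [h3.elim y 0, Ext.comp_zero]

theorem SES.ev_con3 (h : SES f g) {i : ℕ} (h1 : EV R M₁ Y i) (h2 : EV R M₂ Y (i + 1)) :
    EV R M₃ Y (i + 1) := by
  unfold EV at *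
  refine subsingleton_of_forall_eq 0 fun x => ?_
  obtain ⟨y, rfl⟩ := Ext.contravariant_sequence_exact₃ h.shortExact (ModuleCat.of R Y) x
    (h2.elim _ _) (add_comm 1 i)
  rw [h1.elim y 0, Ext.comp_zero]

theorem SES.ev_con1 (h : SES f g) {i : ℕ} (h2 : EV R M₂ Y i) (h3 : EV R M₃ Y (i + 1)) :
    EV R M₁ Y i := by
  unfold EV at *
  refine subsingleton_of_forall_eq 0 fun x => ?_
  obtain ⟨y, rfl⟩ := Ext.contravariant_sequence_exact₁ h.shortExact (ModuleCat.of R Y) x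
    (add_comm 1 i) (h3.elim _ _)
  rw [h2.elim y 0, Ext.comp_zero]

theorem ev_zero_iff : EV R X M 0 ↔ Subsingleton (X →ₗ[R] M) := by
  unfold EV
  exact (Ext.addEquiv₀.toEquiv.trans ModuleCat.homEquiv).subsingleton_congr

theorem SES.lift (h : SES f g) (h1 : EV R X M₁ 1) (φ : X →ₗ[R] M₃) :
    ∃ ψ : X →ₗ[R] M₂, g ∘ₗ ψ = φ := by
  unfold EV at *
  obtain ⟨y, hy⟩ := Ext.covariant_sequence_exact₃ (ModuleCat.of R X) h.shortExact
    (Ext.mk₀ (ModuleCat.ofHom φ)) (zero_add 1) (h1.elim _ _)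
  obtain ⟨y, rfl⟩ := (Ext.mk₀_bijective _ _).2 y
  rw [Ext.mk₀_comp_mk₀] at hy
  have := (Ext.mk₀_bijective _ _).1 hy
  exact ⟨y.hom, congrArg ModuleCat.Hom.hom this⟩

theorem SES.extend (h : SES f g) (h3 : EV R M₃ Y 1) (φ : M₁ →ₗ[R] Y) :
    ∃ ψ : M₂ →ₗ[R] Y, ψ ∘ₗ f = φ := by
  unfold EV at *
  obtain ⟨y, hy⟩ := Ext.contravariant_sequence_exact₁ h.shortExact (ModuleCat.of R Y)
    (Ext.mk₀ (ModuleCat.ofHom φ)) (add_zero 1) (h3.elim _ _)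
  obtain ⟨y, rfl⟩ := (Ext.mk₀_bijective _ _).2 y
  rw [Ext.mk₀_comp_mk₀] at hy
  have := (Ext.mk₀_bijective _ _).1 hy
  exact ⟨y.hom, congrArg ModuleCat.Hom.hom this⟩

theorem SES.ev1_of_lift (h : SES f g) (hl : ∀ φ : X →ₗ[R] M₃, ∃ ψ : X →ₗ[R] M₂, g ∘ₗ ψ = φ)
    (h2 : EV R X M₂ 1) : EV R X M₁ 1 := by
  unfold EV at *
  refine subsingleton_of_forall_eq 0 fun x => ?_
  obtain ⟨y, rfl⟩ := Ext.covariant_sequence_exact₁ (ModuleCat.of R X) h.shortExact x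
    (h2.elim _ _) (zero_add 1)
  obtain ⟨y, rfl⟩ := (Ext.mk₀_bijective _ _).2 y
  obtain ⟨ψ, hψ⟩ := hl y.hom
  have : y = ModuleCat.ofHom ψ ≫ ModuleCat.ofHom g := ModuleCat.hom_ext hψ.symm
  rw [this, ← Ext.mk₀_comp_mk₀, Ext.comp_assoc _ _ _ (add_zero 0) (zero_add 1) (by simp)]
  have := h.shortExact.comp_extClass
  dsimp at this
  rw [this, Ext.comp_zero]

theorem SES.ev1_of_extend (h : SES f g) (hl : ∀ φ : M₁ →ₗ[R] Y, ∃ ψ : M₂ →ₗ[R] Y, ψ ∘ₗ f = φ)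
    (h2 : EV R M₂ Y 1) : EV R M₃ Y 1 := by
  unfold EV at *
  refine subsingleton_of_forall_eq 0 fun x => ?_
  obtain ⟨y, rfl⟩ := Ext.contravariant_sequence_exact₃ h.shortExact (ModuleCat.of R Y) x
    (h2.elim _ _) (add_zero 1)
  obtain ⟨y, rfl⟩ := (Ext.mk₀_bijective _ _).2 y
  obtain ⟨ψ, hψ⟩ := hl y.hom
  have : y = ModuleCat.ofHom f ≫ ModuleCat.ofHom ψ := ModuleCat.hom_ext hψ.symm
  rw [this, ← Ext.mk₀_comp_mk₀, ← Ext.comp_assoc _ _ _ (add_zero 1) (zero_add 0) (by simp)]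
  have := h.shortExact.extClass_comp
  dsimp at this
  rw [this, Ext.zero_comp]

theorem ev_of_injective [Module.Injective R M] (i : ℕ) : EV R X M (i + 1) := by
  have := (Module.injective_iff_injective_object R M).1 inferInstance
  exact Ext.subsingleton_of_injective _ _ _

theorem ev_of_projective [Module.Projective R X] (i : ℕ) : EV R X M (i + 1) := by
  have := (IsProjective.iff_projective (R := R) X).1 inferInstance
  exact Ext.subsingleton_of_projective _ _ _

/-- Ext vanishing passes to retracts in the first variable. -/
theorem EV.retract_left {i : ℕ} (h : EV R Y M i) (s : X →ₗ[R] Y) (r : Y →ₗ[R] X)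
    (hrs : r ∘ₗ s = LinearMap.id) : EV R X M i := by
  unfold EV at *
  refine subsingleton_of_forall_eq 0 fun x => ?_
  have h1 : ModuleCat.ofHom s ≫ ModuleCat.ofHom r = 𝟙 (ModuleCat.of R X) := by
    rw [← ModuleCat.ofHom_comp, hrs]; rfl
  rw [← Ext.mk₀_id_comp x, ← h1, ← Ext.mk₀_comp_mk₀,
    Ext.comp_assoc _ _ _ (add_zero 0) (zero_add i) (by simp),
    h.elim ((Ext.mk₀ (ModuleCat.ofHom r)).comp x (zero_add i)) 0, Ext.comp_zero]

/-- Ext vanishing passes to retracts in the second variable. -/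
theorem EV.retract_right {i : ℕ} (h : EV R X Y i) (s : M →ₗ[R] Y) (r : Y →ₗ[R] M)
    (hrs : r ∘ₗ s = LinearMap.id) : EV R X M i := by
  unfold EV at *
  refine subsingleton_of_forall_eq 0 fun x => ?_
  have h1 : ModuleCat.ofHom s ≫ ModuleCat.ofHom r = 𝟙 (ModuleCat.of R M) := by
    rw [← ModuleCat.ofHom_comp, hrs]; rfl
  rw [← Ext.comp_mk₀_id x, ← h1, ← Ext.mk₀_comp_mk₀,
    ← Ext.comp_assoc _ _ _ (add_zero i) (add_zero 0) (by simp),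
    h.elim (x.comp (Ext.mk₀ (ModuleCat.ofHom s)) (add_zero i)) 0, Ext.zero_comp]

theorem EV.congr_left {i : ℕ} (h : EV R Y M i) (e : X ≃ₗ[R] Y) : EV R X M i :=
  h.retract_left e.toLinearMap e.symm.toLinearMap (by ext; simp)

theorem EV.congr_right {i : ℕ} (h : EV R X Y i) (e : M ≃ₗ[R] Y) : EV R X M i :=
  h.retract_right e.toLinearMap e.symm.toLinearMap (by ext; simp)

theorem ev_of_subsingleton_left [Subsingleton X] (i : ℕ) : EV R X M i := by
  cases i with
  | zero =>
    rw [ev_zero_iff]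
    exact ⟨fun a b => LinearMap.ext fun x => by simp [Subsingleton.elim x 0]⟩
  | succ n => exact ev_of_projective n

theorem ev_of_subsingleton_right [Subsingleton M] (i : ℕ) : EV R X M i := by
  refine EV.retract_right (Y := M) ?_ LinearMap.id LinearMap.id rfl
  cases i with
  | zero => rw [ev_zero_iff]; exact ⟨fun a b => LinearMap.ext fun x => Subsingleton.elim _ _⟩
  | succ n =>
    have : Module.Injective R M := ⟨fun {_ _} _ _ _ _ _ _ _ => ⟨0, fun _ => Subsingleton.elim _ _⟩⟩
    exact ev_of_injective n

theorem ses_prod : SES (LinearMap.inl R M Y) (LinearMap.snd R M Y) :=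
  ⟨LinearMap.inl_injective, LinearMap.snd_surjective, .inl_snd⟩

theorem EV.pi_fin_right {i : ℕ} (h : EV R X M i) (n : ℕ) : EV R X (Fin n → M) i := by
  induction n with
  | zero => exact ev_of_subsingleton_right i
  | succ n ih =>
    have : EV R X (M × (Fin n → M)) i := ses_prod.ev_cov2 h ih
    exact this.congr_right (Fin.consLinearEquiv R (fun _ => M)).symm

theorem EV.pi_fin_left {i : ℕ} (h : EV R X M i) (n : ℕ) : EV R (Fin n → X) M i := by
  induction n with
  | zero => exact ev_of_subsingleton_left i
  | succ n ih =>
    have : EV R (X × (Fin n → X)) M i := ses_prod.ev_con2 h ih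
    exact this.congr_left (Fin.consLinearEquiv R (fun _ => X)).symm

/-- Nakayama's lemma for Ext. -/
theorem ev_of_nakayama [IsNoetherianRing R] [Module.Finite R X] [Module.Finite R M]
    {y : R} (hy : y ∈ (⊥ : Ideal R).jacobson) {g : M →ₗ[R] M₃}
    (h : SES (LinearMap.lsmul R M y) g) {i : ℕ} (h3 : EV R X M₃ i) : EV R X M i := by
  unfold EV at *
  have hfin : Module.Finite R (Ext (ModuleCat.of R X) (ModuleCat.of R M) i) := inferInstance
  have htop : (⊤ : Submodule R (Ext (ModuleCat.of R X) (ModuleCat.of R M) i)) = ⊥ := by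
    refine Submodule.eq_bot_of_le_smul_of_le_jacobson_bot (Ideal.span {y}) _ hfin.fg_top ?_
      (by rwa [Ideal.span_singleton_le_iff_mem])
    intro x _
    obtain ⟨z, hz⟩ := Ext.covariant_sequence_exact₂ (ModuleCat.of R X) h.shortExact x
      (h3.elim _ _)
    have h1 : ModuleCat.ofHom (LinearMap.lsmul R M y) = y • 𝟙 (ModuleCat.of R M) := rfl
    dsimp only at hz
    rw [h1, ← Ext.smul_eq_comp_mk₀] at hz
    rw [← hz]
    exact Submodule.smul_mem_smul (Ideal.mem_span_singleton_self y) trivial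
  exact subsingleton_of_forall_eq 0 fun x => (Submodule.mem_bot R).1 (htop ▸ trivial)

theorem ses_ker (g : M₂ →ₗ[R] M₃) (h : Function.Surjective g) :
    SES (LinearMap.ker g).subtype g :=
  ⟨Subtype.val_injective, h, LinearMap.exact_subtype_ker_map g⟩

theorem ses_range (f : M₁ →ₗ[R] M₂) (h : Function.Injective f) :
    SES f (LinearMap.range f).mkQ :=
  ⟨h, Submodule.mkQ_surjective _, LinearMap.exact_map_mkQ_range f⟩

end ExtVanishing

/-! ### Diagram lemmas for short exact sequences -/

section Diagrams

variable {R : Type u} [CommRing R]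
variable {A B C : Type u} [AddCommGroup A] [Module R A] [AddCommGroup B] [Module R B]
  [AddCommGroup C] [Module R C] {f : A →ₗ[R] B} {g : B →ₗ[R] C}
  {X Y Z W : Type u} [AddCommGroup X] [Module R X] [AddCommGroup Y] [Module R Y]
  [AddCommGroup Z] [Module R Z] [AddCommGroup W] [Module R W]

theorem SES.range_eq (h : SES f g) : LinearMap.range f = LinearMap.ker g :=
  (LinearMap.exact_iff.1 h.exact).symm

theorem SES.exists_of_apply_eq_zero (h : SES f g) {b : B} (hb : g b = 0) : ∃ a, f a = b :=
  (h.exact b).1 hb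

/-- The left term of a short exact sequence is the kernel. -/
noncomputable def SES.kerEquiv (h : SES f g) : A ≃ₗ[R] LinearMap.ker g :=
  (LinearEquiv.ofInjective f h.inj).trans (LinearEquiv.ofEq _ _ h.range_eq)

/-- The right term of a short exact sequence is the quotient. -/
noncomputable def SES.quotEquiv (h : SES f g) : (B ⧸ LinearMap.range f) ≃ₗ[R] C :=
  (Submodule.quotEquivOfEq _ _ h.range_eq).trans (g.quotKerEquivOfSurjective h.surj)

theorem SES.congr_left (h : SES f g) (e : X ≃ₗ[R] A) : SES (f ∘ₗ e.toLinearMap) g :=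
  ⟨h.inj.comp e.injective, h.surj, fun b => by
    rw [h.exact b]
    exact ⟨fun ⟨a, ha⟩ => ⟨e.symm a, by simpa using ha⟩, fun ⟨x, hx⟩ => ⟨e x, hx⟩⟩⟩

theorem SES.congr_right (h : SES f g) (e : C ≃ₗ[R] X) : SES f (e.toLinearMap ∘ₗ g) :=
  ⟨h.inj, e.surjective.comp h.surj, fun b => by rw [← h.exact b]; simp⟩

theorem ses_zero_right (e : X ≃ₗ[R] Y) [Subsingleton Z] : SES e.toLinearMap (0 : Y →ₗ[R] Z) :=
  ⟨e.injective, fun z => ⟨0, Subsingleton.elim _ _⟩, fun y => by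
    simp only [LinearMap.zero_apply, true_iff]; exact ⟨e.symm y, by simp⟩⟩

theorem ses_zero_left (e : X ≃ₗ[R] Y) [Subsingleton Z] : SES (0 : Z →ₗ[R] X) e.toLinearMap :=
  ⟨fun _ _ _ => Subsingleton.elim _ _, e.surjective, fun y => by
    simp only [LinearEquiv.coe_coe, LinearEquiv.map_eq_zero_iff]
    exact ⟨fun h => ⟨0, by simp [h]⟩, fun ⟨_, h⟩ => by simpa using h.symm⟩⟩

theorem SES.horseshoe_proj (h : SES f g) {pa : X →ₗ[R] A} (ha : Function.Surjective pa)
    {pc : Y →ₗ[R] C} (hc : Function.Surjective pc) {l : Y →ₗ[R] B} (hl : g ∘ₗ l = pc) :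
    Function.Surjective ((f ∘ₗ pa).coprod l) ∧
      ∃ (i : LinearMap.ker pa →ₗ[R] LinearMap.ker ((f ∘ₗ pa).coprod l))
        (p : LinearMap.ker ((f ∘ₗ pa).coprod l) →ₗ[R] LinearMap.ker pc), SES i p := by
  have hl' : ∀ y, g (l y) = pc y := fun y => LinearMap.congr_fun hl y
  refine ⟨fun b => ?_, ?_⟩
  · obtain ⟨y, hy⟩ := hc (g b)
    obtain ⟨a, ha'⟩ := h.exists_of_apply_eq_zero (b := b - l y) (by rw [map_sub, hl', hy, sub_self])
    obtain ⟨x, rfl⟩ := ha a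
    exact ⟨(x, y), by simp [ha']⟩
  · refine ⟨(LinearMap.inl R X Y).restrict fun x hx => ?_,
      (LinearMap.snd R X Y).restrict fun z hz => ?_, ?_, ?_, ?_⟩
    · have : pa x = 0 := hx
      simp [this]
    · have : f (pa z.1) + l z.2 = 0 := by simpa using hz
      have := congrArg g this
      simpa [h.apply_apply, hl'] using this
    · intro x y hxy
      have := congrArg (fun z => (z.1 : X × Y).1) hxy
      exact Subtype.ext this
    · rintro ⟨y, hy⟩
      have hy' : pc y = 0 := hy
      obtain ⟨a, ha'⟩ := h.exists_of_apply_eq_zero (b := l y) (by rw [hl', hy'])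
      obtain ⟨x, hx⟩ := ha a
      refine ⟨⟨(-x, y), ?_⟩, rfl⟩
      simp [hx, ha']
    · rintro ⟨⟨x, y⟩, hz⟩
      constructor
      · intro h0
        have h0 : y = 0 := congrArg Subtype.val h0
        subst h0
        have : f (pa x) = 0 := by simpa using hz
        exact ⟨⟨x, h.inj (by simpa using this)⟩, rfl⟩
      · rintro ⟨⟨x', hx'⟩, h0⟩
        have := congrArg (fun z => (z.1 : X × Y).2) h0
        exact Subtype.ext this.symm

theorem SES.horseshoe_inj (h : SES f g) {ia : A →ₗ[R] X} (ha : Function.Injective ia)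
    {ic : C →ₗ[R] Y} (hc : Function.Injective ic) {e : B →ₗ[R] X} (he : e ∘ₗ f = ia) :
    Function.Injective (e.prod (ic ∘ₗ g)) ∧
      ∃ (i : (X ⧸ LinearMap.range ia) →ₗ[R] ((X × Y) ⧸ LinearMap.range (e.prod (ic ∘ₗ g))))
        (p : ((X × Y) ⧸ LinearMap.range (e.prod (ic ∘ₗ g))) →ₗ[R] (Y ⧸ LinearMap.range ic)),
        SES i p := by
  have he' : ∀ a, e (f a) = ia a := fun a => LinearMap.congr_fun he a
  refine ⟨?_, ?_⟩
  · rw [injective_iff_map_eq_zero]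
    intro b hb
    have hb2 : ic (g b) = 0 := congrArg Prod.snd hb
    have hb1 : e b = 0 := congrArg Prod.fst hb
    obtain ⟨a, rfl⟩ := h.exists_of_apply_eq_zero (b := b) (hc (by simpa using hb2))
    rw [he'] at hb1
    rw [ha (hb1.trans (map_zero ia).symm), map_zero]
  · refine ⟨Submodule.mapQ _ _ (LinearMap.inl R X Y) ?_,
      Submodule.mapQ _ _ (LinearMap.snd R X Y) ?_, ?_, ?_, ?_⟩
    · rintro _ ⟨a, rfl⟩
      exact ⟨f a, by simp [he', h.apply_apply]⟩
    · rintro _ ⟨b, rfl⟩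
      exact ⟨g b, by simp⟩
    · rw [injective_iff_map_eq_zero]
      intro x hx
      obtain ⟨x, rfl⟩ := Submodule.mkQ_surjective _ x
      simp only [Submodule.mkQ_apply, Submodule.mapQ_apply, Submodule.Quotient.mk_eq_zero] at hx ⊢
      obtain ⟨b, hb⟩ := hx
      have hb2 : ic (g b) = 0 := congrArg Prod.snd hb
      have hb1 : e b = x := congrArg Prod.fst hb
      obtain ⟨a, rfl⟩ := h.exists_of_apply_eq_zero (b := b) (hc (by simpa using hb2))
      exact ⟨a, by rw [← he', hb1]⟩
    · intro y
      obtain ⟨y, rfl⟩ := Submodule.mkQ_surjective _ y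
      exact ⟨Submodule.mkQ _ (0, y), by simp⟩
    · intro z
      obtain ⟨⟨x, y⟩, rfl⟩ := Submodule.mkQ_surjective _ z
      constructor
      · intro hz
        simp only [Submodule.mkQ_apply, Submodule.mapQ_apply, Submodule.Quotient.mk_eq_zero] at hz
        obtain ⟨c, hc'⟩ := hz
        obtain ⟨b, rfl⟩ := h.surj c
        refine ⟨Submodule.mkQ _ (x - e b), ?_⟩
        simp only [Submodule.mkQ_apply, Submodule.mapQ_apply]
        rw [Submodule.Quotient.eq]
        refine ⟨-b, ?_⟩
        have : ic (g b) = y := hc'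
        ext <;> simp [this]
      · rintro ⟨x', hx'⟩
        obtain ⟨x', rfl⟩ := Submodule.mkQ_surjective _ x'
        rw [← hx']
        simp

theorem SES.pushout (h : SES f g) {i : A →ₗ[R] X} {q : X →ₗ[R] Y} (h' : SES i q) :
    ∃ (D : Type u) (_ : AddCommGroup D) (_ : Module R D) (u : X →ₗ[R] D) (p : D →ₗ[R] C)
      (v : B →ₗ[R] D) (w : D →ₗ[R] Y), SES u p ∧ SES v w := by
  let s := i.prod (-f)
  refine ⟨(X × B) ⧸ LinearMap.range s, inferInstance, inferInstance,
    Submodule.mkQ _ ∘ₗ LinearMap.inl R X B,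
    Submodule.liftQ _ (g ∘ₗ LinearMap.snd R X B) ?_, Submodule.mkQ _ ∘ₗ LinearMap.inr R X B,
    Submodule.liftQ _ (q ∘ₗ LinearMap.fst R X B) ?_, ⟨?_, ?_, ?_⟩, ⟨?_, ?_, ?_⟩⟩
  · rintro _ ⟨a, rfl⟩
    simp [s, h.apply_apply]
  · rintro _ ⟨a, rfl⟩
    simp [s, h'.apply_apply]
  · rw [injective_iff_map_eq_zero]
    intro x hx
    simp only [LinearMap.comp_apply, Submodule.mkQ_apply, Submodule.Quotient.mk_eq_zero] at hx
    obtain ⟨a, ha⟩ := hx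
    have h2 : f a = 0 := by simpa [s] using congrArg Prod.snd ha
    have h1 : i a = x := congrArg Prod.fst ha
    rw [← h1, h.inj (h2.trans (map_zero f).symm), map_zero]
  · intro c
    obtain ⟨b, rfl⟩ := h.surj c
    exact ⟨Submodule.mkQ _ (0, b), by simp⟩
  · intro z
    obtain ⟨⟨x, b⟩, rfl⟩ := Submodule.mkQ_surjective _ z
    constructor
    · intro hz
      obtain ⟨a, rfl⟩ := h.exists_of_apply_eq_zero (b := b) (by simpa using hz)
      refine ⟨x + i a, ?_⟩
      simp only [LinearMap.comp_apply, Submodule.mkQ_apply]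
      rw [Submodule.Quotient.eq]
      exact ⟨a, by ext <;> simp [s]⟩
    · rintro ⟨x', hx'⟩
      rw [← hx']
      simp
  · rw [injective_iff_map_eq_zero]
    intro b hb
    simp only [LinearMap.comp_apply, Submodule.mkQ_apply, Submodule.Quotient.mk_eq_zero] at hb
    obtain ⟨a, ha⟩ := hb
    have h2 : -f a = b := congrArg Prod.snd ha
    have h1 : i a = 0 := congrArg Prod.fst ha
    rw [← h2, h'.inj (h1.trans (map_zero i).symm), map_zero, neg_zero]
  · intro c
    obtain ⟨x, rfl⟩ := h'.surj c
    exact ⟨Submodule.mkQ _ (x, 0), by simp⟩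
  · intro z
    obtain ⟨⟨x, b⟩, rfl⟩ := Submodule.mkQ_surjective _ z
    constructor
    · intro hz
      obtain ⟨a, rfl⟩ := h'.exists_of_apply_eq_zero (b := x) (by simpa using hz)
      refine ⟨b + f a, ?_⟩
      simp only [LinearMap.comp_apply, Submodule.mkQ_apply]
      rw [Submodule.Quotient.eq]
      exact ⟨-a, by ext <;> simp [s]⟩
    · rintro ⟨x', hx'⟩
      rw [← hx']
      simp

theorem SES.pullback (h : SES f g) {i : X →ₗ[R] Y} {q : Y →ₗ[R] C} (h' : SES i q) :
    ∃ (D : Type u) (_ : AddCommGroup D) (_ : Module R D) (u : A →ₗ[R] D) (p : D →ₗ[R] Y)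
      (v : X →ₗ[R] D) (w : D →ₗ[R] B), SES u p ∧ SES v w := by
  let s := g ∘ₗ LinearMap.fst R B Y - q ∘ₗ LinearMap.snd R B Y
  have hs : ∀ z : B × Y, z ∈ LinearMap.ker s ↔ g z.1 = q z.2 := fun z => by
    simp [s, sub_eq_zero]
  refine ⟨LinearMap.ker s, inferInstance, inferInstance,
    (LinearMap.inl R B Y ∘ₗ f).codRestrict _ fun a => ?_,
    LinearMap.snd R B Y ∘ₗ Submodule.subtype _,
    (LinearMap.inr R B Y ∘ₗ i).codRestrict _ fun a => ?_,
    LinearMap.fst R B Y ∘ₗ Submodule.subtype _, ⟨?_, ?_, ?_⟩, ⟨?_, ?_, ?_⟩⟩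
  · rw [hs]; simp [h.apply_apply]
  · rw [hs]; simp [h'.apply_apply]
  · intro a b hab
    exact h.inj (congrArg (fun z => (z.1 : B × Y).1) hab)
  · intro y
    obtain ⟨b, hb⟩ := h.surj (q y)
    exact ⟨⟨(b, y), (hs _).2 hb⟩, rfl⟩
  · rintro ⟨⟨b, y⟩, hz⟩
    rw [hs] at hz
    constructor
    · intro h0
      have h0 : y = 0 := h0
      subst h0
      obtain ⟨a, rfl⟩ := h.exists_of_apply_eq_zero (b := b) (by simpa using hz)
      exact ⟨a, rfl⟩
    · rintro ⟨a, ha⟩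
      exact (congrArg (fun z => (z.1 : B × Y).2) ha).symm
  · intro a b hab
    exact h'.inj (congrArg (fun z => (z.1 : B × Y).2) hab)
  · intro b
    obtain ⟨y, hy⟩ := h'.surj (g b)
    exact ⟨⟨(b, y), (hs _).2 hy.symm⟩, rfl⟩
  · rintro ⟨⟨b, y⟩, hz⟩
    rw [hs] at hz
    constructor
    · intro h0
      have h0 : b = 0 := h0
      subst h0
      obtain ⟨a, rfl⟩ := h'.exists_of_apply_eq_zero (b := y) (by simpa using hz.symm)
      exact ⟨a, rfl⟩
    · rintro ⟨a, ha⟩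
      exact (congrArg (fun z => (z.1 : B × Y).1) ha).symm

theorem SES.quot_comp (h : SES f g) {j : B →ₗ[R] X} (hj : Function.Injective j) :
    ∃ (i : C →ₗ[R] (X ⧸ LinearMap.range (j ∘ₗ f)))
      (p : (X ⧸ LinearMap.range (j ∘ₗ f)) →ₗ[R] (X ⧸ LinearMap.range j)), SES i p := by
  have hle : LinearMap.range f ≤ LinearMap.ker ((LinearMap.range (j ∘ₗ f)).mkQ ∘ₗ j) := by
    rintro _ ⟨a, rfl⟩
    simp only [LinearMap.mem_ker, LinearMap.comp_apply, Submodule.mkQ_apply,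
      Submodule.Quotient.mk_eq_zero]
    exact ⟨a, rfl⟩
  refine ⟨(LinearMap.range f).liftQ _ hle ∘ₗ h.quotEquiv.symm.toLinearMap,
    Submodule.factor (LinearMap.range_comp_le_range f j), ?_, Submodule.factor_surjective _, ?_⟩
  · rw [LinearMap.coe_comp]
    refine Function.Injective.comp ?_ h.quotEquiv.symm.injective
    rw [injective_iff_map_eq_zero]
    intro b hb
    obtain ⟨b, rfl⟩ := Submodule.mkQ_surjective _ b
    simp only [Submodule.mkQ_apply, Submodule.liftQ_apply, LinearMap.comp_apply,
      Submodule.Quotient.mk_eq_zero] at hb ⊢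
    obtain ⟨a, ha⟩ := hb
    exact ⟨a, hj ha⟩
  · intro z
    obtain ⟨x, rfl⟩ := Submodule.mkQ_surjective _ z
    constructor
    · intro hz
      obtain ⟨b, rfl⟩ : x ∈ LinearMap.range j := by simpa using hz
      exact ⟨h.quotEquiv (Submodule.Quotient.mk b), by simp⟩
    · rintro ⟨c, hc⟩
      obtain ⟨b, rfl⟩ := h.quotEquiv.surjective c
      obtain ⟨b, rfl⟩ := Submodule.mkQ_surjective _ b
      rw [← hc]
      simp

theorem SES.ker_comp (h : SES f g) {q : X →ₗ[R] B} (hq : Function.Surjective q) :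
    ∃ (i : LinearMap.ker q →ₗ[R] LinearMap.ker (g ∘ₗ q))
      (p : LinearMap.ker (g ∘ₗ q) →ₗ[R] A), SES i p := by
  refine ⟨Submodule.inclusion (LinearMap.ker_le_ker_comp q g),
    h.kerEquiv.symm.toLinearMap ∘ₗ q.restrict (fun x hx => hx), Submodule.inclusion_injective _,
    h.kerEquiv.symm.surjective.comp ?_, ?_⟩
  · rintro ⟨b, hb⟩
    obtain ⟨x, rfl⟩ := hq b
    exact ⟨⟨x, hb⟩, rfl⟩
  · rintro ⟨x, hx⟩
    simp only [LinearMap.comp_apply, LinearEquiv.coe_coe, LinearEquiv.map_eq_zero_iff]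
    constructor
    · intro h0
      exact ⟨⟨x, congrArg Subtype.val h0⟩, rfl⟩
    · rintro ⟨⟨y, hy⟩, h0⟩
      have : y = x := congrArg Subtype.val h0
      subst this
      exact Subtype.ext hy

/-- A map with larger kernel factors through any map into an injective module. -/
theorem Module.Injective.exists_comp_eq {E : Type u} [AddCommGroup E] [Module R E]
    (hE : Module.Injective R E) (α : A →ₗ[R] B) (φ : A →ₗ[R] E)
    (h : LinearMap.ker α ≤ LinearMap.ker φ) : ∃ ψ : B →ₗ[R] E, ψ ∘ₗ α = φ := by
  obtain ⟨ψ, hψ⟩ := hE.out ((LinearMap.ker α).liftQ α le_rfl)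
    (LinearMap.ker_eq_bot.1 (Submodule.ker_liftQ_eq_bot _ _ _ le_rfl))
    ((LinearMap.ker α).liftQ φ h)
  exact ⟨ψ, LinearMap.ext fun a => hψ (Submodule.Quotient.mk a)⟩

theorem Module.Injective.of_equiv {E E' : Type u} [AddCommGroup E] [Module R E]
    [AddCommGroup E'] [Module R E'] (h : Module.Injective R E) (e : E ≃ₗ[R] E') :
    Module.Injective R E' :=
  ⟨fun {X Y} _ _ _ _ f hf g => by
    obtain ⟨ψ, hψ⟩ := h.out f hf (e.symm.toLinearMap ∘ₗ g)
    exact ⟨e.toLinearMap ∘ₗ ψ, fun x => by simp [hψ]⟩⟩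

theorem Module.Injective.prod {E E' : Type u} [AddCommGroup E] [Module R E]
    [AddCommGroup E'] [Module R E'] (h : Module.Injective R E) (h' : Module.Injective R E') :
    Module.Injective R (E × E') :=
  ⟨fun {X Y} _ _ _ _ f hf g => by
    obtain ⟨ψ, hψ⟩ := h.out f hf (LinearMap.fst R E E' ∘ₗ g)
    obtain ⟨ψ', hψ'⟩ := h'.out f hf (LinearMap.snd R E E' ∘ₗ g)
    exact ⟨ψ.prod ψ', fun x => by ext <;> simp [hψ, hψ']⟩⟩

theorem Module.Injective.exists_embedding (R : Type u) [CommRing R] (A : Type u) [AddCommGroup A]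
    [Module R A] : ∃ (E : Type u) (_ : AddCommGroup E) (_ : Module R E) (i : A →ₗ[R] E),
      Module.Injective R E ∧ Function.Injective i := by
  let E := CategoryTheory.Injective.under (ModuleCat.of R A)
  refine ⟨E, inferInstance, inferInstance, (CategoryTheory.Injective.ι (ModuleCat.of R A)).hom,
    (Module.injective_iff_injective_object R E).2 (by
      exact (inferInstance : CategoryTheory.Injective E)), ?_⟩
  exact (ModuleCat.mono_iff_injective _).1 inferInstance

end Diagrams

/-! ### Torsion submodules and divisibility -/

section Torsion

variable {R : Type u} [CommRing R]

/-- Every element of `M` is annihilated by a power of each element of `s`. -/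
def IsTors (s : Set R) (M : Type u) [AddCommGroup M] [Module R M] : Prop :=
  ∀ a ∈ s, ∀ x : M, ∃ n : ℕ, a ^ n • x = 0

/-- The submodule of `a`-power torsion elements. -/
def gam (a : R) (M : Type u) [AddCommGroup M] [Module R M] : Submodule R M where
  carrier := {x | ∃ n : ℕ, a ^ n • x = 0}
  zero_mem' := ⟨0, by simp⟩
  add_mem' := by
    rintro x y ⟨n, hn⟩ ⟨k, hk⟩
    refine ⟨n + k, ?_⟩
    rw [smul_add, pow_add, mul_comm, mul_smul, hn, smul_zero, mul_comm, mul_smul, hk, smul_zero,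
      add_zero]
  smul_mem' := by
    rintro r x ⟨n, hn⟩
    exact ⟨n, by rw [smul_comm, hn, smul_zero]⟩

variable {A B C : Type u} [AddCommGroup A] [Module R A] [AddCommGroup B] [Module R B]
  [AddCommGroup C] [Module R C] {f : A →ₗ[R] B} {g : B →ₗ[R] C} {s t : Set R}

theorem IsTors.of_injective (h : IsTors s B) (hf : Function.Injective f) : IsTors s A :=
  fun a ha x => (h a ha (f x)).imp fun n hn => hf (by rw [map_smul, hn, map_zero])

theorem IsTors.of_surjective (h : IsTors s B) (hg : Function.Surjective g) : IsTors s C :=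
  fun a ha x => by
    obtain ⟨y, rfl⟩ := hg x
    exact (h a ha y).imp fun n hn => by rw [← map_smul, hn, map_zero]

theorem IsTors.congr (h : IsTors s A) (e : A ≃ₗ[R] B) : IsTors s B :=
  h.of_surjective (g := e.toLinearMap) e.surjective

theorem IsTors.mono (h : IsTors t A) (hst : s ⊆ t) : IsTors s A := fun a ha => h a (hst ha)

theorem SES.isTors (h : SES f g) (hA : IsTors s A) (hC : IsTors s C) :
    IsTors s B := fun a ha x => by
  obtain ⟨n, hn⟩ := hC a ha (g x)
  obtain ⟨y, hy⟩ := h.exists_of_apply_eq_zero (b := a ^ n • x) (by rw [map_smul, hn])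
  obtain ⟨k, hk⟩ := hA a ha y
  exact ⟨k + n, by rw [pow_add, mul_smul, ← hy, ← map_smul, hk, map_zero]⟩

theorem IsTors.prod (hA : IsTors s A) (hB : IsTors s B) : IsTors s (A × B) :=
  ses_prod.isTors hA hB

theorem isTors_of_subsingleton [Subsingleton A] : IsTors s A :=
  fun _ _ _ => ⟨0, Subsingleton.elim _ _⟩

theorem isTors_gam (a : R) : IsTors {a} (gam a A) := by
  rintro _ rfl ⟨x, n, hn⟩
  exact ⟨n, Subtype.ext hn⟩

theorem isTors_insert {a : R} : IsTors (insert a s) A ↔ IsTors s A ∧ gam a A = ⊤ := by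
  refine ⟨fun h => ⟨h.mono (Set.subset_insert _ _), ?_⟩, fun ⟨h, h'⟩ => ?_⟩
  · rw [eq_top_iff]
    exact fun x _ => h a (Set.mem_insert _ _) x
  · rintro b (rfl | hb) x
    · have : x ∈ gam b A := h' ▸ trivial
      exact this
    · exact h b hb x

theorem isTors_span (h : IsTors s A) : IsTors (Ideal.span s : Set R) A := by
  intro a ha x
  have : Ideal.span s ≤ (Ideal.span {r : R | r • x = 0}).radical := by
    rw [Ideal.span_le]
    intro b hb
    exact (h b hb x).imp fun n hn => Ideal.subset_span hn
  obtain ⟨n, hn⟩ := this ha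
  refine ⟨n, ?_⟩
  have hle : Ideal.span {r : R | r • x = 0} ≤ LinearMap.ker (LinearMap.toSpanSingleton R A x) := by
    rw [Ideal.span_le]
    intro b hb
    exact hb
  exact hle hn

/-- For a finitely generated ideal, each element is killed by a power of the ideal. -/
theorem IsTors.exists_pow {I : Ideal R} (hI : I.FG) (h : IsTors (I : Set R) A) (x : A) :
    ∃ n : ℕ, ∀ r ∈ I ^ n, r • x = 0 := by
  have hle : I ≤ Ideal.radical (LinearMap.ker (LinearMap.toSpanSingleton R A x)) :=
    fun a ha => h a ha x
  obtain ⟨n, hn⟩ := Ideal.exists_pow_le_of_le_radical_of_fg hle hI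
  exact ⟨n, fun r hr => hn hr⟩

/-- Restriction of a linear map to torsion submodules. -/
def gamMap (a : R) (f : A →ₗ[R] B) : gam a A →ₗ[R] gam a B :=
  f.restrict fun x hx => hx.imp fun n hn => by rw [← map_smul, hn, map_zero]

@[simp] theorem gamMap_coe (a : R) (f : A →ₗ[R] B) (x : gam a A) : (gamMap a f x : B) = f x := rfl

/-- `M` is `a`-divisible up to `a`-torsion. -/
def DivUpTo (a : R) (M : Type u) [AddCommGroup M] [Module R M] : Prop :=
  ∀ q : M, ∃ q' : M, a • q' - q ∈ gam a M

theorem DivUpTo.of_surjective {a : R} (h : DivUpTo a B) (hg : Function.Surjective g) :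
    DivUpTo a C := fun q => by
  obtain ⟨q, rfl⟩ := hg q
  obtain ⟨q', n, hn⟩ := h q
  exact ⟨g q', n, by rw [← map_smul, ← map_sub, ← map_smul, hn, map_zero]⟩

theorem DivUpTo.pow {a : R} (h : DivUpTo a A) (n : ℕ) (q : A) :
    ∃ q' : A, a ^ n • q' - q ∈ gam a A := by
  induction n with
  | zero => exact ⟨q, by simp⟩
  | succ n ih =>
    obtain ⟨q', hq'⟩ := ih
    obtain ⟨q'', hq''⟩ := h q'
    refine ⟨q'', ?_⟩
    have := add_mem ((gam a A).smul_mem (a ^ n) hq'') hq'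
    rwa [smul_sub, smul_smul, ← pow_succ, sub_add_sub_cancel] at this

theorem divUpTo_of_gam_eq_top {a : R} (h : gam a A = ⊤) : DivUpTo a A :=
  fun _ => ⟨0, h ▸ trivial⟩

theorem divUpTo_of_injective [IsNoetherianRing R] (a : R) (hA : Module.Injective R A) :
    DivUpTo a A := by
  intro q
  obtain ⟨n, hn⟩ := monotone_stabilizes_iff_noetherian.2
    (inferInstance : IsNoetherian R R)
    ⟨fun n => LinearMap.ker (LinearMap.lsmul R R (a ^ n)), fun i j hij x hx => by
      obtain ⟨k, rfl⟩ := Nat.exists_eq_add_of_le hij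
      have hx : a ^ i * x = 0 := hx
      change a ^ (i + k) * x = 0
      rw [pow_add, mul_comm (a ^ i), mul_assoc, hx, mul_zero]⟩
  obtain ⟨ψ, hψ⟩ := hA.exists_comp_eq (LinearMap.lsmul R R (a ^ (n + 1)))
    (LinearMap.toSpanSingleton R A (a ^ n • q)) (by
      intro x hx
      have hx' : x ∈ LinearMap.ker (LinearMap.lsmul R R (a ^ n)) := by
        have h1 : LinearMap.ker (LinearMap.lsmul R R (a ^ n)) =
          LinearMap.ker (LinearMap.lsmul R R (a ^ (n + 1))) := hn (n + 1) (Nat.le_succ n)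
        rwa [h1]
      have hx' : a ^ n * x = 0 := hx'
      change x • a ^ n • q = 0
      rw [smul_smul, mul_comm, hx', zero_smul])
  have h1 := LinearMap.congr_fun hψ 1
  have h1 : ψ (a ^ (n + 1) * 1) = (1 : R) • a ^ n • q := h1
  rw [one_smul, ← smul_eq_mul, map_smul] at h1
  refine ⟨ψ 1, n, ?_⟩
  rw [smul_sub, smul_smul, ← pow_succ, h1, sub_self]

/-- Right exactness of torsion for a divisible left term. -/
theorem SES.gam (h : SES f g) {a : R} (hA : DivUpTo a A) : SES (gamMap a f) (gamMap a g) := by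
  refine ⟨fun x y hxy => Subtype.ext (h.inj (congrArg Subtype.val hxy)), ?_, ?_⟩
  · rintro ⟨c, n, hn⟩
    obtain ⟨b, rfl⟩ := h.surj c
    obtain ⟨q, hq⟩ := h.exists_of_apply_eq_zero (b := a ^ n • b) (by rw [map_smul, hn])
    obtain ⟨q', k, hk⟩ := hA.pow n q
    refine ⟨⟨b - f q', k + n, ?_⟩, Subtype.ext ?_⟩
    · rw [pow_add, mul_smul, smul_sub, ← hq, ← map_smul, ← map_sub, ← map_smul, ← neg_sub,
        smul_neg, hk, neg_zero, map_zero]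
    · simp [h.apply_apply]
  · rintro ⟨b, hb⟩
    constructor
    · intro h0
      obtain ⟨x, rfl⟩ := h.exists_of_apply_eq_zero (b := b) (congrArg Subtype.val h0)
      refine ⟨⟨x, ?_⟩, rfl⟩
      obtain ⟨n, hn⟩ := hb
      exact ⟨n, h.inj (by rw [map_smul, hn, map_zero])⟩
    · rintro ⟨x, hx⟩
      rw [← hx]
      exact Subtype.ext (h.apply_apply _)

theorem injective_gam [IsNoetherianRing R] (a : R) (hA : Module.Injective R A) :
    Module.Injective R (gam a A) := by
  apply Module.Baer.injective
  intro I φ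
  classical
  obtain ⟨S, hS⟩ := (inferInstance : IsNoetherian R I).noetherian ⊤
  have hann : ∃ n : ℕ, ∀ x : I, a ^ n • φ x = 0 := by
    have h1 : IsTors {a} (gam a A) := isTors_gam a
    choose N hN using fun x : I => h1 a rfl (φ x)
    refine ⟨∑ x ∈ S, N x, fun x => ?_⟩
    have hx : x ∈ Submodule.span R (S : Set I) := hS ▸ trivial
    induction hx using Submodule.span_induction with
    | mem y hy =>
      rw [← Finset.sum_erase_add S N hy, pow_add, mul_smul, hN, smul_zero]
    | zero => simp
    | add y z _ _ hy hz => rw [map_add, smul_add, hy, hz, add_zero]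
    | smul r y _ hy => rw [map_smul, smul_comm, hy, smul_zero]
  obtain ⟨n, hn⟩ := hann
  obtain ⟨k, hk⟩ := Ideal.exists_pow_inf_eq_pow_smul (Ideal.span {a}) (N := (I : Submodule R R))
  have hle : LinearMap.ker ((Ideal.span {a ^ (n + k)}).mkQ ∘ₗ I.subtype) ≤
      LinearMap.ker ((gam a A).subtype ∘ₗ φ) := by
    rintro ⟨x, hx⟩ hxk
    have hx1 : x ∈ Ideal.span {a ^ (n + k)} := (Submodule.Quotient.mk_eq_zero _).1 hxk
    have hx2 : x ∈ (Ideal.span {a}) ^ (n + k) • (⊤ : Submodule R R) ⊓ I := by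
      refine ⟨?_, hx⟩
      rwa [Ideal.span_singleton_pow, smul_eq_mul, Ideal.mul_top]
    rw [hk (n + k) (Nat.le_add_left k n), Nat.add_sub_cancel, Ideal.span_singleton_pow,
      Submodule.ideal_span_singleton_smul, Submodule.mem_smul_pointwise_iff_exists] at hx2
    obtain ⟨z, hz, rfl⟩ := hx2
    have : (⟨a ^ n • z, hx⟩ : I) = a ^ n • ⟨z, hz.2⟩ := rfl
    rw [this, LinearMap.mem_ker, LinearMap.comp_apply, map_smul, hn, map_zero]
  obtain ⟨ψ, hψ⟩ := hA.exists_comp_eq _ _ hle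
  have hmem : ∀ r, ψ (Submodule.Quotient.mk r) ∈ gam a A := fun r => by
    refine ⟨n + k, ?_⟩
    rw [← map_smul, ← Submodule.Quotient.mk_smul, (Submodule.Quotient.mk_eq_zero _).2, map_zero]
    exact Ideal.mul_mem_right _ _ (Ideal.mem_span_singleton_self _)
  refine ⟨(ψ ∘ₗ Submodule.mkQ _).codRestrict _ hmem, fun x hx => Subtype.ext ?_⟩
  exact LinearMap.congr_fun hψ ⟨x, hx⟩

end Torsion

/-! ### Torsion analogues of Gorenstein injective modules -/

section Classes

variable (R : Type u) [CommRing R]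

/-- An injective module which is torsion with respect to `s`. -/
def InjTors (s : Set R) (Q : Type u) [AddCommGroup Q] [Module R Q] : Prop :=
  Module.Injective R Q ∧ IsTors s Q

/-- `Ext^1` from injective `t`-torsion modules vanishes on `X`. -/
def EV1 (t : Set R) (X : Type u) [AddCommGroup X] [Module R X] : Prop :=
  ∀ (Q : Type u) [AddCommGroup Q] [Module R Q], InjTors R t Q → EV R Q X 1

/-- All higher `Ext` from injective `t`-torsion modules vanish on `X`. -/
def EVAll (t : Set R) (X : Type u) [AddCommGroup X] [Module R X] : Prop :=
  ∀ (Q : Type u) [AddCommGroup Q] [Module R Q], InjTors R t Q → ∀ i : ℕ, EV R Q X (i + 1)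

/-- A predicate on `s`-torsion modules stable under taking syzygies and cosyzygies in
`s`-torsion injective modules. -/
def IsTwoSided (t s : Set R) (P : ∀ (X : Type u) [AddCommGroup X] [Module R X], Prop) : Prop :=
  ∀ (X : Type u) [AddCommGroup X] [Module R X], P X → IsTors s X ∧ EV1 R t X ∧
    (∃ (X' Q : Type u) (_ : AddCommGroup X') (_ : Module R X') (_ : AddCommGroup Q)
      (_ : Module R Q) (f : X' →ₗ[R] Q) (g : Q →ₗ[R] X), P X' ∧ InjTors R s Q ∧ SES f g) ∧
    (∃ (X' Q : Type u) (_ : AddCommGroup X') (_ : Module R X') (_ : AddCommGroup Q)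
      (_ : Module R Q) (f : X →ₗ[R] Q) (g : Q →ₗ[R] X'), P X' ∧ InjTors R s Q ∧ SES f g)

/-- The largest two-sided class. -/
def TwoSided (t s : Set R) (X : Type u) [AddCommGroup X] [Module R X] : Prop :=
  ∃ P : ∀ (X : Type u) [AddCommGroup X] [Module R X], Prop, IsTwoSided R t s P ∧ P X

/-- Coresolutions of length `n` by modules in the largest two-sided class. -/
def TwoSidedDim (t s : Set R) : (n : ℕ) → (X : Type u) → [AddCommGroup X] → [Module R X] → Prop
  | 0, X, _, _ => TwoSided R t s X
  | n + 1, X, _, _ => ∃ (J C : Type u) (_ : AddCommGroup J) (_ : Module R J) (_ : AddCommGroup C)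
      (_ : Module R C) (f : X →ₗ[R] J) (g : J →ₗ[R] C), TwoSided R t s J ∧ SES f g ∧
      TwoSidedDim t s n C

variable {R} {t s : Set R}
variable {A B C : Type u} [AddCommGroup A] [Module R A] [AddCommGroup B] [Module R B]
  [AddCommGroup C] [Module R C] {f : A →ₗ[R] B} {g : B →ₗ[R] C}

theorem EV1.congr (h : EV1 R t A) (e : A ≃ₗ[R] B) : EV1 R t B :=
  fun Q _ _ hQ => (h Q hQ).congr_right e.symm

theorem EVAll.congr (h : EVAll R t A) (e : A ≃ₗ[R] B) : EVAll R t B :=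
  fun Q _ _ hQ i => (h Q hQ i).congr_right e.symm

theorem TwoSided.unfold (h : TwoSided R t s A) : IsTors s A ∧ EV1 R t A ∧
    (∃ (X' Q : Type u) (_ : AddCommGroup X') (_ : Module R X') (_ : AddCommGroup Q)
      (_ : Module R Q) (f : X' →ₗ[R] Q) (g : Q →ₗ[R] A), TwoSided R t s X' ∧ InjTors R s Q ∧
      SES f g) ∧
    (∃ (X' Q : Type u) (_ : AddCommGroup X') (_ : Module R X') (_ : AddCommGroup Q)
      (_ : Module R Q) (f : A →ₗ[R] Q) (g : Q →ₗ[R] X'), TwoSided R t s X' ∧ InjTors R s Q ∧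
      SES f g) := by
  obtain ⟨P, hP, hA⟩ := h
  obtain ⟨h1, h2, ⟨X, Q, _, _, _, _, f, g, hX, hQ, h3⟩,
    ⟨X', Q', _, _, _, _, f', g', hX', hQ', h4⟩⟩ :=
    hP A hA
  exact ⟨h1, h2, ⟨X, Q, _, _, _, _, f, g, ⟨P, hP, hX⟩, hQ, h3⟩,
    ⟨X', Q', _, _, _, _, f', g', ⟨P, hP, hX'⟩, hQ', h4⟩⟩

theorem InjTors.gam [IsNoetherianRing R] (h : InjTors R s A) (a : R) :
    InjTors R (insert a s) (_root_.gam a A) :=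
  ⟨injective_gam a h.1, isTors_insert.2 ⟨h.2.of_injective (f := (_root_.gam a A).subtype)
    Subtype.val_injective, eq_top_iff.2 fun x _ => isTors_gam a a rfl x⟩⟩

theorem TwoSided.divUpTo [IsNoetherianRing R] (h : TwoSided R t s A) (a : R) : DivUpTo a A := by
  obtain ⟨_, _, ⟨X', Q, _, _, _, _, f, g, _, hQ, h⟩, _⟩ := h.unfold
  exact (divUpTo_of_injective a hQ.1).of_surjective h.surj

/-- Applying `a`-torsion to a two-sided class. -/
theorem TwoSided.gam [IsNoetherianRing R] {a : R} (ha : a ∈ t) (h : TwoSided R t s A) :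
    TwoSided R t (insert a s) (_root_.gam a A) := by
  refine ⟨fun Y _ _ => ∃ (X : Type u) (_ : AddCommGroup X) (_ : Module R X)
    (_ : Y ≃ₗ[R] _root_.gam a X), TwoSided R t s X, ?_, ⟨A, _, _, LinearEquiv.refl _ _, h⟩⟩
  rintro Y _ _ ⟨X, _, _, e, hX⟩
  obtain ⟨h1, h2, ⟨X', Q, _, _, _, _, f, g, hX', hQ, h3⟩,
    ⟨X'', Q', _, _, _, _, f', g', hX'', hQ', h4⟩⟩ := hX.unfold
  have hs : SES (gamMap a f) (gamMap a g) := h3.gam (hX'.divUpTo a)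
  have hs' : SES (gamMap a f') (gamMap a g') := h4.gam (hX.divUpTo a)
  refine ⟨isTors_insert.2 ⟨?_, ?_⟩, ?_,
    ⟨_, _, _, _, _, _, gamMap a f, e.symm.toLinearMap ∘ₗ gamMap a g,
      ⟨X', _, _, LinearEquiv.refl _ _, hX'⟩, hQ.gam a, hs.congr_right e.symm⟩,
    ⟨_, _, _, _, _, _, gamMap a f' ∘ₗ e.toLinearMap, gamMap a g',
      ⟨X'', _, _, LinearEquiv.refl _ _, hX''⟩, hQ'.gam a, hs'.congr_left e⟩⟩
  · exact h1.of_injective (f := (_root_.gam a X).subtype ∘ₗ e.toLinearMap)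
      (Subtype.val_injective.comp e.injective)
  · exact eq_top_iff.2 fun x _ => ((isTors_gam a).congr e.symm) a rfl x
  · refine EV1.congr (A := _root_.gam a X) ?_ e.symm
    intro W _ _ hW
    refine hs'.ev1_of_lift (fun φ => ?_) (by
      have := injective_gam a hQ'.1
      exact ev_of_injective 0)
    obtain ⟨ψ, hψ⟩ := h4.lift (h2 W hW) ((_root_.gam a X'').subtype ∘ₗ φ)
    refine ⟨ψ.codRestrict _ fun x => ?_, ?_⟩
    · exact (hW.2 a ha x).imp fun n hn => by rw [← map_smul, hn, map_zero]
    · ext x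
      exact LinearMap.congr_fun hψ x

theorem TwoSidedDim.congr {n : ℕ} (h : TwoSidedDim R t s n A) (e : A ≃ₗ[R] B) :
    TwoSidedDim R t s n B := by
  cases n with
  | zero =>
    refine ⟨fun Y _ _ => ∃ (X : Type u) (_ : AddCommGroup X) (_ : Module R X)
      (_ : Y ≃ₗ[R] X), TwoSided R t s X, ?_, ⟨A, _, _, e.symm, h⟩⟩
    rintro Y _ _ ⟨X, _, _, e, hX⟩
    obtain ⟨h1, h2, ⟨X', Q, _, _, _, _, f, g, hX', hQ, h3⟩,
      ⟨X'', Q', _, _, _, _, f', g', hX'', hQ', h4⟩⟩ := hX.unfold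
    exact ⟨h1.congr e.symm, h2.congr e.symm,
      ⟨X', Q, _, _, _, _, _, _, ⟨X', _, _, LinearEquiv.refl _ _, hX'⟩, hQ, h3.congr_right e.symm⟩,
      ⟨X'', Q', _, _, _, _, _, _, ⟨X'', _, _, LinearEquiv.refl _ _, hX''⟩, hQ', h4.congr_left e⟩⟩
  | succ n =>
    obtain ⟨J, C, _, _, _, _, f, g, hJ, h, hC⟩ := h
    exact ⟨J, C, _, _, _, _, _, g, hJ, h.congr_left e.symm, hC⟩

theorem TwoSidedDim.gam [IsNoetherianRing R] {a : R} (ha : a ∈ t) {n : ℕ}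
    (h : TwoSidedDim R t s n A) (hA : DivUpTo a A) :
    TwoSidedDim R t (insert a s) n (_root_.gam a A) := by
  induction n generalizing A with
  | zero => exact TwoSided.gam ha h
  | succ n ih =>
    obtain ⟨J, C, _, _, _, _, f, g, hJ, h, hC⟩ := h
    exact ⟨_, _, _, _, _, _, gamMap a f, gamMap a g, hJ.gam ha, h.gam hA,
      ih hC ((hJ.divUpTo a).of_surjective h.surj)⟩

theorem TwoSidedDim.of_isTors [IsNoetherianRing R] {n : ℕ} (h : TwoSidedDim R t ∅ n A)
    (hA : IsTors t A) (u : Finset R) (hu : (u : Set R) ⊆ t) : TwoSidedDim R t u n A := by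
  classical
  induction u using Finset.induction_on with
  | empty => simpa using h
  | insert a u _ ih =>
    rw [Finset.coe_insert] at hu ⊢
    have h1 : _root_.gam a A = ⊤ := eq_top_iff.2 fun x _ => hA a (hu (Set.mem_insert _ _)) x
    refine TwoSidedDim.congr ((ih ((Set.subset_insert _ _).trans hu)).gam
      (hu (Set.mem_insert _ _)) (divUpTo_of_gam_eq_top h1)) ?_
    exact (LinearEquiv.ofEq _ _ h1).trans Submodule.topEquiv

/-- Every Gorenstein injective module belongs to the largest two-sided class. -/
theorem IsGorensteinInjective.twoSided (h : IsGorensteinInjective R A) : TwoSided R t ∅ A := by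
  obtain ⟨w⟩ := h
  let := w.instAdd
  let := w.instMod
  have hex : ∀ i : ℤ, SES (LinearMap.range (w.d (i + 1))).subtype (w.d i).rangeRestrict := fun i =>
    ⟨Subtype.val_injective, LinearMap.surjective_rangeRestrict _, fun x => by
      rw [← Subtype.coe_inj]
      refine (w.exact i x).trans ?_
      simp⟩
  have hQ : ∀ i, InjTors R (∅ : Set R) (w.I i) := fun i => ⟨w.injective i, fun a ha => ha.elim⟩
  refine ⟨fun Y _ _ => ∃ (i : ℤ), Nonempty (Y ≃ₗ[R] LinearMap.range (w.d i)), ?_, ⟨0, w.iso⟩⟩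
  rintro Y _ _ ⟨i, ⟨e⟩⟩
  refine ⟨fun a ha => ha.elim, ?_,
    ⟨_, _, _, _, _, _, _, _, ⟨i + 1, ⟨LinearEquiv.refl _ _⟩⟩, hQ (i + 1),
    (hex i).congr_right e.symm⟩, ?_⟩
  · obtain ⟨i, rfl⟩ : ∃ j : ℤ, i = j + 1 := ⟨i - 1, by ring⟩
    refine EV1.congr (A := LinearMap.range (w.d (i + 1))) ?_ e.symm
    intro W _ _ hW
    have := w.injective (i + 1)
    refine (hex i).ev1_of_lift (fun φ => ?_) (ev_of_injective 0)
    obtain ⟨i, rfl⟩ : ∃ j : ℤ, i = j + 1 := ⟨i - 1, by ring⟩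
    obtain ⟨ψ, hψ⟩ := (w.exact_hom W hW.1 i ((LinearMap.range (w.d (i + 1))).subtype ∘ₗ φ)).1 (by
      ext x
      obtain ⟨y, hy⟩ := (φ x).2
      change w.d i (φ x) = 0
      rw [← hy]
      exact (w.exact i).apply_apply_eq_zero y)
    refine ⟨ψ, ?_⟩
    ext x
    exact LinearMap.congr_fun hψ x
  · obtain ⟨i, rfl⟩ : ∃ j : ℤ, i = j + 1 := ⟨i - 1, by ring⟩
    exact ⟨_, _, _, _, _, _, _, _, ⟨i, ⟨LinearEquiv.refl _ _⟩⟩, hQ (i + 1), (hex i).congr_left e⟩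

theorem gidLE.twoSidedDim {n : ℕ} (h : gidLE R n A) : TwoSidedDim R t ∅ n A := by
  induction n generalizing A with
  | zero => exact IsGorensteinInjective.twoSided h
  | succ n ih =>
    obtain ⟨c, hc⟩ := h
    exact ⟨c.J, _, _, _, _, _, c.ι, _, c.ginj.twoSided, ses_range c.ι c.inj, ih hc⟩

variable (R) in
/-- A predicate on torsion modules with vanishing Ext from torsion injectives, stable under
taking syzygies in torsion injective modules. -/
def IsLeftClass (t : Set R) (P : ∀ (X : Type u) [AddCommGroup X] [Module R X], Prop) : Prop :=
  ∀ (X : Type u) [AddCommGroup X] [Module R X], P X → IsTors t X ∧ EVAll R t X ∧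
    (∃ (X' Q : Type u) (_ : AddCommGroup X') (_ : Module R X') (_ : AddCommGroup Q)
      (_ : Module R Q) (f : X' →ₗ[R] Q) (g : Q →ₗ[R] X), P X' ∧ InjTors R t Q ∧ SES f g)

variable (R) in
/-- The largest left class: the torsion Gorenstein injective modules. -/
def LeftC (t : Set R) (X : Type u) [AddCommGroup X] [Module R X] : Prop :=
  ∃ P : ∀ (X : Type u) [AddCommGroup X] [Module R X], Prop, IsLeftClass R t P ∧ P X

theorem LeftC.unfold (h : LeftC R t A) : IsTors t A ∧ EVAll R t A ∧
    (∃ (X' Q : Type u) (_ : AddCommGroup X') (_ : Module R X') (_ : AddCommGroup Q)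
      (_ : Module R Q) (f : X' →ₗ[R] Q) (g : Q →ₗ[R] A), LeftC R t X' ∧ InjTors R t Q ∧
      SES f g) := by
  obtain ⟨P, hP, hA⟩ := h
  obtain ⟨h1, h2, ⟨X, Q, _, _, _, _, f, g, hX, hQ, h3⟩⟩ := hP A hA
  exact ⟨h1, h2, ⟨X, Q, _, _, _, _, f, g, ⟨P, hP, hX⟩, hQ, h3⟩⟩

theorem LeftC.isTors (h : LeftC R t A) : IsTors t A := h.unfold.1

theorem LeftC.evAll (h : LeftC R t A) : EVAll R t A := h.unfold.2.1

theorem LeftC.fold {X' Q : Type u} [AddCommGroup X'] [Module R X'] [AddCommGroup Q] [Module R Q]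
    {f : X' →ₗ[R] Q} {g : Q →ₗ[R] A} (h1 : EVAll R t A)
    (hX : LeftC R t X') (hQ : InjTors R t Q) (h : SES f g) : LeftC R t A := by
  refine ⟨fun Y _ _ => LeftC R t Y ∨ (IsTors t Y ∧ EVAll R t Y ∧
    (∃ (X' Q : Type u) (_ : AddCommGroup X') (_ : Module R X') (_ : AddCommGroup Q)
      (_ : Module R Q) (f : X' →ₗ[R] Q) (g : Q →ₗ[R] Y), LeftC R t X' ∧ InjTors R t Q ∧
      SES f g)), ?_, Or.inr ⟨hQ.2.of_surjective h.surj, h1, X', Q, _, _, _, _, f, g, hX, hQ, h⟩⟩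
  intro Y _ _ hY
  obtain ⟨h1, h2, ⟨X, Q, _, _, _, _, f, g, hX, hQ, h3⟩⟩ := hY.elim (fun h => h.unfold) id
  exact ⟨h1, h2, ⟨X, Q, _, _, _, _, f, g, Or.inl hX, hQ, h3⟩⟩

theorem TwoSided.evAll (h : TwoSided R t s A) : EVAll R t A := by
  intro Q _ _ hQ i
  induction i generalizing A with
  | zero => exact h.unfold.2.1 Q hQ
  | succ i ih =>
    obtain ⟨_, _, _, ⟨X', I, _, _, _, _, f', g', hX', hI, h4⟩⟩ := h.unfold
    have := hI.1
    exact h4.ev_cov1 (ih hX') (ev_of_injective _)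

theorem TwoSided.leftC (h : TwoSided R t t A) : LeftC R t A := by
  refine ⟨fun Y _ _ => TwoSided R t t Y, ?_, h⟩
  intro X _ _ hX
  obtain ⟨h1, _, h3, _⟩ := hX.unfold
  exact ⟨h1, hX.evAll, h3⟩

theorem LeftC.congr (h : LeftC R t A) (e : A ≃ₗ[R] B) : LeftC R t B := by
  obtain ⟨_, h2, ⟨X', Q, _, _, _, _, f, g, hX', hQ, h3⟩⟩ := h.unfold
  exact LeftC.fold (h2.congr e) hX' hQ (h3.congr_right e)

theorem leftC_of_subsingleton [Subsingleton A] : LeftC R t A := by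
  refine ⟨fun Y _ _ => Subsingleton Y, ?_, inferInstance⟩
  intro X _ _ hX
  refine ⟨isTors_of_subsingleton, fun Q _ _ _ i => ev_of_subsingleton_right _, X, X, _, _, _, _,
    0, LinearMap.id, hX, ⟨?_, isTors_of_subsingleton⟩,
    ses_zero_left (X := X) (Y := X) (Z := X) (LinearEquiv.refl R X)⟩
  exact ⟨fun {_ _} _ _ _ _ _ _ _ => ⟨0, fun _ => Subsingleton.elim _ _⟩⟩

theorem InjTors.evAll (h : InjTors R s A) : EVAll R t A := fun _ _ _ _ i => by
  have := h.1
  exact ev_of_injective i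

theorem InjTors.leftC (h : InjTors R t A) : LeftC R t A :=
  LeftC.fold (X' := PUnit) h.evAll leftC_of_subsingleton h (ses_zero_left (LinearEquiv.refl R A))

theorem InjTors.prod (h : InjTors R t A) (h' : InjTors R t B) : InjTors R t (A × B) :=
  ⟨h.1.prod h'.1, h.2.prod h'.2⟩

theorem SES.evAll_mid (h : SES f g) (hA : EVAll R t A) (hC : EVAll R t C) : EVAll R t B :=
  fun Q _ _ hQ i => h.ev_cov2 (hA Q hQ i) (hC Q hQ i)

theorem SES.evAll_right (h : SES f g) (hA : EVAll R t A) (hB : EVAll R t B) : EVAll R t C :=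
  fun Q _ _ hQ i => h.ev_cov3 (hB Q hQ i) (hA Q hQ (i + 1))

theorem SES.leftC_mid (h : SES f g) (hA : LeftC R t A) (hC : LeftC R t C) : LeftC R t B := by
  refine ⟨fun Y _ _ => ∃ (A C : Type u) (_ : AddCommGroup A) (_ : Module R A) (_ : AddCommGroup C)
    (_ : Module R C) (f : A →ₗ[R] Y) (g : Y →ₗ[R] C), LeftC R t A ∧ LeftC R t C ∧ SES f g, ?_,
    ⟨A, C, _, _, _, _, f, g, hA, hC, h⟩⟩
  rintro B _ _ ⟨A, C, _, _, _, _, f, g, hA, hC, h⟩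
  obtain ⟨a1, a2, ⟨A', QA, _, _, _, _, fa, ga, hA', hQA, h3⟩⟩ := hA.unfold
  obtain ⟨c1, c2, ⟨C', QC, _, _, _, _, fc, gc, hC', hQC, h4⟩⟩ := hC.unfold
  obtain ⟨l, hl⟩ := h.lift (a2 QC hQC 0) gc
  obtain ⟨hs, i, p, hK⟩ := h.horseshoe_proj h3.surj h4.surj hl
  exact ⟨h.isTors a1 c1, h.evAll_mid a2 c2, _, _, _, _, _, _, _, _,
    ⟨_, _, _, _, _, _, i, p, hA'.congr h3.kerEquiv, hC'.congr h4.kerEquiv, hK⟩, hQA.prod hQC,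
    ses_ker _ hs⟩

theorem SES.leftC_right (h : SES f g) (hA : LeftC R t A) (hB : LeftC R t B) : LeftC R t C := by
  obtain ⟨b1, b2, ⟨B', QB, _, _, _, _, fb, gb, hB', hQB, h3⟩⟩ := hB.unfold
  obtain ⟨i, p, hK⟩ := h.ker_comp h3.surj
  exact LeftC.fold (h.evAll_right hA.evAll b2)
    (hK.leftC_mid (hB'.congr h3.kerEquiv) hA) hQB (ses_ker _ (h.surj.comp h3.surj))

theorem SES.leftC_left (h : SES f g) (hB : LeftC R t B) (hC : LeftC R t C) (hA : EV1 R t A) :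
    LeftC R t A := by
  obtain ⟨c1, c2, ⟨C', QC, _, _, _, _, fc, gc, hC', hQC, h4⟩⟩ := hC.unfold
  obtain ⟨Z, _, _, u, p, v, w, hu, hv⟩ := h.pullback h4
  have hZ : LeftC R t Z := hv.leftC_mid hC' hB
  obtain ⟨s, hs⟩ := hu.lift (hA QC hQC) LinearMap.id
  have hs' : ∀ y, p (s y) = y := fun y => LinearMap.congr_fun hs y
  have hpi : Function.Injective s := fun x y hxy => by rw [← hs' x, hxy, hs']
  have hpr : ∀ z, ∃ a, u a = z - s (p z) := fun z =>
    hu.exists_of_apply_eq_zero (by rw [map_sub, hs', sub_self])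
  -- the complement of the splitting is `A`
  have hses := ses_range s hpi
  have hinj : Function.Injective ((LinearMap.range s).mkQ ∘ₗ u) := by
    rw [injective_iff_map_eq_zero]
    intro a ha
    obtain ⟨y, hy⟩ : u a ∈ LinearMap.range s := (Submodule.Quotient.mk_eq_zero _).1 ha
    have : p (u a) = 0 := hu.apply_apply a
    rw [← hy, hs'] at this
    rw [this, map_zero] at hy
    exact hu.inj (by rw [← hy, map_zero])
  have hsurj : Function.Surjective ((LinearMap.range s).mkQ ∘ₗ u) := by
    intro z
    obtain ⟨z, rfl⟩ := Submodule.mkQ_surjective _ z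
    obtain ⟨a, ha⟩ := hpr z
    refine ⟨a, ?_⟩
    rw [LinearMap.comp_apply, ha, map_sub, sub_eq_self]
    exact (Submodule.Quotient.mk_eq_zero _).2 ⟨_, rfl⟩
  exact (hses.leftC_right hQC.leftC hZ).congr (LinearEquiv.ofBijective _ ⟨hinj, hsurj⟩).symm

end Classes

/-! ### Coresolution dimension with respect to torsion Gorenstein injective modules -/

section Phi

variable {R : Type u} [CommRing R] {t : Set R}
variable {A B C : Type u} [AddCommGroup A] [Module R A] [AddCommGroup B] [Module R B]
  [AddCommGroup C] [Module R C] {f : A →ₗ[R] B} {g : B →ₗ[R] C}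

theorem exists_injTors_embedding_finset [IsNoetherianRing R] (u : Finset R)
    (hA : IsTors (u : Set R) A) :
    ∃ (E : Type u) (_ : AddCommGroup E) (_ : Module R E) (i : A →ₗ[R] E),
      InjTors R (u : Set R) E ∧ Function.Injective i := by
  classical
  induction u using Finset.induction_on with
  | empty =>
    obtain ⟨E, _, _, i, hE, hi⟩ := Module.Injective.exists_embedding R A
    exact ⟨E, _, _, i, ⟨hE, fun a ha => by simp at ha⟩, hi⟩
  | insert a u _ ih =>
    rw [Finset.coe_insert] at hA ⊢
    obtain ⟨E, _, _, i, hE, hi⟩ := ih (hA.mono (Set.subset_insert _ _))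
    refine ⟨gam a E, _, _, i.codRestrict _ fun x => ?_, hE.gam a, fun x y hxy => hi ?_⟩
    · exact (hA a (Set.mem_insert _ _) x).imp fun n hn => by rw [← map_smul, hn, map_zero]
    · exact congrArg Subtype.val hxy

theorem exists_injTors_embedding [IsNoetherianRing R] {I : Ideal R}
    (hA : IsTors (I : Set R) A) :
    ∃ (E : Type u) (_ : AddCommGroup E) (_ : Module R E) (i : A →ₗ[R] E),
      InjTors R (I : Set R) E ∧ Function.Injective i := by
  obtain ⟨u, hu⟩ := (inferInstance : IsNoetherian R R).noetherian I
  have hu : Ideal.span (u : Set R) = I := hu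
  obtain ⟨E, _, _, i, hE, hi⟩ := exists_injTors_embedding_finset u
    (hA.mono (hu ▸ Ideal.subset_span))
  exact ⟨E, _, _, i, ⟨hE.1, hu ▸ isTors_span hE.2⟩, hi⟩

variable (R) in
/-- Coresolution dimension at most `n` with respect to the left class. -/
def Phi (t : Set R) : (n : ℕ) → (X : Type u) → [AddCommGroup X] → [Module R X] → Prop
  | 0, X, _, _ => LeftC R t X
  | n + 1, X, _, _ => ∃ (J C : Type u) (_ : AddCommGroup J) (_ : Module R J) (_ : AddCommGroup C)
      (_ : Module R C) (f : X →ₗ[R] J) (g : J →ₗ[R] C), LeftC R t J ∧ SES f g ∧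
      Phi t n C

theorem Phi.congr {n : ℕ} (h : Phi R t n A) (e : A ≃ₗ[R] B) : Phi R t n B := by
  cases n with
  | zero => exact LeftC.congr h e
  | succ n =>
    obtain ⟨J, C, _, _, _, _, f, g, hJ, h, hC⟩ := h
    exact ⟨J, C, _, _, _, _, _, g, hJ, h.congr_left e.symm, hC⟩

theorem phi_of_subsingleton [Subsingleton A] (n : ℕ) : Phi R t n A := by
  induction n with
  | zero => exact leftC_of_subsingleton
  | succ n ih => exact ⟨A, A, _, _, _, _, _, _, leftC_of_subsingleton,
      ses_zero_right (LinearEquiv.refl R A), ih⟩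

theorem LeftC.phi (h : LeftC R t A) (n : ℕ) : Phi R t n A := by
  cases n with
  | zero => exact h
  | succ n => exact ⟨A, PUnit, _, _, _, _, _, _, h,
      ses_zero_right (LinearEquiv.refl R A), phi_of_subsingleton n⟩

theorem Phi.succ {n : ℕ} (h : Phi R t n A) : Phi R t (n + 1) A := by
  induction n generalizing A with
  | zero => exact LeftC.phi h 1
  | succ n ih =>
    obtain ⟨J, C, _, _, _, _, f, g, hJ, h, hC⟩ := h
    exact ⟨J, C, _, _, _, _, f, g, hJ, h, ih hC⟩

theorem Phi.mono {n k : ℕ} (h : Phi R t n A) (hnk : n ≤ k) : Phi R t k A := by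
  induction hnk with
  | refl => exact h
  | step _ ih => exact ih.succ

theorem Phi.isTors {n : ℕ} (h : Phi R t n A) : IsTors t A := by
  cases n with
  | zero => exact LeftC.isTors h
  | succ n =>
    obtain ⟨J, C, _, _, _, _, f, g, hJ, h, hC⟩ := h
    exact hJ.isTors.of_injective h.inj

theorem SES.phi_right_of_leftC {n : ℕ} (h : SES f g) (hA : LeftC R t A) (hB : Phi R t n B) :
    Phi R t n C := by
  cases n with
  | zero => exact h.leftC_right hA hB
  | succ n =>
    obtain ⟨J, D, _, _, _, _, f', g', hJ, h', hD⟩ := hB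
    obtain ⟨i, p, hip⟩ := h.quot_comp h'.inj
    exact ⟨_, _, _, _, _, _, i, p,
      (ses_range (f' ∘ₗ f) (h'.inj.comp h.inj)).leftC_right hA hJ, hip, hD.congr h'.quotEquiv.symm⟩

theorem SES.exists_retraction_of_injective (h : SES f g) (hA : Module.Injective R A) :
    ∃ r : B →ₗ[R] A, r ∘ₗ f = LinearMap.id :=
  (hA.out f h.inj LinearMap.id).imp fun _ hr => LinearMap.ext hr

/-- A split short exact sequence. -/
theorem SES.equiv_prod (h : SES f g) {r : B →ₗ[R] A} (hr : r ∘ₗ f = LinearMap.id) :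
    Nonempty (B ≃ₗ[R] A × C) := by
  have hr' : ∀ a, r (f a) = a := fun a => LinearMap.congr_fun hr a
  refine ⟨LinearEquiv.ofBijective (r.prod g) ⟨?_, ?_⟩⟩
  · rw [injective_iff_map_eq_zero]
    intro b hb
    obtain ⟨a, rfl⟩ := h.exists_of_apply_eq_zero (b := b) (congrArg Prod.snd hb)
    have : r (f a) = 0 := congrArg Prod.fst hb
    rw [hr'] at this
    rw [this, map_zero]
  · rintro ⟨a, c⟩
    obtain ⟨b, rfl⟩ := h.surj c
    exact ⟨b + f (a - r b), by ext <;> simp [hr', h.apply_apply]⟩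

theorem Phi.prod_left {n : ℕ} (h : Phi R t n A) (hB : InjTors R t B) : Phi R t n (B × A) := by
  cases n with
  | zero => exact ses_prod.leftC_mid hB.leftC h
  | succ n =>
    obtain ⟨J, C, _, _, _, _, f, g, hJ, h, hC⟩ := h
    refine ⟨B × J, C, _, _, _, _, LinearMap.prodMap LinearMap.id f, g ∘ₗ LinearMap.snd R B J,
      ses_prod.leftC_mid hB.leftC hJ, ⟨?_, ?_, ?_⟩, hC⟩
    · exact Function.Injective.prodMap Function.injective_id h.inj
    · exact h.surj.comp LinearMap.snd_surjective
    · rintro ⟨b, j⟩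
      refine (h.exact j).trans ?_
      constructor
      · rintro ⟨a, rfl⟩
        exact ⟨(b, a), rfl⟩
      · rintro ⟨⟨b', a⟩, hba⟩
        exact ⟨a, congrArg Prod.snd hba⟩

theorem SES.phi_cosyzygy {n : ℕ} (h : SES f g) (hA : Phi R t (n + 1) A) (hB : InjTors R t B) :
    Phi R t n C := by
  obtain ⟨J, D, _, _, _, _, f', g', hJ, h', hD⟩ := hA
  obtain ⟨Z, _, _, u, p, v, w, hu, hv⟩ := h'.pushout h
  obtain ⟨r, hr⟩ := hu.exists_retraction_of_injective hB.1
  obtain ⟨e⟩ := hu.equiv_prod hr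
  exact hv.phi_right_of_leftC hJ ((hD.prod_left hB).congr e.symm)

theorem SES.phi_mid [IsNoetherianRing R] {I : Ideal R} {n : ℕ} (h : SES f g)
    (hA : Phi R (I : Set R) n A) (hC : Phi R (I : Set R) n C) : Phi R (I : Set R) n B := by
  induction n generalizing A B C with
  | zero => exact h.leftC_mid hA hC
  | succ n ih =>
    obtain ⟨X, _, _, i, hX, hi⟩ := exists_injTors_embedding hA.isTors
    obtain ⟨Y, _, _, j, hY, hj⟩ := exists_injTors_embedding hC.isTors
    obtain ⟨e, he⟩ := hX.1.out f h.inj i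
    obtain ⟨hinj, a, b, hab⟩ := h.horseshoe_inj hi hj (e := e) (LinearMap.ext he)
    exact ⟨_, _, _, _, _, _, _, _, (hX.prod hY).leftC, ses_range _ hinj,
      ih hab ((ses_range i hi).phi_cosyzygy hA hX) ((ses_range j hj).phi_cosyzygy hC hY)⟩

variable (R) in
/-- Finite coresolution dimension with respect to the left class. -/
def PhiFin (t : Set R) (X : Type u) [AddCommGroup X] [Module R X] : Prop := ∃ n, Phi R t n X

theorem PhiFin.congr (h : PhiFin R t A) (e : A ≃ₗ[R] B) : PhiFin R t B :=
  h.imp fun _ h => h.congr e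

theorem SES.phiFin_mid [IsNoetherianRing R] {I : Ideal R} (h : SES f g)
    (hA : PhiFin R (I : Set R) A) (hC : PhiFin R (I : Set R) C) : PhiFin R (I : Set R) B := by
  obtain ⟨n, hn⟩ := hA
  obtain ⟨k, hk⟩ := hC
  exact ⟨max n k, h.phi_mid (hn.mono (le_max_left _ _)) (hk.mono (le_max_right _ _))⟩

theorem SES.phiFin_right [IsNoetherianRing R] {I : Ideal R} (h : SES f g)
    (hA : PhiFin R (I : Set R) A) (hB : PhiFin R (I : Set R) B) : PhiFin R (I : Set R) C := by
  obtain ⟨n, hn⟩ := hA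
  obtain ⟨X, _, _, i, hX, hi⟩ := exists_injTors_embedding hn.isTors
  obtain ⟨Z, _, _, u, p, v, w, hu, hv⟩ := h.pushout (ses_range i hi)
  obtain ⟨k, hk⟩ := hv.phiFin_mid hB ⟨n, (ses_range i hi).phi_cosyzygy hn.succ hX⟩
  exact ⟨k, hu.phi_right_of_leftC hX.leftC hk⟩

theorem SES.phiFin_left [IsNoetherianRing R] {I : Ideal R} (h : SES f g)
    (hB : PhiFin R (I : Set R) B) (hC : PhiFin R (I : Set R) C) : PhiFin R (I : Set R) A := by
  obtain ⟨n, hn⟩ := hB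
  obtain ⟨X, _, _, i, hX, hi⟩ := exists_injTors_embedding hn.isTors
  obtain ⟨a, b, hab⟩ := h.quot_comp hi
  obtain ⟨k, hk⟩ := hab.phiFin_mid hC ⟨n, (ses_range i hi).phi_cosyzygy hn.succ hX⟩
  exact ⟨k + 1, _, _, _, _, _, _, _, _, hX.leftC, ses_range (i ∘ₗ f) (hi.comp h.inj), hk⟩

theorem Phi.leftC {n : ℕ} (h : Phi R t n A) (hA : EVAll R t A) : LeftC R t A := by
  induction n generalizing A with
  | zero => exact h
  | succ n ih =>
    obtain ⟨J, D, _, _, _, _, f', g', hJ, h', hD⟩ := h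
    exact h'.leftC_left hJ (ih hD (h'.evAll_right hA hJ.evAll)) fun Q _ _ hQ => hA Q hQ 0

theorem Phi.ev {n : ℕ} (h : Phi R t n A) {Q : Type u} [AddCommGroup Q] [Module R Q]
    (hQ : InjTors R t Q) {i : ℕ} (hi : n < i) : EV R Q A i := by
  obtain ⟨i, rfl⟩ : ∃ j, i = j + 1 := ⟨i - 1, by omega⟩
  induction n generalizing A i with
  | zero => exact LeftC.evAll h Q hQ i
  | succ n ih =>
    obtain ⟨J, D, _, _, _, _, f', g', hJ, h', hD⟩ := h
    obtain ⟨i, rfl⟩ : ∃ j, i = j + 1 := ⟨i - 1, by omega⟩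
    exact h'.ev_cov1 (ih hD i (by omega)) (hJ.evAll Q hQ _)

theorem TwoSidedDim.phi {n : ℕ} (h : TwoSidedDim R t t n A) : Phi R t n A := by
  induction n generalizing A with
  | zero => exact TwoSided.leftC h
  | succ n ih =>
    obtain ⟨J, D, _, _, _, _, f', g', hJ, h', hD⟩ := h
    exact ⟨J, D, _, _, _, _, f', g', hJ.leftC, h', ih hD⟩

theorem TwoSided.mono_tors {s s' : Set R} (hs : ∀ (X : Type u) [AddCommGroup X] [Module R X],
    IsTors s X → IsTors s' X) (h : TwoSided R t s A) : TwoSided R t s' A := by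
  refine ⟨fun Y _ _ => TwoSided R t s Y, ?_, h⟩
  intro X _ _ hX
  obtain ⟨h1, h2, ⟨X', Q, _, _, _, _, f, g, hX', hQ, h3⟩,
    ⟨X'', Q', _, _, _, _, f', g', hX'', hQ', h4⟩⟩ := hX.unfold
  exact ⟨hs _ h1, h2, ⟨X', Q, _, _, _, _, f, g, hX', ⟨hQ.1, hs _ hQ.2⟩, h3⟩,
    ⟨X'', Q', _, _, _, _, f', g', hX'', ⟨hQ'.1, hs _ hQ'.2⟩, h4⟩⟩

theorem TwoSidedDim.mono_tors {n : ℕ} {s s' : Set R}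
    (hs : ∀ (X : Type u) [AddCommGroup X] [Module R X],
    IsTors s X → IsTors s' X) (h : TwoSidedDim R t s n A) : TwoSidedDim R t s' n A := by
  induction n generalizing A with
  | zero => exact TwoSided.mono_tors hs h
  | succ n ih =>
    obtain ⟨J, D, _, _, _, _, f', g', hJ, h', hD⟩ := h
    exact ⟨J, D, _, _, _, _, f', g', TwoSided.mono_tors hs hJ, h', ih hD⟩

/-- A torsion module of Gorenstein injective dimension at most `n` has torsion
coresolution dimension at most `n`. -/
theorem gidLE.phi [IsNoetherianRing R] {I : Ideal R} {n : ℕ} (h : gidLE R n A)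
    (hA : IsTors (I : Set R) A) : Phi R (I : Set R) n A := by
  obtain ⟨u, hu⟩ := (inferInstance : IsNoetherian R R).noetherian I
  have hu : Ideal.span (u : Set R) = I := hu
  have h1 := (h.twoSidedDim (t := (I : Set R))).of_isTors hA u (hu ▸ Ideal.subset_span)
  exact (h1.mono_tors fun X _ _ hX => hu ▸ isTors_span hX).phi

end Phi

/-! ### Matlis duality over complete local rings -/

section Matlis

/-- `E` is an injective hull of the residue field of the local ring `A`, whose socle is
generated by `e₀`. -/
structure IsMatlis (A : Type u) [CommRing A] [IsLocalRing A] (E : Type u) [AddCommGroup E]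
    [Module A E] (e₀ : E) : Prop where
  inj : Module.Injective A E
  tors : IsTors (maximalIdeal A : Set A) E
  ne_zero : e₀ ≠ 0
  smul_eq_zero : ∀ r ∈ maximalIdeal A, r • e₀ = 0
  ess : ∀ x : E, x ≠ 0 → e₀ ∈ Submodule.span A {x}

variable {A : Type u} [CommRing A] [IsLocalRing A]

theorem Submodule.mkQ_eq_zero {R X : Type u} [CommRing R] [AddCommGroup X] [Module R X]
    {W : Submodule R X} {x : X} : W.mkQ x = 0 ↔ x ∈ W := Submodule.Quotient.mk_eq_zero W

theorem Module.Injective.of_retract {R E F : Type u} [CommRing R] [AddCommGroup E] [Module R E]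
    [AddCommGroup F] [Module R F] (hE : Module.Injective R E) (s : F →ₗ[R] E) (r : E →ₗ[R] F)
    (h : r ∘ₗ s = LinearMap.id) : Module.Injective R F := by
  refine ⟨fun X Y _ _ _ _ f hf g => ?_⟩
  obtain ⟨k, hk⟩ := hE.out f hf (s ∘ₗ g)
  exact ⟨r ∘ₗ k, fun x => by
    rw [LinearMap.comp_apply, hk]; exact LinearMap.congr_fun h (g x)⟩

variable (A) in
theorem exists_isMatlis [IsNoetherianRing A] :
    ∃ (E : Type u) (_ : AddCommGroup E) (_ : Module A E) (e₀ : E), IsMatlis A E e₀ := by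
  have hk : IsTors (maximalIdeal A : Set A) (ResidueField A) := fun a ha x => ⟨1, by
    rw [pow_one, Algebra.smul_def, ResidueField.algebraMap_eq, (residue_eq_zero_iff a).2 ha,
      zero_mul]⟩
  obtain ⟨Q, _, _, i, ⟨hQ, hQt⟩, hi⟩ := exists_injTors_embedding hk
  set u : Q := i 1 with hu
  have hu0 : u ≠ 0 := fun h => one_ne_zero (hi (h.trans (map_zero i).symm))
  have hmu : ∀ r ∈ maximalIdeal A, r • u = 0 := fun r hr => by
    rw [hu, ← map_smul, Algebra.smul_def, ResidueField.algebraMap_eq,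
      (residue_eq_zero_iff r).2 hr, zero_mul, map_zero]
  have hess : ∀ x ∈ Submodule.span A {u}, x ≠ 0 → u ∈ Submodule.span A {x} := by
    intro x hx hx0
    obtain ⟨r, rfl⟩ := Submodule.mem_span_singleton.1 hx
    have hr : IsUnit r := by
      by_contra h
      exact hx0 (hmu r ((mem_maximalIdeal r).2 h))
    obtain ⟨v, rfl⟩ := hr
    exact Submodule.mem_span_singleton.2 ⟨(v⁻¹ : Aˣ), by rw [smul_smul]; simp⟩
  obtain ⟨W, hW1, hW⟩ := zorn_le_nonempty₀
    {W : Submodule A Q | ∀ x ∈ W, x ≠ 0 → u ∈ Submodule.span A {x}} (by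
      intro c hc hchain y hy
      refine ⟨sSup c, ?_, fun z hz => le_sSup hz⟩
      intro x hx hx0
      obtain ⟨z, hz, hxz⟩ := (Submodule.mem_sSup_of_directed ⟨y, hy⟩ hchain.directedOn).1 hx
      exact hc hz x hxz hx0) _ hess
  obtain ⟨U, -, hU⟩ := zorn_le_nonempty₀ {U : Submodule A Q | u ∉ U} (by
      intro c hc hchain y hy
      refine ⟨sSup c, ?_, fun z hz => le_sSup hz⟩
      intro hx
      obtain ⟨z, hz, hxz⟩ := (Submodule.mem_sSup_of_directed ⟨y, hy⟩ hchain.directedOn).1 hx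
      exact hc hz hxz) ⊥ hu0
  have huW : u ∈ W := hW1 (Submodule.mem_span_singleton_self u)
  have hUu : ∀ x : Q, x ∉ U → ∃ r : A, u - r • x ∈ U := by
    intro x hx
    by_contra! hc
    have h1 : u ∉ U ⊔ Submodule.span A {x} := by
      intro h
      obtain ⟨v, hv, w, hw, hvw⟩ := Submodule.mem_sup.1 h
      obtain ⟨r, rfl⟩ := Submodule.mem_span_singleton.1 hw
      exact hc r (by rw [← hvw, add_sub_cancel_right]; exact hv)
    exact hx (hU.2 h1 le_sup_left (Submodule.mem_sup_right (Submodule.mem_span_singleton_self x)))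
  obtain ⟨ψ, hψ⟩ := hQ.exists_comp_eq (U.mkQ ∘ₗ W.subtype) W.subtype (by
    rintro ⟨x, hx⟩ hxU
    have hxU : x ∈ U := by simpa using hxU
    by_contra h
    have hx0 : x ≠ 0 := fun h' => h (by simpa using h')
    exact hU.1 ((Submodule.span_singleton_le_iff_mem x U).2 hxU (hW.1 x hx hx0)))
  have hψ' : ∀ x ∈ W, ψ (U.mkQ x) = x := fun x hx => LinearMap.congr_fun hψ ⟨x, hx⟩
  have hrange : LinearMap.range ψ = W := by
    refine le_antisymm (hW.2 ?_ ?_) ?_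
    · rintro _ ⟨x, rfl⟩ hx0
      obtain ⟨x, rfl⟩ := U.mkQ_surjective x
      have hxU : x ∉ U := fun h => hx0 (by rw [Submodule.mkQ_eq_zero.2 h, map_zero])
      obtain ⟨r, hr⟩ := hUu x hxU
      refine Submodule.mem_span_singleton.2 ⟨r, ?_⟩
      have : U.mkQ u = r • U.mkQ x := by
        rw [← map_smul, ← sub_eq_zero, ← map_sub]
        exact Submodule.mkQ_eq_zero.2 hr
      rw [← map_smul, ← this, hψ' u huW]
    · exact fun x hx => ⟨_, hψ' x hx⟩
    · exact fun x hx => ⟨_, hψ' x hx⟩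
  have hWi : Module.Injective A W := hQ.of_retract W.subtype
    ((ψ ∘ₗ U.mkQ).codRestrict W fun x => hrange ▸ ⟨_, rfl⟩) (by
      ext x; exact hψ' x x.2)
  refine ⟨W, inferInstance, inferInstance, ⟨u, huW⟩, hWi,
    hQt.of_injective (f := W.subtype) W.subtype_injective, fun h => hu0 (congrArg Subtype.val h),
    fun r hr => Subtype.ext (hmu r hr), fun x hx => ?_⟩
  obtain ⟨r, hr⟩ := Submodule.mem_span_singleton.1 (hW.1 x x.2 fun h => hx (Subtype.ext h))
  exact Submodule.mem_span_singleton.2 ⟨r, Subtype.ext hr⟩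

variable {E : Type u} [AddCommGroup E] [Module A E] {e₀ : E}
variable {X : Type u} [AddCommGroup X] [Module A X]

theorem IsMatlis.exists_apply_ne_zero (hE : IsMatlis A E e₀) {x : X} (hx : x ≠ 0) :
    ∃ φ : X →ₗ[A] E, φ x ≠ 0 := by
  obtain ⟨φ, hφ⟩ := hE.inj.exists_comp_eq (LinearMap.toSpanSingleton A X x)
    (LinearMap.toSpanSingleton A E e₀) (by
      intro r hr
      refine hE.smul_eq_zero r ((mem_maximalIdeal r).2 fun h => hx ?_)
      exact (h.smul_eq_zero).1 (by simpa using hr))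
  refine ⟨φ, ?_⟩
  have := LinearMap.congr_fun hφ 1
  simp only [LinearMap.comp_apply, LinearMap.toSpanSingleton_apply, one_smul] at this
  rw [this]
  exact hE.ne_zero

theorem IsMatlis.exists_apply_ne_zero_of_notMem (hE : IsMatlis A E e₀) {W : Submodule A X} {x : X}
    (hx : x ∉ W) : ∃ φ : X →ₗ[A] E, (∀ w ∈ W, φ w = 0) ∧ φ x ≠ 0 := by
  obtain ⟨φ, hφ⟩ := hE.exists_apply_ne_zero (x := W.mkQ x)
    fun h => hx (Submodule.mkQ_eq_zero.1 h)
  exact ⟨φ ∘ₗ W.mkQ, fun w hw => by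
    rw [LinearMap.comp_apply, Submodule.mkQ_eq_zero.2 hw, map_zero], hφ⟩

theorem IsMatlis.mem_socle (hE : IsMatlis A E e₀) {x : E} (hx : ∀ r ∈ maximalIdeal A, r • x = 0) :
    ∃ r : A, x = r • e₀ := by
  by_cases h0 : x = 0
  · exact ⟨0, by simp [h0]⟩
  obtain ⟨r, hr⟩ := Submodule.mem_span_singleton.1 (hE.ess x h0)
  have hu : IsUnit r := by
    by_contra h
    exact hE.ne_zero (hr ▸ hx r ((mem_maximalIdeal r).2 h))
  obtain ⟨v, rfl⟩ := hu
  exact ⟨(v⁻¹ : Aˣ), by rw [← hr, smul_smul]; simp⟩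

theorem IsMatlis.end_eq_smul_of_pow_le [IsNoetherianRing A] (hE : IsMatlis A E e₀) (φ : E →ₗ[A] E)
    (n : ℕ) (J : Ideal A) (hJ : maximalIdeal A ^ n ≤ J) :
    ∃ r : A, ∀ e : E, (∀ j ∈ J, j • e = 0) → φ e = r • e := by
  induction J using IsNoetherian.induction with
  | hgt J ih =>
    by_cases hJt : J = ⊤
    · exact ⟨0, fun e he => by
        have : e = 0 := by simpa using he 1 (hJt ▸ trivial)
        simp [this]⟩
    have hex : ∃ k, maximalIdeal A ^ k ≤ J := ⟨n, hJ⟩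
    classical
    obtain ⟨k, hk⟩ : ∃ k, Nat.find hex = k + 1 := Nat.exists_eq_succ_of_ne_zero fun h => hJt (by
      have := Nat.find_spec hex
      rw [h, pow_zero, Ideal.one_eq_top] at this
      exact top_le_iff.1 this)
    have hk1 : maximalIdeal A ^ (k + 1) ≤ J := hk ▸ Nat.find_spec hex
    obtain ⟨a, ha, haJ⟩ := Set.not_subset.1 (Nat.find_min hex (m := k) (by omega))
    have hma : ∀ r ∈ maximalIdeal A, r * a ∈ J := fun r hr => hk1 (by
      rw [pow_succ']; exact Ideal.mul_mem_mul hr ha)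
    obtain ⟨r, hr⟩ := ih (J ⊔ Ideal.span {a}) (lt_of_le_of_ne le_sup_left fun h => haJ (by
      rw [h]; exact Ideal.mem_sup_right (Ideal.mem_span_singleton_self a)))
      (hJ.trans le_sup_left)
    let EJ : Submodule A E := ⨅ j : J, LinearMap.ker (LinearMap.lsmul A E (j : A))
    have hEJ : ∀ e : E, e ∈ EJ ↔ ∀ j ∈ J, j • e = 0 := by simp [EJ, Submodule.mem_iInf]
    obtain ⟨ψ, hψ⟩ := hE.inj.exists_comp_eq (LinearMap.lsmul A E a ∘ₗ EJ.subtype)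
      ((φ - LinearMap.lsmul A E r) ∘ₗ EJ.subtype) (by
        rintro ⟨e, he⟩ h
        have h : a • e = 0 := by simpa using h
        have := hr e (by
          intro j hj
          obtain ⟨j, hj', b, hb, rfl⟩ := Submodule.mem_sup.1 hj
          obtain ⟨b, rfl⟩ := Ideal.mem_span_singleton'.1 hb
          rw [add_smul, (hEJ e).1 he j hj', mul_smul, h, smul_zero, add_zero])
        simp [this])
    obtain ⟨s, hs⟩ := hE.mem_socle (x := ψ e₀) fun r hr => by
      rw [← map_smul, hE.smul_eq_zero r hr, map_zero]
    refine ⟨r + s * a, fun e he => ?_⟩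
    have h1 := LinearMap.congr_fun hψ ⟨e, (hEJ e).2 he⟩
    simp only [LinearMap.comp_apply, Submodule.subtype_apply, LinearMap.lsmul_apply,
      LinearMap.sub_apply] at h1
    obtain ⟨t, ht⟩ := hE.mem_socle (x := a • e) fun r hr => by
      rw [smul_smul, he _ (hma r hr)]
    rw [ht, map_smul, hs, smul_comm, ← ht, smul_smul] at h1
    rw [add_smul, h1]; abel

/-- Every endomorphism of the injective hull of the residue field of a complete local ring is
a homothety. -/
theorem IsMatlis.end_eq_smul [IsNoetherianRing A] [IsAdicComplete (maximalIdeal A) A]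
    (hE : IsMatlis A E e₀) (φ : E →ₗ[A] E) : ∃ r : A, ∀ e : E, φ e = r • e := by
  choose r hr using fun n : ℕ => hE.end_eq_smul_of_pow_le φ n _ (le_refl (maximalIdeal A ^ n))
  have hmem : ∀ n (s : A), (∀ e : E, (∀ j ∈ maximalIdeal A ^ n, j • e = 0) → s • e = 0) →
      s ∈ maximalIdeal A ^ n := by
    intro n s hs
    by_contra h
    obtain ⟨φ, hφ, hφ'⟩ := hE.exists_apply_ne_zero_of_notMem (W := maximalIdeal A ^ n) h
    apply hφ'
    have h1 : ∀ t : A, φ t = t • φ 1 := fun t => by rw [← map_smul, smul_eq_mul, mul_one]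
    rw [h1]
    exact hs _ fun j hj => by rw [← h1, hφ j hj]
  obtain ⟨L, hL⟩ := IsPrecomplete.prec (I := maximalIdeal A) (M := A) inferInstance (f := r) (by
    intro m n hmn
    rw [smul_eq_mul, Ideal.mul_top, SModEq.sub_mem]
    refine hmem m _ fun e he => ?_
    rw [sub_smul, ← hr m e he, ← hr n e fun j hj => he j (Ideal.pow_le_pow_right hmn hj), sub_self])
  refine ⟨L, fun e => ?_⟩
  obtain ⟨n, hn⟩ := hE.tors.exists_pow (IsNoetherian.noetherian _) e
  have := hL n
  rw [smul_eq_mul, Ideal.mul_top, SModEq.sub_mem] at this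
  rw [hr n e hn, ← sub_eq_zero, ← sub_smul, hn _ this]

theorem IsMatlis.exists_embedding_pi (hE : IsMatlis A E e₀) [IsArtinian A X] :
    ∃ (n : ℕ) (ι : X →ₗ[A] (Fin n → E)), Function.Injective ι := by
  obtain ⟨W, ⟨n, ι, rfl⟩, hW⟩ := IsArtinian.set_has_minimal
    {W : Submodule A X | ∃ (n : ℕ) (ι : X →ₗ[A] (Fin n → E)), W = LinearMap.ker ι}
    ⟨_, 0, 0, rfl⟩
  refine ⟨n, ι, LinearMap.ker_eq_bot.1 ?_⟩
  by_contra hne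
  obtain ⟨x, hx, hx0⟩ := Submodule.exists_mem_ne_zero_of_ne_bot hne
  obtain ⟨φ, hφ⟩ := hE.exists_apply_ne_zero hx0
  refine hW _ ⟨n + 1, LinearMap.pi (Fin.cons φ fun i => LinearMap.proj i ∘ₗ ι), rfl⟩ ?_
  refine lt_of_le_of_ne (fun y hy => ?_) fun h => hφ ?_
  · refine LinearMap.mem_ker.2 (funext fun i => ?_)
    simpa using congrFun (LinearMap.mem_ker.1 hy) i.succ
  · rw [← h] at hx
    simpa using congrFun (LinearMap.mem_ker.1 hx) 0

/-- The Matlis dual of an artinian module over a complete local ring is finite, and every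
functional on the dual is an evaluation. -/
theorem IsMatlis.dual_artinian [IsNoetherianRing A] [IsAdicComplete (maximalIdeal A) A]
    (hE : IsMatlis A E e₀) [IsArtinian A X] :
    Module.Finite A (X →ₗ[A] E) ∧
      ∀ ψ : (X →ₗ[A] E) →ₗ[A] E, ∃ x : X, ∀ φ, ψ φ = φ x := by
  obtain ⟨n, ι, hι⟩ := hE.exists_embedding_pi (X := X)
  have hend : ∀ φ : (Fin n → E) →ₗ[A] E, ∃ r : Fin n → A, ∀ e, φ e = ∑ i, r i • e i := by
    intro φ
    choose r hr using fun i => hE.end_eq_smul (φ ∘ₗ LinearMap.single A (fun _ => E) i)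
    refine ⟨r, fun e => ?_⟩
    conv_lhs => rw [← Finset.univ_sum_single e, map_sum]
    exact Finset.sum_congr rfl fun i _ => hr i (e i)
  have hext : ∀ φ : X →ₗ[A] E, ∃ r : Fin n → A, ∀ x, φ x = ∑ i, r i • ι x i := by
    intro φ
    obtain ⟨φ', hφ'⟩ := hE.inj.out ι hι φ
    obtain ⟨r, hr⟩ := hend φ'
    exact ⟨r, fun x => by rw [← hφ', hr]⟩
  refine ⟨?_, fun ψ => ?_⟩
  · refine Module.Finite.of_surjective
      (∑ i, (LinearMap.proj i : (Fin n → A) →ₗ[A] A).smulRight (LinearMap.proj i ∘ₗ ι)) fun φ => ?_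
    obtain ⟨r, hr⟩ := hext φ
    exact ⟨r, by ext x; simp [hr]⟩
  · set e : Fin n → E := fun i => ψ (LinearMap.proj i ∘ₗ ι) with he
    have key : ∀ (φ : X →ₗ[A] E) (r : Fin n → A), (∀ x, φ x = ∑ i, r i • ι x i) →
        ψ φ = ∑ i, r i • e i := by
      intro φ r h
      have : φ = ∑ i, r i • (LinearMap.proj i ∘ₗ ι) := by ext x; simp [h]
      rw [this, map_sum]
      exact Finset.sum_congr rfl fun i _ => by rw [map_smul]
    have hmem : e ∈ LinearMap.range ι := by
      by_contra h
      obtain ⟨φ, hφ, hφ'⟩ := hE.exists_apply_ne_zero_of_notMem h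
      obtain ⟨r, hr⟩ := hend φ
      apply hφ'
      rw [hr, ← key 0 r fun x => by rw [← hr, hφ _ ⟨x, rfl⟩]; rfl, map_zero]
    obtain ⟨x, hx⟩ := hmem
    refine ⟨x, fun φ => ?_⟩
    obtain ⟨r, hr⟩ := hext φ
    rw [key φ r hr, hr, hx]

/-- Biduality for artinian modules. -/
theorem IsMatlis.exists_bidual_equiv [IsNoetherianRing A] [IsAdicComplete (maximalIdeal A) A]
    (hE : IsMatlis A E e₀) [IsArtinian A X] :
    Nonempty (X ≃ₗ[A] ((X →ₗ[A] E) →ₗ[A] E)) := by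
  refine ⟨LinearEquiv.ofBijective (LinearMap.applyₗ (R := A) (M := X) (M₂ := E)) ⟨?_, ?_⟩⟩
  · refine (injective_iff_map_eq_zero _).2 fun x hx => ?_
    by_contra h
    obtain ⟨φ, hφ⟩ := hE.exists_apply_ne_zero h
    exact hφ (LinearMap.congr_fun hx φ)
  · intro ψ
    obtain ⟨x, hx⟩ := hE.dual_artinian.2 ψ
    exact ⟨x, by ext φ; exact (hx φ).symm⟩

/-- `A` is the Matlis dual of `E`. -/
theorem IsMatlis.exists_end_equiv [IsNoetherianRing A] [IsAdicComplete (maximalIdeal A) A]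
    (hE : IsMatlis A E e₀) : Nonempty (A ≃ₗ[A] (E →ₗ[A] E)) := by
  refine ⟨LinearEquiv.ofBijective (LinearMap.lsmul A E) ⟨?_, ?_⟩⟩
  · refine (injective_iff_map_eq_zero _).2 fun r hr => ?_
    by_contra h
    obtain ⟨φ, hφ⟩ := hE.exists_apply_ne_zero h
    apply hφ
    have : φ r = r • φ 1 := by rw [← map_smul, smul_eq_mul, mul_one]
    rw [this]
    exact LinearMap.congr_fun hr (φ 1)
  · intro φ
    obtain ⟨r, hr⟩ := hE.end_eq_smul φ
    exact ⟨r, by ext e; exact (hr e).symm⟩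

end Matlis

open TensorProduct

/-! ### Base change of torsion injective modules and flatness of duals -/

section BaseChange

variable {A : Type u} [CommRing A] {W : Type u} [AddCommGroup W] [Module A W]

theorem exists_smul_of_pow_le [IsLocalRing A] [IsNoetherianRing A]
    (hW : ∀ f : maximalIdeal A →ₗ[A] W, ∃ w : W, ∀ r, f r = (r : A) • w)
    (n : ℕ) (J : Ideal A) (hJ : maximalIdeal A ^ n ≤ J) (f : J →ₗ[A] W) :
    ∃ w : W, ∀ x : J, f x = (x : A) • w := by
  induction J using IsNoetherian.induction with
  | hgt J ih =>
    by_cases hJt : J = ⊤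
    · subst hJt
      exact ⟨f ⟨1, trivial⟩, fun x => by
        rw [← map_smul]; congr 1; ext; simp⟩
    have hex : ∃ k, maximalIdeal A ^ k ≤ J := ⟨n, hJ⟩
    classical
    obtain ⟨k, hk⟩ : ∃ k, Nat.find hex = k + 1 := Nat.exists_eq_succ_of_ne_zero fun h => hJt (by
      have := Nat.find_spec hex
      rw [h, pow_zero, Ideal.one_eq_top] at this
      exact top_le_iff.1 this)
    have hk1 : maximalIdeal A ^ (k + 1) ≤ J := hk ▸ Nat.find_spec hex
    obtain ⟨a, ha, haJ⟩ := Set.not_subset.1 (Nat.find_min hex (m := k) (by omega))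
    have hma : ∀ r ∈ maximalIdeal A, r * a ∈ J := fun r hr => hk1 (by
      rw [pow_succ']; exact Ideal.mul_mem_mul hr ha)
    have hnu : ∀ c : A, c * a ∈ J → c ∈ maximalIdeal A := fun c hc =>
      (mem_maximalIdeal c).2 fun h => haJ ((Ideal.unit_mul_mem_iff_mem J h).1 hc)
    obtain ⟨w, hw⟩ := hW (f ∘ₗ
      { toFun := fun r => (⟨r * a, hma r r.2⟩ : J)
        map_add' := fun r s => Subtype.ext (by simp [add_mul])
        map_smul' := fun r s => Subtype.ext (by simp [mul_assoc]) })
    have hw' : ∀ (c : A) (hc : c * a ∈ J), f ⟨c * a, hc⟩ = c • w := fun c hc =>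
      hw ⟨c, hnu c hc⟩
    let p : A →ₗ.[A] W := ⟨J, f⟩
    let q : A →ₗ.[A] W := LinearPMap.mkSpanSingleton' a w fun c hc => by
      rw [RingHom.id_apply, ← hw' c (by rw [← smul_eq_mul, hc]; exact J.zero_mem)]
      have : (⟨c * a, by rw [← smul_eq_mul, hc]; exact J.zero_mem⟩ : J) = 0 := Subtype.ext hc
      rw [this, map_zero]
    have hpq : ∀ (x : p.domain) (y : q.domain), (x : A) = y → p x = q y := by
      rintro ⟨x, hx⟩ ⟨y, hy⟩ (rfl : x = y)
      obtain ⟨c, rfl⟩ := Submodule.mem_span_singleton.1 hy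
      rw [LinearPMap.mkSpanSingleton'_apply]
      exact hw' c hx
    obtain ⟨v, hv⟩ := ih (p.sup q hpq).domain (lt_of_le_of_ne le_sup_left fun h => haJ (by
      rw [h]; exact Submodule.mem_sup_right (Submodule.mem_span_singleton_self a)))
      (hJ.trans le_sup_left) (p.sup q hpq).toFun
    refine ⟨v, fun x => ?_⟩
    have := hv ⟨x, Submodule.mem_sup_left x.2⟩
    rw [← this]
    exact (LinearPMap.left_le_sup p q hpq).2 (x := x) (y := ⟨x, Submodule.mem_sup_left x.2⟩) rfl

/-- A torsion module over a noetherian local ring is injective once maps from the maximal ideal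
extend to the ring. -/
theorem injective_of_isTors [IsLocalRing A] [IsNoetherianRing A]
    (ht : IsTors (maximalIdeal A : Set A) W)
    (hW : ∀ f : maximalIdeal A →ₗ[A] W, ∃ w : W, ∀ r, f r = (r : A) • w) :
    Module.Injective A W := by
  refine Module.Baer.injective fun I f => ?_
  obtain ⟨s, hs⟩ := (inferInstance : IsNoetherian A I).noetherian ⊤
  have h1 : ∀ x : I, ∃ n : ℕ, ∀ r ∈ maximalIdeal A ^ n, r • f x = 0 := fun x =>
    ht.exists_pow (IsNoetherian.noetherian _) (f x)
  choose n hn using h1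
  set k := s.sup n with hk
  have h2 : ∀ x : I, ∀ r ∈ maximalIdeal A ^ k, r • f x = 0 := by
    intro x r hr
    have hx : x ∈ Submodule.span A (s : Set I) := hs ▸ trivial
    induction hx using Submodule.span_induction with
    | mem x hx => exact hn x r (Ideal.pow_le_pow_right (Finset.le_sup hx) hr)
    | zero => simp
    | add x y _ _ hx hy => rw [map_add, smul_add, hx, hy, add_zero]
    | smul c x _ hx => rw [map_smul, smul_comm, hx, smul_zero]
  obtain ⟨c, hc⟩ := Ideal.exists_pow_inf_eq_pow_smul (maximalIdeal A) (I : Submodule A A)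
  have h3 : ∀ x : I, (x : A) ∈ maximalIdeal A ^ (k + c) → f x = 0 := by
    intro x hx
    have h4 : (x : A) ∈ maximalIdeal A ^ k • (I : Submodule A A) := by
      have h5 : (x : A) ∈ maximalIdeal A ^ (k + c) • (⊤ : Submodule A A) ⊓ I := by
        refine ⟨?_, x.2⟩
        rw [smul_eq_mul, Ideal.mul_top]; exact hx
      rw [hc (k + c) (by omega), Nat.add_sub_cancel] at h5
      exact Submodule.smul_mono le_rfl inf_le_right h5
    have h6 : x ∈ maximalIdeal A ^ k • (⊤ : Submodule A I) := by
      have h7 : (x : A) ∈ Submodule.map (Submodule.subtype I)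
          (maximalIdeal A ^ k • (⊤ : Submodule A I)) := by
        rwa [Submodule.map_smul'', Submodule.map_subtype_top]
      obtain ⟨y, hy, hyx⟩ := h7
      rwa [← Subtype.ext hyx]
    clear h4 hx
    induction h6 using Submodule.smul_induction_on' with
    | smul r hr y _ => rw [map_smul]; exact h2 y r hr
    | add y _ z _ hy hz => rw [map_add, hy, hz, add_zero]
  let p : A →ₗ.[A] W := ⟨I, f⟩
  let q : A →ₗ.[A] W := ⟨maximalIdeal A ^ (k + c), 0⟩
  have hpq : ∀ (x : p.domain) (y : q.domain), (x : A) = y → p x = q y :=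
    fun x y hxy => h3 x (hxy ▸ y.2)
  obtain ⟨w, hw⟩ := exists_smul_of_pow_le hW (k + c) (p.sup q hpq).domain le_sup_right
    (p.sup q hpq).toFun
  refine ⟨LinearMap.toSpanSingleton A W w, fun x hx => ?_⟩
  have := hw ⟨x, Submodule.mem_sup_left hx⟩
  rw [LinearMap.toSpanSingleton_apply, ← this]
  exact ((LinearPMap.left_le_sup p q hpq).2 (x := ⟨x, hx⟩)
    (y := ⟨x, Submodule.mem_sup_left hx⟩) rfl).symm


variable {R : Type u} [CommRing R]

/-- The map `M^t → M^s` whose components are given by the columns of the matrix of a linear map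
`R^s → R^t`. -/
def dualMat {s t : ℕ} (b : (Fin s → R) →ₗ[R] (Fin t → R)) (M : Type u) [AddCommGroup M]
    [Module R M] : (Fin t → M) →ₗ[R] (Fin s → M) :=
  LinearMap.pi fun k => ∑ j, b (Pi.single k 1) j • LinearMap.proj j

theorem dualMat_apply {s t : ℕ} (b : (Fin s → R) →ₗ[R] (Fin t → R)) (M : Type u) [AddCommGroup M]
    [Module R M] (x : Fin t → M) (k : Fin s) :
    dualMat b M x k = ∑ j, b (Pi.single k 1) j • x j := by
  simp [dualMat]

theorem exact_dualMat {s t v : ℕ} {b : (Fin s → R) →ₗ[R] (Fin t → R)}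
    {a : (Fin t → R) →ₗ[R] (Fin v → R)} (h : Function.Exact b a) {Q : Type u} [AddCommGroup Q]
    [Module R Q] (hQ : Module.Injective R Q) :
    Function.Exact (dualMat a Q) (dualMat b Q) := by
  have hev : ∀ {s t : ℕ} (b : (Fin s → R) →ₗ[R] (Fin t → R)) (x : Fin t → Q) (r : Fin s → R),
      (Fintype.linearCombination R x) (b r) = (Fintype.linearCombination R (dualMat b Q x)) r := by
    intro s t b x r
    have : (Fintype.linearCombination R x) ∘ₗ b = Fintype.linearCombination R (dualMat b Q x) := by
      ext k
      simp [Fintype.linearCombination_apply, dualMat_apply, Pi.single_apply]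
    exact LinearMap.congr_fun this r
  intro x
  constructor
  · intro hx
    obtain ⟨ψ, hψ⟩ := hQ.exists_comp_eq a (Fintype.linearCombination R x) (by
      intro r hr
      obtain ⟨r', rfl⟩ := (h r).1 hr
      rw [LinearMap.mem_ker, hev, hx]; simp [Fintype.linearCombination_apply])
    refine ⟨fun k => ψ (Pi.single k 1), ?_⟩
    ext k
    have h1 := LinearMap.congr_fun hψ (Pi.single k 1)
    simp only [LinearMap.comp_apply, Fintype.linearCombination_apply_single, one_smul] at h1
    rw [dualMat_apply, ← h1]
    conv_rhs => rw [← Finset.univ_sum_single (a (Pi.single k 1)), map_sum]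
    refine Finset.sum_congr rfl fun j _ => ?_
    rw [← map_smul]
    congr 1
    ext i
    simp [Pi.single_apply]
  · rintro ⟨y, rfl⟩
    ext k
    have h1 := hev b (dualMat a Q y) (Pi.single k 1)
    rw [← hev a, h.apply_apply_eq_zero, map_zero] at h1
    simpa [Fintype.linearCombination_apply_single] using h1.symm


theorem exact_dualMat_tensor {s t v : ℕ} {b : (Fin s → R) →ₗ[R] (Fin t → R)}
    {a : (Fin t → R) →ₗ[R] (Fin v → R)} (h : Function.Exact b a) {Q : Type u} [AddCommGroup Q]
    [Module R Q] (hQ : Module.Injective R Q) (P : Type u) [AddCommGroup P] [Module R P]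
    [Module.Flat R P] :
    Function.Exact (dualMat a (P ⊗[R] Q)) (dualMat b (P ⊗[R] Q)) := by
  have hcomm : ∀ {s t : ℕ} (b : (Fin s → R) →ₗ[R] (Fin t → R)),
      dualMat b (P ⊗[R] Q) ∘ₗ (TensorProduct.piRight R R P fun _ : Fin t => Q).toLinearMap =
        (TensorProduct.piRight R R P fun _ : Fin s => Q).toLinearMap ∘ₗ
          (dualMat b Q).lTensor P := by
    intro s t b
    refine TensorProduct.ext' fun x q => ?_
    ext k
    simp [dualMat_apply, TensorProduct.tmul_sum, TensorProduct.tmul_smul]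
  have h1 := Module.Flat.lTensor_exact P (exact_dualMat h hQ)
  exact (Function.Exact.iff_of_ladder_linearEquiv (hcomm a) (hcomm b)).2 h1

theorem exists_exact_of_ideal [IsNoetherianRing R] {s : ℕ} (x : Fin s → R) :
    ∃ (p : ℕ) (b : (Fin p → R) →ₗ[R] (Fin s → R)) (a : (Fin s → R) →ₗ[R] (Fin 1 → R)),
      Function.Exact b a ∧ ∀ i, a (Pi.single i 1) 0 = x i := by
  let a : (Fin s → R) →ₗ[R] (Fin 1 → R) := LinearMap.pi fun _ => Fintype.linearCombination R x
  obtain ⟨p, b, hb⟩ := Module.Finite.exists_fin' R (LinearMap.ker a)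
  refine ⟨p, (LinearMap.ker a).subtype ∘ₗ b, a, ?_, fun i => ?_⟩
  · rw [LinearMap.exact_iff, LinearMap.range_comp, LinearMap.range_eq_top.2 hb,
      Submodule.map_top, Submodule.range_subtype]
  · simp [a, Fintype.linearCombination_apply_single]

/-- Maps from an ideal to the tensor product of a flat and an injective module extend to
the ring. -/
theorem exists_smul_of_flat_tensor [IsNoetherianRing R] {Q : Type u} [AddCommGroup Q]
    [Module R Q] (hQ : Module.Injective R Q) (P : Type u) [AddCommGroup P] [Module R P]
    [Module.Flat R P] (I : Ideal R) (f : I →ₗ[R] P ⊗[R] Q) :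
    ∃ w, ∀ r : I, f r = (r : R) • w := by
  obtain ⟨s, g, hg⟩ := Module.Finite.exists_fin' R I
  obtain ⟨p, b, a, hba, ha⟩ := exists_exact_of_ideal fun i => (g (Pi.single i 1) : R)
  have hz : dualMat b (P ⊗[R] Q) (fun i => f (g (Pi.single i 1))) = 0 := by
    ext k
    have h1 : a (b (Pi.single k 1)) 0 = 0 := by rw [hba.apply_apply_eq_zero]; rfl
    have h2 : a (b (Pi.single k 1)) 0 = (∑ j, b (Pi.single k 1) j • g (Pi.single j 1) : I) := by
      conv_lhs => rw [pi_eq_sum_univ' (b (Pi.single k 1)), map_sum]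
      simp only [map_smul, Finset.sum_apply, Pi.smul_apply]
      push_cast
      refine Finset.sum_congr rfl fun j _ => ?_
      rw [← ha j]
    rw [dualMat_apply]
    simp only [← map_smul, ← map_sum]
    rw [h1] at h2
    have h3 : (∑ j, b (Pi.single k 1) j • g (Pi.single j 1) : I) = 0 := Subtype.ext h2.symm
    simp only [← map_smul, ← map_sum] at h3 ⊢
    rw [h3, map_zero]; rfl
  obtain ⟨w, hw⟩ := (exact_dualMat_tensor hba hQ P _).1 hz
  refine ⟨w 0, fun r => ?_⟩
  obtain ⟨r, rfl⟩ := hg r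
  have hlin : f ∘ₗ g = (LinearMap.toSpanSingleton R _ (w 0)) ∘ₗ Submodule.subtype I ∘ₗ g := by
    ext i
    have := congrFun hw i
    simp only [dualMat_apply, Finset.univ_unique, Fin.default_eq_zero, Finset.sum_singleton,
      ha] at this
    simp [← this]
  simpa using LinearMap.congr_fun hlin r

/-- The module of homomorphisms between injective modules over a noetherian ring is flat. -/
theorem flat_hom_of_injective [IsNoetherianRing R] {Q E : Type u} [AddCommGroup Q]
    [Module R Q] [AddCommGroup E] [Module R E] (hQ : Module.Injective R Q)
    (hE : Module.Injective R E) : Module.Flat R (Q →ₗ[R] E) := by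
  refine Module.Flat.of_forall_isTrivialRelation fun {l f x} hfx => ?_
  obtain ⟨p, b, a, hba, ha⟩ := exists_exact_of_ideal f
  obtain ⟨ψ, hψ⟩ := hE.exists_comp_eq (dualMat b Q) (∑ i, x i ∘ₗ LinearMap.proj i) (by
    intro q hq
    obtain ⟨y, rfl⟩ := (exact_dualMat hba hQ q).1 hq
    have := LinearMap.congr_fun hfx (y 0)
    simpa [dualMat_apply, ha] using this)
  refine ⟨p, fun i k => b (Pi.single k 1) i,
    fun k => ψ ∘ₗ LinearMap.single R (fun _ => Q) k, fun i => ?_, fun k => ?_⟩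
  · ext q
    have h1 := LinearMap.congr_fun hψ (Pi.single i q)
    have h2 : (∑ i, x i ∘ₗ LinearMap.proj i : (Fin l → Q) →ₗ[R] E) (Pi.single i q) = x i q := by
      simp [Pi.single_apply, apply_ite]
    rw [h2, LinearMap.comp_apply, ← Finset.univ_sum_single (dualMat b Q (Pi.single i q)),
      map_sum] at h1
    rw [← h1]
    simp only [LinearMap.sum_apply, LinearMap.smul_apply, LinearMap.comp_apply,
      LinearMap.single_apply, ← map_smul]
    refine Finset.sum_congr rfl fun k _ => congrArg ψ ?_
    rw [dualMat_apply]
    ext j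
    simp [Pi.single_apply]
  · have h1 : a (b (Pi.single k 1)) 0 = 0 := by rw [hba.apply_apply_eq_zero]; rfl
    rw [pi_eq_sum_univ' (b (Pi.single k 1)), map_sum] at h1
    simp only [map_smul, Finset.sum_apply, Pi.smul_apply, smul_eq_mul] at h1
    rw [← h1]
    refine Finset.sum_congr rfl fun j _ => ?_
    rw [← ha j, mul_comm]

/-- Base change of torsion injective modules along a flat unramified local homomorphism. -/
theorem InjTors.baseChange [IsLocalRing R] [IsNoetherianRing R] [IsLocalRing A]
    [IsNoetherianRing A] [Algebra R A] [Module.Flat R A]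
    (hm : maximalIdeal A = (maximalIdeal R).map (algebraMap R A)) {Q : Type u} [AddCommGroup Q]
    [Module R Q] (hQ : InjTors R (maximalIdeal R : Set R) Q) :
    Module.Injective A (A ⊗[R] Q) := by
  refine injective_of_isTors ?_ fun f => ?_
  · rw [hm]
    refine isTors_span ?_
    rintro _ ⟨r, hr, rfl⟩ x
    induction x using TensorProduct.induction_on with
    | zero => exact ⟨0, by simp⟩
    | tmul a q =>
      obtain ⟨n, hn⟩ := hQ.2 r hr q
      refine ⟨n, ?_⟩
      rw [← map_pow, algebraMap_smul, ← TensorProduct.tmul_smul, hn, TensorProduct.tmul_zero]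
    | add x y hx hy =>
      obtain ⟨n, hn⟩ := hx
      obtain ⟨k, hk⟩ := hy
      refine ⟨n + k, ?_⟩
      rw [smul_add, pow_add, mul_comm, mul_smul, hn, smul_zero, mul_comm, mul_smul, hk, smul_zero,
        add_zero]
  · have hmem : ∀ r : maximalIdeal R, algebraMap R A r ∈ maximalIdeal A := fun r => by
      rw [hm]; exact Ideal.mem_map_of_mem _ r.2
    obtain ⟨w, hw⟩ := exists_smul_of_flat_tensor hQ.1 A (maximalIdeal R)
      { toFun := fun r => f ⟨algebraMap R A r, hmem r⟩
        map_add' := fun r s => by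
          rw [← map_add]; congr 1; ext; simp
        map_smul' := fun r s => by
          rw [RingHom.id_apply, ← algebraMap_smul A r (f _), ← map_smul]
          congr 1
          ext
          simp [Algebra.smul_def] }
    refine ⟨w, fun x => ?_⟩
    have hx : (x : A) ∈ Submodule.span A (algebraMap R A '' (maximalIdeal R : Set R)) :=
      hm.le x.2
    obtain ⟨x, hx'⟩ := x
    simp only at hx ⊢
    induction hx using Submodule.span_induction with
    | mem y hy =>
      obtain ⟨r, hr, rfl⟩ := hy
      rw [algebraMap_smul]; exact hw ⟨r, hr⟩
    | zero => rw [zero_smul]; exact map_zero f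
    | add y z hy hz hy1 hz1 =>
      have h1 : y ∈ maximalIdeal A := by rw [hm]; exact hy
      have h2 : z ∈ maximalIdeal A := by rw [hm]; exact hz
      rw [add_smul, ← hy1 h1, ← hz1 h2, ← map_add]; rfl
    | smul a y hy hy1 =>
      have h1 : y ∈ maximalIdeal A := by rw [hm]; exact hy
      rw [smul_assoc, ← hy1 h1, ← map_smul]; rfl

end BaseChange

/-! ### Matlis-type duals along an algebra -/

section DualAlong

variable {R A E : Type u} [CommRing R] [CommRing A] [Algebra R A] [AddCommGroup E] [Module A E]
  [Module R E] [IsScalarTower R A E]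
variable {N N₁ N₂ N₃ : Type u} [AddCommGroup N] [Module A N] [AddCommGroup N₁] [Module A N₁]
  [AddCommGroup N₂] [Module A N₂] [AddCommGroup N₃] [Module A N₃]
variable {f : N₁ →ₗ[A] N₂} {g : N₂ →ₗ[A] N₃}

variable (R) in
theorem SES.dual (h : SES f g) (hE : Module.Injective A E) :
    SES (LinearMap.lcomp R E g) (LinearMap.lcomp R E f) := by
  refine ⟨fun a b hab => ?_, fun φ => ?_, fun φ => ⟨fun hφ => ?_, ?_⟩⟩
  · ext x
    obtain ⟨y, rfl⟩ := h.surj x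
    exact LinearMap.congr_fun hab y
  · obtain ⟨ψ, hψ⟩ := hE.out f h.inj φ
    exact ⟨ψ, LinearMap.ext hψ⟩
  · refine ⟨(LinearMap.ker g).liftQ φ ?_ ∘ₗ
      (g.quotKerEquivOfSurjective h.surj).symm.toLinearMap, ?_⟩
    · rw [← h.range_eq]
      rintro _ ⟨x, rfl⟩
      exact LinearMap.congr_fun hφ x
    · ext x
      simp [LinearMap.lcomp_apply, LinearMap.quotKerEquivOfSurjective_symm_apply]
  · rintro ⟨ψ, rfl⟩
    ext x
    simp [LinearMap.lcomp_apply, h.apply_apply]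

variable (R) in
theorem Module.Injective.restrict_of_flat [Module.Flat R A] (hE : Module.Injective A E) :
    Module.Injective R E := by
  refine ⟨fun X Y _ _ _ _ f hf g => ?_⟩
  have hinj : Function.Injective (f.baseChange A) :=
    Module.Flat.lTensor_preserves_injective_linearMap (M := A) f hf
  obtain ⟨k, hk⟩ := hE.out (f.baseChange A) hinj (LinearMap.liftBaseChangeEquiv A g)
  refine ⟨(LinearMap.liftBaseChangeEquiv A).symm k, fun x => ?_⟩
  have := hk (1 ⊗ₜ x)
  simpa using this

variable (R E) in
/-- The dual of a finite free module. -/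
noncomputable def dualPiEquiv (n : ℕ) : ((Fin n → A) →ₗ[A] E) ≃ₗ[R] (Fin n → E) where
  toFun φ i := φ (Pi.single i 1)
  invFun e := Fintype.linearCombination A e
  map_add' _ _ := rfl
  map_smul' _ _ := rfl
  left_inv φ := by
    ext i
    simp [Fintype.linearCombination_apply_single]
  right_inv e := by
    ext i
    simp [Fintype.linearCombination_apply_single]

theorem Module.Injective.pi_fin (hE : Module.Injective R E) (n : ℕ) :
    Module.Injective R (Fin n → E) := by
  refine ⟨fun X Y _ _ _ _ f hf g => ?_⟩
  choose k hk using fun i => hE.out f hf (LinearMap.proj i ∘ₗ g)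
  exact ⟨LinearMap.pi k, fun x => funext fun i => hk i x⟩

variable (R) in
theorem Module.Injective.dual_pi [Module.Flat R A] (hE : Module.Injective A E) (n : ℕ) :
    Module.Injective R ((Fin n → A) →ₗ[A] E) :=
  ((hE.restrict_of_flat R).pi_fin n).of_equiv (dualPiEquiv R E n).symm

/-- Swapping the arguments of `Ext` into a dual. -/
theorem ev_swap_iff [Module.Flat R A] [IsNoetherianRing A] (hE : Module.Injective A E)
    {Q : Type u} [AddCommGroup Q] [Module R Q] [Module.Finite A N] (i : ℕ) :
    EV R Q (N →ₗ[A] E) (i + 1) ↔ EV A N (Q →ₗ[R] E) (i + 1) := by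
  induction i generalizing N with
  | zero =>
    obtain ⟨n, π, hπ⟩ := Module.Finite.exists_fin' A N
    have hs := ses_ker π hπ
    have hd := hs.dual R hE
    have := hE.dual_pi R n
    constructor
    · intro h
      refine hs.ev1_of_extend (fun φ => ?_) (ev_of_projective 0)
      obtain ⟨ψ, hψ⟩ := hd.lift h φ.flip
      refine ⟨ψ.flip, LinearMap.ext fun x => LinearMap.ext fun q => ?_⟩
      exact LinearMap.congr_fun (LinearMap.congr_fun hψ q) x
    · intro h
      refine hd.ev1_of_lift (fun φ => ?_) (ev_of_injective 0)
      obtain ⟨ψ, hψ⟩ := hs.extend h φ.flip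
      refine ⟨ψ.flip, LinearMap.ext fun x => LinearMap.ext fun q => ?_⟩
      exact LinearMap.congr_fun (LinearMap.congr_fun hψ q) x
  | succ i ih =>
    obtain ⟨n, π, hπ⟩ := Module.Finite.exists_fin' A N
    have hs := ses_ker π hπ
    have hd := hs.dual R hE
    have := hE.dual_pi R n
    constructor
    · intro h
      exact hs.ev_con3 (ih.1 (hd.ev_cov3 (ev_of_injective i) h)) (ev_of_projective _)
    · intro h
      exact hd.ev_cov1 (ih.2 (hs.ev_con1 (ev_of_projective i) h)) (ev_of_injective _)

theorem ev1_flat_of_ev1 [IsNoetherianRing A] [Module.Finite A N] (h : EV A N A 1)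
    (P : Type u) [AddCommGroup P] [Module A P] [Module.Flat A P] : EV A N P 1 := by
  obtain ⟨n, π, hπ⟩ := Module.Finite.exists_fin' A N
  have hs := ses_ker π hπ
  refine hs.ev1_of_extend (fun φ => ?_) (ev_of_projective 0)
  have : Module.FinitePresentation A (LinearMap.ker π) := Module.finitePresentation_of_finite A _
  obtain ⟨k, α, β, rfl⟩ := Module.Flat.exists_factorization_of_finitePresentation φ
  have hk : EV A N (Fin k →₀ A) 1 :=
    (h.pi_fin_right k).congr_right (Finsupp.linearEquivFunOnFinite A A (Fin k))
  obtain ⟨ψ, hψ⟩ := hs.extend hk α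
  exact ⟨β ∘ₗ ψ, by rw [LinearMap.comp_assoc, hψ]⟩

theorem ev_flat_of_ev [IsNoetherianRing A] [Module.Finite A N] (h : ∀ i, EV A N A (i + 1))
    (P : Type u) [AddCommGroup P] [Module A P] [Module.Flat A P] (i : ℕ) : EV A N P (i + 1) := by
  induction i generalizing N with
  | zero => exact ev1_flat_of_ev1 (h 0) P
  | succ i ih =>
    obtain ⟨n, π, hπ⟩ := Module.Finite.exists_fin' A N
    have hs := ses_ker π hπ
    exact hs.ev_con3 (ih fun j => hs.ev_con1 (ev_of_projective j) (h (j + 1))) (ev_of_projective _)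

/-- The module embeds into a finite free module. -/
def EmbedsFree (A : Type u) [CommRing A] (N : Type u) [AddCommGroup N] [Module A N] : Prop :=
  ∃ (n : ℕ) (j : N →ₗ[A] (Fin n → A)), Function.Injective j

variable (R A E) in
/-- Finite modules without higher extensions to the ring and whose dual has finite Gorenstein
injective dimension are torsionless. -/
def GammaC [IsLocalRing R] : Prop :=
  ∀ (N : Type u) [AddCommGroup N] [Module A N] [Module.Finite A N],
    PhiFin R (maximalIdeal R : Set R) (N →ₗ[A] E) → (∀ i, EV A N A (i + 1)) → EmbedsFree A N

theorem gammaC_of_unramified [IsLocalRing R] [IsNoetherianRing R] [IsLocalRing A]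
    [IsNoetherianRing A] [Module.Flat R A]
    (hm : maximalIdeal A = (maximalIdeal R).map (algebraMap R A)) {e₀ : E}
    (hE : IsMatlis A E e₀) : GammaC R A E := by
  intro N _ _ _ ⟨n, hn⟩ hN
  have hev : EVAll R (maximalIdeal R : Set R) (N →ₗ[A] E) := fun Q _ _ hQ i => by
    have := flat_hom_of_injective (hQ.baseChange hm) hE.inj
    have : Module.Flat A (Q →ₗ[R] E) :=
      Module.Flat.of_linearEquiv (LinearMap.liftBaseChangeEquiv (R := R) (M := Q) (N := E) A)
    exact (ev_swap_iff hE.inj i).2 (ev_flat_of_ev hN _ i)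
  obtain ⟨-, -, X, Q, _, _, _, _, ι, π, -, hQ, hs⟩ := (hn.leftC hev).unfold
  have := flat_hom_of_injective (hQ.baseChange hm) hE.inj
  have : Module.Flat A (Q →ₗ[R] E) :=
    Module.Flat.of_linearEquiv (LinearMap.liftBaseChangeEquiv (R := R) (M := Q) (N := E) A)
  have : Module.FinitePresentation A N := Module.finitePresentation_of_finite A N
  obtain ⟨k, α, β, hαβ⟩ := Module.Flat.exists_factorization_of_finitePresentation π.flip
  refine ⟨k, (Finsupp.linearEquivFunOnFinite A A (Fin k)).toLinearMap ∘ₗ α,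
    (injective_iff_map_eq_zero _).2 fun x hx => ?_⟩
  rw [LinearMap.comp_apply, LinearEquiv.coe_coe, LinearEquiv.map_eq_zero_iff] at hx
  by_contra h
  obtain ⟨φ, hφ⟩ := hE.exists_apply_ne_zero h
  obtain ⟨q, rfl⟩ := hs.surj φ
  apply hφ
  have : π.flip x = 0 := by rw [hαβ, LinearMap.comp_apply, hx, map_zero]
  exact LinearMap.congr_fun this q

end DualAlong

/-! ### Change of rings along the quotient by a regular element -/

section Quotient

open CategoryTheory Abelian

variable {A B : Type u} [CommRing A] [CommRing B] [Algebra A B] {y : A}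

theorem smul_eq_zero_of_ses (hAB : SES (LinearMap.lsmul A A y) (Algebra.linearMap A B))
    {X : Type u} [AddCommGroup X] [Module A X] [Module B X] [IsScalarTower A B X] (x : X) :
    y • x = 0 := by
  have h : algebraMap A B y = 0 := by simpa using hAB.apply_apply 1
  rw [← algebraMap_smul B y x, h, zero_smul]

theorem one_tmul_eq_zero_iff (hAB : SES (LinearMap.lsmul A A y) (Algebra.linearMap A B))
    {X : Type u} [AddCommGroup X] [Module A X] (x : X) :
    (1 : B) ⊗ₜ[A] x = 0 ↔ ∃ x', y • x' = x := by
  constructor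
  · intro h
    have h1 := rTensor_exact X hAB.exact hAB.surj
    obtain ⟨z, hz⟩ := (h1 (1 ⊗ₜ x)).1 (by simpa using h)
    refine ⟨TensorProduct.lid A X z, ?_⟩
    have h2 := congrArg (TensorProduct.lid A X) hz
    rw [TensorProduct.lid_tmul, one_smul] at h2
    rw [← h2]
    have h3 : y • (TensorProduct.lid A X).toLinearMap =
        (TensorProduct.lid A X).toLinearMap ∘ₗ (LinearMap.lsmul A A y).rTensor X :=
      TensorProduct.ext' fun a x => by simp [mul_smul]
    exact LinearMap.congr_fun h3 z
  · rintro ⟨x, rfl⟩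
    rw [TensorProduct.tmul_smul, TensorProduct.smul_tmul', smul_eq_zero_of_ses hAB,
      TensorProduct.zero_tmul]

theorem exists_one_tmul (hAB : SES (LinearMap.lsmul A A y) (Algebra.linearMap A B))
    {X : Type u} [AddCommGroup X] [Module A X] (z : B ⊗[A] X) : ∃ x, z = 1 ⊗ₜ x := by
  induction z using TensorProduct.induction_on with
  | zero => exact ⟨0, by simp⟩
  | tmul b x =>
    obtain ⟨a, rfl⟩ := hAB.surj b
    exact ⟨a • x, by simp [TensorProduct.tmul_smul, TensorProduct.smul_tmul', Algebra.smul_def]⟩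
  | add z w hz hw =>
    obtain ⟨x, rfl⟩ := hz
    obtain ⟨x', rfl⟩ := hw
    exact ⟨x + x', by rw [TensorProduct.tmul_add]⟩

variable {N N₁ N₂ N₃ : Type u} [AddCommGroup N] [Module A N] [AddCommGroup N₁] [Module A N₁]
  [AddCommGroup N₂] [Module A N₂] [AddCommGroup N₃] [Module A N₃]
variable {f : N₁ →ₗ[A] N₂} {g : N₂ →ₗ[A] N₃}

theorem ses_one_tmul (hAB : SES (LinearMap.lsmul A A y) (Algebra.linearMap A B))
    (hy : ∀ x : N, y • x = 0 → x = 0) :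
    SES (LinearMap.lsmul A N y) (TensorProduct.mk A B N 1) :=
  ⟨(injective_iff_map_eq_zero _).2 hy, fun z => (exists_one_tmul hAB z).imp fun _ h => h.symm,
    fun x => one_tmul_eq_zero_iff hAB x⟩

theorem SES.baseChange_quotient (h : SES f g)
    (hAB : SES (LinearMap.lsmul A A y) (Algebra.linearMap A B)) (hy : ∀ x : N₃, y • x = 0 → x = 0) :
    SES (f.baseChange B) (g.baseChange B) := by
  refine ⟨(injective_iff_map_eq_zero _).2 fun z hz => ?_, ?_, ?_⟩
  · obtain ⟨x, rfl⟩ := exists_one_tmul hAB z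
    rw [LinearMap.baseChange_tmul, one_tmul_eq_zero_iff hAB] at hz
    obtain ⟨x₂, hx₂⟩ := hz
    obtain ⟨x₁, rfl⟩ := h.exists_of_apply_eq_zero (b := x₂)
      (hy _ (by rw [← map_smul, hx₂, h.apply_apply]))
    exact (one_tmul_eq_zero_iff hAB _).2 ⟨x₁, h.inj (by rw [map_smul, hx₂])⟩
  · exact LinearMap.lTensor_surjective B h.surj
  · exact lTensor_exact B h.exact h.surj

/-- Extensions over the quotient ring of the reduction of a module. -/
theorem ev_quotient_of_ev [IsNoetherianRing A]
    (hAB : SES (LinearMap.lsmul A A y) (Algebra.linearMap A B)) [Module.Finite A N]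
    (hy : ∀ x : N, y • x = 0 → x = 0) {Y : Type u} [AddCommGroup Y] [Module A Y] [Module B Y]
    [IsScalarTower A B Y] (i : ℕ) (h : EV A N Y (i + 1)) : EV B (B ⊗[A] N) Y (i + 1) := by
  induction i generalizing N with
  | zero =>
    obtain ⟨n, π, hπ⟩ := Module.Finite.exists_fin' A N
    have hs := ses_ker π hπ
    refine (hs.baseChange_quotient hAB hy).ev1_of_extend (fun φ => ?_) (ev_of_projective 0)
    obtain ⟨ψ, hψ⟩ := hs.extend h ((φ.restrictScalars A) ∘ₗ TensorProduct.mk A B _ 1)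
    refine ⟨LinearMap.liftBaseChange B ψ, ?_⟩
    ext x
    simpa using LinearMap.congr_fun hψ x
  | succ i ih =>
    obtain ⟨n, π, hπ⟩ := Module.Finite.exists_fin' A N
    have hs := ses_ker π hπ
    refine (hs.baseChange_quotient hAB hy).ev_con3 (ih (fun x hx => ?_)
      (hs.ev_con1 (ev_of_projective _) h)) (ev_of_projective _)
    refine Subtype.ext (funext fun k => hAB.inj ?_)
    have := congrFun (congrArg Subtype.val hx) k
    simpa using this

theorem ext_smul_eq_zero {X : Type u} [AddCommGroup X] [Module A X] (hy : ∀ x : X, y • x = 0)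
    {i : ℕ} (z : Ext (ModuleCat.of A X) (ModuleCat.of A N) i) : y • z = 0 := by
  have h : y • 𝟙 (ModuleCat.of A X) = 0 := by
    ext x
    exact hy x
  rw [← Ext.mk₀_id_comp z, ← Ext.smul_comp, ← Ext.mk₀_smul, h, Ext.mk₀_zero, Ext.zero_comp]

theorem exists_ext_one_eq_comp (hAB : SES (LinearMap.lsmul A A y) (Algebra.linearMap A B))
    {X : Type u} [AddCommGroup X] [Module A X] (hy : ∀ x : X, y • x = 0)
    (z : Ext (ModuleCat.of A X) (ModuleCat.of A A) 1) :
    ∃ θ : X →ₗ[A] B, z = (Ext.mk₀ (ModuleCat.ofHom θ)).comp hAB.shortExact.extClass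
      (zero_add 1) := by
  obtain ⟨w, hw⟩ := Ext.covariant_sequence_exact₁ (ModuleCat.of A X) hAB.shortExact z (by
    exact (Ext.smul_eq_comp_mk₀ z y).symm.trans (ext_smul_eq_zero hy z)) (zero_add 1)
  obtain ⟨w, rfl⟩ := (Ext.mk₀_bijective _ _).2 w
  exact ⟨w.hom, hw.symm⟩

theorem hom_subsingleton_of_smul (hAB : SES (LinearMap.lsmul A A y) (Algebra.linearMap A B))
    {X : Type u} [AddCommGroup X] [Module A X] (hy : ∀ x : X, y • x = 0) :
    EV A X A 0 := by
  rw [ev_zero_iff]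
  refine subsingleton_of_forall_eq 0 fun φ => LinearMap.ext fun x => hAB.inj ?_
  rw [LinearMap.lsmul_apply, ← map_smul, hy, map_zero, LinearMap.zero_apply, map_zero]

theorem ev_quotient_ring (hAB : SES (LinearMap.lsmul A A y) (Algebra.linearMap A B)) (i n : ℕ) :
    EV A (Fin n → B) A (i + 2) :=
  (hAB.ev_con3 (ev_of_projective i) (ev_of_projective (i + 1))).pi_fin_left n

section Rees

variable {X : Type u} [AddCommGroup X] [Module A X] [Module B X] [IsScalarTower A B X]
variable {X' : Type u} [AddCommGroup X'] [Module A X'] [Module B X'] [IsScalarTower A B X']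
  {n : ℕ} {ι : X' →ₗ[B] (Fin n → B)} {π : (Fin n → B) →ₗ[B] X}

theorem ses_restrictScalars {Y : Type u} [AddCommGroup Y] [Module A Y] [Module B Y]
    [IsScalarTower A B Y] {ι : X' →ₗ[B] Y} {π : Y →ₗ[B] X} (h : SES ι π) :
    SES (ι.restrictScalars A) (π.restrictScalars A) := ⟨h.inj, h.surj, h.exact⟩

theorem ev_one_of_ev_two (hAB : SES (LinearMap.lsmul A A y) (Algebra.linearMap A B))
    (hs : SES ι π) (h : EV A X A 2) : EV B X B 1 := by
  have hs' : SES (ι.restrictScalars A) (π.restrictScalars A) := ses_restrictScalars hs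
  refine hs.ev1_of_extend (fun φ => ?_) (ev_of_projective 0)
  unfold EV at h
  obtain ⟨w, hw⟩ := Ext.contravariant_sequence_exact₁ hs'.shortExact (ModuleCat.of A A)
    ((Ext.mk₀ (ModuleCat.ofHom (φ.restrictScalars A))).comp hAB.shortExact.extClass
      (zero_add 1)) (add_comm 1 1) (h.elim _ _)
  obtain ⟨θ, rfl⟩ := exists_ext_one_eq_comp hAB (fun x => smul_eq_zero_of_ses hAB x) w
  have h0 : (Ext.mk₀ (ModuleCat.ofHom (φ.restrictScalars A - θ ∘ₗ ι.restrictScalars A))).comp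
      hAB.shortExact.extClass (zero_add 1) = 0 := by
    have h1 : ModuleCat.ofHom (φ.restrictScalars A - θ ∘ₗ ι.restrictScalars A) =
      ModuleCat.ofHom (φ.restrictScalars A) -
        ModuleCat.ofHom (ι.restrictScalars A) ≫ ModuleCat.ofHom θ := rfl
    have h2 : (Ext.mk₀ (ModuleCat.ofHom (ι.restrictScalars A) ≫ ModuleCat.ofHom θ)).comp
        hAB.shortExact.extClass (zero_add 1) = (Ext.mk₀ (ModuleCat.ofHom
          (φ.restrictScalars A))).comp hAB.shortExact.extClass (zero_add 1) := by
      rw [← Ext.mk₀_comp_mk₀_assoc]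
      exact hw
    rw [h1, sub_eq_add_neg, Ext.mk₀_add, Ext.add_comp, ← h2, Ext.mk₀_neg, Ext.neg_comp,
      add_neg_cancel]
  obtain ⟨v, hv⟩ := Ext.covariant_sequence_exact₃ (ModuleCat.of A X') hAB.shortExact _
    (zero_add 1) h0
  have h2 : Subsingleton (Ext (ModuleCat.of A X') (ModuleCat.of A A) 0) :=
    hom_subsingleton_of_smul hAB fun x => smul_eq_zero_of_ses hAB x
  have h3 : φ.restrictScalars A - θ ∘ₗ ι.restrictScalars A = 0 := by
    have : Ext.mk₀ (ModuleCat.ofHom (φ.restrictScalars A - θ ∘ₗ ι.restrictScalars A)) = 0 := by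
      rw [← hv, h2.elim v 0, Ext.zero_comp]
    rw [Ext.mk₀_eq_zero_iff] at this
    exact congrArg ModuleCat.Hom.hom this
  refine ⟨θ.extendScalarsOfSurjective hAB.surj, LinearMap.ext fun x => ?_⟩
  exact (sub_eq_zero.1 (LinearMap.congr_fun h3 x)).symm

theorem ev_two_of_ev_one (hAB : SES (LinearMap.lsmul A A y) (Algebra.linearMap A B))
    (hs : SES ι π) (h : EV B X B 1) : EV A X A 2 := by
  have hs' : SES (ι.restrictScalars A) (π.restrictScalars A) := ses_restrictScalars hs
  have hB : EV A (Fin n → B) A 2 := ev_quotient_ring hAB 0 n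
  unfold EV at hB ⊢
  refine subsingleton_of_forall_eq 0 fun x => ?_
  obtain ⟨z, rfl⟩ := Ext.contravariant_sequence_exact₃ hs'.shortExact (ModuleCat.of A A) x
    (hB.elim _ _) (add_comm 1 1)
  obtain ⟨θ, rfl⟩ := exists_ext_one_eq_comp hAB (fun x => smul_eq_zero_of_ses hAB x) z
  obtain ⟨ψ, hψ⟩ := hs.extend h (θ.extendScalarsOfSurjective hAB.surj)
  have h1 : ModuleCat.ofHom θ =
      ModuleCat.ofHom (ι.restrictScalars A) ≫ ModuleCat.ofHom (ψ.restrictScalars A) := by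
    rw [← ModuleCat.ofHom_comp]
    congr 1
    ext x
    exact (LinearMap.congr_fun hψ x).symm
  rw [h1, ← Ext.mk₀_comp_mk₀_assoc]
  exact hs'.shortExact.extClass_comp_assoc _

/-- Rees' theorem: vanishing of `Ext` descends to the quotient by a regular element. -/
theorem ev_rees_down [IsNoetherianRing B] [Module.Finite B X]
    (hAB : SES (LinearMap.lsmul A A y) (Algebra.linearMap A B)) (i : ℕ)
    (h : EV A X A (i + 1)) : EV B X B i := by
  match i with
  | 0 =>
    have h1 : EV A X B 0 := hAB.ev_cov3
      (hom_subsingleton_of_smul hAB fun x => smul_eq_zero_of_ses hAB x) h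
    rw [ev_zero_iff] at h1 ⊢
    refine subsingleton_of_forall_eq 0 fun φ => LinearMap.ext fun x => ?_
    exact LinearMap.congr_fun (h1.elim (φ.restrictScalars A) 0) x
  | i + 1 =>
    induction i generalizing X with
    | zero =>
      obtain ⟨n, π, hπ⟩ := Module.Finite.exists_fin' B X
      exact ev_one_of_ev_two hAB (ses_ker π hπ) h
    | succ i ih =>
      obtain ⟨n, π, hπ⟩ := Module.Finite.exists_fin' B X
      have hs := ses_ker π hπ
      exact hs.ev_con3 (ih ((ses_restrictScalars (A := A) hs).ev_con1
        (ev_quotient_ring hAB i n) h)) (ev_of_projective _)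

theorem ev_rees_up [IsNoetherianRing B] [Module.Finite B X]
    (hAB : SES (LinearMap.lsmul A A y) (Algebra.linearMap A B)) (i : ℕ)
    (h : EV B X B (i + 1)) : EV A X A (i + 2) := by
  induction i generalizing X with
  | zero =>
    obtain ⟨n, π, hπ⟩ := Module.Finite.exists_fin' B X
    exact ev_two_of_ev_one hAB (ses_ker π hπ) h
  | succ i ih =>
    obtain ⟨n, π, hπ⟩ := Module.Finite.exists_fin' B X
    have hs := ses_ker π hπ
    exact (ses_restrictScalars (A := A) hs).ev_con3
      (ih (hs.ev_con1 (ev_of_projective _) h)) (ev_quotient_ring hAB (i + 1) n)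

end Rees

end Quotient

set_option linter.unusedSectionVars false

/-! ### Totally reflexive-type classes and their behaviour modulo a regular element -/

section Universal

variable {A : Type u} [CommRing A] [IsNoetherianRing A]
variable {N : Type u} [AddCommGroup N] [Module A N]

theorem exists_universal_map (N : Type u) [AddCommGroup N] [Module A N] [Module.Finite A N] :
    ∃ (m : ℕ) (β : N →ₗ[A] (Fin m → A)), ∀ φ : N →ₗ[A] A, ∃ ψ : (Fin m → A) →ₗ[A] A,
      ψ ∘ₗ β = φ := by
  obtain ⟨n, π, hπ⟩ := Module.Finite.exists_fin' A N
  have hj : Function.Injective ((LinearMap.lcomp A A π)) := fun a b h =>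
    LinearMap.ext fun x => by
      obtain ⟨x, rfl⟩ := hπ x
      exact LinearMap.congr_fun h x
  have : IsNoetherian A (N →ₗ[A] A) := isNoetherian_of_injective _ hj
  obtain ⟨m, ρ, hρ⟩ := Module.Finite.exists_fin' A (N →ₗ[A] A)
  refine ⟨m, LinearMap.pi fun i => ρ (Pi.single i 1), fun φ => ?_⟩
  obtain ⟨c, rfl⟩ := hρ φ
  refine ⟨Fintype.linearCombination A c, LinearMap.ext fun x => ?_⟩
  have hc : c = ∑ i, c i • Pi.single i (1 : A) := by
    ext j
    simp [Finset.sum_apply, Pi.single_apply]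
  conv_rhs => rw [hc]
  simp [Fintype.linearCombination_apply, mul_comm]

theorem exists_pi_comp_eq {m n : ℕ} {β : N →ₗ[A] (Fin m → A)}
    (hβ : ∀ φ : N →ₗ[A] A, ∃ ψ : (Fin m → A) →ₗ[A] A, ψ ∘ₗ β = φ) (φ : N →ₗ[A] (Fin n → A)) :
    ∃ ψ : (Fin m → A) →ₗ[A] (Fin n → A), ψ ∘ₗ β = φ := by
  choose ψ hψ using fun i => hβ (LinearMap.proj i ∘ₗ φ)
  exact ⟨LinearMap.pi ψ, LinearMap.ext fun x => funext fun i => LinearMap.congr_fun (hψ i) x⟩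

theorem EmbedsFree.injective_of_universal (h : EmbedsFree A N) {m : ℕ} {β : N →ₗ[A] (Fin m → A)}
    (hβ : ∀ φ : N →ₗ[A] A, ∃ ψ : (Fin m → A) →ₗ[A] A, ψ ∘ₗ β = φ) : Function.Injective β := by
  obtain ⟨n, j, hj⟩ := h
  obtain ⟨ψ, hψ⟩ := exists_pi_comp_eq hβ j
  refine Function.Injective.of_comp (f := ψ) ?_
  rwa [← LinearMap.coe_comp, hψ]

theorem EmbedsFree.of_prod {n m : ℕ} {j : N →ₗ[A] ((Fin n → A) × (Fin m → A))}
    (hj : Function.Injective j) : EmbedsFree A N :=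
  ⟨n + m, ((LinearEquiv.funCongrLeft A A finSumFinEquiv.symm).toLinearMap ∘ₗ
    (LinearEquiv.sumArrowLequivProdArrow (Fin n) (Fin m) A A).symm.toLinearMap) ∘ₗ j, by
    simpa using hj⟩

end Universal

section TotClass

variable {R A E : Type u} [CommRing R] [CommRing A] [Algebra R A] [AddCommGroup E] [Module A E]
  [Module R E] [IsScalarTower R A E] [IsLocalRing R] [IsNoetherianRing R]

theorem PhiFin.pi_fin {I : Ideal R} (h : PhiFin R (I : Set R) E) (n : ℕ) :
    PhiFin R (I : Set R) (Fin n → E) := by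
  induction n with
  | zero => exact ⟨0, leftC_of_subsingleton⟩
  | succ n ih =>
    exact (ses_prod.phiFin_mid h ih).congr (Fin.consLinearEquiv R (fun _ : Fin (n + 1) => E))

theorem PhiFin.dual_pi {I : Ideal R} (h : PhiFin R (I : Set R) E) (n : ℕ) :
    PhiFin R (I : Set R) ((Fin n → A) →ₗ[A] E) :=
  (h.pi_fin n).congr (dualPiEquiv R E n).symm

variable (R A E) in
/-- The class of finite modules without self-extensions against `A` whose dual has finite
dimension. -/
structure TotC (N : Type u) [AddCommGroup N] [Module A N] : Prop where
  finite : Module.Finite A N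
  phi : PhiFin R (maximalIdeal R : Set R) (N →ₗ[A] E)
  ev : ∀ i, EV A N A (i + 1)

variable {N N₁ L : Type u} [AddCommGroup N] [Module A N] [AddCommGroup N₁] [Module A N₁]
  [AddCommGroup L] [Module A L]

theorem TotC.syzygy [IsNoetherianRing A] (hE : Module.Injective A E)
    (hφ : PhiFin R (maximalIdeal R : Set R) E) {n : ℕ} {f : N₁ →ₗ[A] (Fin n → A)}
    {g : (Fin n → A) →ₗ[A] N} (hs : SES f g) (h : TotC R A E N) : TotC R A E N₁ :=
  ⟨Module.Finite.of_injective f hs.inj, (hs.dual R hE).phiFin_right h.phi (hφ.dual_pi n),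
    fun i => hs.ev_con1 (ev_of_projective i) (h.ev (i + 1))⟩

theorem TotC.cosyzygy (hE : Module.Injective A E)
    (hφ : PhiFin R (maximalIdeal R : Set R) E) {n : ℕ} {f : N →ₗ[A] (Fin n → A)}
    {g : (Fin n → A) →ₗ[A] L} (hs : SES f g) (h : TotC R A E N)
    (hf : ∀ φ : N →ₗ[A] A, ∃ ψ : (Fin n → A) →ₗ[A] A, ψ ∘ₗ f = φ) : TotC R A E L := by
  refine ⟨Module.Finite.of_surjective g hs.surj, (hs.dual R hE).phiFin_left (hφ.dual_pi n) h.phi,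
    fun i => ?_⟩
  cases i with
  | zero => exact hs.ev1_of_extend hf (ev_of_projective 0)
  | succ i => exact hs.ev_con3 (h.ev i) (ev_of_projective _)

theorem TotC.exists_cosyzygy [IsNoetherianRing A] (hE : Module.Injective A E)
    (hφ : PhiFin R (maximalIdeal R : Set R) E) (h : TotC R A E N) (hN : EmbedsFree A N) :
    ∃ (m : ℕ) (L : Type u) (_ : AddCommGroup L) (_ : Module A L) (f : N →ₗ[A] (Fin m → A))
      (g : (Fin m → A) →ₗ[A] L), SES f g ∧ TotC R A E L ∧
      ∀ φ : N →ₗ[A] A, ∃ ψ : (Fin m → A) →ₗ[A] A, ψ ∘ₗ f = φ := by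
  have := h.finite
  obtain ⟨m, β, hβ⟩ := exists_universal_map (A := A) N
  have hs := ses_range β (hN.injective_of_universal hβ)
  exact ⟨m, _, _, _, β, _, hs, h.cosyzygy hE hφ hs hβ, hβ⟩

theorem GammaC.embedsFree (hΓ : GammaC R A E) (h : TotC R A E N) : EmbedsFree A N :=
  have := h.finite
  hΓ N h.phi h.ev

end TotClass

section ChangeOfRings

variable {R A B E F : Type u} [CommRing R] [CommRing A] [CommRing B] [Algebra R A] [Algebra R B]
  [Algebra A B] [AddCommGroup E] [Module A E] [Module R E] [IsScalarTower R A E]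
  [AddCommGroup F] [Module A F] [Module B F] [Module R F] [IsScalarTower A B F]
  [IsScalarTower R A F] [IsScalarTower R B F] {y : A}
variable {j : F →ₗ[A] E}
variable {X : Type u} [AddCommGroup X] [Module A X] [Module B X] [IsScalarTower A B X]

theorem exists_dual_equiv (hAB : SES (LinearMap.lsmul A A y) (Algebra.linearMap A B))
    (hEF : SES j (LinearMap.lsmul A E y)) : Nonempty ((X →ₗ[B] F) ≃ₗ[R] (X →ₗ[A] E)) := by
  let T : (X →ₗ[B] F) →ₗ[R] (X →ₗ[A] E) :=
    { toFun := fun φ => j ∘ₗ φ.restrictScalars A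
      map_add' := fun _ _ => by ext; simp
      map_smul' := fun r φ => by
        ext x
        show j (r • φ x) = r • j (φ x)
        rw [← algebraMap_smul A r (φ x), map_smul, algebraMap_smul] }
  refine ⟨LinearEquiv.ofBijective T ⟨fun φ ψ h => ?_, fun φ => ?_⟩⟩
  · ext x
    exact hEF.inj (LinearMap.congr_fun h x)
  · have h : ∀ x, ∃ z, j z = φ x := fun x => hEF.exists_of_apply_eq_zero (by
      rw [LinearMap.lsmul_apply, ← map_smul, smul_eq_zero_of_ses hAB x, map_zero])
    choose ψ hψ using h
    let ψ' : X →ₗ[A] F :=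
      { toFun := ψ
        map_add' := fun a b => hEF.inj (by simp only [map_add, hψ])
        map_smul' := fun a b => hEF.inj (by simp only [map_smul, hψ, RingHom.id_apply]) }
    exact ⟨ψ'.extendScalarsOfSurjective hAB.surj, LinearMap.ext hψ⟩

variable [IsLocalRing R] [IsNoetherianRing R] [IsNoetherianRing A]
variable {N L : Type u} [AddCommGroup N] [Module A N] [AddCommGroup L] [Module A L]

theorem TotC.exists_cosyzygy_of_quotient (hE : Module.Injective A E)
    (hφ : PhiFin R (maximalIdeal R : Set R) E)
    (hAB : SES (LinearMap.lsmul A A y) (Algebra.linearMap A B))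
    (hEF : SES j (LinearMap.lsmul A E y)) (hy : y ∈ (⊥ : Ideal A).jacobson)
    (hΓ : GammaC R B F) (h : TotC R A E N) (hN : ∀ x : N, y • x = 0 → x = 0) :
    ∃ (m : ℕ) (L : Type u) (_ : AddCommGroup L) (_ : Module A L) (f : N →ₗ[A] (Fin m → A))
      (g : (Fin m → A) →ₗ[A] L), SES f g ∧ TotC R A E L ∧ (∀ x : L, y • x = 0 → x = 0) ∧
      ∀ φ : N →ₗ[A] A, ∃ ψ : (Fin m → A) →ₗ[A] A, ψ ∘ₗ f = φ := by
  have := h.finite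
  have hs := ses_one_tmul (B := B) hAB hN
  obtain ⟨e⟩ := exists_dual_equiv (R := R) (X := B ⊗[A] N) hAB hEF
  obtain ⟨k, i, hi⟩ := hΓ (B ⊗[A] N)
    (((hs.dual R hE).phiFin_left h.phi h.phi).congr e.symm)
    fun i => ev_quotient_of_ev hAB hN i (hAB.ev_cov3 (h.ev i) (h.ev (i + 1)))
  obtain ⟨m, β, hβ⟩ := exists_universal_map (A := A) N
  have key : ∀ (x : N) (w : Fin m → A), β x = y • w → ∃ x', y • x' = x := by
    intro x w hw
    refine (one_tmul_eq_zero_iff (B := B) hAB x).1 (hi ?_)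
    rw [map_zero]
    ext c
    obtain ⟨φ, hφ'⟩ := hAB.lift (h.ev 0) ((LinearMap.proj c ∘ₗ i).restrictScalars A ∘ₗ
      TensorProduct.mk A B N 1)
    obtain ⟨ψ, rfl⟩ := hβ φ
    have h1 := LinearMap.congr_fun hφ' x
    simp only [LinearMap.comp_apply, hw, map_smul] at h1
    rw [smul_eq_zero_of_ses hAB] at h1
    exact h1.symm
  have hinj : Function.Injective β := by
    rw [← LinearMap.ker_eq_bot]
    refine Submodule.eq_bot_of_le_smul_of_le_jacobson_bot (Ideal.span {y}) _
      (IsNoetherian.noetherian _) (fun x hx => ?_) ((Ideal.span_singleton_le_iff_mem _).2 hy)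
    obtain ⟨x', rfl⟩ := key x 0 (by rw [smul_zero]; exact hx)
    refine Submodule.smul_mem_smul (Ideal.mem_span_singleton_self y) ?_
    rw [LinearMap.mem_ker, map_smul] at hx
    exact funext fun c => hAB.inj (by simpa using congrFun hx c)
  have hs' := ses_range β hinj
  refine ⟨m, _, _, _, β, _, hs', h.cosyzygy hE hφ hs' hβ, fun x hx => ?_, hβ⟩
  obtain ⟨w, rfl⟩ := hs'.surj x
  rw [← map_smul] at hx
  obtain ⟨x, hx⟩ := hs'.exists_of_apply_eq_zero hx
  obtain ⟨x, rfl⟩ := key x w hx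
  have : β x = w := funext fun c => hAB.inj (by
    rw [map_smul] at hx
    simpa using congrFun hx c)
  rw [← this, hs'.apply_apply]

/-- Ascent of the embedding property along the quotient by a regular element. -/
theorem GammaC.of_quotient (hE : Module.Injective A E)
    (hφ : PhiFin R (maximalIdeal R : Set R) E)
    (hAB : SES (LinearMap.lsmul A A y) (Algebra.linearMap A B))
    (hEF : SES j (LinearMap.lsmul A E y)) (hy : y ∈ (⊥ : Ideal A).jacobson)
    (hΓ : GammaC R B F) : GammaC R A E := by
  intro N _ _ _ h1 h2
  have h : TotC R A E N := ⟨inferInstance, h1, h2⟩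
  obtain ⟨n, π, hπ⟩ := Module.Finite.exists_fin' A N
  have hs := ses_ker π hπ
  obtain ⟨m, L, _, _, β, ρ, hβ, hL, hLy, hu⟩ :=
    (h.syzygy hE hφ hs).exists_cosyzygy_of_quotient hE hφ hAB hEF hy hΓ fun x hx =>
      Subtype.ext (funext fun k => hAB.inj (by
        have := congrFun (congrArg Subtype.val hx) k
        simpa using this))
  obtain ⟨m', L', _, _, β', ρ', hβ', -, -, -⟩ :=
    hL.exists_cosyzygy_of_quotient hE hφ hAB hEF hy hΓ hLy
  obtain ⟨γ, hγ⟩ := hs.extend ((h.ev 0).pi_fin_right m) β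
  obtain ⟨α, hα⟩ := exists_pi_comp_eq hu (LinearMap.ker π).subtype
  let T : (Fin n → A) →ₗ[A] ((Fin n → A) × (Fin m' → A)) :=
    (LinearMap.id - α ∘ₗ γ).prod (β' ∘ₗ ρ ∘ₗ γ)
  have hT : LinearMap.ker T = LinearMap.ker π := by
    ext x
    constructor
    · intro hx
      have hx1 : x - α (γ x) = 0 := congrArg Prod.fst hx
      have hx2 : β' (ρ (γ x)) = 0 := congrArg Prod.snd hx
      obtain ⟨z, hz⟩ := hβ.exists_of_apply_eq_zero ((map_eq_zero_iff β' hβ'.inj).1 hx2)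
      rw [← hz, ← LinearMap.comp_apply, hα] at hx1
      rw [sub_eq_zero.1 hx1]
      exact z.2
    · intro hx
      have h3 : γ x = β ⟨x, hx⟩ := LinearMap.congr_fun hγ ⟨x, hx⟩
      have h4 : α (β ⟨x, hx⟩) = x := LinearMap.congr_fun hα ⟨x, hx⟩
      refine Prod.ext ?_ ?_
      · show x - α (γ x) = 0
        rw [h3, h4, sub_self]
      · show β' (ρ (γ x)) = 0
        rw [h3, hβ.apply_apply, map_zero]
  refine EmbedsFree.of_prod (j := (LinearMap.ker π).liftQ T hT.ge ∘ₗ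
    (π.quotKerEquivOfSurjective hπ).symm.toLinearMap) ?_
  rw [LinearMap.coe_comp]
  refine Function.Injective.comp ?_ (LinearEquiv.injective _)
  rw [← LinearMap.ker_eq_bot]
  exact Submodule.ker_liftQ_eq_bot _ _ _ hT.le

/-- Descent of the embedding property to the quotient by a regular element. -/
theorem GammaC.quotient [IsNoetherianRing B] (hE : Module.Injective A E)
    (hφ : PhiFin R (maximalIdeal R : Set R) E)
    (hAB : SES (LinearMap.lsmul A A y) (Algebra.linearMap A B))
    (hEF : SES j (LinearMap.lsmul A E y)) (hΓ : GammaC R A E) : GammaC R B F := by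
  intro N _ _ _ h1 h2
  let _ : Module A N := Module.compHom N (algebraMap A B)
  have : IsScalarTower A B N := ⟨fun a b x => by
    rw [Algebra.smul_def, mul_smul]
    rfl⟩
  have hfin : Module.Finite A B := Module.Finite.of_surjective (Algebra.linearMap A B) hAB.surj
  have : Module.Finite A N := Module.Finite.trans B N
  obtain ⟨n, π, hπ⟩ := Module.Finite.exists_fin' A N
  have hs := ses_ker π hπ
  obtain ⟨e⟩ := exists_dual_equiv (R := R) (X := N) hAB hEF
  have h : TotC R A E (LinearMap.ker π) := ⟨inferInstance,
    (hs.dual R hE).phiFin_right (h1.congr e) (hφ.dual_pi n),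
    fun i => hs.ev_con1 (ev_of_projective i) (ev_rees_up hAB i (h2 i))⟩
  obtain ⟨m, L, _, _, β, ρ, hβ, hL, -⟩ := h.exists_cosyzygy hE hφ (hΓ.embedsFree h)
  obtain ⟨k, i, hi⟩ := hΓ.embedsFree hL
  let q : (Fin m → A) →ₗ[A] (Fin m → B) := (Algebra.linearMap A B).compLeft (Fin m)
  have hx : ∀ v, y • v ∈ LinearMap.ker π := fun v => by
    rw [LinearMap.mem_ker, map_smul, smul_eq_zero_of_ses hAB]
  let T : (Fin n → A) →ₗ[A] (Fin m → B) :=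
    q ∘ₗ β ∘ₗ (LinearMap.lsmul A (Fin n → A) y).codRestrict _ hx
  have hT : LinearMap.ker T = LinearMap.ker π := by
    ext v
    constructor
    · intro hv
      have hv' : ∀ c, algebraMap A B (β ⟨y • v, hx v⟩ c) = 0 := fun c => congrFun hv c
      choose w hw using fun c => hAB.exists_of_apply_eq_zero (hv' c)
      have hw' : β ⟨y • v, hx v⟩ = y • w := funext fun c => (hw c).symm
      have h3 : ρ w = 0 := hi (by
        rw [map_zero]
        ext c
        refine hAB.inj ?_
        rw [Pi.zero_apply, map_zero, LinearMap.lsmul_apply, ← Pi.smul_apply, ← map_smul,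
          ← map_smul, ← hw', hβ.apply_apply, map_zero, Pi.zero_apply])
      obtain ⟨z, rfl⟩ := hβ.exists_of_apply_eq_zero h3
      rw [← map_smul] at hw'
      have h4 : y • v = y • z.1 := congrArg Subtype.val (hβ.inj hw')
      have h5 : v = z.1 := funext fun c => hAB.inj (congrFun h4 c)
      rw [h5]
      exact z.2
    · intro hv
      have h3 : β ⟨y • v, hx v⟩ = y • β ⟨v, hv⟩ := by
        rw [← map_smul]
        rfl
      show q (β ⟨y • v, hx v⟩) = 0
      rw [h3, map_smul, smul_eq_zero_of_ses hAB]
  let i' := (LinearMap.ker π).liftQ T hT.ge ∘ₗ (π.quotKerEquivOfSurjective hπ).symm.toLinearMap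
  refine ⟨m, i'.extendScalarsOfSurjective hAB.surj, ?_⟩
  show Function.Injective i'
  rw [LinearMap.coe_comp]
  refine Function.Injective.comp ?_ (LinearEquiv.injective _)
  rw [← LinearMap.ker_eq_bot]
  exact Submodule.ker_liftQ_eq_bot _ _ _ hT.le

end ChangeOfRings

/-! ### The quotient of a complete local ring by a regular element -/

section LocalQuotient

theorem isAdicComplete_of_surjective {A B : Type u} [CommRing A] [IsLocalRing A]
    [IsAdicComplete (maximalIdeal A) A] [CommRing B] [IsLocalRing B] [IsNoetherianRing B]
    (π : A →+* B) (hπ : Function.Surjective π) : IsAdicComplete (maximalIdeal B) B := by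
  have hmap : ∀ n : ℕ, maximalIdeal B ^ n = (maximalIdeal A ^ n).map π := fun n => by
    rw [Ideal.map_pow, map_maximalIdeal_of_surjective π hπ]
  have h1 : IsHausdorff (maximalIdeal B) B := inferInstance
  have h2 : IsPrecomplete (maximalIdeal B) B := by
    refine ⟨fun f hf => ?_⟩
    have hstep : ∀ n, ∃ a ∈ maximalIdeal A ^ n, π a = f (n + 1) - f n := fun n => by
      have := hf (Nat.le_succ n)
      rw [SModEq.sub_mem, smul_eq_mul, Ideal.mul_top, hmap] at this
      obtain ⟨a, ha, ha'⟩ := (Ideal.mem_map_iff_of_surjective π hπ).1 this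
      exact ⟨-a, neg_mem ha, by rw [map_neg, ha']; ring⟩
    choose a ha ha' using hstep
    obtain ⟨a₀, ha₀⟩ := hπ (f 0)
    let g : ℕ → A := fun n => a₀ + ∑ i ∈ Finset.range n, a i
    have hg : ∀ n, π (g n) = f n := fun n => by
      induction n with
      | zero => simp [g, ha₀]
      | succ n ih =>
        have : g (n + 1) = g n + a n := by simp [g, Finset.sum_range_succ, add_assoc]
        rw [this, map_add, ih, ha']
        ring
    have hg' : ∀ {m n}, m ≤ n → g m ≡ g n [SMOD (maximalIdeal A ^ m • ⊤ : Submodule A A)] := by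
      intro m n hmn
      rw [SModEq.comm, SModEq.sub_mem, smul_eq_mul, Ideal.mul_top]
      induction n, hmn using Nat.le_induction with
      | base => simp
      | succ n hmn ih =>
        have : g (n + 1) - g m = (g n - g m) + a n := by
          simp only [g, Finset.sum_range_succ]
          ring
        rw [this]
        exact add_mem ih (Ideal.pow_le_pow_right hmn (ha n))
    obtain ⟨L, hL⟩ := IsPrecomplete.prec inferInstance hg'
    refine ⟨π L, fun n => ?_⟩
    have := hL n
    rw [SModEq.sub_mem, smul_eq_mul, Ideal.mul_top] at this ⊢
    rw [hmap, ← hg, ← map_sub]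
    exact Ideal.mem_map_of_mem π this
  exact { h1, h2 with }

variable {A : Type u} [CommRing A] [IsLocalRing A] {y : A}

theorem isLocalRing_quotient (hy : y ∈ maximalIdeal A) : IsLocalRing (A ⧸ Ideal.span {y}) :=
  have : Nontrivial (A ⧸ Ideal.span {y}) := Ideal.Quotient.nontrivial_iff.2 fun h =>
    (maximalIdeal.isMaximal A).ne_top (top_le_iff.1 (h ▸ (Ideal.span_singleton_le_iff_mem _).2 hy))
  IsLocalRing.of_surjective' (Ideal.Quotient.mk _) Ideal.Quotient.mk_surjective

theorem ses_quotient {A : Type u} [CommRing A] {y : A} (hy : ∀ a, y * a = 0 → a = 0) :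
    SES (LinearMap.lsmul A A y) (Algebra.linearMap A (A ⧸ Ideal.span {y})) := by
  refine ⟨(injective_iff_map_eq_zero _).2 hy, Ideal.Quotient.mk_surjective, fun x => ?_⟩
  show Ideal.Quotient.mk _ x = 0 ↔ _
  rw [Ideal.Quotient.eq_zero_iff_mem, Ideal.mem_span_singleton']
  simp [mul_comm]

theorem mem_jacobson_bot (hy : y ∈ maximalIdeal A) : y ∈ (⊥ : Ideal A).jacobson := by
  rwa [jacobson_eq_maximalIdeal _ bot_ne_top]

variable {E : Type u} [AddCommGroup E] [Module A E]

theorem ses_torsionBy (hy : ∀ a, y * a = 0 → a = 0) (hE : Module.Injective A E) :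
    SES (Submodule.torsionBy A E y).subtype (LinearMap.lsmul A E y) := by
  refine ⟨Subtype.val_injective, fun e => ?_, fun e => ?_⟩
  · obtain ⟨φ, hφ⟩ := hE.out (LinearMap.lsmul A A y) (ses_quotient hy).inj
      (LinearMap.toSpanSingleton A E e)
    refine ⟨φ 1, ?_⟩
    have := hφ 1
    rw [LinearMap.toSpanSingleton_apply, one_smul] at this
    rw [← this, LinearMap.lsmul_apply, LinearMap.lsmul_apply, map_smul]
  · simp [Submodule.mem_torsionBy_iff]

theorem IsMatlis.torsionBy {e₀ : E} [IsLocalRing (A ⧸ Ideal.span {y})] (hE : IsMatlis A E e₀)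
    (hy : y ∈ maximalIdeal A) :
    IsMatlis (A ⧸ Ideal.span {y}) (Submodule.torsionBy A E y)
      ⟨e₀, hE.smul_eq_zero y hy⟩ := by
  have hmap := map_maximalIdeal_of_surjective (Ideal.Quotient.mk (Ideal.span {y}))
    Ideal.Quotient.mk_surjective
  refine ⟨⟨fun X Y _ _ _ _ f hf g => ?_⟩, ?_, ?_, ?_, ?_⟩
  · let _ : Module A X := Module.compHom X (Ideal.Quotient.mk (Ideal.span {y}))
    let _ : Module A Y := Module.compHom Y (Ideal.Quotient.mk (Ideal.span {y}))
    let f' : X →ₗ[A] Y := { f with map_smul' := fun a x => f.map_smul (Ideal.Quotient.mk _ a) x }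
    let g' : X →ₗ[A] E :=
      { toFun := fun x => (g x : E)
        map_add' := by simp
        map_smul' := fun a x => congrArg Subtype.val (g.map_smul (Ideal.Quotient.mk _ a) x) }
    obtain ⟨k, hk⟩ := hE.inj.out f' hf g'
    have hky : ∀ z, k z ∈ Submodule.torsionBy A E y := fun z => by
      rw [Submodule.mem_torsionBy_iff, ← map_smul]
      have : y • z = (Ideal.Quotient.mk (Ideal.span {y}) y) • z := rfl
      rw [this, Ideal.Quotient.eq_zero_iff_mem.2 (Ideal.mem_span_singleton_self y), zero_smul,
        map_zero]
    refine ⟨{ toFun := fun z => ⟨k z, hky z⟩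
              map_add' := fun a b => Subtype.ext (map_add k a b)
              map_smul' := fun a z => ?_ }, fun x => Subtype.ext (hk x)⟩
    obtain ⟨a, rfl⟩ := Ideal.Quotient.mk_surjective a
    exact Subtype.ext (map_smul k a z)
  · intro a ha x
    rw [SetLike.mem_coe, ← hmap] at ha
    obtain ⟨a, ha', rfl⟩ := (Ideal.mem_map_iff_of_surjective _ Ideal.Quotient.mk_surjective).1 ha
    obtain ⟨n, hn⟩ := hE.tors a ha' (x : E)
    exact ⟨n, by rw [← map_pow]; exact Subtype.ext hn⟩
  · exact fun h => hE.ne_zero (congrArg Subtype.val h)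
  · intro a ha
    rw [← hmap] at ha
    obtain ⟨a, ha', rfl⟩ := (Ideal.mem_map_iff_of_surjective _ Ideal.Quotient.mk_surjective).1 ha
    exact Subtype.ext (hE.smul_eq_zero a ha')
  · intro x hx
    obtain ⟨a, ha⟩ := Submodule.mem_span_singleton.1
      (hE.ess x fun h => hx (Subtype.ext h))
    exact Submodule.mem_span_singleton.2 ⟨Ideal.Quotient.mk _ a, Subtype.ext ha⟩

end LocalQuotient

/-! ### Towers -/

section Tower

/-- `A` is flat over `R`, and successive quotients by `n` regular elements outside the square
of the maximal ideal produce a flat `R`-algebra whose maximal ideal is extended from `R`. -/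
def FlatTower (R : Type u) [CommRing R] [IsLocalRing R] :
    ℕ → (A : Type u) → [CommRing A] → [Algebra R A] → Prop
  | 0, A, _, _ => Module.Flat R A ∧ ∃ _ : IsLocalRing A,
      maximalIdeal A = (maximalIdeal R).map (algebraMap R A)
  | n + 1, A, _, _ => Module.Flat R A ∧ ∃ _ : IsLocalRing A, ∃ y ∈ maximalIdeal A,
      y ∉ maximalIdeal A ^ 2 ∧ (∀ a, y * a = 0 → a = 0) ∧ FlatTower R n (A ⧸ Ideal.span {y})

variable {R A E : Type u} [CommRing R] [IsLocalRing R] [IsNoetherianRing R] [CommRing A]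
  [Algebra R A] [AddCommGroup E] [Module A E] [Module R E] [IsScalarTower R A E]
  {e₀ : E} {n : ℕ}

theorem FlatTower.flat (h : FlatTower R n A) : Module.Flat R A := by
  cases n with
  | zero => exact h.1
  | succ n => exact h.1

theorem FlatTower.map_le [IsLocalRing A] (h : FlatTower R n A) :
    (maximalIdeal R).map (algebraMap R A) ≤ maximalIdeal A := by
  induction n generalizing A with
  | zero => exact h.2.2.ge
  | succ n ih =>
    obtain ⟨-, _, y, hy, -, -, hB⟩ := h
    have := isLocalRing_quotient hy
    have h1 := ih hB
    rw [Ideal.map_le_iff_le_comap] at h1 ⊢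
    intro r hr
    have h2 := h1 hr
    rw [Ideal.mem_comap, mem_maximalIdeal, mem_nonunits_iff] at h2 ⊢
    exact fun hu => h2 (hu.map (Ideal.Quotient.mk (Ideal.span {y})))

variable [IsLocalRing A] [IsNoetherianRing A]

theorem IsMatlis.injTors_restrict [Module.Flat R A]
    (hle : (maximalIdeal R).map (algebraMap R A) ≤ maximalIdeal A)
    (hE : IsMatlis A E e₀) : InjTors R (maximalIdeal R : Set R) E := by
  refine ⟨hE.inj.restrict_of_flat R, fun r hr x => ?_⟩
  obtain ⟨n, hn⟩ := hE.tors (algebraMap R A r) (hle (Ideal.mem_map_of_mem _ hr)) x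
  exact ⟨n, by rw [← hn, ← map_pow, algebraMap_smul]⟩

theorem FlatTower.phiFin (h : FlatTower R n A) (hE : IsMatlis A E e₀) :
    PhiFin R (maximalIdeal R : Set R) E :=
  have := h.flat
  ⟨0, (hE.injTors_restrict h.map_le).leftC⟩

theorem FlatTower.gammaC (h : FlatTower R n A) (hE : IsMatlis A E e₀) : GammaC R A E := by
  have hφ := h.phiFin hE
  induction n generalizing A E with
  | zero =>
    have := h.1
    exact gammaC_of_unramified h.2.2 hE
  | succ n ih =>
    obtain ⟨-, _, y, hy, -, hreg, hB⟩ := h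
    have := isLocalRing_quotient hy
    exact GammaC.of_quotient hE.inj hφ (ses_quotient hreg) (ses_torsionBy hreg hE.inj)
      (mem_jacobson_bot hy) (ih hB (hE.torsionBy hy) (hB.phiFin (hE.torsionBy hy)))

end Tower

/-! ### Vanishing of extensions against the ring -/

section ExtBound

variable {R P A E Q N : Type u} [CommRing R] [IsLocalRing R] [IsNoetherianRing R]
  [CommRing P] [IsLocalRing P] [IsNoetherianRing P] [Algebra R P]
  [CommRing A] [Algebra R A] [Algebra P A]
  [AddCommGroup E] [Module A E] [Module R E] [Module P E] [IsScalarTower R A E]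
  [IsScalarTower R P E] [IsScalarTower P A E]
  [AddCommGroup Q] [Module R Q] [AddCommGroup N] [Module P N] [Module.Finite P N]
  {e₀ : E} {q₀ : Q}

theorem exists_retract_of_unramified [IsLocalRing A] [IsNoetherianRing A] [Module.Flat R A]
    [IsAdicComplete (maximalIdeal A) A]
    (hm : maximalIdeal A = (maximalIdeal R).map (algebraMap R A)) (hE : IsMatlis A E e₀)
    (hQ : IsMatlis R Q q₀) :
    ∃ (i : A →ₗ[A] (Q →ₗ[R] E)) (r : (Q →ₗ[R] E) →ₗ[A] A), r ∘ₗ i = LinearMap.id := by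
  have hinj : Module.Injective A (A ⊗[R] Q) := InjTors.baseChange hm ⟨hQ.inj, hQ.tors⟩
  have hloc : IsLocalHom (algebraMap R A) :=
    ((local_hom_TFAE (algebraMap R A)).out 0 2).2 hm.ge
  have hff : Module.FaithfullyFlat R A := Module.FaithfullyFlat.of_flat_of_isLocalHom
  have h0 : (1 : A) ⊗ₜ[R] q₀ ≠ 0 := fun h => hQ.ne_zero
    (Module.FaithfullyFlat.tensorProduct_mk_injective (A := R) (B := A) Q (by simpa using h))
  obtain ⟨s, hs⟩ := hinj.exists_comp_eq (LinearMap.toSpanSingleton A E e₀)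
    (LinearMap.toSpanSingleton A (A ⊗[R] Q) (1 ⊗ₜ q₀)) (by
      intro r hr
      have hr' : r ∈ maximalIdeal A := (mem_maximalIdeal r).2 fun h => hE.ne_zero
        (h.smul_eq_zero.1 (by simpa using hr))
      rw [hm] at hr'
      have hle : (maximalIdeal R).map (algebraMap R A) ≤
          LinearMap.ker (LinearMap.toSpanSingleton A (A ⊗[R] Q) (1 ⊗ₜ q₀)) := by
        refine Ideal.span_le.2 ?_
        rintro _ ⟨a, ha, rfl⟩
        rw [SetLike.mem_coe, LinearMap.mem_ker, LinearMap.toSpanSingleton_apply, algebraMap_smul,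
          ← TensorProduct.tmul_smul, hQ.smul_eq_zero a ha, TensorProduct.tmul_zero]
      exact hle hr')
  have hs0 : s e₀ = 1 ⊗ₜ q₀ := by simpa using LinearMap.congr_fun hs 1
  have hsinj : Function.Injective s := by
    refine (injective_iff_map_eq_zero s).2 fun x hx => ?_
    by_contra hx0
    obtain ⟨a, ha⟩ := Submodule.mem_span_singleton.1 (hE.ess x hx0)
    exact h0 (by rw [← hs0, ← ha, map_smul, hx, smul_zero])
  obtain ⟨p, hp⟩ := hE.inj.out s hsinj LinearMap.id
  obtain ⟨e⟩ := hE.exists_end_equiv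
  refine ⟨((LinearMap.liftBaseChangeEquiv A).symm.toLinearMap ∘ₗ LinearMap.lcomp A E p) ∘ₗ
    e.toLinearMap, e.symm.toLinearMap ∘ₗ LinearMap.lcomp A E s ∘ₗ
      (LinearMap.liftBaseChangeEquiv A).toLinearMap, LinearMap.ext fun a => ?_⟩
  have : (LinearMap.lcomp A E s) ((LinearMap.lcomp A E p) (e a)) = e a :=
    LinearMap.ext fun x => by simp [LinearMap.lcomp_apply, hp]
  simp only [LinearMap.comp_apply, LinearEquiv.coe_coe, LinearEquiv.apply_symm_apply, this,
    LinearEquiv.symm_apply_apply, LinearMap.id_apply]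

/-- Postcomposition of `R`-linear maps with a linear map over an `R`-algebra `P`. -/
def compHomRight (R : Type u) {P Q M₁ M₂ : Type u} [CommRing R] [CommRing P] [Algebra R P]
    [AddCommGroup Q] [Module R Q] [AddCommGroup M₁] [AddCommGroup M₂]
    [Module P M₁] [Module P M₂] [Module R M₁] [Module R M₂]
    [IsScalarTower R P M₁] [IsScalarTower R P M₂] (f : M₁ →ₗ[P] M₂) :
    (Q →ₗ[R] M₁) →ₗ[P] (Q →ₗ[R] M₂) where
  toFun φ := f.restrictScalars R ∘ₗ φ
  map_add' φ ψ := LinearMap.ext fun x => by simp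
  map_smul' p φ := LinearMap.ext fun x => by simp

theorem ses_hom_right {Q M₁ M₂ M₃ : Type u} [AddCommGroup Q] [Module R Q]
    [AddCommGroup M₁] [AddCommGroup M₂] [AddCommGroup M₃] [Module P M₁] [Module P M₂] [Module P M₃]
    [Module R M₁] [Module R M₂] [Module R M₃] [IsScalarTower R P M₁] [IsScalarTower R P M₂]
    [IsScalarTower R P M₃] {f : M₁ →ₗ[P] M₂} {g : M₂ →ₗ[P] M₃} (h : SES f g)
    (hQ : EV R Q M₁ 1) :
    SES (compHomRight R (Q := Q) f) (compHomRight R (Q := Q) g) := by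
  refine ⟨fun φ ψ hφ => LinearMap.ext fun x => h.inj (LinearMap.congr_fun hφ x), fun φ => ?_,
    fun φ => ⟨fun hφ => ?_, ?_⟩⟩
  · obtain ⟨ψ, hψ⟩ := (ses_restrictScalars (A := R) h).lift hQ φ
    exact ⟨ψ, hψ⟩
  · choose ψ hψ using fun x => (h.exact (φ x)).1 (LinearMap.congr_fun hφ x)
    exact ⟨⟨⟨ψ, fun a b => h.inj (by simp [hψ])⟩, fun a b => h.inj (by
      simp only [hψ, map_smul, RingHom.id_apply]
      rw [LinearMap.map_smul_of_tower, hψ])⟩, LinearMap.ext hψ⟩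
  · rintro ⟨ψ, rfl⟩
    exact LinearMap.ext fun x => (h.exact _).2 ⟨ψ x, rfl⟩

theorem FlatTower.ev_self_of_ev_hom {n : ℕ} [IsNoetherianRing A] [IsLocalRing A]
    [IsAdicComplete (maximalIdeal A) A] [IsScalarTower R P A]
    (hsurj : Function.Surjective (algebraMap P A)) (h : FlatTower R n A) (hE : IsMatlis A E e₀)
    (hQ : IsMatlis R Q q₀) {d : ℕ} (hN : ∀ i, d < i → EV P N (Q →ₗ[R] E) i) :
    ∀ i, d + n < i → EV P N A i := by
  induction n generalizing A E d with
  | zero =>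
    have := h.1
    obtain ⟨s, r, hsr⟩ := exists_retract_of_unramified h.2.2 hE hQ
    intro i hi
    exact (hN i hi).retract_right (s.restrictScalars P) (r.restrictScalars P)
      (LinearMap.ext fun x => LinearMap.congr_fun hsr x)
  | succ n ih =>
    obtain ⟨-, _, y, hy, -, hreg, hB⟩ := h
    have := isLocalRing_quotient hy
    have := isAdicComplete_of_surjective (Ideal.Quotient.mk (Ideal.span {y}))
      Ideal.Quotient.mk_surjective
    have hF := hE.torsionBy hy
    have := hB.flat
    have hFi := hF.inj.restrict_of_flat R
    have hses := ses_restrictScalars (A := P) (ses_torsionBy hreg hE.inj)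
    have hses' := ses_hom_right (R := R) (Q := Q) hses (ev_of_injective 0)
    have hB' := ih (E := Submodule.torsionBy A E y) (A := A ⧸ Ideal.span {y})
      (Ideal.Quotient.mk_surjective.comp hsurj) hB hF (d := d + 1) (fun i hi => by
        obtain ⟨i, rfl⟩ : ∃ j, i = j + 1 := ⟨i - 1, by omega⟩
        exact hses'.ev_cov1 (hN i (by omega)) (hN (i + 1) (by omega)))
    intro i hi
    obtain ⟨y', rfl⟩ := hsurj y
    have : Module.Finite P A := Module.Finite.of_surjective (Algebra.linearMap P A) hsurj
    have hy' : y' ∈ maximalIdeal P := (mem_maximalIdeal y').2 fun hu =>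
      (mem_maximalIdeal _).1 hy (hu.map _)
    have h1 := ses_restrictScalars (A := P) (ses_quotient hreg)
    refine ev_of_nakayama (mem_jacobson_bot hy') (g := (Algebra.linearMap A
      (A ⧸ Ideal.span {algebraMap P A y'})).restrictScalars P) ?_ (hB' i (by omega))
    convert h1 using 1
    ext a
    simp [Algebra.smul_def]

theorem FlatTower.ev_self_of_phi {n : ℕ} [IsAdicComplete (maximalIdeal P) P]
    {E : Type u} {e₀ : E} [AddCommGroup E] [Module P E] [Module R E] [IsScalarTower R P E]
    (h : FlatTower R n P) (hE : IsMatlis P E e₀)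
    {d : ℕ} (hN : Phi R (maximalIdeal R : Set R) d (N →ₗ[P] E)) :
    ∀ i, d + n < i → EV P N P i := by
  obtain ⟨Q, _, _, q₀, hQ⟩ := exists_isMatlis R
  have := h.flat
  refine h.ev_self_of_ev_hom (A := P) Function.surjective_id hE hQ fun i hi => ?_
  obtain ⟨i, rfl⟩ : ∃ j, i = j + 1 := ⟨i - 1, by omega⟩
  exact (ev_swap_iff hE.inj i).1 (hN.ev ⟨hQ.inj, hQ.tors⟩ hi)

end ExtBound

/-! ### Finite projective dimension -/

section PdLE

/-- `PdLE A n X` says that the `A`-module `X` has projective dimension at most `n`, detected by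
vanishing of extensions. -/
def PdLE (A : Type u) [CommRing A] (n : ℕ) (X : Type u) [AddCommGroup X] [Module A X] : Prop :=
  ∀ (Y : Type u) [AddCommGroup Y] [Module A Y] (i : ℕ), n < i → EV A X Y i

variable {A X K F : Type u} [CommRing A] [AddCommGroup X] [Module A X] [AddCommGroup K] [Module A K]
  [AddCommGroup F] [Module A F] {f : K →ₗ[A] F} {g : F →ₗ[A] X} {n : ℕ}

theorem PdLE.syzygy [Module.Projective A F] (h : SES f g) (hX : PdLE A (n + 1) X) :
    PdLE A n K := fun Y _ _ i hi => by
  obtain ⟨i, rfl⟩ : ∃ j, i = j + 1 := ⟨i - 1, by omega⟩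
  exact h.ev_con1 (ev_of_projective i) (hX Y (i + 1 + 1) (by omega))

theorem PdLE.of_syzygy [Module.Projective A F] (h : SES f g) (hK : PdLE A n K) :
    PdLE A (n + 1) X := fun Y _ _ i hi => by
  obtain ⟨i, rfl⟩ : ∃ j, i = j + 1 + 1 := ⟨i - 2, by omega⟩
  exact h.ev_con3 (hK Y (i + 1) (by omega)) (ev_of_projective _)

theorem PdLE.of_projective [Module.Projective A X] : PdLE A n X := fun Y _ _ i hi => by
  obtain ⟨i, rfl⟩ : ∃ j, i = j + 1 := ⟨i - 1, by omega⟩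
  exact ev_of_projective _

theorem PdLE.mono {m : ℕ} (hX : PdLE A n X) (hnm : n ≤ m) : PdLE A m X :=
  fun Y _ _ i hi => hX Y i (by omega)

theorem PdLE.projective [Module.Finite A X] (hX : PdLE A 0 X) : Module.Projective A X := by
  obtain ⟨n, p, hp⟩ := Module.Finite.exists_fin' A X
  obtain ⟨s, hs⟩ := (ses_ker p hp).lift (hX _ 1 one_pos) LinearMap.id
  exact Module.Projective.of_split s p hs

variable {B : Type u} [CommRing B] [Algebra A B]

theorem SES.baseChange_flat [Module.Flat A B] (h : SES f g) :
    SES (f.baseChange B) (g.baseChange B) where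
  inj := Module.Flat.lTensor_preserves_injective_linearMap f h.inj
  surj := LinearMap.lTensor_surjective B h.surj
  exact := Module.Flat.lTensor_exact B h.exact

/-- Over a local ring of depth zero a finite module with a free resolution of length one is free. -/
theorem SES.free_of_socle [IsLocalRing A] [Module.Free A K] [Module.Finite A K] [Module.Free A F]
    [Module.Finite A F] (h : SES f g) {z : A} (hz : z ≠ 0) (hzm : ∀ a ∈ maximalIdeal A, a * z = 0) :
    Module.Free A X ∧ Module.finrank A X + Module.finrank A K = Module.finrank A F := by
  have hle : ∀ {M : Type u} [AddCommGroup M] [Module A M] (w : M),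
      w ∈ (maximalIdeal A • ⊤ : Submodule A M) → z • w = 0 := by
    intro M _ _ w hw
    refine Submodule.smul_induction_on hw (fun a ha v _ => ?_) (fun v w hv hw => ?_)
    · rw [smul_smul, mul_comm, hzm a ha, zero_smul]
    · rw [smul_add, hv, hw, add_zero]
  have hinj : Function.Injective (f.lTensor (ResidueField A)) := by
    refine (injective_iff_map_eq_zero _).2 fun t ht => ?_
    obtain ⟨v, rfl⟩ := TensorProduct.mk_surjective A K (ResidueField A)
      Ideal.Quotient.mk_surjective t
    have h1 : f v ∈ LinearMap.ker (TensorProduct.mk A (ResidueField A) F 1) := ht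
    have h2 := hle _ ((LinearMap.ker_tensorProductMk (Q := F) (I := maximalIdeal A)).le h1)
    rw [← map_smul, ← map_zero f] at h2
    have h3 := h.inj h2
    have h4 : v ∈ (maximalIdeal A • ⊤ : Submodule A K) := by
      let b := Module.Free.chooseBasis A K
      rw [← b.sum_repr v]
      refine Submodule.sum_mem _ fun i _ => Submodule.smul_mem_smul ?_ trivial
      refine (mem_maximalIdeal _).2 fun hu => hz ?_
      have := DFunLike.congr_fun (congrArg b.repr h3) i
      rw [map_smul, Finsupp.smul_apply, map_zero, Finsupp.zero_apply, smul_eq_mul] at this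
      exact (IsUnit.mul_left_eq_zero hu).1 this
    exact (LinearMap.ker_tensorProductMk (Q := K) (I := maximalIdeal A)).ge h4
  have hfree : Module.Free A X :=
    Module.free_of_lTensor_residueField_injective f g h.surj h.exact hinj
  obtain ⟨s, hs⟩ := Module.projective_lifting_property g LinearMap.id h.surj
  refine ⟨hfree, ?_⟩
  have : Module.Finite A X := Module.Finite.of_surjective g h.surj
  have e : (K × X) ≃ₗ[A] F := by
    refine LinearEquiv.ofBijective (f.coprod s) ⟨?_, ?_⟩
    · refine (injective_iff_map_eq_zero _).2 ?_
      rintro ⟨a, x⟩ hx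
      rw [LinearMap.coprod_apply] at hx
      have hx0 : x = 0 := by
        have := congrArg g hx
        rw [map_add, h.apply_apply, zero_add, map_zero] at this
        exact (LinearMap.congr_fun hs x).symm.trans this
      subst hx0
      rw [map_zero, add_zero] at hx
      exact Prod.ext (h.inj (hx.trans (map_zero f).symm)) rfl
    · intro y
      obtain ⟨a, ha⟩ := (h.exact (y - s (g y))).1 (by
        rw [map_sub, sub_eq_zero]
        exact (LinearMap.congr_fun hs (g y)).symm)
      exact ⟨(a, g y), by rw [LinearMap.coprod_apply, ha]; simp⟩
  rw [← e.finrank_eq, Module.finrank_prod, add_comm]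

theorem PdLE.exists_rank [IsNoetherianRing A] [IsLocalRing A] [Module.Finite A X]
    (hX : PdLE A n X) : ∃ χ : ℤ, ∀ (p : Ideal A) [p.IsPrime], p ∈ associatedPrimes A A →
      Module.Free (Localization.AtPrime p) (Localization.AtPrime p ⊗[A] X) ∧
      (Module.finrank (Localization.AtPrime p) (Localization.AtPrime p ⊗[A] X) : ℤ) = χ := by
  induction n generalizing X with
  | zero =>
    have := hX.projective
    have : Module.Free A X := Module.free_of_flat_of_isLocalRing
    exact ⟨Module.finrank A X, fun p _ _ => ⟨inferInstance, by rw [Module.finrank_baseChange]⟩⟩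
  | succ n ih =>
    obtain ⟨m, p, hp⟩ := Module.Finite.exists_fin' A X
    have h := ses_ker p hp
    obtain ⟨χ, hχ⟩ := ih (PdLE.syzygy h hX)
    refine ⟨m - χ, fun q _ hq => ?_⟩
    obtain ⟨h1, h2⟩ := hχ q hq
    obtain ⟨-, z, hz⟩ := isAssociatedPrime_iff.1 hq
    have hcolon : ∀ a, a ∈ q ↔ a * z = 0 := fun a => by
      rw [hz, Submodule.mem_colon_singleton, Submodule.mem_bot, smul_eq_mul]
    have hz0 : algebraMap A (Localization.AtPrime q) z ≠ 0 := fun h0 => by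
      obtain ⟨s, hs⟩ := (IsLocalization.map_eq_zero_iff q.primeCompl _ z).1 h0
      exact s.2 ((hcolon s).2 hs)
    have hzm : ∀ a ∈ maximalIdeal (Localization.AtPrime q),
        a * algebraMap A (Localization.AtPrime q) z = 0 := by
      rw [← Localization.AtPrime.map_eq_maximalIdeal]
      intro a ha
      have : q.map (algebraMap A (Localization.AtPrime q)) ≤
          LinearMap.ker (LinearMap.mulRight (Localization.AtPrime q)
            (algebraMap A (Localization.AtPrime q) z)) := by
        refine Ideal.span_le.2 ?_
        rintro _ ⟨b, hb, rfl⟩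
        rw [SetLike.mem_coe, LinearMap.mem_ker, LinearMap.mulRight_apply, ← map_mul,
          (hcolon b).1 hb, map_zero]
      exact this ha
    obtain ⟨h3, h4⟩ := (h.baseChange_flat (B := Localization.AtPrime q)).free_of_socle hz0 hzm
    refine ⟨h3, ?_⟩
    rw [Module.finrank_baseChange (M' := Fin m → A), Module.finrank_fin_fun] at h4
    omega

/-- A non-zero ideal of finite projective dimension contains a regular element. -/
theorem PdLE.exists_notMem_associatedPrimes [IsNoetherianRing A] [IsLocalRing A] {I : Ideal A}
    (hX : PdLE A n (A ⧸ I)) (hI : I ≠ ⊥) : ∀ p ∈ associatedPrimes A A, ¬ I ≤ p := by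
  intro p hp hIp
  obtain ⟨χ, hχ⟩ := hX.exists_rank
  have hχ0 : χ ≠ 0 := by
    have hp' := hp.isPrime
    obtain ⟨h1, h2⟩ := hχ p hp
    intro h0
    rw [h0, Nat.cast_eq_zero] at h2
    have h3 : Subsingleton (Localization.AtPrime p ⊗[A] (A ⧸ I)) :=
      (Module.finrank_eq_zero_iff_of_free _ _).1 h2
    obtain ⟨s, hs⟩ := (IsLocalizedModule.eq_zero_iff p.primeCompl
      (TensorProduct.mk A (Localization.AtPrime p) (A ⧸ I) 1) (m := Ideal.Quotient.mk I 1)).1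
        (Subsingleton.elim _ _)
    refine s.2 (hIp (Ideal.Quotient.eq_zero_iff_mem.1 ?_))
    rw [← mul_one (s : A), map_mul]
    exact hs
  refine hI (eq_bot_iff.2 fun x hx => ?_)
  by_contra hx0
  obtain ⟨q, hq, hxq⟩ := exists_le_isAssociatedPrime_of_isNoetherianRing A x hx0
  have hq' := hq.isPrime
  obtain ⟨h1, h2⟩ := hχ q hq
  have h3 : algebraMap A (Localization.AtPrime q) x = 0 := by
    have hnt : Nontrivial (Localization.AtPrime q ⊗[A] (A ⧸ I)) := by
      refine Module.nontrivial_of_finrank_pos (R := Localization.AtPrime q) ?_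
      omega
    have hkill : ∀ t : Localization.AtPrime q ⊗[A] (A ⧸ I),
        algebraMap A (Localization.AtPrime q) x • t = 0 := fun t => by
      rw [algebraMap_smul]
      induction t with
      | zero => rw [smul_zero]
      | add a b ha hb => rw [smul_add, ha, hb, add_zero]
      | tmul a b =>
        obtain ⟨b, rfl⟩ := Ideal.Quotient.mk_surjective b
        rw [← TensorProduct.tmul_smul, ← Ideal.Quotient.mk_eq_mk, ← Submodule.Quotient.mk_smul,
          smul_eq_mul, (Submodule.Quotient.mk_eq_zero I).2 (I.mul_mem_right b hx),
          TensorProduct.tmul_zero]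
    let b := Module.Free.chooseBasis (Localization.AtPrime q) (Localization.AtPrime q ⊗[A] (A ⧸ I))
    obtain ⟨i⟩ := b.index_nonempty
    have := DFunLike.congr_fun (congrArg b.repr (hkill (b i))) i
    rwa [map_smul, b.repr_self, Finsupp.smul_apply, Finsupp.single_eq_same, smul_eq_mul, mul_one,
      map_zero, Finsupp.zero_apply] at this
  obtain ⟨s, hs⟩ := (IsLocalization.map_eq_zero_iff q.primeCompl _ x).1 h3
  exact s.2 (hxq (Submodule.mem_colon_singleton.2 hs))

end PdLE

/-! ### Embedding dimension -/

section EmbDim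

variable {A B : Type u} [CommRing A] [IsLocalRing A] [IsNoetherianRing A]
  [CommRing B] [IsLocalRing B] [IsNoetherianRing B]

theorem embDim_eq_spanFinrank : embDim A = (maximalIdeal A).spanFinrank := by
  have h := rank_cotangentSpace_eq_spanrank_maximalIdeal (R := A)
  rw [embDim, Module.finrank, h,
    Submodule.FG.spanRank_eq_spanFinrank (maximalIdeal A).fg_of_isNoetherianRing,
    Cardinal.toNat_natCast]

theorem embDim_le_card {s : Finset A} (hs : Ideal.span (s : Set A) = maximalIdeal A) :
    embDim A ≤ s.card := by
  rw [embDim_eq_spanFinrank, ← hs, ← Set.ncard_coe_finset]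
  exact Submodule.spanFinrank_span_le_ncard_of_finite s.finite_toSet

theorem exists_finset_card_eq_embDim :
    ∃ s : Finset A, s.card = embDim A ∧ Ideal.span (s : Set A) = maximalIdeal A := by
  obtain ⟨s, hs, hs'⟩ :=
    Submodule.FG.exists_span_finset_card_eq_spanFinrank (maximalIdeal A).fg_of_isNoetherianRing
  exact ⟨s, by rw [embDim_eq_spanFinrank, hs], hs'⟩

theorem span_eq_maximalIdeal_of_le_sup_sq {J : Ideal A} (hJ : J ≤ maximalIdeal A)
    (h : maximalIdeal A ≤ J ⊔ maximalIdeal A ^ 2) : J = maximalIdeal A :=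
  le_antisymm hJ (Submodule.le_of_le_smul_of_le_jacobson_bot
    (maximalIdeal A).fg_of_isNoetherianRing (maximalIdeal_le_jacobson _)
    (by rwa [smul_eq_mul, ← sq]))

theorem exists_finset_insert {x : A} (hx : x ∈ maximalIdeal A) (hx2 : x ∉ maximalIdeal A ^ 2) :
    ∃ s : Finset A, s.card + 1 = embDim A ∧
      Ideal.span (insert x (s : Set A)) = maximalIdeal A := by
  classical
  obtain ⟨s, hs, hsm⟩ := exists_finset_card_eq_embDim (A := A)
  obtain ⟨c, hc⟩ := Submodule.mem_span_finset'.1 (hsm ▸ hx : x ∈ Ideal.span (s : Set A))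
  have hj : ∃ j, c j ∉ maximalIdeal A := by
    by_contra! hcon
    refine hx2 (hc ▸ sum_mem fun j _ => ?_)
    rw [sq]
    exact Ideal.mul_mem_mul (hcon j) (hsm ▸ Ideal.subset_span j.2)
  obtain ⟨j, hj⟩ := hj
  refine ⟨s.erase j, ?_, le_antisymm ?_ ?_⟩
  · rw [Finset.card_erase_add_one j.2, hs]
  · refine Ideal.span_le.2 (Set.insert_subset hx fun y hy => ?_)
    exact hsm ▸ Ideal.subset_span (Finset.erase_subset _ _ hy)
  · have hrest : ∀ i ∈ s, i ≠ j → i ∈ Ideal.span (insert x (s.erase j : Set A)) := fun i hi hij =>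
      Ideal.subset_span (Set.mem_insert_of_mem _ (by simpa using ⟨hi, hij⟩))
    rw [← hsm, Ideal.span_le]
    intro i hi
    by_cases hij : i = j
    · obtain ⟨j, hj'⟩ := j
      obtain rfl : i = j := hij
      have hu : IsUnit (c ⟨i, hi⟩) := by simpa using hj
      rw [← Finset.add_sum_erase _ _ (Finset.mem_univ (⟨i, hi⟩ : s))] at hc
      have : c ⟨i, hi⟩ * i ∈ Ideal.span (insert x (s.erase i : Set A)) := by
        have h1 : c ⟨i, hi⟩ * i = x - ∑ k ∈ Finset.univ.erase (⟨i, hi⟩ : s), c k • (k : A) := by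
          rw [← hc]; simp
        rw [h1]
        refine sub_mem (Ideal.subset_span (Set.mem_insert _ _)) (sum_mem fun k hk => ?_)
        exact Ideal.mul_mem_left _ _ (hrest k k.2 fun h => (Finset.ne_of_mem_erase hk)
          (Subtype.ext h))
      exact (Ideal.unit_mul_mem_iff_mem _ hu).1 this
    · exact hrest i hi hij

theorem embDim_le_add_one (π : A →+* B) (hπ : Function.Surjective π) {x : A}
    (hker : RingHom.ker π = Ideal.span {x}) : embDim A ≤ embDim B + 1 := by
  classical
  obtain ⟨s, hs, hsm⟩ := exists_finset_card_eq_embDim (A := B)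
  have hx : x ∈ RingHom.ker π := hker ▸ Ideal.mem_span_singleton_self x
  refine (embDim_le_card (s := insert x (s.image (Function.surjInv hπ))) ?_).trans
    ((Finset.card_insert_le _ _).trans (by grw [Finset.card_image_le, hs]))
  have hloc : IsLocalHom π := IsLocalHom.of_surjective π hπ
  have h1 : (maximalIdeal B).comap π = maximalIdeal A :=
    ((local_hom_TFAE π).out 0 4).1 hloc
  rw [← h1, ← hsm, Finset.coe_insert, Finset.coe_image, Ideal.span_insert, ← hker]
  have h2 : π '' (Function.surjInv hπ '' (s : Set B)) = s := by
    rw [← Set.image_comp, (Function.rightInverse_surjInv hπ).comp_eq_id, Set.image_id]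
  rw [← h2, ← Ideal.map_span, Ideal.comap_map_of_surjective π hπ, h2, sup_comm]
  rfl

theorem embDim_add_one_le (π : A →+* B) (hπ : Function.Surjective π) {x : A}
    (hxπ : π x = 0) (hx : x ∈ maximalIdeal A) (hx2 : x ∉ maximalIdeal A ^ 2) :
    embDim B + 1 ≤ embDim A := by
  classical
  obtain ⟨s, hs, hsm⟩ := exists_finset_insert hx hx2
  rw [← hs]
  refine Nat.succ_le_succ ((embDim_le_card (s := s.image π) ?_).trans Finset.card_image_le)
  rw [← map_maximalIdeal_of_surjective π hπ, ← hsm, Ideal.map_span, Set.image_insert_eq, hxπ,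
    Ideal.span_insert_zero, Finset.coe_image]

theorem exists_mem_ker_notMem_sq (π : A →+* B) (hπ : Function.Surjective π)
    (h : embDim B < embDim A) : ∃ x ∈ RingHom.ker π, x ∉ maximalIdeal A ^ 2 := by
  classical
  by_contra! hcon
  obtain ⟨s, hs, hsm⟩ := exists_finset_card_eq_embDim (A := B)
  have hloc : IsLocalHom π := IsLocalHom.of_surjective π hπ
  have h1 : (maximalIdeal B).comap π = maximalIdeal A :=
    ((local_hom_TFAE π).out 0 4).1 hloc
  have h2 : π '' (Function.surjInv hπ '' (s : Set B)) = s := by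
    rw [← Set.image_comp, (Function.rightInverse_surjInv hπ).comp_eq_id, Set.image_id]
  have h3 : maximalIdeal A = Ideal.span (Function.surjInv hπ '' (s : Set B)) ⊔ RingHom.ker π := by
    rw [← h1, ← hsm]
    conv_lhs => rw [← h2]
    rw [← Ideal.map_span, Ideal.comap_map_of_surjective π hπ]
    rfl
  have h4 := span_eq_maximalIdeal_of_le_sup_sq (h3 ▸ le_sup_left)
    (h3.le.trans (sup_le_sup_left hcon _))
  have h5 := embDim_le_card (s := s.image (Function.surjInv hπ)) (by rwa [Finset.coe_image])
  have h6 : (s.image (Function.surjInv hπ)).card ≤ s.card := Finset.card_image_le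
  omega

/-- An ideal of finite projective dimension with quotient of smaller embedding dimension contains
a regular element outside the square of the maximal ideal. -/
theorem exists_regular_notMem_sq (π : A →+* B) (hπ : Function.Surjective π)
    (h : embDim B < embDim A) {n : ℕ} (hpd : PdLE A n (A ⧸ RingHom.ker π)) :
    ∃ x ∈ RingHom.ker π, x ∉ maximalIdeal A ^ 2 ∧ ∀ a, x * a = 0 → a = 0 := by
  classical
  obtain ⟨x₀, hx₀, hx₀2⟩ := exists_mem_ker_notMem_sq π hπ h
  have hI : RingHom.ker π ≠ ⊥ := fun h0 => hx₀2 (by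
    rw [h0] at hx₀
    rw [hx₀]
    exact zero_mem _)
  have hav := hpd.exists_notMem_associatedPrimes hI
  have hfin := associatedPrimes.finite A A
  by_contra! hcon
  have hsub : (RingHom.ker π : Set A) ⊆
      ⋃ i ∈ ((insert (maximalIdeal A ^ 2) hfin.toFinset : Finset (Ideal A)) : Set (Ideal A)),
        ((id i : Ideal A) : Set A) := by
    intro x hx
    by_cases hx2 : x ∈ maximalIdeal A ^ 2
    · exact Set.mem_biUnion (x := maximalIdeal A ^ 2) (by simp) hx2
    · obtain ⟨a, ha, ha0⟩ := hcon x hx hx2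
      have h1 : x ∈ ⋃ p ∈ associatedPrimes A A, (p : Set A) := by
        rw [biUnion_associatedPrimes_eq_zero_divisors]
        exact ⟨a, ha0, ha⟩
      simp only [Set.mem_iUnion] at h1
      obtain ⟨p, hp, hxp⟩ := h1
      exact Set.mem_biUnion (x := p) (by simp [hp]) hxp
  obtain ⟨p, hp, hle⟩ := (Ideal.subset_union_prime (maximalIdeal A ^ 2) (maximalIdeal A ^ 2)
    (fun i hi hi2 _ => by
      have : i ∈ associatedPrimes A A := by simpa [hi2] using hi
      exact this.isPrime)).1 hsub
  rcases Finset.mem_insert.1 hp with rfl | hp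
  · exact hx₀2 (hle hx₀)
  · exact hav p (by simpa using hp) hle

end EmbDim

/-! ### Projective dimension over a hypersurface quotient -/

section Nagata

theorem exists_minimal_generators (A : Type u) {X : Type u} [CommRing A] [IsLocalRing A]
    [AddCommGroup X] [Module A X] [Module.Finite A X] :
    ∃ (n : ℕ) (f : Fin n → X), Submodule.span A (Set.range f) = ⊤ ∧
      ∀ v : Fin n → A, ∑ i, v i • f i = 0 → ∀ i, v i ∈ maximalIdeal A := by
  let b := Module.finBasis (ResidueField A) (ResidueField A ⊗[A] X)
  choose f hf using fun i => TensorProduct.mk_surjective A X (ResidueField A)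
    Ideal.Quotient.mk_surjective (b i)
  refine ⟨_, f, IsLocalRing.span_eq_top_of_tmul_eq_basis f b hf, fun v hv i => ?_⟩
  have h1 : ∑ i, residue A (v i) • b i = 0 := by
    have h2 := congrArg (TensorProduct.mk A (ResidueField A) X 1) hv
    rw [map_sum, map_zero] at h2
    rw [← h2]
    refine Finset.sum_congr rfl fun j _ => ?_
    rw [map_smul, hf]
    rfl
  exact (residue_eq_zero_iff _).1 (Fintype.linearIndependent_iff.1 b.linearIndependent _ h1 i)

variable {A B X : Type u} [CommRing A] [IsLocalRing A] [IsNoetherianRing A]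
  [CommRing B] [Algebra A B] [AddCommGroup X] [Module A X] [Module B X] [IsScalarTower A B X]
  {x : A}

theorem PdLE.free_quotient [Module.Finite A X] (hsurj : Function.Surjective (algebraMap A B))
    (hker : RingHom.ker (algebraMap A B) = Ideal.span {x})
    (hreg : ∀ a, x * a = 0 → a = 0) (hx2 : x ∉ maximalIdeal A ^ 2)
    (h : PdLE A 1 X) : Module.Free B X := by
  obtain ⟨n, f, hf, hmin⟩ := exists_minimal_generators A (X := X)
  have hxB : algebraMap A B x = 0 := by
    have : x ∈ RingHom.ker (algebraMap A B) := hker ▸ Ideal.mem_span_singleton_self x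
    exact this
  have hxX : ∀ z : X, x • z = 0 := fun z => by rw [← algebraMap_smul B, hxB, zero_smul]
  let p : (Fin n → A) →ₗ[A] X := Fintype.linearCombination A f
  have hp : Function.Surjective p := by
    rw [← LinearMap.range_eq_top, Fintype.range_linearCombination, hf]
  have hK : PdLE A 0 (LinearMap.ker p) := PdLE.syzygy (ses_ker p hp) h
  have := hK.projective
  have : Module.Free A (LinearMap.ker p) := Module.free_of_flat_of_isLocalRing
  let φ : (Fin n → A) →ₗ[A] LinearMap.ker p :=
    (LinearMap.lsmul A (Fin n → A) x).codRestrict _ fun v => by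
      rw [LinearMap.mem_ker, LinearMap.lsmul_apply, map_smul, hxX]
  have hφinj : Function.Injective φ := by
    refine (injective_iff_map_eq_zero _).2 fun v hv => funext fun i => hreg _ ?_
    exact congrFun (congrArg Subtype.val hv) i
  have hrank : Module.finrank A (LinearMap.ker p) = n := by
    have h1 := LinearMap.finrank_le_finrank_of_injective hφinj
    have h2 := LinearMap.finrank_le_finrank_of_injective (LinearMap.ker p).injective_subtype
    rw [Module.finrank_fin_fun] at h1 h2
    omega
  have hk : Function.Injective (φ.lTensor (ResidueField A)) := by
    refine (injective_iff_map_eq_zero _).2 fun t ht => ?_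
    obtain ⟨v, rfl⟩ := TensorProduct.mk_surjective A (Fin n → A) (ResidueField A)
      Ideal.Quotient.mk_surjective t
    have h1 : φ v ∈ LinearMap.ker (TensorProduct.mk A (ResidueField A) (LinearMap.ker p) 1) := ht
    have h2 := (LinearMap.ker_tensorProductMk (Q := LinearMap.ker p) (I := maximalIdeal A)).le h1
    have h3 : ∀ w ∈ (maximalIdeal A • ⊤ : Submodule A (LinearMap.ker p)), ∀ i,
        (w : Fin n → A) i ∈ maximalIdeal A ^ 2 := by
      intro w hw i
      refine Submodule.smul_induction_on hw (fun a ha u _ => ?_) (fun u w hu hw => ?_)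
      · rw [sq]
        exact Ideal.mul_mem_mul ha (hmin u.1 u.2 i)
      · exact add_mem hu hw
    have h4 : ∀ i, v i ∈ maximalIdeal A := fun i => (mem_maximalIdeal _).2 fun hu => hx2
      ((Ideal.mul_unit_mem_iff_mem _ hu).1 (h3 _ h2 i))
    have h5 : v ∈ (maximalIdeal A • ⊤ : Submodule A (Fin n → A)) := by
      rw [← (Pi.basisFun A (Fin n)).sum_repr v]
      exact Submodule.sum_mem _ fun i _ => Submodule.smul_mem_smul (by simpa using h4 i) trivial
    exact (LinearMap.ker_tensorProductMk (Q := Fin n → A) (I := maximalIdeal A)).ge h5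
  obtain ⟨l, hl⟩ := (IsLocalRing.split_injective_iff_lTensor_residueField_injective φ).2 hk
  have hl' : ∀ v, l (φ v) = v := LinearMap.congr_fun hl
  have hlinj : Function.Injective l := by
    let e : (Fin n → A) ≃ₗ[A] LinearMap.ker p :=
      (Module.finBasisOfFinrankEq A (LinearMap.ker p) hrank).equivFun.symm
    have h1 : Function.Injective (l ∘ₗ e.toLinearMap) :=
      OrzechProperty.injective_of_surjective_endomorphism _ fun v => ⟨e.symm (φ v), by simp [hl']⟩
    intro a b hab
    have := @h1 (e.symm a) (e.symm b) (by simpa using hab)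
    exact e.symm.injective this
  have hφ : ∀ w : LinearMap.ker p, ∃ v, x • v = (w : Fin n → A) := fun w =>
    ⟨l w, congrArg Subtype.val (hlinj (hl' (l w)) : φ (l w) = w)⟩
  have hli : LinearIndependent B f := by
    refine Fintype.linearIndependent_iff.2 fun b hb i => ?_
    choose v hv using fun i => hsurj (b i)
    have : ∑ i, v i • f i = 0 := by
      rw [← hb]
      exact Finset.sum_congr rfl fun j _ => by rw [← hv, algebraMap_smul]
    obtain ⟨w, hw⟩ := hφ ⟨v, this⟩
    rw [← hv i, ← show x • w i = v i from congrFun hw i, smul_eq_mul, map_mul, hxB, zero_mul]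
  refine Module.Free.of_basis (Module.Basis.mk hli ?_)
  intro z _
  have hz : z ∈ Submodule.span A (Set.range f) := hf ▸ trivial
  exact Submodule.span_le_restrictScalars A B _ hz

theorem pdLE_one_quotient (hAB : SES (LinearMap.lsmul A A x) (Algebra.linearMap A B)) (m : ℕ) :
    PdLE A 1 (Fin m → B) := fun Y _ _ i hi => by
  obtain ⟨i, rfl⟩ : ∃ j, i = j + 1 + 1 := ⟨i - 2, by omega⟩
  exact EV.pi_fin_left (hAB.ev_con3 (ev_of_projective i) (ev_of_projective (i + 1))) m

/-- Passing to the quotient by a regular element outside the square of the maximal ideal preserves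
finiteness of projective dimension. -/
theorem PdLE.quotient [IsNoetherianRing B] [Module.Finite B X] {n : ℕ}
    (hAB : SES (LinearMap.lsmul A A x) (Algebra.linearMap A B))
    (hx2 : x ∉ maximalIdeal A ^ 2) (h : PdLE A (n + 1) X) : PdLE B n X := by
  have : Module.Finite A B := Module.Finite.of_surjective (Algebra.linearMap A B) hAB.surj
  have : Module.Finite A X := Module.Finite.trans B X
  induction n generalizing X with
  | zero =>
    have : Module.Free B X := h.free_quotient hAB.surj (by
      ext a
      rw [Ideal.mem_span_singleton']
      refine (hAB.exact a).trans ⟨fun ⟨b, hb⟩ => ⟨b, by rw [← hb, mul_comm]; rfl⟩, ?_⟩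
      rintro ⟨b, rfl⟩
      exact ⟨b, mul_comm _ _⟩)
      (fun a ha => hAB.inj (by simpa using ha)) hx2
    exact PdLE.of_projective
  | succ n ih =>
    obtain ⟨m, p, hp⟩ := Module.Finite.exists_fin' B X
    have hs := ses_ker p hp
    refine PdLE.of_syzygy hs (ih (X := LinearMap.ker p) ?_ (Module.Finite.trans B _))
    intro Y _ _ i hi
    exact (ses_restrictScalars (A := A) hs).ev_con1 (pdLE_one_quotient hAB m Y i (by omega))
      (h Y (i + 1) (by omega))

end Nagata

/-! ### Constructing complete injective resolutions -/

section GorensteinInjective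

variable {A : Type u} [CommRing A]

/-- `InjStep Y X` says that `X` is the quotient of an injective module by `Y`. -/
def InjStep (A : Type u) [CommRing A] (Y X : ModuleCat.{u} A) : Prop :=
  ∃ (J : ModuleCat.{u} A) (f : Y →ₗ[A] J) (g : J →ₗ[A] X), Module.Injective A J ∧ SES f g

theorem isGorensteinInjective_of_int (o : ℤ → ModuleCat.{u} A)
    (ho : ∀ i, InjStep A (o (i + 1)) (o i))
    (hev : ∀ i (Q : Type u) [AddCommGroup Q] [Module A Q], Module.Injective A Q → EV A Q (o i) 1) :
    IsGorensteinInjective A (o 1) := by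
  choose J f g hJ hs using ho
  refine ⟨{
    I := fun i => J i
    d := fun i => f i ∘ₗ g (i + 1)
    injective := hJ
    exact := fun i x => ⟨fun hx => ?_, ?_⟩
    exact_hom := fun Q _ _ hQ i φ => ⟨fun hφ => ?_, ?_⟩
    iso := ⟨(LinearEquiv.ofInjective (f 0) (hs 0).inj).trans (LinearEquiv.ofEq _ _ ?_)⟩ }⟩
  · obtain ⟨y, hy⟩ := ((hs (i + 1)).exact x).1 ((hs i).inj (hx.trans (map_zero _).symm))
    obtain ⟨z, hz⟩ := (hs (i + 1 + 1)).surj y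
    exact ⟨z, by rw [LinearMap.comp_apply, hz, hy]⟩
  · rintro ⟨z, rfl⟩
    rw [LinearMap.comp_apply, LinearMap.comp_apply, (hs (i + 1)).apply_apply, map_zero]
  · have h1 : ∀ q, g (i + 1) (φ q) = 0 := fun q =>
      (hs i).inj ((LinearMap.congr_fun hφ q).trans (map_zero _).symm)
    obtain ⟨ψ, hψ⟩ : ∃ ψ : Q →ₗ[A] o (i + 1 + 1), f (i + 1) ∘ₗ ψ = φ := by
      choose ψ hψ using fun q => ((hs (i + 1)).exact (φ q)).1 (h1 q)
      exact ⟨⟨⟨ψ, fun a b => (hs (i + 1)).inj (by simp [hψ])⟩,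
        fun a b => (hs (i + 1)).inj (by simp [hψ])⟩, LinearMap.ext hψ⟩
    obtain ⟨χ, hχ⟩ := (hs (i + 1 + 1)).lift (hev (i + 1 + 1 + 1) Q hQ) ψ
    exact ⟨χ, by rw [← hψ, ← hχ]; rfl⟩
  · rintro ⟨χ, rfl⟩
    refine LinearMap.ext fun q => ?_
    change f i (g (i + 1) (f (i + 1) (g (i + 1 + 1) (χ q)))) = 0
    rw [(hs (i + 1)).apply_apply, map_zero]
  · rw [LinearMap.range_comp, LinearMap.range_eq_top.2 (hs (0 + 1)).surj, Submodule.map_top]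

theorem isGorensteinInjective_of_class (C : ModuleCat.{u} A → Prop)
    (hleft : ∀ X, C X → ∃ Y, C Y ∧ InjStep A Y X) (hright : ∀ X, C X → ∃ Y, C Y ∧ InjStep A X Y)
    (hev : ∀ X, C X → ∀ (Q : Type u) [AddCommGroup Q] [Module A Q], Module.Injective A Q →
      EV A Q X 1) (M : ModuleCat.{u} A) (hM : C M) : IsGorensteinInjective A M := by
  choose! L hL hL' using hleft
  choose! T hT hT' using hright
  have hLn : ∀ n, C (L^[n] M) := fun n => by
    induction n with
    | zero => exact hM
    | succ n ih => rw [Function.iterate_succ_apply']; exact hL _ ih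
  have hTn : ∀ n, C (T^[n] M) := fun n => by
    induction n with
    | zero => exact hM
    | succ n ih => rw [Function.iterate_succ_apply']; exact hT _ ih
  let o : ℤ → ModuleCat.{u} A := fun i => match i with
    | .ofNat 0 => T M
    | .ofNat (n + 1) => L^[n] M
    | .negSucc n => T^[n + 2] M
  have hC : ∀ i, C (o i) := fun i => match i with
    | .ofNat 0 => hT _ hM
    | .ofNat (n + 1) => hLn n
    | .negSucc n => hTn _
  refine isGorensteinInjective_of_int o (fun i => ?_) (fun i => hev _ (hC i))
  match i with
  | .ofNat 0 => exact hT' _ hM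
  | .ofNat (n + 1) =>
    change InjStep A (L^[n + 1] M) (L^[n] M)
    rw [Function.iterate_succ_apply']
    exact hL' _ (hLn n)
  | .negSucc 0 =>
    exact hT' _ (hT _ hM)
  | .negSucc (n + 1) =>
    change InjStep A (T^[n + 2] M) (T^[n + 1 + 2] M)
    rw [Function.iterate_succ_apply' T (n + 2)]
    exact hT' _ (hTn _)

theorem IsGorensteinInjective.of_equiv {M M' : Type u} [AddCommGroup M] [Module A M]
    [AddCommGroup M'] [Module A M'] (h : IsGorensteinInjective A M) (e : M' ≃ₗ[A] M) :
    IsGorensteinInjective A M' := by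
  obtain ⟨@⟨I, _, _, d, hinj, hex, hhom, ⟨e'⟩⟩⟩ := h
  exact ⟨⟨I, d, hinj, hex, hhom, ⟨e.trans e'⟩⟩⟩

theorem Module.Injective.of_surjective {B I : Type u} [CommRing B] [Algebra A B]
    (hAB : Function.Surjective (algebraMap A B)) [AddCommGroup I] [Module A I] [Module B I]
    [IsScalarTower A B I] (h : Module.Injective A I) : Module.Injective B I := by
  refine ⟨fun X Y _ _ _ _ f hf g => ?_⟩
  let _ : Module A X := Module.compHom X (algebraMap A B)
  let _ : Module A Y := Module.compHom Y (algebraMap A B)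
  have : IsScalarTower A B X := ⟨fun a b x => by rw [Algebra.smul_def, mul_smul]; rfl⟩
  have : IsScalarTower A B Y := ⟨fun a b x => by rw [Algebra.smul_def, mul_smul]; rfl⟩
  obtain ⟨k, hk⟩ := h.out (f.restrictScalars A) hf (g.restrictScalars A)
  exact ⟨LinearMap.extendScalarsOfSurjective hAB k, hk⟩

/-- Gorenstein injectivity only depends on the ring up to isomorphism. -/
theorem IsGorensteinInjective.of_bijective {B M : Type u} [CommRing B] [Algebra A B]
    (hAB : Function.Bijective (algebraMap A B)) [AddCommGroup M] [Module A M] [Module B M]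
    [IsScalarTower A B M] (h : IsGorensteinInjective A M) : IsGorensteinInjective B M := by
  obtain ⟨@⟨I, _, _, d, hinj, hex, hhom, ⟨e⟩⟩⟩ := h
  let σ : B ≃+* A := (RingEquiv.ofBijective _ hAB).symm
  have hσ : ∀ b, algebraMap A B (σ b) = b := (RingEquiv.ofBijective _ hAB).apply_symm_apply
  have hσ' : ∀ a, σ (algebraMap A B a) = a := (RingEquiv.ofBijective _ hAB).symm_apply_apply
  let _ : ∀ i, Module B (I i) := fun i => Module.compHom _ σ.toRingHom
  have hsm : ∀ i (b : B) (x : I i), b • x = σ b • x := fun _ _ _ => rfl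
  have : ∀ i, IsScalarTower A B (I i) := fun i => ⟨fun a b x => by
    rw [hsm, hsm, Algebra.smul_def, map_mul, hσ', mul_smul]⟩
  let d' : ∀ i, I (i + 1) →ₗ[B] I i := fun i => LinearMap.extendScalarsOfSurjective hAB.2 (d i)
  refine ⟨⟨I, d', fun i => (hinj i).of_surjective hAB.2, hex, fun E _ _ hE i φ => ?_,
    ⟨?_⟩⟩⟩
  · let _ : Algebra B A := σ.toRingHom.toAlgebra
    let _ : Module A E := Module.compHom E (algebraMap A B)
    have : IsScalarTower A B E := ⟨fun a b x => by rw [Algebra.smul_def, mul_smul]; rfl⟩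
    have : IsScalarTower B A E := ⟨fun b a x => by
      rw [Algebra.smul_def (R := B) (A := A), mul_smul]
      change algebraMap A B (σ b) • (a • x) = b • (a • x)
      rw [hσ]⟩
    have hE' : Module.Injective A E := hE.of_surjective (A := B) σ.surjective
    have key := hhom E hE' i (φ.restrictScalars A)
    refine ⟨fun h => ?_, ?_⟩
    · obtain ⟨ψ, hψ⟩ := key.1 (LinearMap.ext fun x => LinearMap.congr_fun h x)
      exact ⟨LinearMap.extendScalarsOfSurjective hAB.2 ψ,
        LinearMap.ext fun x => LinearMap.congr_fun hψ x⟩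
    · rintro ⟨ψ, rfl⟩
      exact LinearMap.ext fun x => (hex i _).2 ⟨ψ x, rfl⟩
  · exact
      { toFun := fun x => ⟨(e x).1, (e x).2⟩
        invFun := fun x => e.symm ⟨x.1, x.2⟩
        map_add' := fun _ _ => Subtype.ext (by simp)
        map_smul' := fun b x => by
          obtain ⟨a, rfl⟩ := hAB.2 b
          refine Subtype.ext ?_
          simp only [algebraMap_smul, map_smul, RingHom.id_apply]
          rfl
        left_inv := fun _ => e.symm_apply_apply _
        right_inv := fun x => Subtype.ext (by simp) }

end GorensteinInjective

/-! ### The case of equal embedding dimensions -/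

section EqualEmbDim

theorem exists_hom_ne_zero {A : Type u} [CommRing A] [IsLocalRing A] {N E : Type u}
    [AddCommGroup N] [Module A N] [Module.Finite A N] [Nontrivial N] [AddCommGroup E] [Module A E]
    {e₀ : E} (h0 : e₀ ≠ 0) (he : ∀ r ∈ maximalIdeal A, r • e₀ = 0) :
    ∃ φ : N →ₗ[A] E, φ ≠ 0 ∧ ∀ r ∈ maximalIdeal A, r • φ = 0 := by
  obtain ⟨W, hW, -⟩ := (IsCoatomic.eq_top_or_exists_le_coatom (⊥ : Submodule A N)).resolve_left
    bot_ne_top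
  have hs : IsSimpleModule A (N ⧸ W) := (isSimpleModule_iff_isCoatom (R := A)).2 hW
  obtain ⟨m, hm, ⟨e⟩⟩ := isSimpleModule_iff_quot_maximal.1 hs
  obtain rfl := IsLocalRing.eq_maximalIdeal hm
  let σ : (A ⧸ maximalIdeal A) →ₗ[A] E :=
    Submodule.liftQ _ (LinearMap.toSpanSingleton A E e₀) (by
      intro r hr
      rw [LinearMap.mem_ker, LinearMap.toSpanSingleton_apply, he r hr])
  refine ⟨σ ∘ₗ e.toLinearMap ∘ₗ W.mkQ, fun h => ?_, fun r hr => ?_⟩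
  · obtain ⟨x, hx⟩ := W.mkQ_surjective (e.symm (Submodule.Quotient.mk 1))
    have := LinearMap.congr_fun h x
    simp only [LinearMap.comp_apply, hx, LinearEquiv.coe_coe, LinearEquiv.apply_symm_apply,
      LinearMap.zero_apply] at this
    exact h0 ((one_smul A e₀).symm.trans this)
  · ext x
    simp only [LinearMap.smul_apply, LinearMap.comp_apply, LinearMap.zero_apply]
    obtain ⟨a, ha⟩ := Submodule.Quotient.mk_surjective _ (e.toLinearMap (W.mkQ x))
    rw [← ha]
    change r • (a • e₀) = 0
    rw [smul_comm, he r hr, smul_zero]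

variable {R A E : Type u} [CommRing R] [IsLocalRing R] [IsNoetherianRing R] [CommRing A]
  [IsLocalRing A] [IsNoetherianRing A] [Algebra R A] [AddCommGroup E] [Module A E] [Module R E]
  [IsScalarTower R A E]

variable (R A E) in
/-- The duals of the modules in the class `TotC`. -/
def DualClass (X : ModuleCat.{u} A) : Prop :=
  ∃ (N : Type u) (_ : AddCommGroup N) (_ : Module A N), TotC R A E N ∧
    Nonempty (X ≃ₗ[A] (N →ₗ[A] E))

theorem DualClass.exists_left (hE : Module.Injective A E)
    (hφ : PhiFin R (maximalIdeal R : Set R) E) (hΓ : GammaC R A E) (X : ModuleCat.{u} A)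
    (hX : DualClass R A E X) : ∃ Y, DualClass R A E Y ∧ InjStep A Y X := by
  obtain ⟨N, _, _, hN, ⟨e⟩⟩ := hX
  obtain ⟨m, L, _, _, f, g, hs, hL, -⟩ := hN.exists_cosyzygy hE hφ (hΓ.embedsFree hN)
  exact ⟨ModuleCat.of A (L →ₗ[A] E), ⟨L, _, _, hL, ⟨LinearEquiv.refl _ _⟩⟩,
    ModuleCat.of A ((Fin m → A) →ₗ[A] E), _, _, hE.dual_pi A m,
    (hs.dual A hE).congr_right e.symm⟩

theorem DualClass.exists_right (hE : Module.Injective A E)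
    (hφ : PhiFin R (maximalIdeal R : Set R) E) (X : ModuleCat.{u} A)
    (hX : DualClass R A E X) : ∃ Y, DualClass R A E Y ∧ InjStep A X Y := by
  obtain ⟨N, _, _, hN, ⟨e⟩⟩ := hX
  have := hN.finite
  obtain ⟨n, π, hπ⟩ := Module.Finite.exists_fin' A N
  have hs := ses_ker π hπ
  exact ⟨ModuleCat.of A (LinearMap.ker π →ₗ[A] E),
    ⟨_, _, _, hN.syzygy hE hφ hs, ⟨LinearEquiv.refl _ _⟩⟩,
    ModuleCat.of A ((Fin n → A) →ₗ[A] E), _, _, hE.dual_pi A n,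
    (hs.dual A hE).congr_left e⟩

theorem DualClass.ev (hE : Module.Injective A E) (X : ModuleCat.{u} A)
    (hX : DualClass R A E X) (Q : Type u) [AddCommGroup Q] [Module A Q]
    (hQ : Module.Injective A Q) : EV A Q X 1 := by
  obtain ⟨N, _, _, hN, ⟨e⟩⟩ := hX
  have := hN.finite
  have := flat_hom_of_injective hQ hE
  exact ((ev_swap_iff (R := A) hE 0).2 (ev_flat_of_ev hN.ev _ 0)).congr_right e

theorem DualClass.isGorensteinInjective (hE : Module.Injective A E)
    (hφ : PhiFin R (maximalIdeal R : Set R) E) (hΓ : GammaC R A E) (X : ModuleCat.{u} A)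
    (hX : DualClass R A E X) : IsGorensteinInjective A X :=
  isGorensteinInjective_of_class (DualClass R A E) (DualClass.exists_left hE hφ hΓ)
    (DualClass.exists_right hE hφ) (DualClass.ev hE) X hX

theorem DualClass.ev_of_pdLE (hE : Module.Injective A E)
    (hφ : PhiFin R (maximalIdeal R : Set R) E) (hΓ : GammaC R A E) {Z : Type u} [AddCommGroup Z]
    [Module A Z] {n : ℕ} (hZ : PdLE A n Z) (i : ℕ) (X : ModuleCat.{u} A)
    (hX : DualClass R A E X) : EV A Z X (i + 1) := by
  obtain ⟨k, hk⟩ : ∃ k, n < i + 1 + k := ⟨n, by omega⟩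
  induction k generalizing X i with
  | zero => exact hZ _ _ hk
  | succ k ih =>
    obtain ⟨Y, hY, J, f, g, hJ, hs⟩ := DualClass.exists_left hE hφ hΓ X hX
    exact hs.ev_cov3 (ev_of_injective i) (ih (i + 1) Y hY (by omega))

variable {S N : Type u} [CommRing S] [Algebra A S] [AddCommGroup N] [Module A N] [Module S N]
  [IsScalarTower A S N]

theorem TotC.bijective_algebraMap {e₀ : E} (hE : IsMatlis A E e₀)
    (hφ : PhiFin R (maximalIdeal R : Set R) E) (hΓ : GammaC R A E)
    (hS : Function.Surjective (algebraMap A S)) {n : ℕ} (hpd : PdLE A n S) [Nontrivial N]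
    (hN : TotC R A E N) : Function.Bijective (algebraMap A S) := by
  have := hN.finite
  refine ⟨?_, hS⟩
  have hs := ses_ker (Algebra.linearMap A S) hS
  by_contra hinj
  have : Nontrivial (LinearMap.ker (Algebra.linearMap A S)) := by
    rw [Submodule.nontrivial_iff_ne_bot]
    intro h
    exact hinj (LinearMap.ker_eq_bot.1 h)
  obtain ⟨φ, hφ0, hφm⟩ := exists_hom_ne_zero (N := N) hE.ne_zero hE.smul_eq_zero
  obtain ⟨ψ, hψ0, -⟩ :=
    exists_hom_ne_zero (N := LinearMap.ker (Algebra.linearMap A S)) hφ0 hφm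
  obtain ⟨χ, hχ⟩ := hs.extend (Y := N →ₗ[A] E) (DualClass.ev_of_pdLE hE.inj hφ hΓ hpd 0
    (ModuleCat.of A (N →ₗ[A] E)) ⟨N, _, _, hN, ⟨LinearEquiv.refl _ _⟩⟩) ψ
  refine hψ0 (LinearMap.ext fun x => ?_)
  rw [← hχ]
  change χ x.1 = 0
  rw [← mul_one x.1, ← smul_eq_mul, map_smul]
  ext ν
  rw [LinearMap.smul_apply, ← map_smul, ← algebraMap_smul S]
  have h0 : algebraMap A S x.1 = 0 := x.2
  rw [h0, zero_smul, map_zero, LinearMap.zero_apply]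

end EqualEmbDim

/-! ### Induction on the difference of embedding dimensions -/

section RegularLists

open RingTheory.Sequence
open scoped Pointwise

theorem isRegular_nil {A : Type u} [CommRing A] [Nontrivial A] : IsRegular A ([] : List A) :=
  IsRegular.nil A A

theorem isRegular_cons_quotient {A : Type u} [CommRing A] {x : A} {rs : List A}
    (hx : ∀ a, x * a = 0 → a = 0)
    (h : IsRegular (A ⧸ Ideal.span {x}) (rs.map (Ideal.Quotient.mk (Ideal.span {x})))) :
    IsRegular A (x :: rs) := by
  refine (isRegular_cons_iff' A x rs).2 ⟨fun a b hab => ?_, ?_⟩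
  · exact sub_eq_zero.1 (hx _ (by rw [mul_sub]; exact sub_eq_zero.2 hab))
  · have he : (Ideal.span {x} : Submodule A A) = x • (⊤ : Submodule A A) := by
      rw [← Submodule.ideal_span_singleton_smul, smul_eq_mul, Ideal.mul_top]
    let e := Submodule.quotEquivOfEq _ _ he
    let e' : (A ⧸ Ideal.span {x}) ≃ₗ[A ⧸ Ideal.span {x}] QuotSMulTop x A :=
      LinearEquiv.extendScalarsOfSurjective (R := A) Ideal.Quotient.mk_surjective e
    exact (e'.isRegular_congr _).1 h

theorem exists_regular_lift {A S : Type u} [CommRing A] {x : A} [CommRing S] (π : A →+* S)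
    (ρ : (A ⧸ Ideal.span {x}) →+* S) (hρ : ρ.comp (Ideal.Quotient.mk (Ideal.span {x})) = π)
    (hx : ∀ a, x * a = 0 → a = 0) {rs : List (A ⧸ Ideal.span {x})}
    (h : IsRegular (A ⧸ Ideal.span {x}) rs) (hk : RingHom.ker ρ = Ideal.span {z | z ∈ rs}) :
    ∃ rs' : List A, rs'.length = rs.length + 1 ∧ IsRegular A rs' ∧
      RingHom.ker π = Ideal.span {z | z ∈ rs'} := by
  obtain ⟨rs, rfl⟩ := List.map_surjective_iff.2 Ideal.Quotient.mk_surjective rs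
  refine ⟨x :: rs, by simp, isRegular_cons_quotient hx h, ?_⟩
  have h1 : RingHom.ker π = (RingHom.ker ρ).comap (Ideal.Quotient.mk (Ideal.span {x})) := by
    rw [← hρ, RingHom.comap_ker]
  have h2 : {z | z ∈ rs.map (Ideal.Quotient.mk (Ideal.span {x}))} =
      Ideal.Quotient.mk (Ideal.span {x}) '' {z | z ∈ rs} := by
    ext z; simp
  have h3 : {z | z ∈ x :: rs} = {x} ∪ {z | z ∈ rs} := by ext z; simp
  rw [h1, hk, h2, ← Ideal.map_span, Ideal.comap_map_of_surjective _ Ideal.Quotient.mk_surjective,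
    h3, Ideal.span_union, sup_comm, ← RingHom.ker_eq_comap_bot, Ideal.mk_ker]

end RegularLists

section MainInduction

open RingTheory.Sequence

theorem PdLE.congr {A X Y : Type u} [CommRing A] [AddCommGroup X] [Module A X] [AddCommGroup Y]
    [Module A Y] {n : ℕ} (h : PdLE A n X) (e : Y ≃ₗ[A] X) : PdLE A n Y :=
  fun Z _ _ i hi => (h Z i hi).congr_left e

theorem EmbedsFree.not_ev_zero {A N : Type u} [CommRing A] [AddCommGroup N] [Module A N]
    [Nontrivial N] (h : EmbedsFree A N) : ¬ EV A N A 0 := by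
  intro h0
  rw [ev_zero_iff] at h0
  obtain ⟨n, j, hj⟩ := h
  obtain ⟨x, hx⟩ := exists_ne (0 : N)
  refine hx (hj (funext fun i => ?_))
  rw [map_zero]
  exact LinearMap.congr_fun (h0.elim (LinearMap.proj i ∘ₗ j) 0) x

theorem main_induction {R S M N : Type u} [CommRing R] [IsLocalRing R] [IsNoetherianRing R]
    [CommRing S] [IsLocalRing S] [IsNoetherianRing S] [AddCommGroup M] [Module S M]
    [AddCommGroup N] [Module S N] [Module.Finite S N] [Nontrivial N] (r : ℕ) :
    ∀ {A E : Type u} [CommRing A] [IsLocalRing A] [IsNoetherianRing A] [Algebra R A]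
      [Algebra A S] [AddCommGroup E] [Module A E] [Module R E] [IsScalarTower R A E]
      [Module A M] [IsScalarTower A S M] [Module A N] [IsScalarTower A S N] {e₀ : E} {n : ℕ},
      Function.Surjective (algebraMap A S) → IsMatlis A E e₀ →
      PhiFin R (maximalIdeal R : Set R) E → GammaC R A E → (M ≃ₗ[A] (N →ₗ[A] E)) →
      PhiFin R (maximalIdeal R : Set R) (N →ₗ[A] E) → PdLE A n S →
      embDim A = embDim S + r → (∀ i, r < i → EV A N A i) →
      (∃ rs : List A, rs.length = r ∧ IsRegular A rs ∧
        RingHom.ker (algebraMap A S) = Ideal.span {x | x ∈ rs}) ∧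
      IsGorensteinInjective S M ∧ ¬ EV A N A r := by
  induction r with
  | zero =>
    intro A E _ _ _ _ _ _ _ _ _ _ _ _ _ e₀ n hS hE hφ hΓ e hN hpd hdim hev
    have : Module.Finite A S := Module.Finite.of_surjective (Algebra.linearMap A S) hS
    have : Module.Finite A N := Module.Finite.trans S N
    have hT : TotC R A E N := ⟨inferInstance, hN, fun i => hev _ (Nat.succ_pos i)⟩
    have hb := hT.bijective_algebraMap hE hφ hΓ hS hpd
    refine ⟨⟨[], rfl, isRegular_nil, ?_⟩, ?_, (hΓ.embedsFree hT).not_ev_zero⟩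
    · rw [(RingHom.injective_iff_ker_eq_bot _).1 hb.1]
      simp
    · have h1 := DualClass.isGorensteinInjective hE.inj hφ hΓ (ModuleCat.of A (N →ₗ[A] E))
        ⟨N, _, _, hT, ⟨LinearEquiv.refl _ _⟩⟩
      exact (IsGorensteinInjective.of_equiv h1 e).of_bijective hb
  | succ r ih =>
    intro A E _ _ _ _ _ _ _ _ _ _ _ _ _ e₀ n hS hE hφ hΓ e hN hpd hdim hev
    obtain ⟨x, hxk, hx2, hreg⟩ := exists_regular_notMem_sq (algebraMap A S) hS (by omega)
      (n := n) (hpd.congr ((Algebra.linearMap A S).quotKerEquivOfSurjective hS))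
    have hxm : x ∈ maximalIdeal A := by
      rw [mem_maximalIdeal, mem_nonunits_iff]
      intro hu
      have := hu.map (algebraMap A S)
      rw [RingHom.mem_ker.1 hxk] at this
      exact not_isUnit_zero this
    have := isLocalRing_quotient hxm
    let ρ : (A ⧸ Ideal.span {x}) →+* S := Ideal.Quotient.lift _ (algebraMap A S) fun a ha => by
      obtain ⟨b, rfl⟩ := Ideal.mem_span_singleton'.1 ha
      rw [map_mul, RingHom.mem_ker.1 hxk, mul_zero]
    let _ : Algebra (A ⧸ Ideal.span {x}) S := ρ.toAlgebra
    let _ : Module (A ⧸ Ideal.span {x}) M := Module.compHom M ρ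
    let _ : Module (A ⧸ Ideal.span {x}) N := Module.compHom N ρ
    have : IsScalarTower A (A ⧸ Ideal.span {x}) S := IsScalarTower.of_algebraMap_eq fun a => rfl
    have t1 : IsScalarTower (A ⧸ Ideal.span {x}) S M :=
      ⟨fun a b x => by rw [Algebra.smul_def, mul_smul]; rfl⟩
    have t2 : IsScalarTower (A ⧸ Ideal.span {x}) S N :=
      ⟨fun a b x => by rw [Algebra.smul_def, mul_smul]; rfl⟩
    have t3 : IsScalarTower A (A ⧸ Ideal.span {x}) M :=
      IsScalarTower.of_algebraMap_smul fun a y => algebraMap_smul S a y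
    have t4 : IsScalarTower A (A ⧸ Ideal.span {x}) N :=
      IsScalarTower.of_algebraMap_smul fun a y => algebraMap_smul S a y
    have hρS : Function.Surjective (algebraMap (A ⧸ Ideal.span {x}) S) := fun s => by
      obtain ⟨a, rfl⟩ := hS s
      exact ⟨Ideal.Quotient.mk _ a, rfl⟩
    have : Module.Finite (A ⧸ Ideal.span {x}) S :=
      Module.Finite.of_surjective (Algebra.linearMap _ S) hρS
    have : Module.Finite (A ⧸ Ideal.span {x}) N := Module.Finite.trans S N
    have hAB := ses_quotient hreg
    have hEF := ses_torsionBy hreg hE.inj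
    have hF := hE.torsionBy hxm
    obtain ⟨e₁⟩ := exists_dual_equiv (R := A) (X := N) hAB hEF
    obtain ⟨e₂⟩ := exists_dual_equiv (R := R) (X := N) hAB hEF
    have hφF : PhiFin R (maximalIdeal R : Set R) (Submodule.torsionBy A E x) :=
      (ses_restrictScalars (A := R) hEF).phiFin_left hφ hφ
    have hd1 := embDim_le_add_one (Ideal.Quotient.mk (Ideal.span {x}))
      Ideal.Quotient.mk_surjective Ideal.mk_ker
    have hd2 := embDim_add_one_le (Ideal.Quotient.mk (Ideal.span {x}))
      Ideal.Quotient.mk_surjective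
      (Ideal.Quotient.eq_zero_iff_mem.2 (Ideal.mem_span_singleton_self x)) hxm hx2
    obtain ⟨⟨rs, hrs, hrsr, hrsk⟩, hG, hne⟩ := ih (A := A ⧸ Ideal.span {x})
      (E := Submodule.torsionBy A E x) (n := n) hρS hF hφF
      (GammaC.quotient hE.inj hφ hAB hEF hΓ)
      (LinearEquiv.extendScalarsOfSurjective (R := A) Ideal.Quotient.mk_surjective
        (e.trans e₁.symm))
      (hN.congr e₂.symm) (PdLE.quotient hAB hx2 (hpd.mono (Nat.le_succ n))) (by omega)
      fun i hi => ev_rees_down hAB i (hev _ (by omega))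
    obtain ⟨rs', h1, h2, h3⟩ := exists_regular_lift (algebraMap A S) ρ rfl hreg hrsr hrsk
    exact ⟨⟨rs', by omega, h2, h3⟩, hG, fun h => hne (ev_rees_down hAB r h)⟩

end MainInduction

/-! ### The theorem for a given factorization -/

section Factorization

open RingTheory.Sequence

theorem isTors_of_isArtinian {S M : Type u} [CommRing S] [IsLocalRing S] [AddCommGroup M]
    [Module S M] [IsArtinian S M] : IsTors (maximalIdeal S : Set S) M := by
  intro a ha x
  obtain ⟨n, hn⟩ := IsArtinian.monotone_stabilizes (R := S) (M := M)
    { toFun := fun n => OrderDual.toDual (Submodule.span S {a ^ n • x})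
      monotone' := fun i j hij => by
        change Submodule.span S {a ^ j • x} ≤ Submodule.span S {a ^ i • x}
        rw [Submodule.span_singleton_le_iff_mem, Submodule.mem_span_singleton]
        exact ⟨a ^ (j - i), by rw [← mul_smul, ← pow_add, Nat.sub_add_cancel hij]⟩ }
  have h1 : Submodule.span S {a ^ n • x} = Submodule.span S {a ^ (n + 1) • x} :=
    hn (n + 1) (by omega)
  obtain ⟨b, hb⟩ := Submodule.mem_span_singleton.1
    (h1 ▸ Submodule.mem_span_singleton_self (R := S) (a ^ n • x))
  refine ⟨n, ?_⟩
  have hu : IsUnit (1 - b * a) := by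
    by_contra hu
    have h2 : b * a ∈ maximalIdeal S := Ideal.mul_mem_left _ _ ha
    have h3 := Ideal.add_mem _ ((mem_maximalIdeal _).2 hu) h2
    rw [sub_add_cancel] at h3
    exact (Ideal.ne_top_iff_one _).1 (maximalIdeal.isMaximal S).ne_top h3
  refine hu.smul_eq_zero.1 ?_
  rw [sub_smul, one_smul, sub_eq_zero, mul_smul, ← mul_smul a, ← pow_succ']
  exact hb.symm

theorem main_of_factorization {R S P M : Type u} [CommRing R] [IsLocalRing R] [IsNoetherianRing R]
    [CommRing S] [IsLocalRing S] [IsNoetherianRing S] [CommRing P] [IsLocalRing P]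
    [IsNoetherianRing P] [IsAdicComplete (maximalIdeal P) P] [Algebra R P] [Algebra P S]
    [AddCommGroup M] [Module S M] [Module P M] [Module R M] [IsScalarTower P S M]
    [IsScalarTower R P M] [Nontrivial M] [IsArtinian S M]
    (hS : Function.Surjective (algebraMap P S)) {e : ℕ} (hT : FlatTower R e P)
    (hdim : embDim R + e ≤ embDim P) {n : ℕ} (hpd : PdLE P n S) {g : ℕ} (hg : gidLE R g M)
    (hgd : g + embDim S ≤ embDim R) :
    IsGorensteinInjective S M ∧ g + embDim S = embDim R ∧
      ∃ rs : List P, rs.length = g + e ∧ IsRegular P rs ∧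
        RingHom.ker (algebraMap P S) = Ideal.span {x | x ∈ rs} := by
  have : IsArtinian P M := isArtinian_of_surjective_algebraMap (R := S) hS
  obtain ⟨E, _, _, e₀, hE⟩ := exists_isMatlis P
  let _ : Module R E := Module.compHom E (algebraMap R P)
  have : IsScalarTower R P E := IsScalarTower.of_algebraMap_smul fun a y => rfl
  obtain ⟨hfin, -⟩ := hE.dual_artinian (X := M)
  obtain ⟨b⟩ := hE.exists_bidual_equiv (X := M)
  have htP : IsTors (maximalIdeal P : Set P) M := isTors_of_isArtinian
  have htR : IsTors (maximalIdeal R : Set R) M := fun a ha x => by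
    obtain ⟨n, hn⟩ := htP _ (hT.map_le (Ideal.mem_map_of_mem _ ha)) x
    exact ⟨n, by rw [← hn, ← map_pow, algebraMap_smul]⟩
  have hphi : Phi R (maximalIdeal R : Set R) g ((M →ₗ[P] E) →ₗ[P] E) :=
    (hg.phi htR).congr (b.restrictScalars R)
  have hev := hT.ev_self_of_phi hE hphi
  let _ : Module S (M →ₗ[P] E) :=
    { smul := fun s φ => φ ∘ₗ (LinearMap.lsmul S M s).restrictScalars P
      one_smul := fun φ => LinearMap.ext fun x => congrArg φ (one_smul S x)
      mul_smul := fun s t φ => LinearMap.ext fun x =>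
        congrArg φ ((congrArg (· • x) (mul_comm s t)).trans (mul_smul t s x))
      smul_zero := fun s => rfl
      smul_add := fun s φ ψ => rfl
      add_smul := fun s t φ => LinearMap.ext fun x =>
        (congrArg φ (add_smul s t x)).trans (map_add φ _ _)
      zero_smul := fun φ => LinearMap.ext fun x =>
        (congrArg φ (zero_smul S x)).trans (map_zero φ) }
  have : IsScalarTower P S (M →ₗ[P] E) := IsScalarTower.of_algebraMap_smul fun a φ =>
    LinearMap.ext fun x => (congrArg φ (algebraMap_smul S a x)).trans (map_smul φ a x)
  have : Module.Finite S (M →ₗ[P] E) := Module.Finite.of_restrictScalars_finite P S _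
  have : Nontrivial (M →ₗ[P] E) := by
    obtain ⟨x, hx⟩ := exists_ne (0 : M)
    obtain ⟨φ, hφ⟩ := hE.exists_apply_ne_zero hx
    exact ⟨φ, 0, fun h => hφ (LinearMap.congr_fun h x)⟩
  obtain ⟨r, hr⟩ := Nat.exists_eq_add_of_le (show embDim S + (g + e) ≤ embDim P by omega)
  obtain ⟨⟨rs, h1, h2, h3⟩, hG, hne⟩ := main_induction (R := R) (S := S) (M := M)
    (N := M →ₗ[P] E) (g + e + r) (A := P) hS hE (hT.phiFin hE) (hT.gammaC hE) b ⟨g, hphi⟩ hpd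
    (by omega) fun i hi => hev i (by omega)
  have hr0 : r = 0 := by
    by_contra h0
    exact hne (hev _ (by omega))
  subst hr0
  exact ⟨hG, by omega, rs, h1, h2, h3⟩

end Factorization

/-! ### Numerical invariants of flat towers -/

section TowerInvariants

variable {R A : Type u} [CommRing R] [IsLocalRing R] [IsNoetherianRing R] [CommRing A]
  [IsLocalRing A] [IsNoetherianRing A] [Algebra R A]

theorem isLocalHom_of_map_eq (hm : maximalIdeal A = (maximalIdeal R).map (algebraMap R A)) :
    IsLocalHom (algebraMap R A) :=
  ((local_hom_TFAE (algebraMap R A)).out 0 2).2 hm.ge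

theorem embDim_le_of_unramified [Module.Flat R A]
    (hm : maximalIdeal A = (maximalIdeal R).map (algebraMap R A)) : embDim R ≤ embDim A := by
  classical
  have := isLocalHom_of_map_eq hm
  have : Module.FaithfullyFlat R A := Module.FaithfullyFlat.of_flat_of_isLocalHom
  let s : Set (maximalIdeal A) := {x | ∃ r ∈ maximalIdeal R, algebraMap R A r = x}
  have hs : Submodule.span A s = ⊤ := by
    rw [← (Submodule.map_injective_of_injective (maximalIdeal A).injective_subtype).eq_iff,
      Submodule.map_span, Submodule.map_top, Submodule.range_subtype]
    conv_rhs => rw [hm]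
    congr 1
    ext x
    constructor
    · rintro ⟨_, ⟨r, hr, h⟩, rfl⟩
      exact ⟨r, hr, h⟩
    · rintro ⟨r, hr, rfl⟩
      exact ⟨⟨_, hm ▸ Ideal.mem_map_of_mem _ hr⟩, ⟨r, hr, rfl⟩, rfl⟩
  rw [← CotangentSpace.span_image_eq_top_iff] at hs
  obtain ⟨b, hb, hspan, hli⟩ := exists_linearIndependent (ResidueField A)
    ((maximalIdeal A).toCotangent '' s)
  rw [hs] at hspan
  have : Finite b := hli.finite
  choose! x hx hxb using hb
  choose! c hc hcx using fun v (hv : v ∈ b) => hx hv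
  have := Fintype.ofFinite b
  let t : Finset R := Finset.univ.image fun v : b => c v
  have hcard : t.card ≤ embDim A :=
    Finset.card_image_le.trans (hli.fintype_card_le_finrank)
  refine le_trans (embDim_le_card (s := t) ?_) hcard
  rw [← Ideal.comap_map_eq_self_of_faithfullyFlat (B := A) (maximalIdeal R), ← hm,
    ← Ideal.comap_map_eq_self_of_faithfullyFlat (B := A) (Ideal.span (t : Set R))]
  congr 1
  have hx' : (maximalIdeal A).toCotangent '' (x '' b) = b := by
    rw [Set.image_image]
    exact (Set.image_congr fun v hv => hxb hv).trans (Set.image_id b)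
  rw [← hx', CotangentSpace.span_image_eq_top_iff,
    ← (Submodule.map_injective_of_injective (maximalIdeal A).injective_subtype).eq_iff,
    Submodule.map_span, Submodule.map_top, Submodule.range_subtype] at hspan
  rw [Ideal.map_span]
  refine Eq.trans ?_ hspan
  rw [Ideal.span]
  congr 1
  ext z
  constructor
  · rintro ⟨r, hr, rfl⟩
    obtain ⟨v, -, rfl⟩ := Finset.mem_image.1 hr
    exact ⟨_, ⟨v, v.2, rfl⟩, (hcx v v.2).symm⟩
  · rintro ⟨_, ⟨v, hv, rfl⟩, rfl⟩
    exact ⟨c v, Finset.mem_image.2 ⟨⟨v, hv⟩, Finset.mem_univ _, rfl⟩, hcx v hv⟩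

theorem FlatTower.embDim_le {n : ℕ} (h : FlatTower R n A) : embDim R + n ≤ embDim A := by
  induction n generalizing A with
  | zero =>
    have := h.1
    exact embDim_le_of_unramified h.2.2
  | succ n ih =>
    obtain ⟨-, _, y, hy, hy2, hreg, hB⟩ := h
    have := isLocalRing_quotient hy
    have h1 := embDim_add_one_le (Ideal.Quotient.mk (Ideal.span {y}))
      Ideal.Quotient.mk_surjective
      (Ideal.Quotient.eq_zero_iff_mem.2 (Ideal.mem_span_singleton_self y)) hy hy2
    have h2 := ih hB
    omega

theorem ringKrullDim_eq_of_unramified [Module.Flat R A]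
    (hm : maximalIdeal A = (maximalIdeal R).map (algebraMap R A)) :
    ringKrullDim A = ringKrullDim R := by
  have := isLocalHom_of_map_eq hm
  have : (maximalIdeal A).LiesOver (maximalIdeal R) := ⟨by
    rw [Ideal.under_def]
    exact (maximalIdeal_comap (algebraMap R A)).symm⟩
  have : Nontrivial (A ⧸ (maximalIdeal R).map (algebraMap R A)) := by
    rw [← hm]
    infer_instance
  have h := Ideal.height_eq_height_add_of_liesOver_of_hasGoingDown (maximalIdeal R)
    (maximalIdeal A)
  have h0 :
      (maximalIdeal A).map (Ideal.Quotient.mk ((maximalIdeal R).map (algebraMap R A))) = ⊥ := by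
    rw [hm, Ideal.map_quotient_self]
  rw [h0, Ideal.height_bot, add_zero] at h
  rw [← maximalIdeal_height_eq_ringKrullDim, h, maximalIdeal_height_eq_ringKrullDim]

theorem FlatTower.ringKrullDim_eq {n : ℕ} (h : FlatTower R n A) :
    ringKrullDim A = ringKrullDim R + n := by
  induction n generalizing A with
  | zero =>
    have := h.1
    rw [ringKrullDim_eq_of_unramified h.2.2]
    simp
  | succ n ih =>
    obtain ⟨-, _, y, hy, hy2, hreg, hB⟩ := h
    have := isLocalRing_quotient hy
    have h2 := ih hB
    rw [← ringKrullDim_quotient_span_singleton_succ_eq_ringKrullDim_of_mem_nonZeroDivisors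
      (x := y) ?_ hy, h2]
    · push_cast
      rw [add_assoc]
    · rw [mem_nonZeroDivisors_iff_right]
      exact fun a ha => hreg a (by rw [mul_comm, ha])

end TowerInvariants

/-! ### The closed fibre of a flat tower -/

section Fibre

theorem mem_map_of_mul_mem_of_flat_quotient {R A B : Type u} [CommRing R] [CommRing A]
    [CommRing B] [Algebra R A] [Algebra R B] (π : A →ₐ[R] B) (hπ : Function.Surjective π)
    {y : A} (hreg : ∀ a, y * a = 0 → a = 0) (hker : RingHom.ker π = Ideal.span {y})
    [Module.Flat R B] (I : Ideal R)
    {a : A} (ha : y * a ∈ I.map (algebraMap R A)) : a ∈ I.map (algebraMap R A) := by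
  obtain ⟨n, c, t, hsum⟩ : ∃ (n : ℕ) (c : Fin n → A) (t : Fin n → I),
      ∑ i, c i * algebraMap R A (t i) = y * a := by
    rw [Ideal.map, Ideal.span, Submodule.mem_span_image_iff_exists_fun] at ha
    obtain ⟨t, ht, c, hc⟩ := ha
    refine ⟨t.card, fun i => c (t.equivFin.symm i),
      fun i => ⟨t.equivFin.symm i, ht (Subtype.coe_prop _)⟩, ?_⟩
    rw [← hc]
    exact Fintype.sum_equiv t.equivFin.symm _ _ fun i => rfl
  have h0 : ∑ i, (t i : R) • π (c i) = 0 := by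
    have h1 : π (y * a) = 0 :=
      (RingHom.mem_ker (f := π)).1
        (hker ▸ Ideal.mul_mem_right _ _ (Ideal.mem_span_singleton_self y))
    rw [← h1, ← hsum, map_sum]
    refine Finset.sum_congr rfl fun i _ => ?_
    rw [map_mul, mul_comm, Algebra.smul_def, AlgHom.commutes]
  obtain ⟨k, r, b, hb, hr⟩ := Module.Flat.isTrivialRelation_of_sum_smul_eq_zero
    (R := R) (M := B) (f := fun i => (t i : R)) (x := fun i => π (c i)) h0
  beta_reduce at hb hr
  choose b' hb' using fun j => hπ (b j)
  have h2 : ∀ i, ∃ d, c i = ∑ j, algebraMap R A (r i j) * b' j + y * d := fun i => by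
    have h3 : c i - ∑ j, algebraMap R A (r i j) * b' j ∈ Ideal.span {y} := by
      rw [← hker, RingHom.mem_ker, map_sub, hb i, map_sum, sub_eq_zero]
      refine Finset.sum_congr rfl fun j _ => ?_
      rw [map_mul, hb', Algebra.smul_def, AlgHom.commutes]
    obtain ⟨d, hd⟩ := Ideal.mem_span_singleton'.1 h3
    exact ⟨d, by rw [mul_comm, hd]; ring⟩
  choose d hd using h2
  have h4 : ∑ i, c i * algebraMap R A (t i) = y * ∑ i, d i * algebraMap R A (t i) := by
    have h5 : ∑ i, (∑ j, algebraMap R A (r i j) * b' j) * algebraMap R A (t i) = 0 := by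
      simp_rw [Finset.sum_mul]
      rw [Finset.sum_comm]
      refine Finset.sum_eq_zero fun j _ => ?_
      have h6 := congrArg (algebraMap R A) (hr j)
      rw [map_sum, map_zero] at h6
      calc _ = (∑ i, algebraMap R A ((t i : R) * r i j)) * b' j := by
            rw [Finset.sum_mul]
            exact Finset.sum_congr rfl fun i _ => by rw [map_mul]; ring
        _ = 0 := by
            rw [show ∑ i, algebraMap R A ((t i : R) * r i j) = 0 by simpa using h6, zero_mul]
    calc _ = ∑ i, ((∑ j, algebraMap R A (r i j) * b' j) * algebraMap R A (t i)
          + y * (d i * algebraMap R A (t i))) :=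
          Finset.sum_congr rfl fun i _ => by rw [hd i]; ring
      _ = _ := by rw [Finset.sum_add_distrib, h5, zero_add, Finset.mul_sum]
  have h7 : a = ∑ i, d i * algebraMap R A (t i) := by
    rw [hsum] at h4
    exact sub_eq_zero.1 (hreg _ (by rw [mul_sub, h4, sub_self]))
  rw [h7]
  exact sum_mem fun i _ => Ideal.mul_mem_left _ _ (Ideal.mem_map_of_mem _ (t i).2)

theorem IsRegularLocal.of_equiv {A B : Type u} [CommRing A] [CommRing B] (e : A ≃+* B)
    (h : IsRegularLocal A) : IsRegularLocal B := by
  obtain ⟨h1, _, rs, hrs, hm⟩ := h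
  have : IsLocalRing B := e.isLocalRing
  refine ⟨isNoetherianRing_of_ringEquiv A e, this, rs.map e, ?_, ?_⟩
  · exact (e.toAddEquiv.isRegular_congr (List.forall₂_map_right_iff.2
      (List.forall₂_same.2 fun r _ x => map_mul e r x))).1 hrs
  · have h2 : {x | x ∈ rs.map e} = (e : A →+* B) '' {x | x ∈ rs} := by ext; simp
    rw [h2, ← Ideal.map_span, hm, map_maximalIdeal_of_surjective _ e.surjective]

theorem IsRegularLocal.of_quotient {A : Type u} [CommRing A] [IsNoetherianRing A] [IsLocalRing A]
    {x : A} (hreg : ∀ a, x * a = 0 → a = 0)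
    (h : IsRegularLocal (A ⧸ Ideal.span {x})) : IsRegularLocal A := by
  obtain ⟨-, _, rs, hrs, hm⟩ := h
  obtain ⟨rs', -, h1, h2⟩ := exists_regular_lift
    ((residue (A ⧸ Ideal.span {x})).comp (Ideal.Quotient.mk (Ideal.span {x}))) _ rfl hreg hrs
    (by rw [hm, ker_residue])
  refine ⟨inferInstance, inferInstance, rs', h1, h2.symm.trans ?_⟩
  rw [← RingHom.comap_ker, ker_residue]
  have := IsLocalHom.of_surjective (Ideal.Quotient.mk (Ideal.span {x})) Ideal.Quotient.mk_surjective
  exact maximalIdeal_comap _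

theorem FlatTower.isRegularLocal {R A : Type u} [CommRing R] [IsLocalRing R]
    [IsNoetherianRing R] [CommRing A] [IsLocalRing A] [IsNoetherianRing A] [Algebra R A] {n : ℕ}
    (h : FlatTower R n A) : IsRegularLocal (A ⧸ (maximalIdeal R).map (algebraMap R A)) := by
  have hle := h.map_le
  induction n generalizing A with
  | zero =>
    obtain ⟨-, _, hm⟩ := h
    rw [← hm]
    let _ : Field (A ⧸ maximalIdeal A) := Ideal.Quotient.field _
    refine ⟨inferInstance, inferInstance, [], isRegular_nil, ?_⟩
    simp [maximalIdeal_eq_bot]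
  | succ n ih =>
    obtain ⟨-, _, y, hy, -, hreg, hB⟩ := h
    have := isLocalRing_quotient hy
    have := hB.flat
    have h1 := ih hB hB.map_le
    let I := (maximalIdeal R).map (algebraMap R A)
    have : Nontrivial (A ⧸ I) := Ideal.Quotient.nontrivial_iff.2 fun h =>
      (maximalIdeal.isMaximal A).ne_top (top_le_iff.1 (h ▸ hle))
    have : IsLocalRing (A ⧸ I) :=
      IsLocalRing.of_surjective' (Ideal.Quotient.mk I) Ideal.Quotient.mk_surjective
    refine IsRegularLocal.of_quotient (x := Ideal.Quotient.mk I y) ?_ ?_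
    · intro a ha
      obtain ⟨a, rfl⟩ := Ideal.Quotient.mk_surjective a
      rw [← map_mul, Ideal.Quotient.eq_zero_iff_mem] at ha
      exact Ideal.Quotient.eq_zero_iff_mem.2 (mem_map_of_mul_mem_of_flat_quotient
        (Ideal.Quotient.mkₐ R (Ideal.span {y})) Ideal.Quotient.mk_surjective hreg
        (Ideal.Quotient.mkₐ_ker R _) _ ha)
    · have e := DoubleQuot.quotQuotEquivComm (Ideal.span {y}) I
      have h2 : I.map (Ideal.Quotient.mk (Ideal.span {y})) =
          (maximalIdeal R).map (algebraMap R (A ⧸ Ideal.span {y})) := by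
        rw [Ideal.map_map]; rfl
      have h3 : (Ideal.span {y}).map (Ideal.Quotient.mk I) =
          Ideal.span {Ideal.Quotient.mk I y} := by rw [Ideal.map_span, Set.image_singleton]
      rw [h2, h3] at e
      exact h1.of_equiv e

end Fibre

/-! ### Flatness in terms of colon ideals -/

section ColonFlat

variable {T A : Type u} [CommRing T] [CommRing A] [Algebra T A]

/-- `A ⧸ J` is flat over `T` modulo `I₀`, phrased through the ideals `I ≥ I₀` of `T`. -/
def ColonFlat (J : Ideal A) (I₀ : Ideal T) : Prop :=
  ∀ I : Ideal T, I₀ ≤ I → ∀ (u : T) (d : A),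
    algebraMap T A u * d ∈ I.map (algebraMap T A) ⊔ J →
      ∃ L : Ideal T, (∀ x ∈ L, u * x ∈ I) ∧ d ∈ L.map (algebraMap T A) ⊔ J

theorem ColonFlat.mono {J : Ideal A} {I₀ I₁ : Ideal T} (h : ColonFlat J I₀) (hle : I₀ ≤ I₁) :
    ColonFlat J I₁ := fun I hI => h I (hle.trans hI)

theorem exists_fin_of_mem_map {I : Ideal T} {a : A} (ha : a ∈ I.map (algebraMap T A)) :
    ∃ (n : ℕ) (c : Fin n → A) (t : Fin n → I), ∑ i, c i * algebraMap T A (t i) = a := by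
  rw [Ideal.map, Ideal.span, Submodule.mem_span_image_iff_exists_fun] at ha
  obtain ⟨t, ht, c, hc⟩ := ha
  refine ⟨t.card, fun i => c (t.equivFin.symm i),
    fun i => ⟨t.equivFin.symm i, ht (Subtype.coe_prop _)⟩, ?_⟩
  rw [← hc]
  exact Fintype.sum_equiv t.equivFin.symm _ _ fun i => rfl

theorem colonFlat_of_flat [Module.Flat T A] : ColonFlat (⊥ : Ideal A) (⊥ : Ideal T) := by
  intro I _ u d hd
  rw [sup_bot_eq] at hd
  obtain ⟨n, c, t, hsum⟩ := exists_fin_of_mem_map hd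
  have h0 : ∑ i : Fin (n + 1), (Fin.cons u (fun i => -(t i : T)) : Fin (n + 1) → T) i •
      (Fin.cons d c : Fin (n + 1) → A) i = 0 := by
    rw [Fin.sum_univ_succ]
    simp only [Fin.cons_zero, Fin.cons_succ, Algebra.smul_def, map_neg, neg_mul]
    rw [Finset.sum_neg_distrib, ← hsum, add_neg_eq_zero]
    exact Finset.sum_congr rfl fun i _ => mul_comm _ _
  obtain ⟨k, r, b, hb, hr⟩ := Module.Flat.isTrivialRelation_of_sum_smul_eq_zero
    (R := T) (M := A) (f := Fin.cons u (fun i => -(t i : T))) (x := Fin.cons d c) h0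
  refine ⟨Ideal.span (Set.range (r 0)), fun x hx => ?_, ?_⟩
  · induction hx using Submodule.span_induction with
    | mem x hx =>
      obtain ⟨j, rfl⟩ := hx
      have h1 := hr j
      rw [Fin.sum_univ_succ] at h1
      simp only [Fin.cons_zero, Fin.cons_succ] at h1
      rw [eq_neg_of_add_eq_zero_left h1]
      exact neg_mem (sum_mem fun i _ => Ideal.mul_mem_right _ _ (neg_mem (t i).2))
    | zero => simp
    | add x y _ _ hx hy => rw [mul_add]; exact add_mem hx hy
    | smul a x _ hx => rw [smul_eq_mul, mul_left_comm]; exact Ideal.mul_mem_left _ _ hx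
  · rw [sup_bot_eq]
    have h1 := hb 0
    rw [Fin.cons_zero] at h1
    rw [h1]
    refine sum_mem fun j _ => ?_
    rw [Algebra.smul_def]
    exact Ideal.mul_mem_right _ _ (Ideal.mem_map_of_mem _ (Ideal.subset_span ⟨j, rfl⟩))

/-- The `A`-submodule of `A ^ l` generated by the `T`-linear relations of `f`. -/
def relationSpan (A : Type u) [CommRing A] [Algebra T A] {l : ℕ} (f : Fin l → T) :
    Submodule A (Fin l → A) :=
  Submodule.span A ((fun (b : Fin l → T) i => algebraMap T A (b i)) '' {b | ∑ i, f i * b i = 0})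

theorem isTrivialRelation_of_mem_relationSpan {l : ℕ} {f : Fin l → T} {x : Fin l → A}
    (hx : x ∈ relationSpan A f) : Module.IsTrivialRelation f x := by
  rw [relationSpan, Submodule.mem_span_image_iff_exists_fun] at hx
  obtain ⟨t, ht, c, hc⟩ := hx
  refine ⟨t.card, fun i j => (t.equivFin.symm j : Fin l → T) i, fun j => c (t.equivFin.symm j),
    fun i => ?_, fun j => ht (Subtype.coe_prop _)⟩
  rw [← hc, Finset.sum_apply]
  refine (Fintype.sum_equiv t.equivFin.symm _ _ fun j => ?_).symm
  rw [Algebra.smul_def, Pi.smul_apply, smul_eq_mul, mul_comm]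

theorem cons_zero_mem_relationSpan {l : ℕ} {f : Fin (l + 1) → T} {x : Fin l → A}
    (hx : x ∈ relationSpan A (fun i => f i.succ)) :
    (Fin.cons 0 x : Fin (l + 1) → A) ∈ relationSpan A f := by
  induction hx using Submodule.span_induction with
  | mem x hx =>
    obtain ⟨b, hb, rfl⟩ := hx
    refine Submodule.subset_span ⟨Fin.cons 0 b, ?_, ?_⟩
    · simpa [Fin.sum_univ_succ] using hb
    · ext i
      refine Fin.cases ?_ (fun i => ?_) i <;> simp
  | zero =>
    convert zero_mem (relationSpan A f) using 1
    ext i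
    refine Fin.cases ?_ (fun i => ?_) i <;> simp
  | add x y _ _ hx hy =>
    convert add_mem hx hy using 1
    ext i
    refine Fin.cases ?_ (fun i => ?_) i <;> simp
  | smul a x _ hx =>
    convert Submodule.smul_mem _ a hx using 1
    ext i
    refine Fin.cases ?_ (fun i => ?_) i <;> simp

theorem exists_mem_relationSpan_apply_zero {l : ℕ} {f : Fin (l + 1) → T} {L : Ideal T}
    (hL : ∀ b ∈ L, f 0 * b ∈ Ideal.span (Set.range fun i : Fin l => f i.succ)) {d : A}
    (hd : d ∈ L.map (algebraMap T A)) : ∃ w ∈ relationSpan A f, w 0 = d := by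
  induction hd using Submodule.span_induction with
  | mem d hd =>
    obtain ⟨b, hb, rfl⟩ := hd
    obtain ⟨c, hc⟩ := Ideal.mem_span_range_iff_exists_fun.1 (hL b hb)
    refine ⟨_, Submodule.subset_span ⟨Fin.cons b (fun i => - c i), ?_, rfl⟩, by simp⟩
    simp [Fin.sum_univ_succ, ← hc, mul_comm]
  | zero => exact ⟨0, zero_mem _, rfl⟩
  | add x y _ _ hx hy =>
    obtain ⟨w, hw, rfl⟩ := hx
    obtain ⟨v, hv, rfl⟩ := hy
    exact ⟨w + v, add_mem hw hv, rfl⟩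
  | smul a x _ hx =>
    obtain ⟨w, hw, rfl⟩ := hx
    exact ⟨a • w, Submodule.smul_mem _ a hw, rfl⟩

theorem ColonFlat.mem_relationSpan (h : ColonFlat (⊥ : Ideal A) (⊥ : Ideal T)) {l : ℕ}
    {f : Fin l → T} {x : Fin l → A} (hx : ∑ i, algebraMap T A (f i) * x i = 0) :
    x ∈ relationSpan A f := by
  induction l with
  | zero => rw [Subsingleton.elim x 0]; exact zero_mem _
  | succ l ih =>
    rw [Fin.sum_univ_succ] at hx
    obtain ⟨L, hL, hd⟩ := h (Ideal.span (Set.range fun i : Fin l => f i.succ)) bot_le (f 0) (x 0)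
      (Ideal.mem_sup_left (by
        rw [eq_neg_of_add_eq_zero_left hx]
        exact neg_mem (sum_mem fun i _ => Ideal.mul_mem_right _ _
          (Ideal.mem_map_of_mem _ (Ideal.subset_span ⟨i, rfl⟩)))))
    rw [sup_bot_eq] at hd
    obtain ⟨w, hw, hw0⟩ := exists_mem_relationSpan_apply_zero hL hd
    have hsum : ∑ i, algebraMap T A (f i) * w i = 0 := by
      have h1 := Module.sum_smul_eq_zero_of_isTrivialRelation
        (isTrivialRelation_of_mem_relationSpan hw)
      simpa only [Algebra.smul_def] using h1
    rw [Fin.sum_univ_succ, hw0] at hsum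
    have h2 : (fun i : Fin l => x i.succ - w i.succ) ∈ relationSpan A (fun i => f i.succ) := by
      refine ih ?_
      simp only [mul_sub, Finset.sum_sub_distrib]
      linear_combination hx - hsum
    have h3 : x = w + Fin.cons 0 (fun i : Fin l => x i.succ - w i.succ) := by
      ext i
      refine Fin.cases ?_ (fun i => ?_) i <;> simp [hw0]
    rw [h3]
    exact add_mem hw (cons_zero_mem_relationSpan h2)

theorem flat_of_colonFlat (h : ColonFlat (⊥ : Ideal A) (⊥ : Ideal T)) : Module.Flat T A := by
  rw [Module.Flat.iff_forall_isTrivialRelation]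
  intro k t a hsum
  refine isTrivialRelation_of_mem_relationSpan (h.mem_relationSpan ?_)
  simpa only [Algebra.smul_def] using hsum

theorem ColonFlat.mem_of_mul_mem [IsNoetherianRing T] {𝔪 I₀ : Ideal T} [h𝔪 : 𝔪.IsMaximal]
    {q : ℕ} (hq : 𝔪 ^ q ≤ I₀) {J : Ideal A} (h : ColonFlat J I₀) {g : A}
    (hg : ∀ c, g * c ∈ 𝔪.map (algebraMap T A) ⊔ J → c ∈ 𝔪.map (algebraMap T A) ⊔ J)
    (I : Ideal T) (hI : I₀ ≤ I) (c : A) (hc : g * c ∈ I.map (algebraMap T A) ⊔ J) :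
    c ∈ I.map (algebraMap T A) ⊔ J := by
  induction I using WellFoundedGT.induction generalizing c with
  | ind I ih =>
  by_cases hqI : ∃ j, ¬ 𝔪 ^ j ≤ I
  swap
  · push Not at hqI
    have h1 := hqI 0
    rw [pow_zero, Ideal.one_eq_top, top_le_iff] at h1
    simp [h1, Ideal.map_top]
  obtain ⟨u, huI, hu⟩ : ∃ u, u ∉ I ∧ ∀ x ∈ 𝔪, u * x ∈ I := by
    classical
    have h2 : ∃ j, 𝔪 ^ j ≤ I := ⟨q, hq.trans hI⟩
    obtain ⟨j, hj⟩ : ∃ j, Nat.find h2 = j + 1 := by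
      refine Nat.exists_eq_succ_of_ne_zero fun h0 => ?_
      obtain ⟨j, hj⟩ := hqI
      have h3 := Nat.find_spec h2
      rw [h0, pow_zero, Ideal.one_eq_top, top_le_iff] at h3
      exact hj (h3 ▸ le_top)
    have h3 : ¬ 𝔪 ^ j ≤ I := Nat.find_min h2 (by omega)
    obtain ⟨u, hu, huI⟩ := Set.not_subset.1 h3
    refine ⟨u, huI, fun x hx => ?_⟩
    have h4 := Nat.find_spec h2
    rw [hj, pow_succ] at h4
    exact h4 (Ideal.mul_mem_mul hu hx)
  have hlt : I < I ⊔ Ideal.span {u} := lt_of_le_of_ne le_sup_left fun h => huI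
    (h ▸ (le_sup_right : _ ≤ I ⊔ Ideal.span {u}) (Ideal.mem_span_singleton_self u))
  have h1 := ih _ hlt (hI.trans hlt.le) c (sup_le_sup_right (Ideal.map_mono hlt.le) J hc)
  rw [Ideal.map_sup, Ideal.map_span, Set.image_singleton, sup_right_comm] at h1
  obtain ⟨c', hc', v, hv, rfl⟩ := Submodule.mem_sup.1 h1
  obtain ⟨d, rfl⟩ := Ideal.mem_span_singleton'.1 hv
  rw [mul_add] at hc
  have h2 : algebraMap T A u * (g * d) ∈ I.map (algebraMap T A) ⊔ J := by
    have := (Ideal.add_mem_iff_right _ (Ideal.mul_mem_left _ g hc')).1 hc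
    convert this using 1
    ring
  obtain ⟨L, hL, hd⟩ := h I hI u _ h2
  have hL𝔪 : L ≤ 𝔪 := fun b hb => by
    by_contra hb𝔪
    obtain ⟨z, hz⟩ := h𝔪.exists_inv hb𝔪
    obtain ⟨w, hw, h3⟩ := hz
    have h4 : u = u * w + z * (u * b) := by
      linear_combination (-u) * h3
    exact huI (h4 ▸ add_mem (hu w hw) (Ideal.mul_mem_left _ _ (hL b hb)))
  have h3 := hg d (sup_le_sup_right (Ideal.map_mono hL𝔪) J hd)
  refine add_mem hc' ?_
  obtain ⟨d', hd', j, hj, rfl⟩ := Submodule.mem_sup.1 h3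
  rw [add_mul]
  refine add_mem (Ideal.mem_sup_left ?_) (Ideal.mem_sup_right (Ideal.mul_mem_right _ _ hj))
  rw [mul_comm]
  have h5 : Ideal.map (algebraMap T A) (Ideal.span {u} * 𝔪) ≤ I.map (algebraMap T A) := by
    refine Ideal.map_mono (Ideal.span_singleton_mul_le_iff.2 fun z hz => hu z hz)
  apply h5
  rw [Ideal.map_mul, Ideal.map_span, Set.image_singleton]
  exact Ideal.mul_mem_mul (Ideal.mem_span_singleton_self _) hd'

theorem ColonFlat.sup_span [IsNoetherianRing T] {𝔪 I₀ : Ideal T} [𝔪.IsMaximal]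
    {q : ℕ} (hq : 𝔪 ^ q ≤ I₀) {J : Ideal A} (h : ColonFlat J I₀) {g : A}
    (hg : ∀ c, g * c ∈ 𝔪.map (algebraMap T A) ⊔ J → c ∈ 𝔪.map (algebraMap T A) ⊔ J) :
    ColonFlat (J ⊔ Ideal.span {g}) I₀ := by
  intro I hI u d hd
  rw [← sup_assoc] at hd
  obtain ⟨x, hx, y, hy, hxy⟩ := Submodule.mem_sup.1 hd
  obtain ⟨c, rfl⟩ := Ideal.mem_span_singleton'.1 hy
  have h1 : g * c ∈ (I ⊔ Ideal.span {u}).map (algebraMap T A) ⊔ J := by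
    have h2 : g * c = algebraMap T A u * d - x := by rw [← hxy]; ring
    rw [h2, Ideal.map_sup, Ideal.map_span, Set.image_singleton, sup_right_comm]
    exact sub_mem (Ideal.mem_sup_right (Ideal.mul_mem_right _ _ (Ideal.mem_span_singleton_self _)))
      (Ideal.mem_sup_left hx)
  have h2 := h.mem_of_mul_mem hq hg _ (hI.trans le_sup_left) c h1
  rw [Ideal.map_sup, Ideal.map_span, Set.image_singleton, sup_right_comm] at h2
  obtain ⟨c', hc', v, hv, rfl⟩ := Submodule.mem_sup.1 h2
  obtain ⟨w, rfl⟩ := Ideal.mem_span_singleton'.1 hv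
  obtain ⟨L, hL, h3⟩ := h I hI u (d - w * g) (by
    have h4 : algebraMap T A u * (d - w * g) = x + c' * g := by
      linear_combination (-1 : A) * hxy
    rw [h4]
    exact add_mem hx (Ideal.mul_mem_right _ _ hc'))
  refine ⟨L, hL, ?_⟩
  rw [← sup_assoc, ← sub_add_cancel d (w * g)]
  exact add_mem (Ideal.mem_sup_left h3)
    (Ideal.mem_sup_right (Ideal.mul_mem_left _ _ (Ideal.mem_span_singleton_self _)))

theorem ColonFlat.of_directed {ι : Type*} {g : ι → A} {I₀ : Ideal T}
    (h : ∀ F : Finset ι, ColonFlat (Ideal.span (g '' F)) I₀) :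
    ColonFlat (Ideal.span (Set.range g)) I₀ := by
  intro I hI u d hd
  obtain ⟨x, hx, y, hy, hxy⟩ := Submodule.mem_sup.1 hd
  obtain ⟨F, hF⟩ : ∃ F : Finset ι, y ∈ Ideal.span (g '' F) := by
    rw [← Set.image_univ, Ideal.span, Submodule.mem_span_image_iff_exists_fun] at hy
    obtain ⟨F, -, c, hc⟩ := hy
    refine ⟨F, hc ▸ sum_mem fun i _ => Submodule.smul_mem _ _ (Ideal.subset_span ⟨i, i.2, rfl⟩)⟩
  obtain ⟨L, hL, h1⟩ := h F I hI u d (Submodule.mem_sup.2 ⟨x, hx, y, hF, hxy⟩)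
  exact ⟨L, hL, sup_le_sup_left (α := Ideal A) (Ideal.span_mono (Set.image_subset_range g F)) _ h1⟩

end ColonFlat

/-! ### Complete local rings with finitely generated maximal ideal -/

section Complete

theorem mem_span_of_subset_sup_smul {B : Type u} [CommRing B] {I : Ideal B} [IsAdicComplete I B]
    {a : B} (ha : a ∈ I) {k : ℕ} {p : Fin k → B} {P : Set B}
    (hP : ∀ x ∈ P, ∃ c : Fin k → B, ∃ y ∈ P, x = ∑ j, c j * p j + a * y) {x : B} (hx : x ∈ P) :
    x ∈ Ideal.span (Set.range p) := by
  choose! c y hy hxy using hP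
  let s : ℕ → B := fun n => y^[n] x
  have hs : ∀ n, s n ∈ P := fun n => by
    induction n with
    | zero => exact hx
    | succ n ih =>
      have h1 : s (n + 1) = y (s n) := Function.iterate_succ_apply' y n x
      rw [h1]
      exact hy _ ih
  let C : ℕ → Fin k → B := fun n j => ∑ i ∈ Finset.range n, a ^ i * c (s i) j
  have hC : ∀ n, x = ∑ j, C n j * p j + a ^ n * s n := fun n => by
    induction n with
    | zero => simp [C, s]
    | succ n ih =>
      have h1 : s (n + 1) = y (s n) := Function.iterate_succ_apply' y n x
      have h2 : ∑ j, C (n + 1) j * p j = ∑ j, C n j * p j + a ^ n * ∑ j, c (s n) j * p j := by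
        rw [Finset.mul_sum, ← Finset.sum_add_distrib]
        refine Finset.sum_congr rfl fun j _ => ?_
        simp only [C, Finset.sum_range_succ]
        ring
      rw [h1, h2]
      conv_lhs => rw [ih, hxy (s n) (hs n)]
      ring
  have hlim : ∀ j, ∃ L, ∀ n, C n j ≡ L [SMOD (I ^ n • ⊤ : Submodule B B)] := fun j => by
    refine IsPrecomplete.prec inferInstance fun {m n} hmn => ?_
    rw [SModEq.comm, SModEq.sub_mem]
    simp only [C]
    rw [← Finset.sum_range_add_sum_Ico _ hmn, add_sub_cancel_left, smul_eq_mul, Ideal.mul_top]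
    exact sum_mem fun i hi => Ideal.mul_mem_right _ _
      (Ideal.pow_le_pow_right (Finset.mem_Ico.1 hi).1 (Ideal.pow_mem_pow ha i))
  choose L hL using hlim
  have h0 : x - ∑ j, L j * p j = 0 := by
    refine IsHausdorff.haus (inferInstance : IsHausdorff I B) _ fun n => ?_
    rw [SModEq.zero, smul_eq_mul, Ideal.mul_top]
    have h1 : x - ∑ j, L j * p j = ∑ j, (C n j - L j) * p j + a ^ n * s n := by
      conv_lhs => rw [hC n]
      simp only [sub_mul, Finset.sum_sub_distrib]
      ring
    rw [h1]
    refine add_mem (sum_mem fun j _ => Ideal.mul_mem_right _ _ ?_)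
      (Ideal.mul_mem_right _ _ (Ideal.pow_mem_pow ha n))
    have := SModEq.sub_mem.1 (hL j n)
    rwa [smul_eq_mul, Ideal.mul_top] at this
  rw [sub_eq_zero.1 h0]
  exact sum_mem fun j _ => Ideal.mul_mem_left _ _ (Ideal.subset_span ⟨j, rfl⟩)

theorem isNoetherianRing_of_isAdicComplete {B : Type u} [CommRing B] [IsLocalRing B]
    [IsAdicComplete (maximalIdeal B) B] (hfg : (maximalIdeal B).FG) : IsNoetherianRing B := by
  refine ⟨fun I₀ => ?_⟩
  by_contra hI₀
  obtain ⟨P, -, hP⟩ := zorn_le_nonempty₀ {I : Ideal B | ¬ I.FG} (fun C hC₁ hC₂ I hI =>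
    ⟨sSup C, fun h => by
      obtain ⟨G, hG⟩ := h
      obtain ⟨J, hJ, hGJ⟩ : ∃ J ∈ C, (G : Set B) ⊆ J := by
        refine hC₂.directedOn.exists_mem_subset_of_finset_subset_biUnion ⟨I, hI⟩ fun x hx => ?_
        simp only [Set.mem_iUnion, SetLike.mem_coe, exists_prop]
        exact (Submodule.mem_sSup_of_directed ⟨I, hI⟩ hC₂.directedOn).1
          (hG ▸ Submodule.subset_span hx)
      have h1 : J = sSup C := le_antisymm (le_sSup hJ) (hG ▸ Ideal.span_le.2 hGJ)
      exact hC₁ hJ (h1 ▸ ⟨G, hG⟩), fun _ => le_sSup⟩) I₀ hI₀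
  have hprime := Ideal.isOka_fg.isPrime_of_maximal_not hP
  have hPm : P ≤ maximalIdeal B := le_maximalIdeal hprime.ne_top
  obtain ⟨a, ha, haP⟩ : ∃ a ∈ maximalIdeal B, a ∉ P := by
    by_contra! h
    exact hP.1 (le_antisymm hPm h ▸ hfg)
  have hsup : (P ⊔ Ideal.span {a}).FG := by
    by_contra h
    exact haP (hP.2 h le_sup_left
      ((le_sup_right : _ ≤ P ⊔ Ideal.span {a}) (Ideal.mem_span_singleton_self a)))
  obtain ⟨k, f, hf⟩ := Submodule.fg_iff_exists_fin_generating_family.1 hsup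
  have hf' : ∀ j, ∃ p ∈ P, ∃ b, f j = p + b * a := fun j => by
    have h1 : f j ∈ P ⊔ Ideal.span {a} := hf ▸ Submodule.subset_span ⟨j, rfl⟩
    obtain ⟨p, hp, v, hv, h2⟩ := Submodule.mem_sup.1 h1
    obtain ⟨b, rfl⟩ := Ideal.mem_span_singleton'.1 hv
    exact ⟨p, hp, b, h2.symm⟩
  choose p hpP b hb using hf'
  have hle : P ≤ Ideal.span (Set.range p) := fun x hx => by
    refine mem_span_of_subset_sup_smul ha (P := (P : Set B)) (fun x hx => ?_) hx
    have h1 : x ∈ Ideal.span (Set.range f) := by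
      rw [Ideal.span, hf]
      exact Ideal.mem_sup_left hx
    obtain ⟨c, hc⟩ := Ideal.mem_span_range_iff_exists_fun.1 h1
    have h2 : x = ∑ j, c j * p j + a * ∑ j, c j * b j := by
      rw [← hc, Finset.mul_sum, ← Finset.sum_add_distrib]
      exact Finset.sum_congr rfl fun j _ => by rw [hb]; ring
    refine ⟨c, _, (hprime.mem_or_mem (?_ : a * _ ∈ P)).resolve_left haP, h2⟩
    have h3 : a * ∑ j, c j * b j = x - ∑ j, c j * p j := by rw [h2]; ring
    rw [h3]
    exact sub_mem hx (sum_mem fun j _ => Ideal.mul_mem_left _ _ (hpP j))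
  exact hP.1 (le_antisymm hle (Ideal.span_le.2 (by rintro _ ⟨j, rfl⟩; exact hpP j)) ▸
    ⟨(Set.finite_range p).toFinset, by simp⟩)

variable {T A B : Type u} [CommRing T] [CommRing A] [Algebra T A] [CommRing B] [Algebra T B]

theorem mem_of_forall_mem_sup_pow [IsNoetherianRing A] [IsLocalRing A] {J I : Ideal A}
    (hI : I ≤ maximalIdeal A) {d : A} (h : ∀ n, d ∈ J ⊔ I ^ n) : d ∈ J := by
  rw [← Submodule.Quotient.mk_eq_zero (p := J), ← Submodule.mem_bot A,
    ← Ideal.iInf_pow_smul_eq_bot_of_isLocalRing (M := A ⧸ J) I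
      (ne_top_of_le_ne_top (maximalIdeal.isMaximal A).ne_top hI), Submodule.mem_iInf]
  intro n
  obtain ⟨x, hx, y, hy, rfl⟩ := Submodule.mem_sup.1 (h n)
  rw [Submodule.Quotient.mk_add, (Submodule.Quotient.mk_eq_zero (p := J)).2 hx, zero_add]
  have h1 : (Submodule.Quotient.mk y : A ⧸ J) = y • Submodule.Quotient.mk (p := J) 1 := by
    rw [← Submodule.Quotient.mk_smul, smul_eq_mul, mul_one]
  rw [h1]
  exact Submodule.smul_mem_smul hy trivial

theorem colonFlat_of_forall_pow [IsNoetherianRing T] [IsNoetherianRing A] [IsLocalRing A]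
    {𝔪 : Ideal T} (hm : 𝔪.map (algebraMap T A) ≤ maximalIdeal A)
    (h : ∀ q, ColonFlat (⊥ : Ideal A) (𝔪 ^ q)) : ColonFlat (⊥ : Ideal A) (⊥ : Ideal T) := by
  intro I _ u d hd
  rw [sup_bot_eq] at hd
  refine ⟨Submodule.comap (LinearMap.mulLeft T u) I, fun x hx => hx, ?_⟩
  rw [sup_bot_eq]
  refine mem_of_forall_mem_sup_pow hm fun n => ?_
  obtain ⟨k, hk⟩ := 𝔪.exists_pow_inf_eq_pow_smul (M := T ⧸ I)
    (Submodule.span T {Submodule.Quotient.mk u})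
  obtain ⟨L, hL, hdL⟩ := h (n + k) (I ⊔ 𝔪 ^ (n + k)) le_sup_right u d
    (by rw [sup_bot_eq]; exact Ideal.map_mono le_sup_left hd)
  rw [sup_bot_eq] at hdL
  have hle : L ≤ Submodule.comap (LinearMap.mulLeft T u) I ⊔ 𝔪 ^ n := fun x hx => by
    obtain ⟨i, hi, w, hw, hiw⟩ := Submodule.mem_sup.1 (hL x hx)
    have h1 : (Submodule.Quotient.mk w : T ⧸ I) = x • Submodule.Quotient.mk (p := I) u := by
      rw [← Submodule.Quotient.mk_smul, Submodule.Quotient.eq]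
      have : w - x • u = - i := by rw [smul_eq_mul, mul_comm x u, ← hiw]; ring
      rw [this]
      exact neg_mem hi
    have h2 : (Submodule.Quotient.mk w : T ⧸ I) ∈
        𝔪 ^ (n + k) • (⊤ : Submodule T (T ⧸ I)) ⊓ Submodule.span T {Submodule.Quotient.mk u} := by
      refine ⟨?_, h1 ▸ Submodule.smul_mem _ _ (Submodule.mem_span_singleton_self _)⟩
      have h3 : (Submodule.Quotient.mk w : T ⧸ I) = w • Submodule.Quotient.mk (p := I) 1 := by
        rw [← Submodule.Quotient.mk_smul, smul_eq_mul, mul_one]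
      rw [h3]
      exact Submodule.smul_mem_smul hw trivial
    rw [hk _ (Nat.le_add_left k n), Nat.add_sub_cancel] at h2
    have h3 := Submodule.smul_mono (le_refl (𝔪 ^ n)) inf_le_right h2
    obtain ⟨z, hz, hzw⟩ := Submodule.mem_smul_span_singleton.1 h3
    rw [h1, ← sub_eq_zero, ← sub_smul, ← Submodule.Quotient.mk_smul,
      Submodule.Quotient.mk_eq_zero] at hzw
    refine Submodule.mem_sup.2 ⟨x - z, ?_, z, hz, by ring⟩
    rw [Submodule.mem_comap, LinearMap.mulLeft_apply]
    convert neg_mem hzw using 1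
    rw [smul_eq_mul]
    ring
  have h4 := Ideal.map_mono (f := algebraMap T A) hle hdL
  rwa [Ideal.map_sup, Ideal.map_pow] at h4

theorem ColonFlat.of_approx {J : Ideal A} {I₀ : Ideal T} (h : ColonFlat J I₀) (φ : A →ₐ[T] B)
    (hJ : ∀ a ∈ J, φ a = 0) (hsurj : ∀ b, ∃ a, b - φ a ∈ I₀.map (algebraMap T B))
    (hker : ∀ a, φ a ∈ I₀.map (algebraMap T B) → a ∈ I₀.map (algebraMap T A) ⊔ J) :
    ColonFlat (⊥ : Ideal B) I₀ := by
  have hφ : ∀ L : Ideal T, ∀ a ∈ L.map (algebraMap T A), φ a ∈ L.map (algebraMap T B) :=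
    fun L a ha => by
      have h1 := Ideal.mem_map_of_mem (φ : A →+* B) ha
      rwa [Ideal.map_map, AlgHom.comp_algebraMap] at h1
  intro I hI u b hb
  rw [sup_bot_eq] at hb
  have happ : ∀ b ∈ I.map (algebraMap T B), ∃ a ∈ I.map (algebraMap T A),
      b - φ a ∈ I₀.map (algebraMap T B) := fun b hb => by
    induction hb using Submodule.span_induction with
    | mem b hb =>
      obtain ⟨i, hi, rfl⟩ := hb
      exact ⟨algebraMap T A i, Ideal.mem_map_of_mem _ hi, by simp⟩
    | zero => exact ⟨0, zero_mem _, by simp⟩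
    | add x y _ _ hx hy =>
      obtain ⟨a, ha, hxa⟩ := hx
      obtain ⟨c, hc, hyc⟩ := hy
      exact ⟨a + c, add_mem ha hc, by rw [map_add, add_sub_add_comm]; exact add_mem hxa hyc⟩
    | smul z x _ hx =>
      obtain ⟨a, ha, hxa⟩ := hx
      obtain ⟨e, he⟩ := hsurj z
      refine ⟨e * a, Ideal.mul_mem_left _ _ ha, ?_⟩
      have h1 : z • x - φ (e * a) = z * (x - φ a) + (z - φ e) * φ a := by
        rw [smul_eq_mul, map_mul]; ring
      rw [h1]
      exact add_mem (Ideal.mul_mem_left _ _ hxa) (Ideal.mul_mem_right _ _ he)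
  obtain ⟨a, ha⟩ := hsurj b
  have h1 : algebraMap T B u * φ a ∈ I.map (algebraMap T B) := by
    have h2 : algebraMap T B u * φ a = algebraMap T B u * b - algebraMap T B u * (b - φ a) := by
      ring
    rw [h2]
    exact sub_mem hb (Ideal.mul_mem_left _ _ (Ideal.map_mono hI ha))
  obtain ⟨a', ha', h2⟩ := happ _ h1
  rw [← AlgHom.commutes φ, ← map_mul, ← map_sub] at h2
  have h3 := hker _ h2
  obtain ⟨L, hL, h4⟩ := h I hI u a (by
    rw [← sub_add_cancel (algebraMap T A u * a) a']
    exact add_mem (sup_le_sup_right (α := Ideal A) (Ideal.map_mono hI) J h3)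
      (Ideal.mem_sup_left ha'))
  refine ⟨L ⊔ I₀, fun x hx => ?_, ?_⟩
  · obtain ⟨y, hy, z, hz, rfl⟩ := Submodule.mem_sup.1 hx
    rw [mul_add]
    exact add_mem (hL y hy) (hI (Ideal.mul_mem_left _ _ hz))
  · obtain ⟨y, hy, z, hz, rfl⟩ := Submodule.mem_sup.1 h4
    rw [sup_bot_eq, Ideal.map_sup, ← sub_add_cancel b (φ (y + z))]
    refine add_mem (Ideal.mem_sup_right ha) (Ideal.mem_sup_left ?_)
    rw [map_add, hJ z hz, add_zero]
    exact hφ L y hy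

end Complete

/-! ### Completing an algebra which is flat modulo all powers of a maximal ideal -/

section Completion

variable {T A : Type u} [CommRing T] [CommRing A] [Algebra T A]

theorem mem_map_pow_adicCompletion_iff {𝔪 : Ideal T} (hfg : 𝔪.FG) (q : ℕ)
    (x : AdicCompletion (𝔪.map (algebraMap T A)) A) :
    x ∈ (𝔪 ^ q).map (algebraMap T (AdicCompletion (𝔪.map (algebraMap T A)) A)) ↔
      AdicCompletion.evalₐ (𝔪.map (algebraMap T A)) q x = 0 := by
  have h1 : (𝔪 ^ q).map (algebraMap T (AdicCompletion (𝔪.map (algebraMap T A)) A)) =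
      ((𝔪.map (algebraMap T A)) ^ q).map
        (algebraMap A (AdicCompletion (𝔪.map (algebraMap T A)) A)) := by
    rw [IsScalarTower.algebraMap_eq T A (AdicCompletion (𝔪.map (algebraMap T A)) A),
      ← Ideal.map_map, Ideal.map_pow (algebraMap T A)]
  have h2 := AdicCompletion.pow_smul_top_eq_ker_eval (I := 𝔪.map (algebraMap T A)) (M := A) (n := q)
    (hfg.map _)
  rw [Ideal.smul_top_eq_map] at h2
  rw [h1, ← Submodule.restrictScalars_mem A, h2, LinearMap.mem_ker]
  constructor <;> intro h
  · rw [← AdicCompletion.factor_eval_eq_evalₐ _ _ (le_of_eq (Ideal.mul_top _)), h, map_zero]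
  · rw [← AdicCompletion.factor_evalₐ_eq_eval _ _ (le_of_eq (Ideal.mul_top _).symm), h, map_zero]

theorem exists_complete_of_colonFlat {S : Type u} [CommRing S] [IsLocalRing S]
    [IsAdicComplete (maximalIdeal S) S] [Algebra T S] [IsNoetherianRing T] {𝔪 : Ideal T}
    (hmS : 𝔪.map (algebraMap T S) ≤ maximalIdeal S)
    (hmA : (𝔪.map (algebraMap T A)).IsMaximal)
    (hflat : ∀ q, ColonFlat (⊥ : Ideal A) (𝔪 ^ q))
    (φ : A →ₐ[T] S) (hφ : Function.Surjective φ) :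
    ∃ (P : Type u) (_ : CommRing P) (_ : IsLocalRing P) (_ : Algebra T P),
      IsNoetherianRing P ∧ IsAdicComplete (maximalIdeal P) P ∧ Module.Flat T P ∧
      maximalIdeal P = 𝔪.map (algebraMap T P) ∧ ∃ ψ : P →ₐ[T] S, Function.Surjective ψ := by
  have hfg : 𝔪.FG := IsNoetherian.noetherian 𝔪
  let N := 𝔪.map (algebraMap T A)
  have hNfg : N.FG := hfg.map _
  let P := AdicCompletion N A
  have h1 : 𝔪.map (algebraMap T P) = N.map (algebraMap A P) := by
    rw [IsScalarTower.algebraMap_eq T A P, ← Ideal.map_map]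
  have h2 : (N.map (algebraMap A P)).IsMaximal :=
    AdicCompletion.isMaximal_map_of_le N N le_rfl hNfg
  have h3 : IsAdicComplete (N.map (algebraMap A P)) P := AdicCompletion.isAdicComplete_self N hNfg
  have hloc : IsLocalRing P := isLocalRing_of_isAdicComplete_maximal (N.map (algebraMap A P))
  have hmax : maximalIdeal P = N.map (algebraMap A P) := (eq_maximalIdeal h2).symm
  have hcomp : IsAdicComplete (maximalIdeal P) P := hmax ▸ h3
  have hnoeth : IsNoetherianRing P := isNoetherianRing_of_isAdicComplete (hmax ▸ hNfg.map _)
  have hcf : ∀ q, ColonFlat (⊥ : Ideal P) (𝔪 ^ q) := fun q => by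
    refine (hflat q).of_approx (IsScalarTower.toAlgHom T A P) (fun a ha => ?_) (fun b => ?_)
      (fun a ha => ?_)
    · rw [(Submodule.mem_bot A).1 ha, map_zero]
    · obtain ⟨a, ha⟩ := Ideal.Quotient.mk_surjective (AdicCompletion.evalₐ N q b)
      refine ⟨a, (mem_map_pow_adicCompletion_iff hfg q _).2 ?_⟩
      rw [map_sub, ← ha, sub_eq_zero]
      exact (AlgHom.commutes (AdicCompletion.evalₐ N q) a).symm
    · have h4 := (mem_map_pow_adicCompletion_iff hfg q _).1 ha
      have h5 : AdicCompletion.evalₐ N q (algebraMap A P a) = Ideal.Quotient.mk (N ^ q) a :=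
        AlgHom.commutes (AdicCompletion.evalₐ N q) a
      rw [IsScalarTower.toAlgHom_apply, h5, Ideal.Quotient.eq_zero_iff_mem] at h4
      rw [sup_bot_eq, Ideal.map_pow]
      exact h4
  refine ⟨P, inferInstance, hloc, inferInstance, hnoeth, hcomp,
    flat_of_colonFlat (colonFlat_of_forall_pow (h1.trans hmax.symm).le hcf), hmax.trans h1.symm, ?_⟩
  have hN : ∀ n, N ^ n ≤ ((maximalIdeal S) ^ n).comap φ := fun n => by
    rw [← Ideal.map_le_iff_le_comap]
    refine (Ideal.map_pow φ N n).le.trans (Ideal.pow_right_mono ?_ n)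
    refine le_trans (le_of_eq ?_) hmS
    change (𝔪.map (algebraMap T A)).map (φ : A →+* S) = _
    rw [Ideal.map_map, AlgHom.comp_algebraMap]
  let f : (n : ℕ) → P →ₐ[T] S ⧸ (maximalIdeal S) ^ n := fun n =>
    (Ideal.quotientMapₐ _ φ (hN n)).comp ((AdicCompletion.evalₐ N n).restrictScalars T)
  have hf : ∀ {m n : ℕ} (hle : m ≤ n),
      (Ideal.Quotient.factorₐ T (Ideal.pow_le_pow_right hle)).comp (f n) = f m := by
    intro m n hle
    ext x
    obtain ⟨r, rfl⟩ := AdicCompletion.mk_surjective N A x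
    have h6 : AdicCompletion.evalₐ N m (AdicCompletion.mk N A r) =
        Ideal.Quotient.mk (N ^ m) (r.val n) := by
      rw [AdicCompletion.evalₐ_mk]
      exact (AdicCompletion.Ideal.mk_eq_mk N hle r).symm
    change Ideal.Quotient.factorₐ T (Ideal.pow_le_pow_right hle)
      (Ideal.quotientMapₐ _ φ (hN n) (AdicCompletion.evalₐ N n
      (AdicCompletion.mk N A r))) =
      Ideal.quotientMapₐ _ φ (hN m) (AdicCompletion.evalₐ N m (AdicCompletion.mk N A r))
    rw [AdicCompletion.evalₐ_mk, h6]
    rfl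
  let ψ := IsAdicComplete.liftAlgHom (maximalIdeal S) f hf
  refine ⟨ψ, fun s => ?_⟩
  obtain ⟨a, rfl⟩ := hφ s
  refine ⟨algebraMap A P a, ?_⟩
  refine sub_eq_zero.1 (IsHausdorff.haus (inferInstance : IsHausdorff (maximalIdeal S) S) _
    fun n => ?_)
  rw [SModEq.zero, smul_eq_mul, Ideal.mul_top, ← Ideal.Quotient.eq_zero_iff_mem, map_sub,
    sub_eq_zero, IsAdicComplete.mk_liftAlgHom]
  change Ideal.quotientMapₐ _ φ (hN n) (AdicCompletion.evalₐ N n (algebraMap A P a)) = _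
  have h5 : AdicCompletion.evalₐ N n (algebraMap A P a) = Ideal.Quotient.mk (N ^ n) a :=
    AlgHom.commutes (AdicCompletion.evalₐ N n) a
  rw [h5]
  rfl

end Completion

/-! ### Presentations of integral algebras which are fields -/

section Presentation

open MvPolynomial

theorem mem_map_iff_of_bijective {A B : Type*} [CommRing A] [CommRing B] (f : A →+* B)
    (hf : Function.Bijective f) (I : Ideal A) (a : A) : f a ∈ I.map f ↔ a ∈ I := by
  rw [← Ideal.mem_comap, Ideal.comap_map_of_bijective f hf]

/-- Integral field extensions: subalgebras are closed under inverses. -/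
theorem exists_mul_eq_one_of_mem {T L : Type*} [CommRing T] [Field L] [Algebra T L]
    [Algebra.IsIntegral T L] (D : Subalgebra T L) {y : L} (hy : y ∈ D) (h0 : y ≠ 0) :
    ∃ z ∈ D, y * z = 1 := by
  have : Algebra.IsIntegral D L :=
    ⟨fun x => (Algebra.IsIntegral.isIntegral (R := T) x).tower_top⟩
  have h1 : IsField D := isField_of_isIntegral_of_isField (S := L) Subtype.val_injective
    (Field.toIsField L)
  obtain ⟨z, hz⟩ := h1.mul_inv_cancel (a := ⟨y, hy⟩) fun h => h0 (congrArg Subtype.val h)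
  exact ⟨z, z.2, congrArg Subtype.val hz⟩

variable {T ι : Type*} [CommRing T]

theorem exists_equiv_polynomial (s : ι) :
    ∃ Φ : MvPolynomial ι T ≃ₐ[T] Polynomial (MvPolynomial {t // t ≠ s} T),
      Φ (X s) = Polynomial.X ∧ ∀ t (ht : t ≠ s), Φ (X t) = Polynomial.C (X ⟨t, ht⟩) := by
  classical
  refine ⟨(renameEquiv T (Equiv.optionSubtypeNe s).symm).trans (optionEquivLeft T {t // t ≠ s}),
    ?_, fun t ht => ?_⟩
  · simp [optionEquivLeft_X_none]
  · simp [Equiv.optionSubtypeNe_symm_of_ne ht, optionEquivLeft_X_some]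

/-- A monic polynomial in `X s` over polynomials not involving `s` is a nonzerodivisor modulo
any ideal generated by polynomials not involving `s`. -/
theorem mem_of_monic_mul_mem (s : ι) (P : Polynomial (MvPolynomial ι T)) (hP : P.Monic)
    (hcoeff : ∀ i, P.coeff i ∈ supported T ({s}ᶜ : Set ι)) {G : Set (MvPolynomial ι T)}
    (hG : G ⊆ supported T ({s}ᶜ : Set ι)) {c : MvPolynomial ι T}
    (hc : P.eval (X s) * c ∈ Ideal.span G) : c ∈ Ideal.span G := by
  classical
  obtain ⟨Φ, hXs, hX⟩ := exists_equiv_polynomial (T := T) s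
  have hconst : ∀ b ∈ supported T ({s}ᶜ : Set ι), ∃ d, Φ b = Polynomial.C d := by
    intro b hb
    have hle : supported T ({s}ᶜ : Set ι) ≤
        (Polynomial.CAlgHom (R := T) (A := MvPolynomial {t // t ≠ s} T)).range.comap
          (Φ : MvPolynomial ι T →ₐ[T] _) := by
      rw [supported_eq_adjoin_X, Algebra.adjoin_le_iff]
      rintro _ ⟨t, ht, rfl⟩
      exact ⟨X ⟨t, ht⟩, (hX t ht).symm⟩
    obtain ⟨d, hd⟩ := hle hb
    exact ⟨d, hd.symm⟩
  let J : Ideal (MvPolynomial {t // t ≠ s} T) := Ideal.span {d | ∃ b ∈ G, Φ b = Polynomial.C d}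
  have hJ : (Ideal.span G).map (Φ : MvPolynomial ι T →+* _) = J.map Polynomial.C := by
    rw [Ideal.map_span, Ideal.map_span]
    congr 1
    ext x
    constructor
    · rintro ⟨b, hb, rfl⟩
      obtain ⟨d, hd⟩ := hconst b (hG hb)
      exact ⟨d, ⟨b, hb, hd⟩, hd.symm⟩
    · rintro ⟨d, ⟨b, hb, hd⟩, rfl⟩
      exact ⟨b, hb, hd⟩
  have hmem : ∀ a, a ∈ Ideal.span G ↔ Φ a ∈ J.map Polynomial.C := fun a => by
    rw [← hJ]
    exact (mem_map_iff_of_bijective _ Φ.bijective _ _).symm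
  choose d hd using fun i => hconst _ (hcoeff i)
  let π := Ideal.Quotient.mk J
  have hmem' : ∀ a, a ∈ Ideal.span G ↔ Polynomial.mapRingHom π (Φ a) = 0 := fun a => by
    rw [hmem, Ideal.mem_map_C_iff, Polynomial.ext_iff]
    simp only [Polynomial.coe_mapRingHom, Polynomial.coeff_map, Polynomial.coeff_zero, π,
      Ideal.Quotient.eq_zero_iff_mem]
  have hcoe : ∀ i, (Φ (P.eval (X s))).coeff i = d i := by
    have h1 : Φ (P.eval (X s)) = ∑ i ∈ P.support, Polynomial.monomial i (d i) := by
      rw [Polynomial.eval_eq_sum, Polynomial.sum, map_sum]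
      refine Finset.sum_congr rfl fun i _ => ?_
      rw [map_mul, map_pow, hXs, hd, Polynomial.C_mul_X_pow_eq_monomial]
    intro i
    rw [h1, Polynomial.finsetSum_coeff]
    simp only [Polynomial.coeff_monomial]
    rw [Finset.sum_ite_eq']
    split_ifs with hi
    · rfl
    · rw [Polynomial.notMem_support_iff] at hi
      have := hd i
      rw [hi, map_zero] at this
      exact (Polynomial.C_eq_zero.1 this.symm).symm
  have hmon : (Φ (P.eval (X s))).Monic := by
    refine Polynomial.monic_of_natDegree_le_of_coeff_eq_one P.natDegree ?_ ?_
    · rw [Polynomial.natDegree_le_iff_coeff_eq_zero]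
      intro i hi
      rw [hcoe]
      have := hd i
      rw [Polynomial.coeff_eq_zero_of_natDegree_lt hi, map_zero] at this
      exact Polynomial.C_eq_zero.1 this.symm
    · rw [hcoe]
      have := hd P.natDegree
      rw [hP.coeff_natDegree, map_one] at this
      exact Polynomial.C_injective (this.symm.trans Polynomial.C_1.symm)
  rw [hmem', map_mul, map_mul] at hc
  rw [hmem']
  exact (hmon.map π).mul_right_eq_zero_iff.1 hc

end Presentation

section Presentation

open MvPolynomial

variable {T ι L : Type*} [CommRing T] [Field L] [Algebra T L] [Algebra.IsIntegral T L]
  [LinearOrder ι] (θ : MvPolynomial ι T →ₐ[T] L)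

theorem exists_minimal_monic (s : ι) :
    ∃ P : Polynomial (supported T (Set.Iio s)), P.Monic ∧
      θ (Polynomial.aeval (X s : MvPolynomial ι T) P) = 0 ∧
      ∀ M : Polynomial (supported T (Set.Iio s)), M.Monic →
        θ (Polynomial.aeval (X s : MvPolynomial ι T) M) = 0 → P.natDegree ≤ M.natDegree := by
  classical
  have hex : ∃ n, ∃ P : Polynomial (supported T (Set.Iio s)), P.Monic ∧
      θ (Polynomial.aeval (X s : MvPolynomial ι T) P) = 0 ∧ P.natDegree = n := by
    obtain ⟨q, hq, hq0⟩ := Algebra.IsIntegral.isIntegral (R := T) (θ (X s))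
    refine ⟨_, q.map (algebraMap T (supported T (Set.Iio s))), hq.map _, ?_, rfl⟩
    rw [Polynomial.aeval_map_algebraMap, ← Polynomial.aeval_algHom_apply]
    exact hq0
  obtain ⟨P, hP, h0, hn⟩ := Nat.find_spec hex
  exact ⟨P, hP, h0, fun M hM hM0 => hn.le.trans (Nat.find_min' hex ⟨M, hM, hM0, rfl⟩)⟩

theorem exists_aeval_eq {s : ι} {a : MvPolynomial ι T} (ha : a ∈ supported T (Set.Iic s)) :
    ∃ F : Polynomial (supported T (Set.Iio s)),
      Polynomial.aeval (X s : MvPolynomial ι T) F = a := by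
  have hle : supported T (Set.Iic s) ≤
      ((Polynomial.aeval (R := supported T (Set.Iio s))
        (X s : MvPolynomial ι T)).restrictScalars T).range := by
    rw [supported_eq_adjoin_X, Algebra.adjoin_le_iff]
    rintro _ ⟨t, ht, rfl⟩
    rcases (Set.mem_Iic.1 ht).lt_or_eq with h | rfl
    · exact ⟨Polynomial.C ⟨X t, by
        rw [supported_eq_adjoin_X]; exact Algebra.subset_adjoin ⟨t, h, rfl⟩⟩,
        Polynomial.aeval_C _ _⟩
    · exact ⟨Polynomial.X, Polynomial.aeval_X _⟩
  exact hle ha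

theorem aeval_mem_of_minimal {B A K : Type*} [CommRing B] [CommRing A] [Algebra B A] [Field K]
    (θ : A →+* K) (x : A) {P : Polynomial B} (hP : P.Monic)
    (hP0 : θ (Polynomial.aeval x P) = 0)
    (hmin : ∀ M : Polynomial B, M.Monic →
        θ (Polynomial.aeval x M) = 0 → P.natDegree ≤ M.natDegree)
    (hinv : ∀ c : B, θ (algebraMap B A c) ≠ 0 →
      ∃ v : B, θ (algebraMap B A c) * θ (algebraMap B A v) = 1)
    {I : Ideal A} (hI : ∀ c : B, θ (algebraMap B A c) = 0 → algebraMap B A c ∈ I)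
    (hPI : Polynomial.aeval x P ∈ I) (n : ℕ)
    (F : Polynomial B) (hn : F.degree < n)
    (hF : θ (Polynomial.aeval x F) = 0) :
    Polynomial.aeval x F ∈ I := by
  induction n generalizing F with
  | zero =>
    rw [Polynomial.degree_lt_iff_coeff_zero] at hn
    have : F = 0 := Polynomial.ext fun i => hn i (Nat.zero_le i)
    rw [this, map_zero]
    exact zero_mem I
  | succ n ih =>
    have hlow : ∀ G : Polynomial B, (∀ i, n < i → G.coeff i = 0) →
        G.coeff n = 0 → G.degree < n := fun G h1 h2 => by
      rw [Polynomial.degree_lt_iff_coeff_zero]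
      intro i hi
      rcases hi.lt_or_eq with h | rfl
      · exact h1 i h
      · exact h2
    have hFn : ∀ i, n < i → F.coeff i = 0 := fun i hi =>
      (Polynomial.degree_lt_iff_coeff_zero _ _).1 hn i hi
    set c := F.coeff n with hc
    by_cases h0 : θ (algebraMap B A c) = 0
    · have h1 := hI c h0
      have h2 : Polynomial.aeval x (Polynomial.monomial n c) ∈ I := by
        rw [Polynomial.aeval_monomial]
        exact Ideal.mul_mem_right _ _ h1
      have h3 : θ (Polynomial.aeval x (Polynomial.monomial n c)) = 0 := by
        rw [Polynomial.aeval_monomial, map_mul]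
        exact mul_eq_zero_of_left h0 _
      have h4 := ih (F - Polynomial.monomial n c)
        (hlow _ (fun i hi => by
          rw [Polynomial.coeff_sub, hFn i hi, Polynomial.coeff_monomial, if_neg hi.ne, sub_zero])
          (by rw [Polynomial.coeff_sub, Polynomial.coeff_monomial, if_pos rfl, sub_self]))
        (by rw [map_sub, map_sub, hF, h3, sub_zero])
      have h5 := add_mem h4 h2
      rwa [← map_add, sub_add_cancel] at h5
    · obtain ⟨v, hvz⟩ := hinv c h0
      have hdeg : P.natDegree ≤ n := by
        let M : Polynomial B :=
          Polynomial.C v * F - Polynomial.monomial n (v * c - 1)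
        have hMc : ∀ i, n < i → M.coeff i = 0 := fun i hi => by
          simp only [M, Polynomial.coeff_sub, Polynomial.coeff_C_mul, hFn i hi,
            Polynomial.coeff_monomial, if_neg hi.ne, mul_zero, sub_zero]
        have hMn : M.coeff n = 1 := by
          simp only [M, Polynomial.coeff_sub, Polynomial.coeff_C_mul, Polynomial.coeff_monomial,
            if_pos, ← hc, sub_sub_cancel]
        have hMd : M.natDegree ≤ n := Polynomial.natDegree_le_iff_coeff_eq_zero.2 hMc
        refine (hmin M (Polynomial.monic_of_natDegree_le_of_coeff_eq_one n hMd hMn) ?_).trans hMd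
        have h1 : θ (algebraMap B A (v * c - 1)) = 0 := by
          rw [map_sub, map_sub, map_mul, map_mul, map_one, map_one, mul_comm, hvz, sub_self]
        rw [map_sub, map_sub, map_mul, map_mul, hF, mul_zero, Polynomial.aeval_monomial, map_mul]
        rw [zero_sub, neg_eq_zero]
        exact mul_eq_zero_of_left h1 _
      let Q : Polynomial B := Polynomial.monomial (n - P.natDegree) c * P
      have hQ : Polynomial.aeval x Q ∈ I := by
        rw [map_mul]
        exact Ideal.mul_mem_left _ _ hPI
      have hQ0 : θ (Polynomial.aeval x Q) = 0 := by
        rw [map_mul, map_mul, hP0, mul_zero]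
      have hQd : Q.natDegree ≤ n := by
        refine Polynomial.natDegree_mul_le.trans ?_
        have := Polynomial.natDegree_monomial_le (m := n - P.natDegree) c
        omega
      have hQn : Q.coeff n = c := by
        have h1 : n = P.natDegree + (n - P.natDegree) := by omega
        have h2 : Q.coeff (P.natDegree + (n - P.natDegree)) = c * P.coeff P.natDegree :=
          Polynomial.coeff_monomial_mul _ _ _ _
        rw [← h1, hP.coeff_natDegree, mul_one] at h2
        exact h2
      have h4 := ih (F - Q) (hlow _ (fun i hi => by
          rw [Polynomial.coeff_sub, hFn i hi,
            Polynomial.coeff_eq_zero_of_natDegree_lt (hQd.trans_lt hi), sub_zero])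
          (by rw [Polynomial.coeff_sub, hQn, ← hc, sub_self]))
        (by rw [map_sub, map_sub, hF, hQ0, sub_zero])
      have h5 := add_mem h4 hQ
      rwa [← map_add, sub_add_cancel] at h5

theorem mem_of_forall_supported [WellFoundedLT ι] {I : Ideal (MvPolynomial ι T)}
    (hC : ∀ c : T, algebraMap T L c = 0 → C c ∈ I)
    (hstep : ∀ s, (∀ a ∈ supported T (Set.Iio s), θ a = 0 → a ∈ I) →
      ∀ a ∈ supported T (Set.Iic s), θ a = 0 → a ∈ I) (a : MvPolynomial ι T) (ha : θ a = 0) :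
    a ∈ I := by
  have hvars : ∀ a : MvPolynomial ι T, θ a = 0 →
      (∀ t ∈ a.vars, ∀ b ∈ supported T (Set.Iic t), θ b = 0 → b ∈ I) → a ∈ I := by
    intro a ha h
    rcases a.vars.eq_empty_or_nonempty with h0 | h0
    · have h1 : a ∈ supported T (∅ : Set ι) := by
        rw [mem_supported, h0, Finset.coe_empty]
      rw [supported_empty, Algebra.mem_bot] at h1
      obtain ⟨c, rfl⟩ := h1
      rw [AlgHom.commutes] at ha
      exact hC c ha
    · refine h _ (a.vars.max'_mem h0) a ?_ ha
      rw [mem_supported]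
      exact fun t ht => a.vars.le_max' t ht
  have hall : ∀ s, ∀ b ∈ supported T (Set.Iic s), θ b = 0 → b ∈ I := by
    intro s
    induction s using WellFoundedLT.induction with
    | ind s ih =>
      refine hstep s fun b hb hb0 => hvars b hb0 fun t ht => ih t ?_
      exact (mem_supported.1 hb) ht
  exact hvars a ha fun t _ => hall t

/-- An integral algebra which is a field admits a triangular presentation. -/
theorem exists_triangular_presentation [WellFoundedLT ι] :
    ∃ p : ι → MvPolynomial ι T,
      RingHom.ker θ = (RingHom.ker (algebraMap T L)).map C ⊔ Ideal.span (Set.range p) ∧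
      ∀ (s : ι) (F : Finset ι), (∀ t ∈ F, t < s) → ∀ (N : Ideal T) (c : MvPolynomial ι T),
        p s * c ∈ N.map C ⊔ Ideal.span (p '' F) → c ∈ N.map C ⊔ Ideal.span (p '' F) := by
  choose P hP hP0 hmin using exists_minimal_monic θ
  refine ⟨fun s => Polynomial.aeval (X s : MvPolynomial ι T) (P s), le_antisymm ?_ ?_, ?_⟩
  · intro a ha
    refine mem_of_forall_supported θ (fun c hc => Ideal.mem_sup_left
      (Ideal.mem_map_of_mem _ hc)) (fun s hs a ha ha0 => ?_) a ha
    obtain ⟨F, rfl⟩ := exists_aeval_eq ha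
    refine aeval_mem_of_minimal (θ : MvPolynomial ι T →+* L) (X s) (hP s) (hP0 s) (hmin s)
      (fun c hc => ?_) (fun c hc => hs c c.2 hc)
      (Ideal.mem_sup_right (Ideal.subset_span ⟨s, rfl⟩)) (F.natDegree + 1) F ?_ ha0
    · obtain ⟨z, ⟨v, hv, rfl⟩, hvz⟩ := exists_mul_eq_one_of_mem
        ((supported T (Set.Iio s)).map θ) ⟨c, c.2, rfl⟩ hc
      exact ⟨⟨v, hv⟩, hvz⟩
    · exact lt_of_le_of_lt Polynomial.degree_le_natDegree (by exact_mod_cast Nat.lt_succ_self _)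
  · refine sup_le ?_ ?_
    · rw [Ideal.map_le_iff_le_comap]
      intro c hc
      change θ (algebraMap T _ c) = 0
      rw [AlgHom.commutes]
      exact hc
    · rw [Ideal.span_le]
      rintro _ ⟨s, rfl⟩
      exact hP0 s
  · intro s F hF N c hc
    have hspan : N.map C ⊔ Ideal.span ((fun s => Polynomial.aeval (X s : MvPolynomial ι T)
        (P s)) '' F) = Ideal.span (C '' (N : Set T) ∪ (fun s => Polynomial.aeval
          (X s : MvPolynomial ι T) (P s)) '' F) := by
      rw [Ideal.span_union]
      rfl
    rw [hspan] at hc ⊢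
    have hsub : ∀ t : ι, supported T (Set.Iio t) ≤ supported T (Set.Iic t) := fun t =>
      supported_mono (Set.Iio_subset_Iic_self (a := t))
    refine mem_of_monic_mul_mem s ((P s).map (algebraMap _ (MvPolynomial ι T))) ((hP s).map _)
      (fun i => ?_) ?_ (by rwa [Polynomial.eval_map])
    · rw [Polynomial.coeff_map]
      have hle : supported T (Set.Iio s) ≤ supported T ({s}ᶜ : Set ι) :=
        supported_mono fun r hr => (Set.mem_Iio.1 hr).ne
      exact hle (Subtype.coe_prop ((P s).coeff i))
    · rintro _ (⟨c, -, rfl⟩ | ⟨t, ht, rfl⟩)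
      · exact (supported T ({s}ᶜ : Set ι)).algebraMap_mem c
      · have hle : supported T (Set.Iic t) ≤ supported T ({s}ᶜ : Set ι) :=
          supported_mono fun r hr => ((Set.mem_Iic.1 hr).trans_lt (hF t ht)).ne
        refine hle ?_
        change Polynomial.aeval (X t : MvPolynomial ι T) (P t) ∈ supported T (Set.Iic t)
        rw [Polynomial.aeval_eq_sum_range]
        refine sum_mem fun i _ => ?_
        rw [Algebra.smul_def]
        refine mul_mem (hsub t (Subtype.coe_prop ((P t).coeff i))) (pow_mem ?_ _)
        rw [supported_eq_adjoin_X]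
        exact Algebra.subset_adjoin ⟨t, Set.mem_Iic.2 le_rfl, rfl⟩

end Presentation

section IntegralResidue

theorem sup_span_eq_of_sub_mem {A ι : Type*} [CommRing A] {N : Ideal A} {g p : ι → A}
    (h : ∀ s, p s - g s ∈ N) (F : Set ι) :
    N ⊔ Ideal.span (g '' F) = N ⊔ Ideal.span (p '' F) := by
  refine le_antisymm (sup_le le_sup_left ?_) (sup_le le_sup_left ?_) <;> rw [Ideal.span_le] <;>
    rintro _ ⟨s, hs, rfl⟩
  · have h1 : g s = -(p s - g s) + p s := by ring
    rw [SetLike.mem_coe, h1]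
    exact add_mem (Ideal.mem_sup_left (neg_mem (h s)))
      (Ideal.mem_sup_right (Ideal.subset_span ⟨s, hs, rfl⟩))
  · have h1 : p s = (p s - g s) + g s := by ring
    rw [SetLike.mem_coe, h1]
    exact add_mem (Ideal.mem_sup_left (h s))
      (Ideal.mem_sup_right (Ideal.subset_span ⟨s, hs, rfl⟩))

variable {T T₁ S : Type u} [CommRing T] [IsNoetherianRing T] [CommRing T₁] [CommRing S]
  [IsLocalRing S] [Algebra T T₁] [Algebra T S] [Algebra T₁ S] [IsScalarTower T T₁ S]
  [Module.Flat T T₁]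

theorem exists_colonFlat_of_integral {𝔪 : Ideal T} [𝔪.IsMaximal]
    (hmS : 𝔪.map (algebraMap T S) = maximalIdeal S)
    [Algebra.IsIntegral T₁ (ResidueField S)]
    (hker : RingHom.ker (algebraMap T₁ (ResidueField S)) = 𝔪.map (algebraMap T T₁)) :
    ∃ (A : Type u) (_ : CommRing A) (_ : Algebra T A), (𝔪.map (algebraMap T A)).IsMaximal ∧
      (∀ q, ColonFlat (⊥ : Ideal A) (𝔪 ^ q)) ∧ ∃ φ : A →ₐ[T] S, Function.Surjective φ := by
  classical
  obtain ⟨_, _⟩ : ∃ _ : LinearOrder S, WellFoundedLT S := exists_wellFoundedLT S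
  let φ₀ : MvPolynomial S T₁ →ₐ[T₁] S := MvPolynomial.aeval id
  have hφ₀ : Function.Surjective φ₀ := fun s => ⟨MvPolynomial.X s, MvPolynomial.aeval_X _ _⟩
  let θ : MvPolynomial S T₁ →ₐ[T₁] ResidueField S :=
    (IsScalarTower.toAlgHom T₁ S (ResidueField S)).comp φ₀
  have hθ : Function.Surjective θ := (residue_surjective (R := S)).comp hφ₀
  obtain ⟨p, hp, hnzd⟩ := exists_triangular_presentation θ
  have hN : 𝔪.map (algebraMap T (MvPolynomial S T₁)) =
      (𝔪.map (algebraMap T T₁)).map MvPolynomial.C := by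
    rw [IsScalarTower.algebraMap_eq T T₁ (MvPolynomial S T₁), ← Ideal.map_map]
    rfl
  have hNS : (𝔪.map (algebraMap T (MvPolynomial S T₁))).map (φ₀ : MvPolynomial S T₁ →+* S) =
      maximalIdeal S := by
    rw [Ideal.map_map, ← hmS]
    congr 1
    exact (φ₀.restrictScalars T).comp_algebraMap
  have hlift : ∀ s, ∃ h ∈ 𝔪.map (algebraMap T (MvPolynomial S T₁)), φ₀ h = φ₀ (p s) := by
    intro s
    have h1 : p s ∈ RingHom.ker θ := by
      rw [hp]
      exact Ideal.mem_sup_right (Ideal.subset_span ⟨s, rfl⟩)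
    have h2 : φ₀ (p s) ∈ maximalIdeal S := (residue_eq_zero_iff _).1 h1
    rw [← hNS] at h2
    exact (Ideal.mem_map_iff_of_surjective (φ₀ : MvPolynomial S T₁ →+* S) hφ₀).1 h2
  choose h hh hφh using hlift
  let g : S → MvPolynomial S T₁ := fun s => p s - h s
  have hg : ∀ s, p s - g s ∈ 𝔪.map (algebraMap T (MvPolynomial S T₁)) := fun s => by
    rw [sub_sub_cancel]
    exact hh s
  have hflat : Module.Flat T (MvPolynomial S T₁) := Module.Flat.trans T T₁ _
  have hcolon : ∀ (q : ℕ) (F : Finset S), ColonFlat (Ideal.span (g '' F)) (𝔪 ^ q) := by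
    intro q F
    induction F using Finset.induction_on_max with
    | empty =>
      rw [Finset.coe_empty, Set.image_empty, Ideal.span_empty]
      exact colonFlat_of_flat.mono bot_le
    | insert s F hF ih =>
      have h1 : Ideal.span (g '' (insert s F : Finset S)) =
          Ideal.span (g '' F) ⊔ Ideal.span {g s} := by
        rw [Finset.coe_insert, Set.image_insert_eq, Ideal.span_insert, sup_comm]
      rw [h1]
      refine ih.sup_span le_rfl fun c hc => ?_
      rw [sup_span_eq_of_sub_mem hg] at hc ⊢
      have h2 : p s * c = g s * c + (p s - g s) * c := by ring
      have h3 : p s * c ∈ 𝔪.map (algebraMap T (MvPolynomial S T₁)) ⊔ Ideal.span (p '' F) := by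
        rw [h2]
        exact add_mem hc (Ideal.mem_sup_left (Ideal.mul_mem_right _ _ (hg s)))
      rw [hN] at h3 ⊢
      exact hnzd s F hF _ c h3
  let J := Ideal.span (Set.range g)
  have hker' : 𝔪.map (algebraMap T (MvPolynomial S T₁)) ⊔ J = RingHom.ker θ := by
    change _ ⊔ Ideal.span (Set.range g) = _
    rw [← Set.image_univ, sup_span_eq_of_sub_mem hg, Set.image_univ, hp, hker, hN]
  have hmapA : ∀ I : Ideal T, I.map (algebraMap T (MvPolynomial S T₁ ⧸ J)) =
      (I.map (algebraMap T (MvPolynomial S T₁))).map (Ideal.Quotient.mk J) := fun I => by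
    rw [Ideal.map_map]
    rfl
  refine ⟨MvPolynomial S T₁ ⧸ J, inferInstance, inferInstance, ?_, fun q => ?_, ?_⟩
  · have h1 : (RingHom.ker θ).IsMaximal := RingHom.ker_isMaximal_of_surjective θ hθ
    have h2 : 𝔪.map (algebraMap T (MvPolynomial S T₁ ⧸ J)) =
        (RingHom.ker θ).map (Ideal.Quotient.mk J) := by
      rw [hmapA, ← hker', Ideal.map_sup, Ideal.map_quotient_self, sup_bot_eq]
    rw [h2]
    refine Ideal.IsMaximal.map_of_surjective_of_ker_le Ideal.Quotient.mk_surjective ?_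
    rw [Ideal.mk_ker, ← hker']
    exact le_sup_right
  · refine (ColonFlat.of_directed (hcolon q)).of_approx (Ideal.Quotient.mkₐ T J)
      (fun a ha => Ideal.Quotient.eq_zero_iff_mem.2 ha) (fun b => ?_) (fun a ha => ?_)
    · obtain ⟨a, rfl⟩ := Ideal.Quotient.mk_surjective b
      refine ⟨a, ?_⟩
      rw [Ideal.Quotient.mkₐ_eq_mk, sub_self]
      exact zero_mem _
    · rw [hmapA] at ha
      rw [Ideal.Quotient.mkₐ_eq_mk] at ha
      have h2 : a ∈ (((𝔪 ^ q).map (algebraMap T (MvPolynomial S T₁))).map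
        (Ideal.Quotient.mk J)).comap (Ideal.Quotient.mk J) := ha
      rw [Ideal.comap_map_of_surjective _ Ideal.Quotient.mk_surjective, ← RingHom.ker,
        Ideal.mk_ker] at h2
      exact h2
  · have hJ : ∀ a ∈ J, φ₀.restrictScalars T a = 0 := by
      intro a ha
      have hle : J ≤ RingHom.ker φ₀ := by
        rw [Ideal.span_le]
        rintro _ ⟨s, rfl⟩
        change φ₀ (p s - h s) = 0
        rw [map_sub, hφh, sub_self]
      exact hle ha
    refine ⟨Ideal.Quotient.liftₐ J (φ₀.restrictScalars T) hJ, fun s => ?_⟩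
    obtain ⟨a, rfl⟩ := hφ₀ s
    exact ⟨Ideal.Quotient.mk J a, rfl⟩

end IntegralResidue

section Transcendence

theorem exists_transcendence_basis_lift {T L : Type u} [CommRing T] [Field L] [Algebra T L]
    (hmax : (RingHom.ker (algebraMap T L)).IsMaximal) :
    ∃ (ι : Type u) (x : ι → L),
      RingHom.ker (MvPolynomial.aeval x : MvPolynomial ι T →ₐ[T] L) =
        (RingHom.ker (algebraMap T L)).map MvPolynomial.C ∧
      ∀ z : L, ∃ q : Polynomial L, q ≠ 0 ∧ q.eval z = 0 ∧
        ∀ i, q.coeff i ∈ Set.range (MvPolynomial.aeval x : MvPolynomial ι T →ₐ[T] L) := by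
  let 𝔪 := RingHom.ker (algebraMap T L)
  let _ : Algebra (T ⧸ 𝔪) L := (RingHom.kerLift (algebraMap T L)).toAlgebra
  have hinj : Function.Injective (algebraMap (T ⧸ 𝔪) L) := RingHom.kerLift_injective _
  have : FaithfulSMul (T ⧸ 𝔪) L := (faithfulSMul_iff_algebraMap_injective _ _).2 hinj
  have : Nontrivial (T ⧸ 𝔪) := Ideal.Quotient.nontrivial_iff.2 hmax.ne_top
  obtain ⟨ι, x, hx⟩ := exists_isTranscendenceBasis' (T ⧸ 𝔪) L
  have hfac : ∀ w : MvPolynomial ι T, MvPolynomial.aeval x w =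
      MvPolynomial.aeval (R := T ⧸ 𝔪) x (MvPolynomial.map (Ideal.Quotient.mk 𝔪) w) := fun w => by
    rw [MvPolynomial.aeval_def, MvPolynomial.aeval_def, MvPolynomial.eval₂_map]
    rfl
  refine ⟨ι, x, ?_, fun z => ?_⟩
  · ext w
    rw [RingHom.mem_ker, hfac, map_eq_zero_iff _ hx.1, ← RingHom.mem_ker, MvPolynomial.ker_map,
      Ideal.mk_ker]
  · obtain ⟨q, hq, hqz⟩ := hx.isAlgebraic.isAlgebraic z
    refine ⟨q.map (algebraMap _ L), (Polynomial.map_ne_zero_iff Subtype.val_injective).2 hq, ?_,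
      fun i => ?_⟩
    · rw [Polynomial.eval_map]
      exact hqz
    · rw [Polynomial.coeff_map]
      have h1 := Subtype.coe_prop (q.coeff i)
      have h2 := (Algebra.adjoin_range_eq_range_aeval (T ⧸ 𝔪) x).le h1
      obtain ⟨f, hf⟩ := h2
      obtain ⟨w, rfl⟩ := MvPolynomial.map_surjective _ Ideal.Quotient.mk_surjective f
      exact ⟨w, (hfac w).trans hf⟩

theorem isIntegral_of_root {T L : Type*} [CommRing T] [Field L] [Algebra T L]
    (hinv : ∀ c : T, algebraMap T L c ≠ 0 → (algebraMap T L c)⁻¹ ∈ Set.range (algebraMap T L))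
    {z : L} {q : Polynomial L} (hq : q ≠ 0) (hz : q.eval z = 0)
    (hc : ∀ i, q.coeff i ∈ Set.range (algebraMap T L)) : IsIntegral T z := by
  obtain ⟨c, hcl⟩ := hc q.natDegree
  have hlc : q.leadingCoeff ≠ 0 := Polynomial.leadingCoeff_ne_zero.2 hq
  obtain ⟨d, hd⟩ := hinv c (by rw [hcl]; exact hlc)
  have hmonic : (Polynomial.C (q.leadingCoeff)⁻¹ * q).Monic :=
    Polynomial.monic_C_mul_of_mul_leadingCoeff_eq_one (inv_mul_cancel₀ hlc)
  have hl : Polynomial.C (q.leadingCoeff)⁻¹ * q ∈ Polynomial.lifts (algebraMap T L) := by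
    rw [Polynomial.lifts_iff_coeff_lifts]
    intro i
    obtain ⟨e, he⟩ := hc i
    refine ⟨d * e, ?_⟩
    rw [map_mul, hd, he, hcl, Polynomial.coeff_C_mul]
    rfl
  obtain ⟨p, hp, -, hpm⟩ := Polynomial.lifts_and_natDegree_eq_and_monic hl hmonic
  refine ⟨p, hpm, ?_⟩
  rw [Polynomial.eval₂_eq_eval_map, hp, Polynomial.eval_mul, hz, mul_zero]

variable {T S : Type u} [CommRing T] [CommRing S] [IsLocalRing S] [Algebra T S]

theorem exists_flat_integral_residue {𝔪 : Ideal T} [h𝔪 : 𝔪.IsMaximal]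
    (hmS : 𝔪.map (algebraMap T S) ≤ maximalIdeal S) :
    ∃ (T₁ : Type u) (_ : CommRing T₁) (_ : Algebra T T₁) (_ : Algebra T₁ S),
      IsScalarTower T T₁ S ∧ Module.Flat T T₁ ∧ Algebra.IsIntegral T₁ (ResidueField S) ∧
      RingHom.ker (algebraMap T₁ (ResidueField S)) = 𝔪.map (algebraMap T T₁) := by
  have hkerT : RingHom.ker (algebraMap T (ResidueField S)) = 𝔪 := by
    refine (h𝔪.eq_of_le (RingHom.ker_ne_top _) fun t ht => ?_).symm
    exact (residue_eq_zero_iff _).2 (hmS (Ideal.mem_map_of_mem _ ht))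
  obtain ⟨ι, x, hker, halg⟩ := exists_transcendence_basis_lift (T := T) (L := ResidueField S)
    (hkerT.symm ▸ h𝔪)
  rw [hkerT] at hker
  choose y hy using fun b => residue_surjective (R := S) (x b)
  let α : MvPolynomial ι T →ₐ[T] S := MvPolynomial.aeval y
  have hα : ∀ w, residue S (α w) = MvPolynomial.aeval x w := by
    intro w
    have h1 : (IsScalarTower.toAlgHom T S (ResidueField S)).comp α = MvPolynomial.aeval x := by
      refine MvPolynomial.algHom_ext fun b => ?_
      rw [AlgHom.comp_apply, MvPolynomial.aeval_X, MvPolynomial.aeval_X]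
      exact hy b
    exact DFunLike.congr_fun h1 w
  let 𝔭 : Ideal (MvPolynomial ι T) := 𝔪.map MvPolynomial.C
  have hmem : ∀ w, w ∈ 𝔭 ↔ α w ∈ maximalIdeal S := fun w => by
    rw [← residue_eq_zero_iff, hα, ← RingHom.mem_ker, hker]
  have hprime : 𝔭.IsPrime := by
    have h1 : 𝔭 = (maximalIdeal S).comap α := Ideal.ext hmem
    rw [h1]
    infer_instance
  have hunit : ∀ w : 𝔭.primeCompl, IsUnit ((α : MvPolynomial ι T →+* S) w) := fun w => by
    by_contra hw
    exact w.2 ((hmem w).2 hw)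
  let β : Localization.AtPrime 𝔭 →+* S := IsLocalization.lift hunit
  have hβ : ∀ w, β (algebraMap _ _ w) = α w := fun w => IsLocalization.lift_eq hunit w
  let _ : Algebra (Localization.AtPrime 𝔭) S := β.toAlgebra
  have htower : IsScalarTower T (Localization.AtPrime 𝔭) S := by
    refine IsScalarTower.of_algebraMap_eq fun t => ?_
    rw [IsScalarTower.algebraMap_apply T (MvPolynomial ι T) (Localization.AtPrime 𝔭)]
    exact (AlgHom.commutes α t).symm.trans (hβ _).symm
  have hflat : Module.Flat (MvPolynomial ι T) (Localization.AtPrime 𝔭) :=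
    IsLocalization.flat _ 𝔭.primeCompl
  have hmap : 𝔪.map (algebraMap T (Localization.AtPrime 𝔭)) =
      𝔭.map (algebraMap (MvPolynomial ι T) (Localization.AtPrime 𝔭)) := by
    rw [IsScalarTower.algebraMap_eq T (MvPolynomial ι T) (Localization.AtPrime 𝔭),
      ← Ideal.map_map]
    rfl
  have hres : ∀ a, algebraMap (Localization.AtPrime 𝔭) (ResidueField S) a = residue S (β a) :=
    fun a => rfl
  have hfrac : ∀ a : Localization.AtPrime 𝔭, ∃ (w : MvPolynomial ι T) (v : 𝔭.primeCompl),
      a = IsLocalization.mk' _ w v ∧ β a * α v = α w := fun a => by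
    obtain ⟨w, v, rfl⟩ := IsLocalization.exists_mk'_eq 𝔭.primeCompl a
    refine ⟨w, v, rfl, ?_⟩
    rw [← hβ, ← hβ, ← map_mul, IsLocalization.mk'_spec]
  have hv : ∀ v : 𝔭.primeCompl, residue S (α v) ≠ 0 := fun v h =>
    v.2 ((hmem v).2 ((residue_eq_zero_iff _).1 h))
  refine ⟨Localization.AtPrime 𝔭, inferInstance, inferInstance, inferInstance, htower,
    Module.Flat.trans T (MvPolynomial ι T) _, ⟨fun z => ?_⟩, ?_⟩
  · obtain ⟨q, hq, hqz, hqc⟩ := halg z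
    refine isIntegral_of_root (fun c hc => ?_) hq hqz fun i => ?_
    · obtain ⟨w, v, rfl, hwv⟩ := hfrac c
      have hw : w ∉ 𝔭 := fun h => by
        refine hc ?_
        rw [hres]
        have h1 := congrArg (residue S) hwv
        rw [map_mul, (residue_eq_zero_iff _).2 ((hmem w).1 h)] at h1
        exact (mul_eq_zero.1 h1).resolve_right (hv v)
      refine ⟨IsLocalization.mk' _ (v : MvPolynomial ι T) (⟨w, hw⟩ : 𝔭.primeCompl), ?_⟩
      refine eq_inv_of_mul_eq_one_left ?_
      rw [← map_mul, ← IsLocalization.mk'_mul, mul_comm (v : MvPolynomial ι T) w]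
      have h2 : IsLocalization.mk' (Localization.AtPrime 𝔭) (w * v)
          ((⟨w, hw⟩ : 𝔭.primeCompl) * v) = 1 :=
        IsLocalization.mk'_self' _ (x := (⟨w, hw⟩ : 𝔭.primeCompl) * v)
      rw [h2, map_one]
    · obtain ⟨w, hw⟩ := hqc i
      refine ⟨algebraMap _ _ w, ?_⟩
      rw [hres, hβ, hα, hw]
  · rw [hmap]
    refine le_antisymm (fun a ha => ?_) ?_
    · obtain ⟨w, v, rfl, hwv⟩ := hfrac a
      rw [RingHom.mem_ker, hres] at ha
      have h1 := congrArg (residue S) hwv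
      rw [map_mul, ha, zero_mul] at h1
      have hw : w ∈ 𝔭 := (hmem w).2 ((residue_eq_zero_iff _).1 h1.symm)
      rw [IsLocalization.mk'_mem_map_algebraMap_iff]
      exact ⟨1, Submonoid.one_mem _, by rwa [one_mul]⟩
    · rw [Ideal.map_le_iff_le_comap]
      intro w hw
      rw [Ideal.mem_comap, RingHom.mem_ker, hres, hβ]
      exact (residue_eq_zero_iff _).2 ((hmem w).1 hw)

/-- Every complete local algebra with maximal ideal extended from `T` is a quotient of a flat
complete local `T`-algebra with maximal ideal extended from `T`. -/
theorem exists_unramified_cover [IsNoetherianRing T] [IsAdicComplete (maximalIdeal S) S]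
    {𝔪 : Ideal T} [𝔪.IsMaximal] (hmS : 𝔪.map (algebraMap T S) = maximalIdeal S) :
    ∃ (P : Type u) (_ : CommRing P) (_ : IsLocalRing P) (_ : Algebra T P),
      IsNoetherianRing P ∧ IsAdicComplete (maximalIdeal P) P ∧ Module.Flat T P ∧
      maximalIdeal P = 𝔪.map (algebraMap T P) ∧ ∃ ψ : P →ₐ[T] S, Function.Surjective ψ := by
  obtain ⟨T₁, _, _, _, _, _, _, hker⟩ := exists_flat_integral_residue hmS.le
  obtain ⟨A, _, _, hmax, hflat, φ, hφ⟩ := exists_colonFlat_of_integral hmS hker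
  exact exists_complete_of_colonFlat hmS.le hmax hflat φ hφ

end Transcendence

section PolynomialTower

open Polynomial

/-- Flat local algebras over `T` with maximal ideal extended from `𝔪` are towers over `R`. -/
def TowerOver (R : Type u) [CommRing R] [IsLocalRing R] (n : ℕ) {T : Type u} [CommRing T]
    [Algebra R T] (𝔪 : Ideal T) : Prop :=
  ∀ (A : Type u) [CommRing A] [IsLocalRing A] [Algebra R A] [Algebra T A] [IsScalarTower R T A],
    Module.Flat T A → maximalIdeal A = 𝔪.map (algebraMap T A) → FlatTower R n A

theorem towerOver_zero (R : Type u) [CommRing R] [IsLocalRing R] :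
    TowerOver R 0 (maximalIdeal R) := by
  intro A _ _ i₁ i₂ hi hflat hmax
  have h : i₂ = i₁ := Algebra.algebra_ext _ _ fun r =>
    (@IsScalarTower.algebraMap_apply R R A _ _ _ _ i₂ i₁ hi r).symm
  subst h
  exact ⟨hflat, inferInstance, hmax⟩

variable {T : Type u} [CommRing T]

theorem mem_map_C_sup_span_X_iff (I : Ideal T) (p : T[X]) :
    p ∈ I.map C ⊔ Ideal.span {X} ↔ p.coeff 0 ∈ I := by
  constructor
  · intro h
    have hle : I.map C ⊔ Ideal.span {X} ≤ I.comap (constantCoeff : T[X] →+* T) := by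
      refine sup_le ?_ ?_
      · rw [Ideal.map_le_iff_le_comap]
        intro t ht
        simpa using ht
      · rw [Ideal.span_singleton_le_iff_mem]
        simp
    exact hle h
  · intro h
    rw [← divX_mul_X_add p]
    exact add_mem (Ideal.mem_sup_right (Ideal.mul_mem_left _ _ (Ideal.mem_span_singleton_self _)))
      (Ideal.mem_sup_left (Ideal.mem_map_of_mem _ h))

theorem isMaximal_map_C_sup_span_X (𝔪 : Ideal T) [h𝔪 : 𝔪.IsMaximal] :
    (𝔪.map C ⊔ Ideal.span {X}).IsMaximal := by
  have h1 : 𝔪.map C ⊔ Ideal.span {X} = 𝔪.comap (constantCoeff : T[X] →+* T) :=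
    Ideal.ext fun p => mem_map_C_sup_span_X_iff 𝔪 p
  rw [h1]
  exact Ideal.comap_isMaximal_of_surjective _ fun t => ⟨C t, by simp⟩

theorem coeff_one_mem_of_mem_sq {𝔪 : Ideal T} {p : T[X]}
    (hp : p ∈ (𝔪.map C ⊔ Ideal.span {X}) ^ 2) : p.coeff 1 ∈ 𝔪 := by
  rw [pow_two] at hp
  refine Submodule.mul_induction_on hp (fun a ha b hb => ?_) fun a b ha hb => ?_
  · rw [mem_map_C_sup_span_X_iff] at ha hb
    rw [Polynomial.mul_coeff_one]
    exact add_mem (Ideal.mul_mem_right _ _ ha) (Ideal.mul_mem_left _ _ hb)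
  · rw [coeff_add]
    exact add_mem ha hb

variable {A : Type u} [CommRing A] [Algebra T[X] A] [Algebra T A] [IsScalarTower T T[X] A]

theorem map_map_C_eq (I : Ideal T) :
    (I.map C).map (algebraMap T[X] A) = I.map (algebraMap T A) := by
  rw [IsScalarTower.algebraMap_eq T T[X] A, ← Ideal.map_map]
  rfl

theorem map_sup_span_X (I : Ideal T) :
    (I.map C ⊔ Ideal.span {X}).map (algebraMap T[X] A) =
      I.map (algebraMap T A) ⊔ Ideal.span {algebraMap T[X] A X} := by
  rw [Ideal.map_sup, map_map_C_eq, Ideal.map_span, Set.image_singleton]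

theorem map_algebraMap_quotient (I : Ideal T) (J : Ideal A) :
    I.map (algebraMap T (A ⧸ J)) = (I.map (algebraMap T A)).map (Ideal.Quotient.mk J) := by
  rw [Ideal.map_map]
  rfl

theorem mk_mem_map_iff (I : Ideal T) (J : Ideal A) (a : A) :
    Ideal.Quotient.mk J a ∈ I.map (algebraMap T (A ⧸ J)) ↔ a ∈ I.map (algebraMap T A) ⊔ J := by
  rw [map_algebraMap_quotient, ← Ideal.mem_comap,
    Ideal.comap_map_of_surjective _ Ideal.Quotient.mk_surjective, ← RingHom.ker, Ideal.mk_ker]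

theorem flat_quotient_X [Module.Flat T[X] A] :
    Module.Flat T (A ⧸ Ideal.span {algebraMap T[X] A X}) := by
  refine flat_of_colonFlat fun I _ u d hd => ?_
  obtain ⟨d, rfl⟩ := Ideal.Quotient.mk_surjective d
  rw [sup_bot_eq] at hd
  have h1 : algebraMap T[X] A (C u) * d ∈
      (I.map C ⊔ Ideal.span {X}).map (algebraMap T[X] A) ⊔ ⊥ := by
    rw [sup_bot_eq, map_sup_span_X, ← mk_mem_map_iff, map_mul]
    convert hd using 2
    rw [IsScalarTower.algebraMap_apply T A (A ⧸ Ideal.span {algebraMap T[X] A X}),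
      IsScalarTower.algebraMap_apply T T[X] A]
    rfl
  obtain ⟨L, hL, hdL⟩ := colonFlat_of_flat _ bot_le _ _ h1
  rw [sup_bot_eq] at hdL
  refine ⟨L.map (constantCoeff : T[X] →+* T), fun t ht => ?_, ?_⟩
  · obtain ⟨p, hp, rfl⟩ := (Ideal.mem_map_iff_of_surjective (constantCoeff : T[X] →+* T)
      fun t => ⟨C t, by simp⟩).1 ht
    have h2 := (mem_map_C_sup_span_X_iff I _).1 (hL p hp)
    rwa [coeff_C_mul] at h2
  · rw [sup_bot_eq, mk_mem_map_iff, ← map_sup_span_X]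
    refine Ideal.map_mono (fun p hp => ?_) hdL
    rw [mem_map_C_sup_span_X_iff]
    exact Ideal.mem_map_of_mem (constantCoeff : T[X] →+* T) hp

variable {R : Type u} [CommRing R] [IsLocalRing R] [Algebra R T]

theorem TowerOver.polynomial {n : ℕ} {𝔪 : Ideal T} [Module.Flat R T] [𝔪.IsMaximal]
    (h : TowerOver R n 𝔪) : TowerOver R (n + 1) (𝔪.map C ⊔ Ideal.span {(X : T[X])}) := by
  intro A _ _ _ _ _ hflat hmax
  let _ : Algebra T A := ((algebraMap T[X] A).comp C).toAlgebra
  have : IsScalarTower T T[X] A := IsScalarTower.of_algebraMap_eq fun t => rfl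
  have : IsScalarTower R T A := IsScalarTower.of_algebraMap_eq fun r => by
    rw [IsScalarTower.algebraMap_apply R T[X] A]
    rfl
  have hX : algebraMap T[X] A X ∈ maximalIdeal A := by
    rw [hmax]
    exact Ideal.mem_map_of_mem _ (Ideal.mem_sup_right (Ideal.mem_span_singleton_self _))
  have := isLocalRing_quotient hX
  have : Module.Flat R T[X] := Module.Flat.trans R T T[X]
  refine ⟨Module.Flat.trans R T[X] A, inferInstance, algebraMap T[X] A X, hX, fun h2 => ?_,
    fun a ha => ?_, h _ flat_quotient_X ?_⟩
  · have h3 : algebraMap T[X] A X * 1 ∈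
        ((𝔪.map C ⊔ Ideal.span {X}) ^ 2).map (algebraMap T[X] A) ⊔ ⊥ := by
      rwa [mul_one, sup_bot_eq, Ideal.map_pow, ← hmax]
    obtain ⟨L, hL, h1⟩ := colonFlat_of_flat _ bot_le _ _ h3
    have hle : L ≤ 𝔪.map C ⊔ Ideal.span {X} := fun p hp => by
      have h4 := coeff_one_mem_of_mem_sq (hL p hp)
      rw [mem_map_C_sup_span_X_iff]
      rwa [coeff_X_mul] at h4
    rw [sup_bot_eq] at h1
    have h5 := Ideal.map_mono (f := algebraMap T[X] A) hle h1
    rw [← hmax] at h5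
    exact (Ideal.ne_top_iff_one _).1 (maximalIdeal.isMaximal A).ne_top h5
  · obtain ⟨L, hL, h1⟩ := colonFlat_of_flat (T := T[X]) (A := A) ⊥ le_rfl X a (by
      rw [ha]; exact zero_mem _)
    have hle : L ≤ ⊥ := fun p hp => by
      have h2 : X * p = 0 := hL p hp
      exact (Polynomial.isRegular_X (R := T)).left (by simpa using h2)
    rw [sup_bot_eq] at h1
    have h3 := Ideal.map_mono (f := algebraMap T[X] A) hle h1
    rwa [Ideal.map_bot, Ideal.mem_bot] at h3
  · have h1 : (maximalIdeal A).map (Ideal.Quotient.mk (Ideal.span {algebraMap T[X] A X})) =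
        maximalIdeal (A ⧸ Ideal.span {algebraMap T[X] A X}) :=
      map_maximalIdeal_of_surjective _ Ideal.Quotient.mk_surjective
    rw [← h1, hmax, map_sup_span_X, Ideal.map_sup, Ideal.map_quotient_self, sup_bot_eq,
      ← map_algebraMap_quotient]

theorem exists_towerOver [IsNoetherianRing R] {S : Type u} [CommRing S] [Algebra R S]
    (ys : List S) :
    ∃ (T : Type u) (_ : CommRing T) (_ : Algebra R T) (_ : Algebra T S) (𝔪 : Ideal T),
      IsNoetherianRing T ∧ IsScalarTower R T S ∧ Module.Flat R T ∧ 𝔪.IsMaximal ∧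
      𝔪.map (algebraMap T S) =
        (maximalIdeal R).map (algebraMap R S) ⊔ Ideal.span {y | y ∈ ys} ∧
      TowerOver R ys.length 𝔪 := by
  induction ys with
  | nil =>
    refine ⟨R, inferInstance, inferInstance, inferInstance, maximalIdeal R, inferInstance,
      inferInstance, inferInstance, inferInstance, ?_, towerOver_zero R⟩
    simp
  | cons y ys ih =>
    obtain ⟨T, _, _, _, 𝔪, _, _, _, _, hmap, htower⟩ := ih
    let _ : Algebra T[X] S := (aeval y : T[X] →ₐ[T] S).toRingHom.toAlgebra
    have hC : ∀ t, algebraMap T[X] S (C t) = algebraMap T S t := fun t => aeval_C y t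
    have : IsScalarTower T T[X] S := IsScalarTower.of_algebraMap_eq fun t => (hC t).symm
    have : IsScalarTower R T[X] S := IsScalarTower.of_algebraMap_eq fun r => by
      rw [IsScalarTower.algebraMap_apply R T S, ← hC]
      rfl
    have hX : algebraMap T[X] S X = y := aeval_X y
    refine ⟨T[X], inferInstance, inferInstance, inferInstance, 𝔪.map C ⊔ Ideal.span {X},
      inferInstance, inferInstance, Module.Flat.trans R T T[X], isMaximal_map_C_sup_span_X 𝔪, ?_,
      htower.polynomial⟩
    have hset : {z | z ∈ y :: ys} = insert y {z | z ∈ ys} := by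
      ext z
      simp
    rw [map_sup_span_X, hX, hmap, hset, Ideal.span_insert, sup_assoc,
      sup_comm (Ideal.span {y})]

end PolynomialTower

/-! ### Flat dimension through character modules -/

section FlatDimension

variable {R : Type u} [CommRing R] {M₁ M₂ M₃ : Type u} [AddCommGroup M₁] [Module R M₁]
  [AddCommGroup M₂] [Module R M₂] [AddCommGroup M₃] [Module R M₃]
  {f : M₁ →ₗ[R] M₂} {g : M₂ →ₗ[R] M₃} {n : ℕ}

theorem SES.characterModule (h : SES f g) :
    SES (CharacterModule.dual g) (CharacterModule.dual f) where
  inj := CharacterModule.dual_injective_of_surjective g h.surj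
  surj := CharacterModule.dual_surjective_of_injective f h.inj
  exact c := by
    constructor
    · intro hc
      have hker : (LinearMap.ker g).toAddSubgroup ≤ AddMonoidHom.ker c := by
        intro x hx
        obtain ⟨x, rfl⟩ := (h.exact x).1 hx
        exact DFunLike.congr_fun hc x
      let e := g.quotKerEquivOfSurjective h.surj
      refine ⟨(QuotientAddGroup.lift _ c hker).comp e.symm.toLinearMap.toAddMonoidHom, ?_⟩
      refine DFunLike.ext _ _ fun x => ?_
      have h1 : e.symm (g x) = (LinearMap.ker g).mkQ x := by
        rw [LinearEquiv.symm_apply_eq]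
        rfl
      show QuotientAddGroup.lift _ c hker (e.symm (g x)) = c x
      rw [h1]
      rfl
    · rintro ⟨c, rfl⟩
      refine DFunLike.ext _ _ fun x => ?_
      show c (g (f x)) = 0
      rw [(h.exact (f x)).2 ⟨x, rfl⟩, map_zero]

/-- `FdLE R n M` says that the flat dimension of `M` is at most `n`, detected on the injective
dimension of the character module. -/
def FdLE (R : Type u) [CommRing R] (n : ℕ) (M : Type u) [AddCommGroup M] [Module R M] : Prop :=
  ∀ (X : Type u) [AddCommGroup X] [Module R X] (i : ℕ), n < i → EV R X (CharacterModule M) i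

theorem FdLE.of_flat [Module.Flat R M₁] : FdLE R n M₁ := fun X _ _ i hi => by
  obtain ⟨i, rfl⟩ : ∃ j, i = j + 1 := ⟨i - 1, by omega⟩
  have := (Module.Flat.iff_characterModule_injective (R := R) (M := M₁)).1 inferInstance
  exact ev_of_injective i

theorem FdLE.of_ses (h : SES f g) (h₁ : FdLE R n M₁) (h₂ : FdLE R (n + 1) M₂) :
    FdLE R (n + 1) M₃ := fun X _ _ i hi => by
  obtain ⟨i, rfl⟩ : ∃ j, i = j + 1 := ⟨i - 1, by omega⟩
  exact h.characterModule.ev_cov1 (h₁ X i (by omega)) (h₂ X (i + 1) (by omega))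

theorem FdLE.syzygy (h : SES f g) (h₂ : FdLE R n M₂) (h₃ : FdLE R (n + 1) M₃) :
    FdLE R n M₁ := fun X _ _ i hi =>
  h.characterModule.ev_cov3 (h₂ X i (by omega)) (h₃ X (i + 1) (by omega))

theorem FdLE.mono {m : ℕ} (h : FdLE R n M₁) (hnm : n ≤ m) : FdLE R m M₁ :=
  fun X _ _ i hi => h X i (by omega)

theorem FdLE.of_fdLE {M : Type u} [AddCommGroup M] [Module R M] (h : fdLE R n M) :
    FdLE R n M := by
  induction n generalizing M with
  | zero =>
    have : Module.Flat R M := h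
    exact .of_flat
  | succ n ih =>
    obtain ⟨c, hc⟩ := h
    let _ := c.instAdd
    let _ := c.instMod
    have := c.flat
    exact .of_ses (ses_ker c.π c.surj) (ih hc) .of_flat

variable [IsLocalRing R] {A : Type u} [CommRing A] [IsLocalRing A] [IsNoetherianRing A]
  [Algebra R A]
  {Z : Type u} [AddCommGroup Z] [Module A Z] [Module R Z] [IsScalarTower R A Z] [Module.Finite A Z]

theorem FdLE.projective_of_unramified [Module.Flat R A]
    (hmax : maximalIdeal A = (maximalIdeal R).map (algebraMap R A)) (h : FdLE R 0 Z) :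
    Module.Projective A Z := by
  obtain ⟨n, b, hb, hmin⟩ := exists_minimal_generators A (X := Z)
  let p : (Fin n → A) →ₗ[A] Z := Fintype.linearCombination A b
  have hp : Function.Surjective p := by
    rw [← LinearMap.range_eq_top, Fintype.range_linearCombination, hb]
  have hs := ses_restrictScalars (A := R) (ses_ker p hp)
  obtain ⟨s, hs'⟩ := hs.characterModule.lift (h _ 1 one_pos) LinearMap.id
  have hzero : ∀ c : CharacterModule (Fin n → A), (∀ r ∈ maximalIdeal R, r • c = 0) →
      ∀ t ∈ maximalIdeal A, ∀ w, c (t • w) = 0 := by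
    intro c hc t ht
    rw [hmax] at ht
    refine Submodule.span_induction ?_ ?_ ?_ ?_ ht
    · rintro _ ⟨r, hr, rfl⟩ w
      rw [algebraMap_smul]
      exact DFunLike.congr_fun (hc r hr) w
    · intro w
      rw [zero_smul, map_zero]
    · intro x y _ _ hx hy w
      rw [add_smul, map_add, hx, hy, add_zero]
    · intro a x _ hx w
      rw [smul_eq_mul, mul_comm, mul_smul, hx]
  have hle : (⊤ : Submodule A (LinearMap.ker p)) ≤ maximalIdeal A • ⊤ := by
    intro l _
    by_contra hl
    obtain ⟨c, hc⟩ := CharacterModule.exists_character_apply_ne_zero_of_ne_zero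
      (a := (maximalIdeal A • ⊤ : Submodule A (LinearMap.ker p)).mkQ l)
      (fun h0 => hl ((Submodule.Quotient.mk_eq_zero _).1 h0))
    let χ : CharacterModule (LinearMap.ker p) := c.comp
      (maximalIdeal A • ⊤ : Submodule A (LinearMap.ker p)).mkQ.toAddMonoidHom
    have hχ : ∀ r ∈ maximalIdeal R, r • χ = 0 := fun r hr => DFunLike.ext _ _ fun w => by
      show c ((maximalIdeal A • ⊤ : Submodule A (LinearMap.ker p)).mkQ (r • w)) = 0
      refine (congrArg c ((Submodule.Quotient.mk_eq_zero _).2 ?_)).trans (map_zero c)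
      rw [← algebraMap_smul A r w]
      exact Submodule.smul_mem_smul (hmax ▸ Ideal.mem_map_of_mem _ hr) trivial
    have h1 := hzero (s χ) fun r hr => by rw [← map_smul, hχ r hr, map_zero]
    refine hc ?_
    have h2 : χ l = s χ (l : Fin n → A) :=
      (DFunLike.congr_fun (LinearMap.congr_fun hs' χ) l).symm
    show χ l = 0
    rw [h2, ← (Pi.basisFun A (Fin n)).sum_repr (l : Fin n → A), map_sum]
    exact Finset.sum_eq_zero fun i _ => h1 _ (by simpa using hmin l.1 l.2 i) _
  have hbot : (⊤ : Submodule A (LinearMap.ker p)) = ⊥ :=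
    Submodule.eq_bot_of_le_smul_of_le_jacobson_bot _ _ Module.Finite.fg_top hle
      (IsLocalRing.maximalIdeal_le_jacobson _)
  have hinj : Function.Injective p := LinearMap.ker_eq_bot.1 (by
    rw [eq_bot_iff]
    intro l hl
    have : (⟨l, hl⟩ : LinearMap.ker p) ∈ (⊤ : Submodule A (LinearMap.ker p)) := trivial
    rw [hbot, Submodule.mem_bot] at this
    exact congrArg Subtype.val this)
  exact Module.Projective.of_equiv (LinearEquiv.ofBijective p ⟨hinj, hp⟩)

theorem FdLE.pdLE_of_unramified [Module.Flat R A]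
    (hmax : maximalIdeal A = (maximalIdeal R).map (algebraMap R A)) (h : FdLE R n Z) :
    PdLE A n Z := by
  induction n generalizing Z with
  | zero =>
    have := h.projective_of_unramified hmax
    exact .of_projective
  | succ n ih =>
    obtain ⟨m, p, hp⟩ := Module.Finite.exists_fin' A Z
    have : Module.Flat R (Fin m → A) := Module.Flat.trans R A _
    exact .of_syzygy (ses_ker p hp)
      (ih (FdLE.syzygy (ses_restrictScalars (A := R) (ses_ker p hp)) .of_flat h))

end FlatDimension

section Lifting

open CategoryTheory Abelian in
/-- Nakayama's lemma for Ext, in the first variable. -/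
theorem ev_of_nakayama_left {R X X₃ Y : Type u} [CommRing R] [IsNoetherianRing R] [AddCommGroup X]
    [Module R X] [AddCommGroup X₃] [Module R X₃] [AddCommGroup Y] [Module R Y]
    [Module.Finite R X] [Module.Finite R Y] {y : R} (hy : y ∈ (⊥ : Ideal R).jacobson)
    {g : X →ₗ[R] X₃} (h : SES (LinearMap.lsmul R X y) g) {i : ℕ} (h3 : EV R X₃ Y (i + 1)) :
    EV R X Y i := by
  unfold EV at *
  have hfin : Module.Finite R (Ext (ModuleCat.of R X) (ModuleCat.of R Y) i) := inferInstance
  have htop : (⊤ : Submodule R (Ext (ModuleCat.of R X) (ModuleCat.of R Y) i)) = ⊥ := by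
    refine Submodule.eq_bot_of_le_smul_of_le_jacobson_bot (Ideal.span {y}) _ hfin.fg_top ?_
      (by rwa [Ideal.span_singleton_le_iff_mem])
    intro x _
    obtain ⟨z, hz⟩ := Ext.contravariant_sequence_exact₁ h.shortExact (ModuleCat.of R Y) x
      (add_comm 1 i) (h3.elim _ _)
    have h1 : ModuleCat.ofHom (LinearMap.lsmul R X y) = y • 𝟙 (ModuleCat.of R X) := rfl
    dsimp only at hz
    rw [h1, Ext.mk₀_smul, Ext.smul_comp, Ext.mk₀_id_comp] at hz
    rw [← hz]
    exact Submodule.smul_mem_smul (Ideal.mem_span_singleton_self y) trivial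
  exact subsingleton_of_forall_eq 0 fun x => (Submodule.mem_bot R).1 (htop ▸ trivial)

variable {A B : Type u} [CommRing A] [IsLocalRing A] [IsNoetherianRing A] [CommRing B]
  [Algebra A B] {y : A}

/-- Finiteness of projective dimension lifts along the reduction by a regular element. -/
theorem PdLE.of_baseChange {Z : Type u} [AddCommGroup Z] [Module A Z] [Module.Finite A Z] {n : ℕ}
    (hAB : SES (LinearMap.lsmul A A y) (Algebra.linearMap A B))
    (hy : y ∈ (⊥ : Ideal A).jacobson) (hZ : ∀ z : Z, y • z = 0 → z = 0)
    (h : PdLE B n (B ⊗[A] Z)) : PdLE A n Z := by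
  obtain ⟨m, p, hp⟩ := Module.Finite.exists_fin' A Z
  have hs := ses_ker p hp
  induction n generalizing Z m with
  | zero =>
    have := h.projective
    obtain ⟨k, q, hq⟩ := Module.Finite.exists_fin' B (B ⊗[A] Z)
    obtain ⟨s, hs1⟩ := Module.projective_lifting_property q LinearMap.id hq
    have h2 : EV A (B ⊗[A] Z) (LinearMap.ker p) 2 :=
      (pdLE_one_quotient hAB k _ 2 one_lt_two).retract_left (s.restrictScalars A)
        (q.restrictScalars A) (LinearMap.ext fun x => LinearMap.congr_fun hs1 x)
    have h1 : EV A Z (LinearMap.ker p) 1 := ev_of_nakayama_left hy (ses_one_tmul hAB hZ) h2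
    obtain ⟨t, ht⟩ := hs.lift h1 LinearMap.id
    have := Module.Projective.of_split t p ht
    exact .of_projective
  | succ n ih =>
    obtain ⟨k, q, hq⟩ := Module.Finite.exists_fin' A (LinearMap.ker p)
    refine .of_syzygy hs (ih (fun x hx => ?_) (.syzygy (hs.baseChange_quotient hAB hZ) h)
      k q hq (ses_ker q hq))
    refine Subtype.ext (funext fun k => hAB.inj ?_)
    have := congrFun (congrArg Subtype.val hx) k
    simpa using this

end Lifting

theorem FlatTower.exists_pdLE {R A Z : Type u} [CommRing R] [IsLocalRing R] [CommRing A]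
    [IsNoetherianRing A] [Algebra R A] [AddCommGroup Z] [Module A Z] [Module R Z]
    [IsScalarTower R A Z] [Module.Finite A Z] {n d : ℕ} (hA : FlatTower R n A) (h : FdLE R d Z) :
    ∃ d', PdLE A d' Z := by
  induction n generalizing A Z d with
  | zero =>
    obtain ⟨_, _, hmax⟩ := hA
    exact ⟨d, h.pdLE_of_unramified hmax⟩
  | succ n ih =>
    obtain ⟨_, _, y, hy, -, hreg, hB⟩ := hA
    obtain ⟨m, p, hp⟩ := Module.Finite.exists_fin' A Z
    have : Module.Flat R (Fin m → A) := Module.Flat.trans R A _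
    have hs := ses_ker p hp
    have hK : FdLE R d (LinearMap.ker p) :=
      FdLE.syzygy (ses_restrictScalars (A := R) hs) .of_flat (h.mono d.le_succ)
    have hKy : ∀ x : LinearMap.ker p, y • x = 0 → x = 0 := fun x hx =>
      Subtype.ext (funext fun k => hreg _ (congrFun (congrArg Subtype.val hx) k))
    have hAB := ses_quotient hreg
    have hq : FdLE R (d + 1) ((A ⧸ Ideal.span {y}) ⊗[A] LinearMap.ker p) :=
      FdLE.of_ses (ses_restrictScalars (A := R) (ses_one_tmul hAB hKy)) hK (hK.mono d.le_succ)
    obtain ⟨d', hd'⟩ := ih hB hq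
    exact ⟨d' + 1, .of_syzygy hs (hd'.of_baseChange hAB (mem_jacobson_bot hy) hKy)⟩

theorem exists_of_sInf_coe_lt_top {p : ℕ → Prop}
    (h : sInf ((fun n : ℕ => (n : ℕ∞)) '' {n | p n}) < ⊤) :
    ∃ n, p n ∧ sInf ((fun n : ℕ => (n : ℕ∞)) '' {n | p n}) = n := by
  have hne : ((fun n : ℕ => (n : ℕ∞)) '' {n | p n}).Nonempty := by
    rw [Set.nonempty_iff_ne_empty]
    intro h0
    rw [h0, sInf_empty] at h
    exact lt_irrefl _ h
  obtain ⟨n, hn, h1⟩ := csInf_mem hne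
  exact ⟨n, hn, h1.symm⟩

theorem completionHom_bijective (S : Type u) [CommRing S] [IsLocalRing S]
    [IsAdicComplete (maximalIdeal S) S] : Function.Bijective (completionHom S) :=
  AdicCompletion.of_bijective (maximalIdeal S) S

theorem ringKrullDim_eq_of_ker_eq {P S : Type u} [CommRing P] [IsLocalRing P] [IsNoetherianRing P]
    [CommRing S] [Algebra P S] (hS : Function.Surjective (algebraMap P S)) {rs : List P}
    (hrs : RingTheory.Sequence.IsRegular P rs)
    (hker : RingHom.ker (algebraMap P S) = Ideal.span {x | x ∈ rs}) :
    ringKrullDim S + rs.length = ringKrullDim P := by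
  rw [← ringKrullDim_add_length_eq_ringKrullDim_of_isRegular rs hrs,
    ← ringKrullDim_eq_of_ringEquiv (RingHom.quotientKerEquivOfSurjective hS), hker]

theorem exists_ringKrullDim_eq_natCast (R : Type u) [CommRing R] [IsLocalRing R]
    [IsNoetherianRing R] : ∃ n : ℕ, ringKrullDim R = n := by
  obtain ⟨d, hd⟩ := WithBot.ne_bot_iff_exists.1 (ringKrullDim_ne_bot (R := R))
  have hd' : d ≠ ⊤ := by
    rintro rfl
    exact ringKrullDim_ne_top (R := R) hd.symm
  obtain ⟨n, rfl⟩ := ENat.ne_top_iff_exists.1 hd'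
  exact ⟨n, hd.symm⟩

/-- Over a surjection from a regular fibration, the exceptional complete intersection property is
read off from the length of the regular sequence. -/
theorem isExceptionalCIMap_of_flatTower {R S P : Type u} [CommRing R] [IsLocalRing R]
    [IsNoetherianRing R] [CommRing S] [IsLocalRing S] [IsNoetherianRing S]
    [IsAdicComplete (maximalIdeal S) S] [CommRing P] [IsLocalRing P] [IsNoetherianRing P]
    [IsAdicComplete (maximalIdeal P) P] [Algebra R P] [Algebra P S] {f : R →+* S}
    (hf : (algebraMap P S).comp (algebraMap R P) = f) (hS : Function.Surjective (algebraMap P S))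
    {e g : ℕ} (hT : FlatTower R e P) (hg : g + embDim S = embDim R) {rs : List P}
    (hlen : rs.length = g + e) (hrs : RingTheory.Sequence.IsRegular P rs)
    (hker : RingHom.ker (algebraMap P S) = Ideal.span {x | x ∈ rs}) : IsExceptionalCIMap f := by
  refine ⟨⟨P, inferInstance, algebraMap R P, (completionHom S).comp (algebraMap P S),
    ⟨inferInstance, inferInstance, ?_, ?_, ?_, ?_, hT.isRegularLocal, ?_⟩, rs, hrs, ?_⟩, ?_⟩
  · rwa [IsLocalRing.jacobson_eq_maximalIdeal ⊥ bot_ne_top]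
  · rw [RingHom.comp_assoc, hf]
  · exact ((local_hom_TFAE (algebraMap R P)).out 0 2).2 hT.map_le
  · exact RingHom.flat_algebraMap_iff.2 hT.flat
  · exact (completionHom_bijective S).2.comp hS
  · rw [← RingHom.comap_ker, (RingHom.injective_iff_ker_eq_bot _).1 (completionHom_bijective S).1]
    exact hker
  · have h1 := ringKrullDim_eq_of_ker_eq hS hrs hker
    rw [hT.ringKrullDim_eq, hlen] at h1
    obtain ⟨a, ha⟩ := exists_ringKrullDim_eq_natCast R
    obtain ⟨b, hb⟩ := exists_ringKrullDim_eq_natCast S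
    rw [ha, hb] at h1 ⊢
    norm_cast at h1 ⊢
    omega

/-- **Theorem B.** If `f : R → S` is a local homomorphism of noetherian local rings with
`fd_R S < ∞`, where `R` has a dualizing complex and `S` is complete, and `M` is a non-zero
artinian `S`-module with `Gid_R M ≤ edim R - edim S`, then `M` is Gorenstein injective over
`S`, `f` is an exceptional complete intersection map, and `Gid_R M = edim R - edim S`;
in particular, if `M` is Gorenstein injective over `R`, then `edim R = edim S`. -/
theorem gid_bound_implies_eci {R S : Type u} [CommRing R] [CommRing S]
    [IsLocalRing R] [IsLocalRing S] [IsNoetherianRing R] [IsNoetherianRing S]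
    (f : R →+* S) (hloc : IsLocalHom f) (hfd : flatDimAlong f < ⊤)
    (hD : HasDualizingComplex R)
    (hSc : IsAdicComplete (IsLocalRing.maximalIdeal S) S)
    (M : Type u) [AddCommGroup M] [Module S M] [Nontrivial M] (hart : IsArtinian S M)
    (hgid : gidAlong f M + embDim S ≤ (embDim R : ℕ∞)) :
    IsGorensteinInjective S M ∧ IsExceptionalCIMap f ∧
      gidAlong f M + embDim S = (embDim R : ℕ∞) ∧
      (IsGorensteinInjectiveAlong f M → embDim R = embDim S) := by
  let _ : Algebra R S := f.toAlgebra
  let _ : Module R M := Module.compHom M f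
  have : IsScalarTower R S M := IsScalarTower.of_algebraMap_smul fun r x => rfl
  obtain ⟨d, hd, -⟩ := exists_of_sInf_coe_lt_top (p := fun n => fdLE R n S) hfd
  have hgtop : gid R M < ⊤ :=
    lt_of_le_of_lt (le_self_add.trans hgid) (ENat.natCast_lt_top _)
  obtain ⟨g, hg, hgeq⟩ := exists_of_sInf_coe_lt_top (p := fun n => gidLE R n M) hgtop
  have hgeq' : gidAlong f M = g := hgeq
  rw [hgeq'] at hgid ⊢
  obtain ⟨ys, hys⟩ := (maximalIdeal S).fg_of_isNoetherianRing
  obtain ⟨T, _, _, _, 𝔪, _, _, _, _, hmap, htower⟩ := exists_towerOver (R := R) ys.toList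
  have hmS : 𝔪.map (algebraMap T S) = maximalIdeal S := by
    have h1 : {y | y ∈ ys.toList} = (ys : Set S) := by
      ext y
      simp
    rw [hmap, h1, show Ideal.span (ys : Set S) = maximalIdeal S from hys, sup_eq_right]
    exact ((local_hom_TFAE f).out 0 2).1 hloc
  obtain ⟨P, _, _, _, _, _, hflat, hmax, ψ, hψ⟩ := exists_unramified_cover hmS
  let _ : Algebra P S := ψ.toRingHom.toAlgebra
  let _ : Algebra R P := ((algebraMap T P).comp (algebraMap R T)).toAlgebra
  have : IsScalarTower R T P := IsScalarTower.of_algebraMap_eq fun r => rfl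
  have hcomp : (algebraMap P S).comp (algebraMap R P) = f := RingHom.ext fun r =>
    (ψ.commutes (algebraMap R T r)).trans (IsScalarTower.algebraMap_apply R T S r).symm
  have : IsScalarTower R P S :=
    IsScalarTower.of_algebraMap_eq fun r => (RingHom.congr_fun hcomp r).symm
  let _ : Module P M := Module.compHom M (algebraMap P S)
  have : IsScalarTower P S M := IsScalarTower.of_algebraMap_smul fun r x => rfl
  have : IsScalarTower R P M := IsScalarTower.of_algebraMap_smul fun r x =>
    congrArg (· • x) (RingHom.congr_fun hcomp r)
  have hT : FlatTower R ys.toList.length P := htower P hflat hmax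
  have : Module.Finite P S := Module.Finite.of_surjective (Algebra.linearMap P S) hψ
  obtain ⟨n, hn⟩ := hT.exists_pdLE (FdLE.of_fdLE hd)
  obtain ⟨hG, heq, rs, hlen, hrs, hker⟩ :=
    main_of_factorization hψ hT hT.embDim_le hn hg (by exact_mod_cast hgid)
  refine ⟨hG, isExceptionalCIMap_of_flatTower hcomp hψ hT heq hlen hrs hker,
    by exact_mod_cast heq, fun hM => ?_⟩
  have h0 : gid R M ≤ ((0 : ℕ) : ℕ∞) := sInf_le ⟨0, hM, rfl⟩
  rw [show gid R M = g from hgeq'] at h0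
  have : g = 0 := by
    simpa using h0
  omega
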